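/- Let K be a number field with ring of integers O_K, and let A and B be finite-dimensional central simple K-algebras. Then there exists an injective K-algebra homomorphism A → B if and only if all of the following hold: (i) for every nonzero prime v of O_K (i.e. every element of the height-one spectrum of O_K), writing K_v for the v-adic completion of K, there exists an injective K_v-algebra homomorphism K_v ⊗_K A → K_v ⊗_K B; (ii) for every ring homomorphism σ : K → ℝ, there exists an injective ℝ-algebra homomorphism ℝ ⊗_{K,σ} A → ℝ ⊗_{K,σ} B (base change along σ); and (iii) for every ring homomorphism σ : K → ℂ, there exists an injective ℂ-algebra homomorphism ℂ ⊗_{K,σ} A → ℂ ⊗_{K,σ} B. -/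

import Mathlib

set_option linter.all false

section part01
namespace ABHN
open MeasureTheory Real Complex
open scoped Matrix

/-- Euclidean squared norm on `I → ℝ`. -/
noncomputable def nsq {I : Type*} [Fintype I] (v : I → ℝ) : ℝ := ∑ i, v i ^ 2

variable {I : Type*} [Fintype I]

lemma nsq_nonneg (v : I → ℝ) : 0 ≤ nsq v := Finset.sum_nonneg fun _ _ => sq_nonneg _

lemma nsq_smul (t : ℝ) (v : I → ℝ) : nsq (t • v) = t ^ 2 * nsq v := by
  simp [nsq, mul_pow, Finset.mul_sum]

lemma nsq_eq_zero {v : I → ℝ} (h : nsq v = 0) : v = 0 := by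
  unfold nsq at h
  rw [Finset.sum_eq_zero_iff_of_nonneg (fun _ _ => sq_nonneg _)] at h
  funext i
  simpa using h i (Finset.mem_univ i)

lemma continuous_nsq : Continuous (nsq : (I → ℝ) → ℝ) := by
  unfold nsq; fun_prop

lemma nsq_mulVec_le (B : Matrix I I ℝ) (z : I → ℝ) :
    nsq (B *ᵥ z) ≤ (∑ i, ∑ j, B i j ^ 2) * nsq z := by
  unfold nsq
  rw [Finset.sum_mul]
  refine Finset.sum_le_sum fun i _ => ?_
  simp only [Matrix.mulVec, dotProduct]
  exact Finset.sum_mul_sq_le_sq_mul_sq _ _ _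

lemma exists_nsq_lower [DecidableEq I] (A : Matrix I I ℝ) (hA : A.det ≠ 0) :
    ∃ c > 0, ∀ x, c * nsq x ≤ nsq (A *ᵥ x) := by
  set C := (∑ i, ∑ j, A⁻¹ i j ^ 2) with hC
  have hC0 : 0 ≤ C := by positivity
  refine ⟨(C + 1)⁻¹, by positivity, fun x => ?_⟩
  have h := nsq_mulVec_le A⁻¹ (A *ᵥ x)
  rw [Matrix.mulVec_mulVec, Matrix.nonsing_inv_mul _ (isUnit_iff_ne_zero.mpr hA),
    Matrix.one_mulVec] at h
  rw [inv_mul_le_iff₀ (by positivity)]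
  nlinarith [nsq_nonneg (A *ᵥ x)]

/-- integer vectors as real vectors -/
def cv (m : I → ℤ) : I → ℝ := fun i => (m i : ℝ)

lemma summable_pi_prod {g : ℤ → ℝ} (hg : ∀ k, 0 ≤ g k) (hs : Summable g) :
    Summable fun m : I → ℤ => ∏ i, g (m i) := by
  classical
  refine summable_of_sum_le (c := (∑' k, g k) ^ (Fintype.card I)) 
    (fun m => Finset.prod_nonneg fun i _ => hg _) fun s => ?_
  let t : Finset ℤ := s.biUnion fun m => Finset.univ.image m
  have hst : s ⊆ Fintype.piFinset fun _ : I => t := by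
    intro m hm
    rw [Fintype.mem_piFinset]
    intro i
    exact Finset.mem_biUnion.mpr ⟨m, hm, Finset.mem_image_of_mem _ (Finset.mem_univ i)⟩
  calc _ ≤ ∑ m ∈ Fintype.piFinset fun _ : I => t, ∏ i, g (m i) :=
        Finset.sum_le_sum_of_subset_of_nonneg hst
          fun m _ _ => Finset.prod_nonneg fun i _ => hg _
    _ = ∏ _i : I, ∑ k ∈ t, g k := by rw [Finset.prod_univ_sum]
    _ ≤ ∏ _i : I, ∑' k, g k :=
        Finset.prod_le_prod (fun _ _ => Finset.sum_nonneg fun _ _ => hg _)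
          fun _ _ => hs.sum_le_tsum _ (fun _ _ => hg _)
    _ = _ := by simp

lemma summable_gauss_int {a : ℝ} (ha : 0 < a) :
    Summable fun k : ℤ => Real.exp (-a * (k : ℝ) ^ 2) := by
  have h := summable_pow_mul_jacobiTheta₂_term_bound 0 (T := a / π) (by positivity) 0
  refine h.congr fun k => ?_
  simp only [pow_zero, one_mul, mul_zero, zero_mul, sub_zero]
  congr 1
  field_simp

lemma summable_gauss {a : ℝ} (ha : 0 < a) :
    Summable fun m : I → ℤ => Real.exp (-a * nsq (cv m)) := by
  refine (summable_pi_prod (fun k => (Real.exp_pos _).le) (summable_gauss_int ha)).congr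
    fun m => ?_
  rw [← Real.exp_sum, nsq, Finset.mul_sum]
  rfl

lemma summable_gauss_mat [DecidableEq I] (A : Matrix I I ℝ) (hA : A.det ≠ 0) {a : ℝ} (ha : 0 < a) :
    Summable fun m : I → ℤ => Real.exp (-a * nsq (A *ᵥ cv m)) := by
  obtain ⟨c, hc, h⟩ := exists_nsq_lower A hA
  refine Summable.of_nonneg_of_le (fun _ => (Real.exp_pos _).le) (fun m => ?_)
    (summable_gauss (I := I) (a := a * c) (by positivity))
  rw [Real.exp_le_exp]
  nlinarith [h (cv m)]

lemma nsq_add_ge (x y : I → ℝ) : nsq y / 2 - nsq x ≤ nsq (x + y) := by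
  unfold nsq
  rw [Finset.sum_div, ← Finset.sum_sub_distrib]
  refine Finset.sum_le_sum fun i _ => ?_
  simp only [Pi.add_apply]
  nlinarith [sq_nonneg (2 * x i + y i)]

end ABHN
end part01

section part02
namespace ABHN
set_option linter.unusedSectionVars false
open MeasureTheory Real Complex
open scoped Matrix
variable {I : Type*} [Fintype I]

def cube (n : I → ℤ) : Set (I → ℝ) := {x | ∀ i, x i ∈ Set.Ioc (n i : ℝ) (n i + 1)}

lemma measurableSet_cube (n : I → ℤ) : MeasurableSet (cube n) := by
  have : cube n = Set.univ.pi fun i => Set.Ioc (n i : ℝ) (n i + 1) := by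
    ext x; simp [cube]
  rw [this]
  exact MeasurableSet.univ_pi fun i => measurableSet_Ioc

lemma iUnion_cube : (⋃ n : I → ℤ, cube n) = Set.univ := by
  ext x
  simp only [Set.mem_iUnion, Set.mem_univ, iff_true]
  refine ⟨fun i => ⌈x i⌉ - 1, fun i => ?_⟩
  push_cast
  constructor
  · linarith [Int.ceil_lt_add_one (x i)]
  · linarith [Int.le_ceil (x i)]

lemma disjoint_cube : Pairwise (Function.onFun Disjoint (cube (I := I))) := by
  intro m n hmn
  rw [Function.onFun, Set.disjoint_left]
  intro x hm hn
  apply hmn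
  funext i
  have h1 := hm i
  have h2 := hn i
  have h3 : (m i : ℝ) < n i + 1 := by linarith [h1.1, h2.2]
  have h4 : (n i : ℝ) < m i + 1 := by linarith [h2.1, h1.2]
  have h3' : m i < n i + 1 := by exact_mod_cast h3
  have h4' : n i < m i + 1 := by exact_mod_cast h4
  omega

lemma setIntegral_cube {E : Type*} [NormedAddCommGroup E] [NormedSpace ℝ E] (g : (I → ℝ) → E)
    (n : I → ℤ) : ∫ x in cube n, g x = ∫ x in cube (0 : I → ℤ), g (x + cv n) := by
  have h := (measurePreserving_add_right (volume : Measure (I → ℝ)) (cv n)).setIntegral_preimage_emb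
    (measurableEmbedding_addRight (cv n)) g (cube n)
  rw [← h]
  congr 2
  ext x
  simp only [cube, Set.mem_preimage, Set.mem_ofPred_eq, Pi.add_apply, cv, Set.mem_Ioc,
    Pi.zero_apply, Int.cast_zero, zero_add]
  refine forall_congr' fun i => ?_
  constructor <;> rintro ⟨h1, h2⟩ <;> constructor <;> linarith

lemma hasSum_integral_cube {E : Type*} [NormedAddCommGroup E] [NormedSpace ℝ E]
    [CompleteSpace E] (g : (I → ℝ) → E) (hg : Integrable g) :
    HasSum (fun n : I → ℤ => ∫ x in cube (0 : I → ℤ), g (x + cv n)) (∫ x, g x) := by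
  have h := hasSum_integral_iUnion (μ := volume) (f := g) (s := cube (I := I))
    (fun n => measurableSet_cube n) disjoint_cube (by rw [iUnion_cube]; exact hg.integrableOn)
  rw [iUnion_cube, setIntegral_univ] at h
  refine h.congr_fun ?_
  intro n
  exact (setIntegral_cube g n).symm

/-- General Poisson summation on `ℤ^I`, at the origin. -/
theorem poisson_gen (f : (I → ℝ) → ℂ) (hf : Continuous f) (hfi : Integrable f)
    (hb : ∀ R : ℝ, ∃ u : (I → ℤ) → ℝ, Summable u ∧ ∀ m x, nsq x < R → ‖f (x + cv m)‖ ≤ u m)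
    (hs : Summable fun m : I → ℤ => ∫ x, cexp (-2 * π * Complex.I * ∑ i, (m i : ℂ) * x i) * f x) :
    ∑' m : I → ℤ, f (cv m) =
      ∑' m : I → ℤ, ∫ x, cexp (-2 * π * Complex.I * ∑ i, (m i : ℂ) * x i) * f x := by
  classical
  set H : (I → ℝ) → ℂ := fun x => ∑' n : I → ℤ, f (x + cv n) with hH
  have hsum : ∀ x, Summable fun n : I → ℤ => f (x + cv n) := fun x => by
    obtain ⟨u, hu, h⟩ := hb (nsq x + 1)
    exact Summable.of_norm_bounded hu fun m => h m x (by linarith)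
  have hcont : Continuous H := by
    rw [continuous_iff_continuousAt]
    intro x
    obtain ⟨u, hu, h⟩ := hb (nsq x + 1)
    have hc : ContinuousOn H {y | nsq y < nsq x + 1} := by
      refine continuousOn_tsum (fun m => ?_) hu (fun m y hy => h m y hy)
      exact (hf.comp (continuous_id.add continuous_const)).continuousOn
    refine hc.continuousAt ?_
    exact (isOpen_lt continuous_nsq continuous_const).mem_nhds (by simp)
  have hper : ∀ x (k : I → ℤ), H (x + cv k) = H x := by
    intro x k
    simp only [hH]
    rw [← (Equiv.addLeft k).tsum_eq (fun n : I → ℤ => f (x + cv n))]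
    refine tsum_congr fun n => ?_
    congr 1
    funext i
    simp [cv, add_assoc]
  let π' : (I → ℝ) → UnitAddTorus I := fun x i => (x i : UnitAddCircle)
  have hq : IsOpenQuotientMap π' := by
    refine IsOpenQuotientMap.piMap (f := fun _ : I => fun x : ℝ => (x : UnitAddCircle)) fun i => ?_
    exact QuotientAddGroup.isOpenQuotientMap_mk
  have hfac : ∀ x y, π' x = π' y → H x = H y := by
    intro x y hxy
    have : ∀ i, ∃ k : ℤ, y i + k = x i := by
      intro i
      have h1 : ((x i : ℝ) : UnitAddCircle) = (y i : ℝ) := congrFun hxy i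
      have h2 := QuotientAddGroup.eq_iff_sub_mem.mp h1
      obtain ⟨k, hk⟩ := AddSubgroup.mem_zmultiples_iff.mp h2
      refine ⟨k, ?_⟩
      simp at hk
      linarith
    choose k hk using this
    rw [← hper y k]
    congr 1
    funext i
    simp [cv, hk]
  let F : C(UnitAddTorus I, ℂ) := ⟨hq.surjective.hasRightInverse.choose |> fun s => H ∘ s, by
    rw [hq.isQuotientMap.continuous_iff]
    convert hcont using 1
    funext x
    exact hfac _ _ (hq.surjective.hasRightInverse.choose_spec _)⟩
  have hF : ∀ x, F (π' x) = H x := fun x =>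
    hfac _ _ (hq.surjective.hasRightInverse.choose_spec _)
  have hcoef : ∀ m, UnitAddTorus.mFourierCoeff F m =
      ∫ x, cexp (-2 * π * Complex.I * ∑ i, (m i : ℂ) * x i) * f x := by
    intro m
    set e : (I → ℝ) → ℂ := fun x => cexp (-2 * π * Complex.I * ∑ i, (m i : ℂ) * x i) with he
    have hen : ∀ x, ‖e x‖ = 1 := by
      intro x
      have : (-2 * π * Complex.I * ∑ i, (m i : ℂ) * x i) =
        ((-2 * π * ∑ i, (m i : ℝ) * x i : ℝ) : ℂ) * Complex.I := by push_cast; ring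
      simp only [he]
      rw [this, Complex.norm_exp_ofReal_mul_I]
    have hec : Continuous e := by simp only [he]; fun_prop
    have heper : ∀ x n, e (x + cv n) = e x := by
      intro x n
      simp only [he]
      have : (-2 * π * Complex.I * ∑ i, (m i : ℂ) * ((x + cv n) i : ℝ)) =
        (-2 * π * Complex.I * ∑ i, (m i : ℂ) * x i) +
          ((-∑ i, m i * n i : ℤ) : ℂ) * (2 * π * Complex.I) := by
        simp only [cv, Pi.add_apply, mul_add, Complex.ofReal_add, Finset.sum_add_distrib]
        push_cast
        ring
      rw [this, Complex.exp_add, Complex.exp_int_mul_two_pi_mul_I, mul_one]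
    have hgi : Integrable fun x => e x * f x := by
      refine hfi.bdd_mul hec.aestronglyMeasurable (c := 1) ?_
      filter_upwards with x
      rw [hen]
    rw [UnitAddTorus.mFourierCoeff_eq_integral F m 0]
    have hset : {x : I → ℝ | ∀ i, x i ∈ Set.Ioc ((0 : I → ℝ) i) ((0 : I → ℝ) i + 1)} = cube 0 := by
      ext x; simp [cube]
    rw [hset]
    have h1 : ∀ x : I → ℝ, (UnitAddTorus.mFourier (-m) fun i => (x i : UnitAddCircle)) •
        F (fun i => (x i : UnitAddCircle)) = ∑' n : I → ℤ, e (x + cv n) * f (x + cv n) := by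
      intro x
      rw [show F (fun i => (x i : UnitAddCircle)) = H x from hF x]
      simp_rw [heper, tsum_mul_left]
      rw [smul_eq_mul]
      congr 1
      simp only [UnitAddTorus.mFourier, ContinuousMap.coe_mk, fourier_coe_apply, he]
      rw [← Complex.exp_sum, Finset.mul_sum]
      congr 1
      refine Finset.sum_congr rfl fun i _ => ?_
      push_cast [Pi.neg_apply]
      simp
      ring
    simp_rw [h1]
    have h2 := hasSum_integral_cube (fun x => e x * f x) hgi
    have h3 := hasSum_integral_cube (fun x => ‖e x * f x‖) hgi.norm
    rw [← h2.tsum_eq]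
    symm
    refine integral_tsum_of_summable_integral_norm (fun n => ?_) h3.summable
    exact (hgi.comp_add_right (cv n)).integrableOn
  have hsF : Summable (UnitAddTorus.mFourierCoeff F) := by
    convert hs using 1
    funext m; exact hcoef m
  have hfin := (UnitAddTorus.hasSum_mFourier_series_apply_of_summable hsF (π' 0)).tsum_eq
  rw [hF] at hfin
  have h0 : H 0 = ∑' m : I → ℤ, f (cv m) := by simp [hH]
  rw [← h0, ← hfin]
  refine tsum_congr fun m => ?_
  rw [hcoef, smul_eq_mul]
  convert mul_one _
  simp only [UnitAddTorus.mFourier, ContinuousMap.coe_mk, π']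
  refine Finset.prod_eq_one fun i _ => ?_
  simp

lemma measurableEmbedding_mulVec [DecidableEq I] (A : Matrix I I ℝ) (hA : A.det ≠ 0) :
    MeasurableEmbedding fun x : I → ℝ => A *ᵥ x := by
  have hu := isUnit_iff_ne_zero.mpr hA
  let e : (I → ℝ) ≃ₜ (I → ℝ) :=
    { toFun := fun x => A *ᵥ x
      invFun := fun x => A⁻¹ *ᵥ x
      left_inv := fun x => by simp [Matrix.mulVec_mulVec, Matrix.nonsing_inv_mul _ hu]
      right_inv := fun x => by simp [Matrix.mulVec_mulVec, Matrix.mul_nonsing_inv _ hu]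
      continuous_toFun := Continuous.matrix_mulVec continuous_const continuous_id
      continuous_invFun := Continuous.matrix_mulVec continuous_const continuous_id }
  exact e.measurableEmbedding

lemma map_mulVec_volume [DecidableEq I] (A : Matrix I I ℝ) (hA : A.det ≠ 0) :
    Measure.map (fun x : I → ℝ => A *ᵥ x) volume = ENNReal.ofReal |A.det|⁻¹ • volume := by
  have h := Real.map_matrix_volume_pi_eq_smul_volume_pi hA
  rw [abs_inv] at h
  exact h

/-- Theta function of the lattice `A ℤ^I`. -/
noncomputable def gth (A : Matrix I I ℝ) (t : ℝ) : ℝ :=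
  ∑' m : I → ℤ, Real.exp (-π * t ^ 2 * nsq (A *ᵥ cv m))

theorem gth_poisson_one [DecidableEq I] (A : Matrix I I ℝ) (hA : A.det ≠ 0) :
    gth A 1 = |A.det|⁻¹ * gth (A⁻¹)ᵀ 1 := by
  set f : (I → ℝ) → ℂ := fun x => ((Real.exp (-π * nsq (A *ᵥ x)) : ℝ) : ℂ) with hf
  have hfc : Continuous f := by
    have h1 : Continuous fun x : I → ℝ => nsq (A *ᵥ x) :=
      continuous_nsq.comp (Continuous.matrix_mulVec continuous_const continuous_id)
    simp only [hf]
    fun_prop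
  obtain ⟨c, hc, hcA⟩ := exists_nsq_lower A hA
  -- the pulled-back integrals
  have hcv : ∀ g : (I → ℝ) → ℂ, ∫ x, g (A *ᵥ x) = ((|A.det|⁻¹ : ℝ) : ℂ) * ∫ x, g x := by
    intro g
    rw [← (measurableEmbedding_mulVec A hA).integral_map, map_mulVec_volume A hA,
      integral_smul_measure, ENNReal.toReal_ofReal (by positivity)]
    simp
  have hgi : Integrable fun x : I → ℝ => cexp (-π * ∑ i, (x i : ℂ) ^ 2) := by
    have := GaussianFourier.integrable_cexp_neg_mul_sum_add (ι := I) (b := π)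
      (by simpa using Real.pi_pos) (fun _ => 0)
    simpa using this
  have hfi : Integrable f := by
    have h1 : Integrable (fun x : I → ℝ => cexp (-π * ∑ i, (x i : ℂ) ^ 2))
        (Measure.map (fun x : I → ℝ => A *ᵥ x) volume) := by
      rw [map_mulVec_volume A hA]
      exact hgi.smul_measure ENNReal.ofReal_ne_top
    rw [(measurableEmbedding_mulVec A hA).integrable_map_iff] at h1
    refine h1.congr (Filter.Eventually.of_forall fun x => ?_)
    simp [hf, nsq]
  have hft : ∀ m : I → ℤ, ∫ x, cexp (-2 * π * Complex.I * ∑ i, (m i : ℂ) * x i) * f x =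
      ((|A.det|⁻¹ * Real.exp (-π * 1 ^ 2 * nsq ((A⁻¹)ᵀ *ᵥ cv m)) : ℝ) : ℂ) := by
    intro m
    set w := (A⁻¹)ᵀ *ᵥ cv m with hw
    have h1 : ∀ x : I → ℝ, cexp (-2 * π * Complex.I * ∑ i, (m i : ℂ) * x i) * f x =
      (fun z : I → ℝ => cexp (-π * ∑ i, (z i : ℂ) ^ 2 + ∑ i, (-2 * π * Complex.I * w i) * z i))
        (A *ᵥ x) := by
      intro x
      have h2 : ∑ i, w i * (A *ᵥ x) i = ∑ i, (m i : ℝ) * x i := by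
        change w ⬝ᵥ (A *ᵥ x) = cv m ⬝ᵥ x
        rw [hw, Matrix.mulVec_transpose, ← Matrix.dotProduct_mulVec, Matrix.mulVec_mulVec,
          Matrix.nonsing_inv_mul _ (isUnit_iff_ne_zero.mpr hA), Matrix.one_mulVec]
      have h3 : ∑ i, (w i : ℂ) * ((A *ᵥ x) i : ℝ) = ∑ i, (m i : ℂ) * x i := by
        exact_mod_cast h2
      simp only [hf, nsq]
      push_cast
      rw [← Complex.exp_add, ← h3]
      congr 1
      rw [Finset.mul_sum (s := Finset.univ) (a := -2 * (π : ℂ) * Complex.I)]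
      simp_rw [mul_assoc]
      ring
    rw [integral_congr_ae (Filter.Eventually.of_forall h1)]
    refine (hcv (fun z : I → ℝ => cexp (-π * ∑ i, (z i : ℂ) ^ 2 +
      ∑ i, (-2 * π * Complex.I * w i) * z i))).trans ?_
    rw [GaussianFourier.integral_cexp_neg_mul_sum_add (by simpa using Real.pi_pos)]
    rw [div_self (by exact_mod_cast Real.pi_ne_zero), Complex.one_cpow, one_mul]
    push_cast
    congr 2
    simp only [nsq]
    push_cast
    simp_rw [mul_pow, Complex.I_sq]
    rw [← Finset.mul_sum]
    have : (π : ℂ) ≠ 0 := by exact_mod_cast Real.pi_ne_zero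
    field_simp
    ring
  have hdet : ((A⁻¹)ᵀ).det ≠ 0 := by
    rw [Matrix.det_transpose, Matrix.det_nonsing_inv]
    simpa using hA
  have hsd := (summable_gauss_mat (A⁻¹)ᵀ hdet Real.pi_pos).mul_left |A.det|⁻¹
  have key := poisson_gen f hfc hfi (fun R => ?_) ?_
  · simp_rw [hft] at key
    rw [← Complex.ofReal_tsum, ← Complex.ofReal_tsum] at key
    have key := Complex.ofReal_injective key
    rw [tsum_mul_left] at key
    unfold gth
    rw [← key]
    simp
  · refine ⟨fun m => Real.exp (π * c * R) * Real.exp (-(π * c / 2) * nsq (cv m)),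
      (summable_gauss (by positivity)).mul_left _, fun m x hx => ?_⟩
    simp only [hf]
    rw [Complex.norm_real, Real.norm_of_nonneg (Real.exp_pos _).le, ← Real.exp_add,
      Real.exp_le_exp]
    have h1 := hcA (x + cv m)
    have h2 := nsq_add_ge x (cv m)
    have hpi := Real.pi_pos
    have h3 : c * (nsq (cv m) / 2 - R) ≤ nsq (A *ᵥ (x + cv m)) := by nlinarith
    nlinarith
  · simp_rw [hft]
    simp only [one_pow, mul_one]
    exact_mod_cast hsd

end ABHN
end part02

section part03
namespace ABHN
set_option linter.unusedSectionVars false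
open MeasureTheory Real
open scoped Matrix
variable {I : Type*} [Fintype I] [DecidableEq I]

lemma gth_summable (A : Matrix I I ℝ) (hA : A.det ≠ 0) {t : ℝ} (ht : 0 < t) :
    Summable fun m : I → ℤ => Real.exp (-π * t ^ 2 * nsq (A *ᵥ cv m)) := by
  have := summable_gauss_mat A hA (a := π * t ^ 2) (by positivity)
  simpa using this

lemma gth_smul (A : Matrix I I ℝ) (t : ℝ) : gth A t = gth (t • A) 1 := by
  unfold gth
  refine tsum_congr fun m => ?_
  rw [Matrix.smul_mulVec, nsq_smul]
  ring_nf

theorem gth_poisson (A : Matrix I I ℝ) (hA : A.det ≠ 0) {t : ℝ} (ht : 0 < t) :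
    gth A t = (t ^ Fintype.card I)⁻¹ * |A.det|⁻¹ * gth (A⁻¹)ᵀ t⁻¹ := by
  have h1 : (t • A).det ≠ 0 := by
    rw [Matrix.det_smul]; positivity
  rw [gth_smul A t, gth_poisson_one _ h1, gth_smul _ t⁻¹, Matrix.det_smul, abs_mul,
    abs_of_pos (by positivity : 0 < t ^ Fintype.card I), mul_inv]
  congr 2
  rw [← Matrix.transpose_smul]
  congr 1
  rw [Matrix.inv_eq_left_inv]
  rw [Matrix.smul_mul, Matrix.mul_smul, smul_smul, inv_mul_cancel₀ ht.ne', one_smul,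
    Matrix.nonsing_inv_mul _ (isUnit_iff_ne_zero.mpr hA)]

lemma gth_anti (A : Matrix I I ℝ) (hA : A.det ≠ 0) {s t : ℝ} (hs : 0 < s) (hst : s ≤ t) :
    gth A t ≤ gth A s := by
  refine (gth_summable A hA (hs.trans_le hst)).tsum_le_tsum (fun m => ?_) (gth_summable A hA hs)
  rw [Real.exp_le_exp]
  have h1 := nsq_nonneg (A *ᵥ cv m)
  have h2 : s ^ 2 ≤ t ^ 2 := by gcongr
  have h3 := Real.pi_pos
  have h4 : s ^ 2 * nsq (A *ᵥ cv m) ≤ t ^ 2 * nsq (A *ᵥ cv m) := by gcongr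
  nlinarith

/-- nonzero lattice vectors have squared length at least `κ` -/
def Wmin (κ : ℝ) (A : Matrix I I ℝ) : Prop := ∀ m : I → ℤ, m ≠ 0 → κ ≤ nsq (A *ᵥ cv m)

lemma nsq_zero : nsq (0 : I → ℝ) = 0 := by simp [nsq]
lemma cv_zero : cv (0 : I → ℤ) = 0 := by funext i; simp [cv]

lemma gth_eq_one_add (A : Matrix I I ℝ) (hA : A.det ≠ 0) {t : ℝ} (ht : 0 < t) :
    gth A t = 1 + ∑' m : I → ℤ, if m = 0 then 0 else Real.exp (-π * t ^ 2 * nsq (A *ᵥ cv m)) := by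
  unfold gth
  rw [(gth_summable A hA ht).tsum_eq_add_tsum_ite (0 : I → ℤ)]
  simp [cv_zero, nsq_zero]

lemma gth_sub_one_summable (A : Matrix I I ℝ) (hA : A.det ≠ 0) {t : ℝ} (ht : 0 < t) :
    Summable fun m : I → ℤ => if m = 0 then 0 else Real.exp (-π * t ^ 2 * nsq (A *ᵥ cv m)) := by
  refine Summable.of_nonneg_of_le (fun m => ?_) (fun m => ?_) (gth_summable A hA ht)
  · split_ifs <;> positivity
  · split_ifs
    · positivity
    · exact le_rfl

lemma one_le_gth (A : Matrix I I ℝ) (hA : A.det ≠ 0) {t : ℝ} (ht : 0 < t) : 1 ≤ gth A t := by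
  rw [gth_eq_one_add A hA ht]
  have : 0 ≤ ∑' m : I → ℤ, if m = 0 then 0 else Real.exp (-π * t ^ 2 * nsq (A *ᵥ cv m)) :=
    tsum_nonneg fun m => by split_ifs <;> positivity
  linarith

lemma gth_decay (A : Matrix I I ℝ) (hA : A.det ≠ 0) {κ : ℝ} (hW : Wmin κ A) {t : ℝ} (ht : 1 ≤ t) :
    gth A t - 1 ≤ Real.exp (-π * κ * (t ^ 2 - 1)) * (gth A 1 - 1) := by
  rw [gth_eq_one_add A hA (by linarith : 0 < t), gth_eq_one_add A hA one_pos, add_sub_cancel_left,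
    add_sub_cancel_left, ← tsum_mul_left]
  refine (gth_sub_one_summable A hA (by linarith)).tsum_le_tsum (fun m => ?_)
    ((gth_sub_one_summable A hA one_pos).mul_left _)
  split_ifs with h
  · simp
  · rw [← Real.exp_add, Real.exp_le_exp]
    have h1 := hW m h
    have h2 : 0 ≤ t ^ 2 - 1 := by nlinarith
    have h3 : 0 ≤ π * (t ^ 2 - 1) * (nsq (A *ᵥ cv m) - κ) :=
      mul_nonneg (mul_nonneg Real.pi_pos.le h2) (by linarith)
    nlinarith

lemma gth_one_bound {κ : ℝ} (hκ : 0 < κ) : ∃ C > 0, ∀ A : Matrix I I ℝ, A.det ≠ 0 →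
    Wmin κ A → gth A 1 ≤ C := by
  -- choose t with exp(-πκ(t²-1)) ≤ t^{-N}/2
  set N := Fintype.card I
  obtain ⟨t, ht1, ht⟩ : ∃ t : ℝ, 1 ≤ t ∧ Real.exp (-π * κ * (t ^ 2 - 1)) * t ^ N ≤ 1 / 2 := by
    have h1 : Filter.Tendsto (fun x : ℝ => x ^ N * Real.exp (-(π * κ) * x)) Filter.atTop (nhds 0) := by
      have := tendsto_rpow_mul_exp_neg_mul_atTop_nhds_zero (N : ℝ) (π * κ) (by positivity)
      simpa using this
    have h2 := (h1.const_mul (Real.exp (π * κ))).eventually (gt_mem_nhds (by norm_num :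
      Real.exp (π * κ) * 0 < 1 / 2))
    obtain ⟨t, h3, h4⟩ := (h2.and (Filter.eventually_ge_atTop 1)).exists
    refine ⟨t, h4, le_trans ?_ h3.le⟩
    rw [mul_comm (t ^ N), ← mul_assoc, ← Real.exp_add]
    gcongr
    have : t ≤ t ^ 2 := by nlinarith
    have h5 := Real.pi_pos
    have : 0 ≤ π * κ * (t ^ 2 - t) := by apply mul_nonneg <;> [positivity; linarith]
    nlinarith
  have ht0 : 0 < t := by linarith
  refine ⟨2 * t ^ N, by positivity, fun A hA hW => ?_⟩
  have hdet : ((A⁻¹)ᵀ).det ≠ 0 := by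
    rw [Matrix.det_transpose, Matrix.det_nonsing_inv]
    simpa using hA
  have h1 := gth_decay A hA hW ht1
  have h2 : (t ^ N)⁻¹ * gth A 1 ≤ gth A t := by
    rw [gth_poisson A hA ht0, gth_poisson A hA one_pos]
    have := gth_anti (A⁻¹)ᵀ hdet (inv_pos.mpr ht0) (t := 1⁻¹) (by gcongr)
    rw [one_pow, inv_one, one_mul, mul_assoc]
    rw [inv_one] at this
    gcongr
  have h3 := one_le_gth A hA one_pos
  have h4 : gth A 1 ≤ t ^ N * gth A t := by
    rw [inv_mul_le_iff₀ (by positivity)] at h2; exact h2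
  have h5 : t ^ N * (gth A t - 1) ≤ 1 / 2 * gth A 1 := by
    calc _ ≤ t ^ N * (Real.exp (-π * κ * (t ^ 2 - 1)) * (gth A 1 - 1)) := by gcongr
      _ = (Real.exp (-π * κ * (t ^ 2 - 1)) * t ^ N) * (gth A 1 - 1) := by ring
      _ ≤ 1 / 2 * (gth A 1 - 1) := by gcongr
      _ ≤ _ := by linarith
  linarith

lemma det_inv_transpose_ne (A : Matrix I I ℝ) (hA : A.det ≠ 0) : ((A⁻¹)ᵀ).det ≠ 0 := by
  rw [Matrix.det_transpose, Matrix.det_nonsing_inv]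
  simpa using hA

theorem gth_asymp {κ : ℝ} (hκ : 0 < κ) : ∃ C > 0, ∀ A : Matrix I I ℝ, 1 ≤ |A.det| →
    Wmin κ (A⁻¹)ᵀ → ∀ t, 0 < t → t ≤ 1 →
    |gth A t - (t ^ Fintype.card I)⁻¹ * |A.det|⁻¹| ≤ C * t := by
  obtain ⟨C, hC, hC1⟩ := gth_one_bound (I := I) hκ
  set N := Fintype.card I with hN
  obtain ⟨C', hC', hC2⟩ : ∃ C' > 0, ∀ t : ℝ, 0 < t → t ≤ 1 →
      (t ^ N)⁻¹ * Real.exp (-π * κ * ((t⁻¹) ^ 2 - 1)) ≤ C' * t := by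
    -- exp(-x) ≤ k!/x^k with x = πκ/t², k = N+1
    set k := N + 1
    refine ⟨Real.exp (π * κ) * k.factorial / (π * κ) ^ k, by positivity, fun t h0 h1 => ?_⟩
    have hx : 0 < π * κ * (t⁻¹) ^ 2 := by positivity
    have h2 := Real.pow_div_factorial_le_exp _ hx.le k
    have h3 : Real.exp (-π * κ * ((t⁻¹) ^ 2 - 1)) =
        Real.exp (π * κ) * (Real.exp (π * κ * (t⁻¹) ^ 2))⁻¹ := by
      rw [← Real.exp_neg, ← Real.exp_add]; ring_nf
    have h4 : (Real.exp (π * κ * (t⁻¹) ^ 2))⁻¹ ≤ ((π * κ * (t⁻¹) ^ 2) ^ k / k.factorial)⁻¹ := by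
      gcongr
    rw [h3]
    calc (t ^ N)⁻¹ * (Real.exp (π * κ) * (Real.exp (π * κ * (t⁻¹) ^ 2))⁻¹)
        ≤ (t ^ N)⁻¹ * (Real.exp (π * κ) * ((π * κ * (t⁻¹) ^ 2) ^ k / k.factorial)⁻¹) := by gcongr
      _ = Real.exp (π * κ) * k.factorial / (π * κ) ^ k * (t ^ (2 * k) / t ^ N) := by
        rw [mul_pow, ← pow_mul, inv_pow]
        field_simp
      _ ≤ Real.exp (π * κ) * k.factorial / (π * κ) ^ k * t := by
        gcongr
        rw [div_le_iff₀ (by positivity), ← pow_succ']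
        exact pow_le_pow_of_le_one h0.le h1 (by omega)
  refine ⟨C' * C, by positivity, fun A hdet hW t h0 h1 => ?_⟩
  have hA : A.det ≠ 0 := by intro h; rw [h] at hdet; norm_num at hdet
  have hA' := det_inv_transpose_ne A hA
  have ht1 : 1 ≤ t⁻¹ := (one_le_inv₀ h0).mpr h1
  have h2 := gth_decay _ hA' hW ht1
  have h3 := hC1 _ hA' hW
  have h4 := one_le_gth _ hA' (t := t⁻¹) (by positivity)
  rw [gth_poisson A hA h0, ← hN]
  rw [show (t ^ N)⁻¹ * |A.det|⁻¹ * gth A⁻¹ᵀ t⁻¹ - (t ^ N)⁻¹ * |A.det|⁻¹ =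
    |A.det|⁻¹ * ((t ^ N)⁻¹ * (gth A⁻¹ᵀ t⁻¹ - 1)) by ring]
  rw [abs_of_nonneg (by apply mul_nonneg; positivity; apply mul_nonneg; positivity; linarith)]
  have h5 : |A.det|⁻¹ ≤ 1 := inv_le_one_of_one_le₀ hdet
  have h6 : 0 ≤ (t ^ N)⁻¹ * (gth A⁻¹ᵀ t⁻¹ - 1) := mul_nonneg (by positivity) (by linarith)
  calc _ ≤ 1 * ((t ^ N)⁻¹ * (gth A⁻¹ᵀ t⁻¹ - 1)) := by gcongr
    _ ≤ (t ^ N)⁻¹ * (Real.exp (-π * κ * ((t⁻¹) ^ 2 - 1)) * (gth A⁻¹ᵀ 1 - 1)) := by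
      rw [one_mul]; gcongr
    _ ≤ ((t ^ N)⁻¹ * Real.exp (-π * κ * ((t⁻¹) ^ 2 - 1))) * C := by
      rw [← mul_assoc]
      exact mul_le_mul_of_nonneg_left (by linarith) (by positivity)
    _ ≤ (C' * t) * C := mul_le_mul_of_nonneg_right (hC2 t h0 h1) hC.le
    _ = _ := by ring

/-- Geometry of numbers: lattices stable under an integral division algebra have no short
vectors. -/
theorem exists_Wmin [Nonempty I] (S : I → Matrix I I ℝ)
    (hS : ∀ k : I → ℤ, k ≠ 0 → (∑ i, (k i : ℝ) • S i).det ≠ 0) {d : ℝ} (hd : 0 < d) :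
    ∃ κ > 0, ∀ (A : Matrix I I ℝ) (M : I → Matrix I I ℤ), d ≤ |A.det| →
      (∀ i, S i * A = A * (M i).map (Int.cast : ℤ → ℝ)) → Wmin κ A := by
  set N := Fintype.card I with hN
  set Cs : ℝ := ∑ l, ∑ i, ∑ j, S l i j ^ 2 with hCs
  have hCs0 : 0 ≤ Cs := by positivity
  obtain ⟨κ, hκ, hκd⟩ : ∃ κ > 0, (N.factorial : ℝ) * √(Cs * κ) ^ N < d := by
    have hc : Continuous fun κ : ℝ => (N.factorial : ℝ) * √(Cs * κ) ^ N := by fun_prop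
    have h0 : (N.factorial : ℝ) * √(Cs * 0) ^ N < d := by
      simp [hN, Fintype.card_ne_zero, hd]
    have h1 := (hc.tendsto 0).eventually (gt_mem_nhds h0)
    have h2 : ∀ᶠ x in nhdsWithin (0 : ℝ) (Set.Ioi 0), (N.factorial : ℝ) * √(Cs * x) ^ N < d :=
      h1.filter_mono nhdsWithin_le_nhds
    obtain ⟨κ, h3, h4⟩ := (h2.and self_mem_nhdsWithin).exists
    exact ⟨κ, h4, h3⟩
  refine ⟨κ, hκ, fun A M hA hM m hm => ?_⟩
  by_contra hlt
  push Not at hlt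
  have hA0 : A.det ≠ 0 := by intro h; rw [h, abs_zero] at hA; linarith
  set ξ := A *ᵥ cv m with hξ
  -- integer matrix
  let Q : Matrix I I ℤ := Matrix.of fun i j => (M j *ᵥ m) i
  let B : Matrix I I ℝ := Matrix.of fun i j => (S j *ᵥ ξ) i
  have hcast : ∀ (P : Matrix I I ℤ) (x : I → ℤ), P.map (Int.cast : ℤ → ℝ) *ᵥ cv x = cv (P *ᵥ x) := by
    intro P x
    funext i
    simp [Matrix.mulVec, dotProduct, cv]
  have hBQ : B = A * Q.map (Int.cast : ℤ → ℝ) := by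
    ext i j
    have h1 : S j *ᵥ ξ = A *ᵥ cv (M j *ᵥ m) := by
      rw [hξ, Matrix.mulVec_mulVec, hM, ← Matrix.mulVec_mulVec, hcast]
    simp only [B, Matrix.of_apply, h1]
    simp [Matrix.mulVec, dotProduct, Matrix.mul_apply, cv, Q]
  have hQ : Q.det ≠ 0 := by
    intro h
    obtain ⟨k, hk, hk0⟩ := Matrix.exists_mulVec_eq_zero_iff.mpr h
    have h1 : (∑ i, (k i : ℝ) • S i) *ᵥ ξ = 0 := by
      have h2 : B *ᵥ cv k = 0 := by
        rw [hBQ, ← Matrix.mulVec_mulVec, hcast, hk0, cv_zero, Matrix.mulVec_zero]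
      rw [← h2]
      funext i
      simp only [Matrix.sum_mulVec, Finset.sum_apply, Matrix.smul_mulVec, Pi.smul_apply,
        smul_eq_mul]
      simp [B, Matrix.mulVec, dotProduct, cv, mul_comm]
    have h3 : ξ = 0 := Matrix.eq_zero_of_mulVec_eq_zero (hS k hk) h1
    have h4 : cv m = 0 := Matrix.eq_zero_of_mulVec_eq_zero hA0 h3
    apply hm
    funext i
    have := congrFun h4 i
    simpa [cv] using this
  have hQ1 : (1 : ℝ) ≤ |((Q.det : ℤ) : ℝ)| := by
    have := Int.one_le_abs hQ
    exact_mod_cast this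
  have hdetB : B.det = A.det * (Q.det : ℤ) := by
    rw [hBQ, Matrix.det_mul]
    congr 1
    exact (Int.cast_det Q).symm
  have h1 : d ≤ |B.det| := by
    rw [hdetB, abs_mul]
    nlinarith [abs_nonneg A.det]
  have h2 : |B.det| ≤ (N.factorial : ℝ) * √(Cs * κ) ^ N := by
    have := Matrix.det_le (A := B) (abv := AbsoluteValue.abs) (x := √(Cs * κ)) (fun i j => ?_)
    · simpa [nsmul_eq_mul] using this
    · simp only [AbsoluteValue.abs_apply]
      apply Real.abs_le_sqrt
      have h3 : (B i j) ^ 2 ≤ nsq (S j *ᵥ ξ) :=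
        Finset.single_le_sum (f := fun i => (S j *ᵥ ξ) i ^ 2) (fun _ _ => sq_nonneg _)
          (Finset.mem_univ i)
      have h4 := nsq_mulVec_le (S j) ξ
      have h5 : ∑ i, ∑ l, S j i l ^ 2 ≤ Cs :=
        Finset.single_le_sum (f := fun j => ∑ i, ∑ l, S j i l ^ 2)
          (fun _ _ => by positivity) (Finset.mem_univ j)
      calc _ ≤ _ := h3
        _ ≤ _ := h4
        _ ≤ Cs * κ := by
          have := nsq_nonneg ξ
          gcongr
  linarith
end ABHN
end part03

section part04
namespace ABHN
open MeasureTheory Real Module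
open scoped Matrix

/-- Data of a division ring with an order and a real representation. -/
structure LD (D : Type*) [DivisionRing D] [CharZero D] (I : Type*) [Fintype I] [DecidableEq I] where
  b : Basis I ℚ D
  one_mem : (1 : D) ∈ AddSubgroup.closure (Set.range b)
  mul_mem : ∀ i j, b i * b j ∈ AddSubgroup.closure (Set.range b)
  ρ : D →+* Matrix I I ℝ
  y0 : I → ℝ
  hy0 : (Matrix.of fun i j => (ρ (b j) *ᵥ y0) i).det ≠ 0

variable {D : Type*} [DivisionRing D] [CharZero D] {I : Type*} [Fintype I] [DecidableEq I]

namespace LD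
variable (S : LD D I)

/-- The order. -/
def Λ : AddSubgroup D := AddSubgroup.closure (Set.range S.b)

lemma one_memΛ : (1 : D) ∈ S.Λ := S.one_mem

lemma mul_memΛ {x y : D} (hx : x ∈ S.Λ) (hy : y ∈ S.Λ) : x * y ∈ S.Λ := by
  refine AddSubgroup.closure_induction₂ (p := fun x y _ _ => x * y ∈ S.Λ) ?_ ?_ ?_ ?_ ?_ ?_ ?_ hx hy
  · rintro _ _ ⟨i, rfl⟩ ⟨j, rfl⟩; exact S.mul_mem i j
  · intro x _; simpa using S.Λ.zero_mem
  · intro x _; simpa using S.Λ.zero_mem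
  · intro x y z _ _ _ h1 h2; rw [add_mul]; exact S.Λ.add_mem h1 h2
  · intro x y z _ _ _ h1 h2; rw [mul_add]; exact S.Λ.add_mem h1 h2
  · intro x y _ _ h; rw [neg_mul]; exact S.Λ.neg_mem h
  · intro x y _ _ h; rw [mul_neg]; exact S.Λ.neg_mem h

/-- matrix with columns `ρ (c j) y`. -/
def colM (c : I → D) (y : I → ℝ) : Matrix I I ℝ := Matrix.of fun i j => (S.ρ (c j) *ᵥ y) i

/-- covolume of the order. -/
noncomputable def nu (y : I → ℝ) : ℝ := |(S.colM S.b y).det|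

lemma rho_smul (q : ℚ) (x : D) : S.ρ (q • x) = (q : ℝ) • S.ρ x := by
  have h := (S.ρ.toAddMonoidHom.toRatLinearMap).map_smul q x
  rw [Rat.cast_smul_eq_qsmul]
  exact h

lemma rho_mulVec (c : Basis I ℚ D) (d : D) (y : I → ℝ) :
    S.ρ d *ᵥ y = S.colM c y *ᵥ fun i => (c.repr d i : ℝ) := by
  conv_lhs => rw [← c.sum_repr d, map_sum, Matrix.sum_mulVec]
  ext i
  simp only [Finset.sum_apply, rho_smul, Matrix.smul_mulVec, Pi.smul_apply, smul_eq_mul]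
  simp only [Matrix.mulVec, dotProduct, colM, Matrix.of_apply]
  exact Finset.sum_congr rfl fun j _ => mul_comm _ _

lemma colM_eq (c : Basis I ℚ D) (d : I → D) (y : I → ℝ) :
    S.colM d y = S.colM c y * (c.toMatrix d).map (Rat.cast : ℚ → ℝ) := by
  ext i j
  have := congrFun (S.rho_mulVec c (d j) y) i
  simp only [colM, Matrix.of_apply, Matrix.mul_apply, Matrix.map_apply, Basis.toMatrix_apply]
  rw [this]
  simp [Matrix.mulVec, dotProduct, colM]

lemma det_map_cast (M : Matrix I I ℚ) : (M.map (Rat.cast : ℚ → ℝ)).det = (M.det : ℝ) := by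
  have := (RingHom.map_det (Rat.castHom ℝ) M).symm
  simpa using this

lemma det_colM (c : Basis I ℚ D) (d : I → D) (y : I → ℝ) :
    (S.colM d y).det = (S.colM c y).det * ((c.det d : ℚ) : ℝ) := by
  rw [S.colM_eq c d y, Matrix.det_mul, det_map_cast, Basis.det_apply]

lemma rho_mul_colM (x : D) (d : I → D) (y : I → ℝ) :
    S.ρ x * S.colM d y = S.colM (fun j => x * d j) y := by
  ext i j
  simp only [colM, Matrix.of_apply, map_mul, ← Matrix.mulVec_mulVec]
  simp [Matrix.mul_apply, Matrix.mulVec, dotProduct]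

lemma colM_rho (x : D) (d : I → D) (y : I → ℝ) :
    S.colM d (S.ρ x *ᵥ y) = S.colM (fun j => d j * x) y := by
  ext i j
  simp only [colM, Matrix.of_apply, map_mul, ← Matrix.mulVec_mulVec]

lemma det_left_eq_right (S : LD D I) (x : D) :
    LinearMap.det (LinearMap.mulLeft ℚ x) = LinearMap.det (LinearMap.mulRight ℚ x) := by
  classical
  haveI : FiniteDimensional ℚ D := Module.Finite.of_basis S.b
  obtain ⟨τ, hτ⟩ : ∃ τ : Dual ℚ D, τ 1 ≠ 0 := by
    by_contra h
    push Not at h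
    exact one_ne_zero ((Module.forall_dual_apply_eq_zero_iff ℚ (1:D)).1 h)
  let φ : D →ₗ[ℚ] Dual ℚ D := (LinearMap.llcomp ℚ D D ℚ τ).comp (LinearMap.mul ℚ D)
  have hφ : ∀ a b, φ a b = τ (a * b) := fun a b => rfl
  have inj : Function.Injective φ := by
    rw [injective_iff_map_eq_zero]
    intro a ha
    by_contra h
    apply hτ
    have := congrArg (fun f => f a⁻¹) ha
    simpa [hφ, h] using this
  let e : D ≃ₗ[ℚ] Dual ℚ D := LinearEquiv.ofInjectiveOfFinrankEq φ inj (by simp)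
  have he : ∀ a, e a = φ a := fun a => rfl
  have h1 : (LinearMap.mulLeft ℚ x).dualMap = e.toLinearMap ∘ₗ LinearMap.mulRight ℚ x ∘ₗ e.symm.toLinearMap := by
    apply LinearMap.ext
    intro f
    obtain ⟨a, rfl⟩ := e.surjective f
    ext z
    simp only [LinearMap.comp_apply, LinearEquiv.coe_coe, LinearEquiv.symm_apply_apply,
      LinearMap.dualMap_apply, LinearMap.mulLeft_apply, LinearMap.mulRight_apply]
    rw [he, he, hφ, hφ, mul_assoc]
  rw [← LinearMap.det_dualMap, h1, LinearMap.det_conj]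

lemma det_rho (x : D) : (S.ρ x).det = ((LinearMap.det (LinearMap.mulRight ℚ x) : ℚ) : ℝ) := by
  have h := S.rho_mul_colM x S.b S.y0
  have h2 := congrArg Matrix.det h
  rw [Matrix.det_mul, S.det_colM S.b (fun j => x * S.b j), mul_comm] at h2
  have h3 := mul_left_cancel₀ S.hy0 h2
  rw [h3, ← S.det_left_eq_right]
  congr 1
  rw [← LinearMap.det_toMatrix S.b, Basis.det_apply]
  congr 1
  ext i j
  simp [LinearMap.toMatrix_apply, Basis.toMatrix_apply]

lemma nu_rho (x : D) (y : I → ℝ) : S.nu (S.ρ x *ᵥ y) = |(S.ρ x).det| * S.nu y := by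
  unfold nu
  rw [S.colM_rho, S.det_colM S.b, abs_mul, mul_comm, S.det_rho]
  congr 3
  rw [← LinearMap.det_toMatrix S.b, Basis.det_apply]
  congr 1
  ext i j
  simp [LinearMap.toMatrix_apply, Basis.toMatrix_apply]

lemma det_rho_ne {x : D} (hx : x ≠ 0) : (S.ρ x).det ≠ 0 := by
  have : S.ρ x * S.ρ x⁻¹ = 1 := by rw [← map_mul, mul_inv_cancel₀ hx, map_one]
  have h := congrArg Matrix.det this
  rw [Matrix.det_mul, Matrix.det_one] at h
  exact left_ne_zero_of_mul_eq_one h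

/-- over-lattices of the order, stable under left multiplication. -/
structure IsOL (L : AddSubgroup D) : Prop where
  le : S.Λ ≤ L
  mul : ∀ x ∈ S.Λ, ∀ l ∈ L, x * l ∈ L
  fin : S.Λ.relIndex L ≠ 0

/-- The type of overlattices. -/
abbrev X := {L : AddSubgroup D // S.IsOL L}

/-- index -/
noncomputable def idx (L : S.X) : ℕ := S.Λ.relIndex L.1

lemma idx_pos (L : S.X) : 0 < S.idx L := Nat.pos_of_ne_zero L.2.fin

lemma idx_smul_mem (L : S.X) {l : D} (hl : l ∈ L.1) : S.idx L • l ∈ S.Λ :=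
  AddSubgroup.nsmul_relIndex_mem _ hl

lemma exists_basis_gen (L : AddSubgroup D) (hle : S.Λ ≤ L) (k : ℕ) (hk : k ≠ 0)
    (hkL : ∀ l ∈ L, k • l ∈ S.Λ) :
    ∃ c : Basis I ℚ D, L = AddSubgroup.closure (Set.range c) := by
  classical
  have h2 : (k : D) ≠ 0 := by exact_mod_cast hk
  let f : L.toIntSubmodule →ₗ[ℤ] S.Λ.toIntSubmodule :=
    ((DistribMulAction.toLinearMap ℤ D k).restrict (p := L.toIntSubmodule)
      (q := S.Λ.toIntSubmodule) hkL)
  have hf : Function.Injective f := by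
    intro a b h
    have h1 : k • (a : D) = k • (b : D) := congrArg Subtype.val h
    rw [nsmul_eq_mul, nsmul_eq_mul] at h1
    exact Subtype.ext (mul_left_cancel₀ h2 h1)
  haveI : Module.Finite ℤ S.Λ.toIntSubmodule := Module.Finite.of_basis (S.b.addSubgroupOfClosure S.Λ rfl)
  haveI : Module.Finite ℤ L.toIntSubmodule := Module.Finite.of_injective f hf
  let e := Module.Free.chooseBasis ℤ L.toIntSubmodule
  let v : Free.ChooseBasisIndex ℤ L.toIntSubmodule → D := fun i => (e i : D)
  have hv : LinearIndependent ℤ v :=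
    e.linearIndependent.map' (L.toIntSubmodule.subtype) (Submodule.ker_subtype _)
  have hv2 : LinearIndependent ℚ v := (LinearIndependent.iff_fractionRing ℤ ℚ).1 hv
  have hL : L = AddSubgroup.closure (Set.range v) := by
    apply AddSubgroup.toIntSubmodule.injective
    rw [AddSubgroup.toIntSubmodule_closure]
    have := congrArg (Submodule.map (L.toIntSubmodule.subtype)) e.span_eq
    rw [Submodule.map_span, Submodule.map_top, Submodule.range_subtype] at this
    rw [← Set.range_comp] at this
    exact this.symm
  have hsp : ⊤ ≤ Submodule.span ℚ (Set.range v) := by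
    rw [← S.b.span_eq, Submodule.span_le]
    rintro _ ⟨i, rfl⟩
    have : S.b i ∈ L := hle (AddSubgroup.subset_closure ⟨i, rfl⟩)
    rw [hL] at this
    have h3 : AddSubgroup.closure (Set.range v) ≤ (Submodule.span ℚ (Set.range v)).toAddSubgroup := by
      rw [AddSubgroup.closure_le]
      exact Submodule.subset_span
    exact h3 this
  let c := Basis.mk hv2 hsp
  refine ⟨c.reindex (c.indexEquiv S.b), ?_⟩
  rw [Basis.range_reindex, Basis.coe_mk]
  exact hL

lemma exists_basis (L : S.X) : ∃ c : Basis I ℚ D, L.1 = AddSubgroup.closure (Set.range c) :=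
  S.exists_basis_gen L.1 L.2.le (S.idx L) (S.idx_pos L).ne' fun _ h => S.idx_smul_mem L h

/-- chosen basis -/
noncomputable def bas (L : S.X) : Basis I ℚ D := (S.exists_basis L).choose
lemma bas_spec (L : S.X) : L.1 = AddSubgroup.closure (Set.range (S.bas L)) :=
  (S.exists_basis L).choose_spec

lemma bas_mem (L : S.X) (i : I) : S.bas L i ∈ L.1 := by
  have := S.bas_spec L
  have h : S.bas L i ∈ AddSubgroup.closure (Set.range (S.bas L)) := AddSubgroup.subset_closure ⟨i, rfl⟩
  rwa [← this] at h

lemma det_basis (L : S.X) (c : Basis I ℚ D) (hc : L.1 = AddSubgroup.closure (Set.range c)) (y : I → ℝ) :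
    |(S.colM c y).det| = S.nu y / S.idx L := by
  have h := AddSubgroup.relIndex_eq_abs_det S.Λ L.1 L.2.le S.b c rfl hc
  have h0 : ((S.idx L : ℕ) : ℝ) ≠ 0 := by exact_mod_cast (S.idx_pos L).ne'
  have h1 : ((S.idx L : ℕ) : ℝ) = |((c.det S.b : ℚ) : ℝ)| := by
    have : ((S.idx L : ℕ) : ℚ) = |c.det S.b| := h
    exact_mod_cast congrArg (Rat.cast : ℚ → ℝ) this
  rw [eq_div_iff h0, nu, S.det_colM c S.b, abs_mul, h1]

/-- the lattice matrix -/
noncomputable def AM (L : S.X) (y : I → ℝ) : Matrix I I ℝ := S.colM (S.bas L) y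

lemma abs_det_AM (L : S.X) (y : I → ℝ) : |(S.AM L y).det| = S.nu y / S.idx L :=
  S.det_basis L _ (S.bas_spec L) y

lemma exists_intMat (L : S.X) : ∃ M : I → Matrix I I ℤ, ∀ i y,
    S.ρ (S.b i) * S.AM L y = S.AM L y * (M i).map Int.cast := by
  classical
  let e := (S.bas L).addSubgroupOfClosure L.1 (S.bas_spec L)
  have hm : ∀ i j, S.b i * S.bas L j ∈ L.1 := fun i j =>
    L.2.mul _ (AddSubgroup.subset_closure ⟨i, rfl⟩) _ (S.bas_mem L j)
  refine ⟨fun i => Matrix.of fun k j => e.repr ⟨_, hm i j⟩ k, fun i y => ?_⟩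
  rw [AM, S.rho_mul_colM, S.colM_eq (S.bas L)]
  congr 1
  ext k j
  simp only [Matrix.map_apply, Basis.toMatrix_apply, Matrix.of_apply]
  have : (S.bas L).repr (S.b i * S.bas L j) k = ((e.repr ⟨_, hm i j⟩ k : ℤ) : ℚ) := by
    exact (Basis.addSubgroupOfClosure_repr_apply L.1 (S.bas L) (S.bas_spec L) ⟨_, hm i j⟩ k).symm
  rw [this]; simp

/-- coordinates -/
noncomputable def coordE (L : S.X) : L.1 ≃ (I → ℤ) :=
  ((S.bas L).addSubgroupOfClosure L.1 (S.bas_spec L)).equivFun.toEquiv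

lemma coordE_spec (L : S.X) (l : L.1) (y : I → ℝ) :
    S.ρ (l : D) *ᵥ y = S.AM L y *ᵥ cv (S.coordE L l) := by
  rw [S.rho_mulVec (S.bas L), AM]
  congr 1
  ext i
  have : (S.bas L).repr l i =
    (((S.bas L).addSubgroupOfClosure L.1 (S.bas_spec L)).repr l i : ℤ) := (Basis.addSubgroupOfClosure_repr_apply L.1 (S.bas L) (S.bas_spec L) l i).symm
  rw [this]
  simp only [cv, Rat.cast_intCast]
  rfl

lemma coordE_zero (L : S.X) : S.coordE L 0 = 0 :=
  map_zero ((S.bas L).addSubgroupOfClosure L.1 (S.bas_spec L)).equivFun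

lemma countableD (S : LD D I) : Countable D :=
  S.b.equivFun.toEquiv.injective.countable

end LD
end ABHN
end part04

section part05
namespace ABHN
open MeasureTheory Real Module
open scoped Matrix ENNReal

variable {D : Type*} [DivisionRing D] [CharZero D] {I : Type*} [Fintype I] [DecidableEq I]

namespace LD
variable (S : LD D I)

/-- gaussian -/
noncomputable def Ex (t : ℝ) (y : I → ℝ) : ℝ≥0∞ := ENNReal.ofReal (Real.exp (-π * t ^ 2 * nsq y))

lemma Ex_ne_zero (t : ℝ) (y : I → ℝ) : Ex t y ≠ 0 := by
  simp [Ex, Real.exp_pos]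
lemma Ex_ne_top (t : ℝ) (y : I → ℝ) : Ex t y ≠ ∞ := ENNReal.ofReal_ne_top

lemma measurable_Ex (t : ℝ) : Measurable (Ex (I := I) t) := by
  have : Continuous (nsq (I := I)) := continuous_nsq
  unfold Ex
  exact ENNReal.measurable_ofReal.comp (by fun_prop : Continuous fun y : I → ℝ => Real.exp (-π * t ^ 2 * nsq y)).measurable

lemma continuous_nu : Continuous S.nu := by
  unfold nu colM
  refine (Continuous.matrix_det ?_).abs
  refine continuous_matrix fun i j => ?_
  exact (continuous_apply i).comp (Continuous.matrix_mulVec continuous_const continuous_id)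

/-- inverse covolume -/
noncomputable def nuI (y : I → ℝ) : ℝ≥0∞ := (ENNReal.ofReal (S.nu y))⁻¹

lemma measurable_nuI : Measurable S.nuI :=
  (ENNReal.measurable_ofReal.comp S.continuous_nu.measurable).inv

lemma lintegral_mulVec (A : Matrix I I ℝ) (hA : A.det ≠ 0) (g : (I → ℝ) → ℝ≥0∞) :
    ∫⁻ y, g (A *ᵥ y) = ENNReal.ofReal |A.det|⁻¹ * ∫⁻ y, g y := by
  rw [← (measurableEmbedding_mulVec A hA).lintegral_map g, map_mulVec_volume A hA,
    lintegral_smul_measure, smul_eq_mul]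

lemma invariance {x : D} (hx : x ≠ 0) (f : (I → ℝ) → ℝ≥0∞) :
    ∫⁻ y, f (S.ρ x *ᵥ y) * S.nuI y = ∫⁻ y, f y * S.nuI y := by
  have hd := S.det_rho_ne hx
  have hpos : 0 < |(S.ρ x).det| := abs_pos.2 hd
  have h : ∀ y, f (S.ρ x *ᵥ y) * S.nuI y =
      ENNReal.ofReal |(S.ρ x).det| * (f (S.ρ x *ᵥ y) * S.nuI (S.ρ x *ᵥ y)) := by
    intro y
    have : S.nuI y = ENNReal.ofReal |(S.ρ x).det| * S.nuI (S.ρ x *ᵥ y) := by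
      rw [nuI, nuI, S.nu_rho, ENNReal.ofReal_mul hpos.le, ENNReal.mul_inv (by simp [hd]) (by simp), ← mul_assoc,
        ENNReal.mul_inv_cancel (by simp [hd]) (by simp), one_mul]
    rw [this]; ring
  simp_rw [h]
  rw [lintegral_const_mul', lintegral_mulVec _ hd (fun y => f y * S.nuI y), ← mul_assoc,
    ← ENNReal.ofReal_mul hpos.le, mul_inv_cancel₀ hpos.ne', ENNReal.ofReal_one, one_mul]
  simp

open Classical in
/-- cutoff -/
noncomputable def eta (L : S.X) (y : I → ℝ) : ℝ≥0∞ :=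
  if 1 ≤ S.nu y / S.idx L ∧ S.nu y / S.idx L ≤ 2 then 1 else 0

lemma measurable_eta (L : S.X) : Measurable (S.eta L) := by
  unfold eta
  have := S.continuous_nu.measurable
  refine Measurable.ite ?_ measurable_const measurable_const
  exact (measurableSet_le measurable_const (this.div_const _)).inter
    (measurableSet_le (this.div_const _) measurable_const)

lemma eta_mul_congr (L : S.X) (y : I → ℝ) {a b : ℝ≥0∞}
    (h : 1 ≤ S.nu y / S.idx L → S.nu y / S.idx L ≤ 2 → a = b) : a * S.eta L y = b * S.eta L y := by
  unfold eta
  split_ifs with h1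
  · rw [h h1.1 h1.2]
  · simp

lemma eta_mul_le (L : S.X) (y : I → ℝ) {a b : ℝ≥0∞}
    (h : 1 ≤ S.nu y / S.idx L → S.nu y / S.idx L ≤ 2 → a ≤ b) : a * S.eta L y ≤ b * S.eta L y := by
  unfold eta
  split_ifs with h1
  · gcongr; exact h h1.1 h1.2
  · simp

open Classical in
/-- theta function without zero -/
noncomputable def Th (L : S.X) (y : I → ℝ) (t : ℝ) : ℝ≥0∞ :=
  ∑' x : D, if x ∈ L.1 ∧ x ≠ 0 then Ex t (S.ρ x *ᵥ y) else 0

lemma measurable_Th (L : S.X) (t : ℝ) : Measurable fun y => S.Th L y t := by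
  classical
  haveI := S.countableD
  unfold Th
  refine Measurable.tsum fun x => ?_
  split_ifs
  · exact (measurable_Ex t).comp (Continuous.matrix_mulVec continuous_const continuous_id).measurable
  · exact measurable_const

lemma oneMemX (L : S.X) : (1 : D) ∈ L.1 := L.2.le S.one_memΛ

lemma Th_ne_zero (L : S.X) (y : I → ℝ) (t : ℝ) : S.Th L y t ≠ 0 := by
  classical
  unfold Th
  rw [Ne, ENNReal.tsum_eq_zero]
  intro h
  have := h 1
  rw [if_pos ⟨oneMemX S L, one_ne_zero⟩] at this
  exact Ex_ne_zero _ _ this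

lemma Th_eq (L : S.X) (y : I → ℝ) (hy : (S.AM L y).det ≠ 0) {t : ℝ} (ht : 0 < t) :
    S.Th L y t = ENNReal.ofReal (gth (S.AM L y) t - 1) := by
  classical
  have h1 := gth_eq_one_add (S.AM L y) hy ht
  rw [h1, add_sub_cancel_left, ENNReal.ofReal_tsum_of_nonneg]
  · rw [← (S.coordE L).tsum_eq]
    unfold Th
    have : ∀ x : D, (if x ∈ L.1 ∧ x ≠ 0 then Ex t (S.ρ x *ᵥ y) else 0) =
        (L.1 : Set D).indicator (fun x => if x ≠ 0 then Ex t (S.ρ x *ᵥ y) else 0) x := by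
      intro x
      by_cases h : x ∈ L.1 <;> simp [Set.indicator, h]
    simp_rw [this]
    rw [← tsum_subtype]
    refine tsum_congr fun x => ?_
    have hx : ((x : D) ≠ 0) ↔ ¬ (S.coordE L x = 0) := by
      rw [← S.coordE_zero L, (S.coordE L).injective.eq_iff, Ne, not_iff_not]
      exact (Subtype.ext_iff (a1 := x) (a2 := 0)).symm
    by_cases h : (x : D) = 0
    · have := (not_iff_not.2 hx).1 (by simpa using h)
      rw [if_neg (by simpa using h), if_pos (by simpa using this)]; simp
    · rw [if_pos h, if_neg (hx.1 h), Ex]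
      have := S.coordE_spec L x y
      rw [← this]
  · intro m; split_ifs
    · exact le_rfl
    · positivity
  · exact gth_sub_one_summable (S.AM L y) hy ht

lemma map_mulRight_basis (L : S.X) {x : D} (hx : x ≠ 0) :
    ∃ c : Basis I ℚ D, (∀ i, c i = S.bas L i * x⁻¹) ∧
      AddSubgroup.map (AddMonoidHom.mulRight x⁻¹) L.1 = AddSubgroup.closure (Set.range c) := by
  let e : D ≃ₗ[ℚ] D := LinearEquiv.ofLinear (LinearMap.mulRight ℚ x⁻¹) (LinearMap.mulRight ℚ x)
    (by ext; simp [hx]) (by ext; simp [hx])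
  refine ⟨(S.bas L).map e, fun i => rfl, ?_⟩
  conv_lhs => rw [S.bas_spec L]
  rw [AddMonoidHom.map_closure, ← Set.range_comp]
  rfl

/-- twisting a lattice -/
noncomputable def tw (L : S.X) (x : D) (hx : x ∈ L.1 ∧ x ≠ 0) : S.X :=
  ⟨AddSubgroup.map (AddMonoidHom.mulRight x⁻¹) L.1, by
    have hle : S.Λ ≤ AddSubgroup.map (AddMonoidHom.mulRight x⁻¹) L.1 := by
      intro l hl
      exact ⟨l * x, L.2.mul l hl x hx.1, by simp [hx.2]⟩
    refine ⟨hle, ?_, ?_⟩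
    · rintro l hl _ ⟨z, hz, rfl⟩
      exact ⟨l * z, L.2.mul l hl z hz, by simp [mul_assoc]⟩
    · obtain ⟨c, -, hc⟩ := S.map_mulRight_basis L hx.2
      have h := AddSubgroup.relIndex_eq_abs_det S.Λ _ hle S.b c rfl hc
      intro h0
      rw [h0] at h
      have := (c.isUnit_det S.b).ne_zero
      simp at h
      exact this (abs_eq_zero.1 h.symm)⟩

lemma mem_tw (L : S.X) (x : D) (hx : x ∈ L.1 ∧ x ≠ 0) (z : D) :
    z ∈ (S.tw L x hx).1 ↔ z * x ∈ L.1 := by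
  constructor
  · rintro ⟨w, hw, rfl⟩
    simpa [hx.2] using hw
  · intro h
    exact ⟨z * x, h, by simp [hx.2]⟩

lemma Th_tw (L : S.X) (x : D) (hx : x ∈ L.1 ∧ x ≠ 0) (y : I → ℝ) (t : ℝ) :
    S.Th (S.tw L x hx) (S.ρ x *ᵥ y) t = S.Th L y t := by
  classical
  unfold Th
  rw [← (Equiv.mulRight₀ x hx.2).tsum_eq (fun x => if x ∈ L.1 ∧ x ≠ 0 then Ex t (S.ρ x *ᵥ y) else 0)]
  refine tsum_congr fun z => ?_
  rw [Equiv.mulRight₀_apply, S.mem_tw, map_mul, Matrix.mulVec_mulVec]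
  simp [hx.2]

lemma eta_tw (L : S.X) (x : D) (hx : x ∈ L.1 ∧ x ≠ 0) (y : I → ℝ) :
    S.eta (S.tw L x hx) (S.ρ x *ᵥ y) = S.eta L y := by
  obtain ⟨c, hc1, hc⟩ := S.map_mulRight_basis L hx.2
  have h := S.det_basis (S.tw L x hx) c hc (S.ρ x *ᵥ y)
  rw [S.colM_rho] at h
  have h2 : (fun j => c j * x) = S.bas L := by
    funext j
    rw [hc1]; simp [hx.2]
  rw [h2, S.det_basis L _ (S.bas_spec L)] at h
  unfold eta
  rw [h]

/-- pairs -/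
abbrev Pr := {p : S.X × D // p.2 ∈ p.1.1 ∧ p.2 ≠ 0}

/-- the involution -/
noncomputable def inv (p : S.Pr) : S.Pr :=
  ⟨(S.tw p.1.1 p.1.2 p.2, p.1.2⁻¹), by
    refine ⟨?_, inv_ne_zero p.2.2⟩
    rw [S.mem_tw]
    simpa [p.2.2] using oneMemX S p.1.1⟩

lemma inv_inv : Function.Involutive S.inv := by
  rintro ⟨⟨L, x⟩, hx⟩
  apply Subtype.ext
  apply Prod.ext
  · apply Subtype.ext
    ext z
    simp only [inv]
    rw [S.mem_tw, S.mem_tw, mul_assoc, inv_mul_cancel₀ hx.2, mul_one]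
  · simp [inv]

lemma tsum_pairs (f : S.X → D → ℝ≥0∞) :
    ∑' p : S.Pr, f p.1.1 p.1.2 = ∑' L : S.X, ∑' x : D, (open Classical in if x ∈ L.1 ∧ x ≠ 0 then f L x else 0) := by
  classical
  rw [← ENNReal.tsum_prod]
  have := tsum_subtype {p : S.X × D | p.2 ∈ p.1.1 ∧ p.2 ≠ 0} (fun p => f p.1 p.2)
  rw [show (∑' p : S.Pr, f p.1.1 p.1.2) = ∑' p : {p : S.X × D | p.2 ∈ p.1.1 ∧ p.2 ≠ 0}, f p.1.1 p.1.2 from rfl, this]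
  refine tsum_congr fun p => ?_
  simp [Set.indicator]

/-- truncated zeta integrand -/
noncomputable def Jt (t : ℝ) : ℝ≥0∞ := ∑' L : S.X, ∫⁻ y, Ex t y * S.eta L y * S.nuI y

/-- weight -/
noncomputable def wt (L : S.X) (y : I → ℝ) : ℝ≥0∞ := (S.Th L y 1)⁻¹ * Ex 1 y * S.eta L y * S.nuI y

lemma measurable_wt (L : S.X) : Measurable (S.wt L) :=
  (((S.measurable_Th L 1).inv.mul (measurable_Ex 1)).mul (S.measurable_eta L)).mul S.measurable_nuI

lemma AM_det_ne (L : S.X) (y : I → ℝ) (h : 1 ≤ S.nu y / S.idx L) : (S.AM L y).det ≠ 0 := by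
  rw [← abs_pos, S.abs_det_AM]; linarith

theorem unfolding (t : ℝ) : S.Jt t = ∑' L : S.X, ∫⁻ y, S.Th L y t * S.wt L y := by
  classical
  haveI := S.countableD
  have hmul : ∀ x : D, Measurable fun y : I → ℝ => S.ρ x *ᵥ y := fun x =>
    (Continuous.matrix_mulVec continuous_const continuous_id).measurable
  have e1 : ∀ L : S.X, ∫⁻ y, Ex t y * S.eta L y * S.nuI y =
      ∑' x : D, if x ∈ L.1 ∧ x ≠ 0 then
        ∫⁻ y, (Ex 1 (S.ρ x *ᵥ y) * (S.Th L y 1)⁻¹ * Ex t y * S.eta L y) * S.nuI y else 0 := by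
    intro L
    have : ∀ y, Ex t y * S.eta L y * S.nuI y = ∑' x : D, (if x ∈ L.1 ∧ x ≠ 0 then
        Ex 1 (S.ρ x *ᵥ y) * (S.Th L y 1)⁻¹ * Ex t y * S.eta L y * S.nuI y else 0) := by
      intro y
      have h2 : ∀ x : D, (if x ∈ L.1 ∧ x ≠ 0 then
        Ex 1 (S.ρ x *ᵥ y) * (S.Th L y 1)⁻¹ * Ex t y * S.eta L y * S.nuI y else 0) =
        (if x ∈ L.1 ∧ x ≠ 0 then Ex 1 (S.ρ x *ᵥ y) else 0) * ((S.Th L y 1)⁻¹ * Ex t y * S.eta L y * S.nuI y) := by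
        intro x
        split_ifs
        · ring
        · simp
      simp_rw [h2]
      rw [ENNReal.tsum_mul_right]
      change _ = S.Th L y 1 * _
      rw [← mul_assoc, ← mul_assoc, ← mul_assoc]
      congr 1
      apply S.eta_mul_congr
      intro h3 _
      have h4 := S.AM_det_ne L y h3
      rw [ENNReal.mul_inv_cancel (S.Th_ne_zero L y 1) (by rw [S.Th_eq L y h4 one_pos]; simp), one_mul]
    simp_rw [this]
    rw [lintegral_tsum]
    · refine tsum_congr fun x => ?_
      split_ifs <;> simp
    · intro x
      split_ifs
      · exact ((((((measurable_Ex 1).comp (hmul x)).mul (S.measurable_Th L 1).inv).mul (measurable_Ex t)).mul (S.measurable_eta L)).mul S.measurable_nuI).aemeasurable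
      · exact aemeasurable_const
  have e2 : ∀ L : S.X, ∫⁻ y, S.Th L y t * S.wt L y =
      ∑' x : D, if x ∈ L.1 ∧ x ≠ 0 then
        ∫⁻ y, (Ex t (S.ρ x *ᵥ y) * (S.Th L y 1)⁻¹ * Ex 1 y * S.eta L y) * S.nuI y else 0 := by
    intro L
    have : ∀ y, S.Th L y t * S.wt L y = ∑' x : D, (if x ∈ L.1 ∧ x ≠ 0 then
        Ex t (S.ρ x *ᵥ y) * (S.Th L y 1)⁻¹ * Ex 1 y * S.eta L y * S.nuI y else 0) := by
      intro y
      rw [Th, ← ENNReal.tsum_mul_right]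
      refine tsum_congr fun x => ?_
      split_ifs
      · rw [wt]; ring
      · simp
    simp_rw [this]
    rw [lintegral_tsum]
    · refine tsum_congr fun x => ?_
      split_ifs <;> simp
    · intro x
      split_ifs
      · exact ((((((measurable_Ex t).comp (hmul x)).mul (S.measurable_Th L 1).inv).mul (measurable_Ex 1)).mul (S.measurable_eta L)).mul S.measurable_nuI).aemeasurable
      · exact aemeasurable_const
  unfold Jt
  simp_rw [e1, e2]
  rw [← S.tsum_pairs (fun L x => ∫⁻ y, (Ex 1 (S.ρ x *ᵥ y) * (S.Th L y 1)⁻¹ * Ex t y * S.eta L y) * S.nuI y),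
    ← S.tsum_pairs (fun L x => ∫⁻ y, (Ex t (S.ρ x *ᵥ y) * (S.Th L y 1)⁻¹ * Ex 1 y * S.eta L y) * S.nuI y),
    ← (S.inv_inv.toPerm).tsum_eq]
  refine tsum_congr ?_
  rintro ⟨⟨L, x⟩, hx⟩
  change ∫⁻ y, (Ex 1 (S.ρ x⁻¹ *ᵥ y) * (S.Th (S.tw L x hx) y 1)⁻¹ * Ex t y * S.eta (S.tw L x hx) y) * S.nuI y = _
  rw [← S.invariance hx.2]
  refine lintegral_congr fun y => ?_
  rw [S.Th_tw, S.eta_tw, Matrix.mulVec_mulVec, ← map_mul, inv_mul_cancel₀ hx.2, map_one, Matrix.one_mulVec]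
  ring

end LD
end ABHN
end part05

section part06
namespace ABHN
open MeasureTheory Real Module
open scoped Matrix ENNReal

variable {D : Type*} [DivisionRing D] [CharZero D] {I : Type*} [Fintype I] [DecidableEq I]

namespace LD
variable (S : LD D I)

lemma nonemptyI (S : LD D I) : Nonempty I := S.b.index_nonempty

instance countableX : Countable S.X := by
  haveI := S.countableD
  refine Function.Injective.countable (f := fun L : S.X => (fun i => S.bas L i : I → D)) ?_
  intro L1 L2 h
  apply Subtype.ext
  rw [S.bas_spec L1, S.bas_spec L2]
  have : (S.bas L1 : I → D) = S.bas L2 := h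
  rw [this]

/-- zeta function -/
noncomputable def zX (s : ℝ) : ℝ≥0∞ := ∑' L : S.X, (ENNReal.ofReal (S.idx L)) ^ (-s)

/-- archimedean factor -/
noncomputable def arch (s : ℝ) : ℝ≥0∞ := ∫⁻ y, Ex 1 y * (ENNReal.ofReal (S.nu y)) ^ s * S.nuI y

/-- scaled coordinates mod k -/
noncomputable def gmod (L : S.X) (k : ℕ) : I → I → ZMod k := fun i j =>
  (((S.b.addSubgroupOfClosure S.Λ rfl).repr ⟨_, S.idx_smul_mem L (S.bas_mem L i)⟩ j : ℤ) : ZMod k)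

lemma gmod_le {L1 L2 : S.X} (h : S.idx L1 = S.idx L2) (hg : S.gmod L1 (S.idx L1) = S.gmod L2 (S.idx L1)) :
    L1.1 ≤ L2.1 := by
  conv_lhs => rw [S.bas_spec L1]
  rw [AddSubgroup.closure_le]
  rintro _ ⟨i, rfl⟩
  set k := S.idx L1
  have hk : (k : D) ≠ 0 := by exact_mod_cast (S.idx_pos L1).ne'
  set e := S.b.addSubgroupOfClosure S.Λ rfl
  set u : S.Λ.toIntSubmodule := ⟨_, S.idx_smul_mem L1 (S.bas_mem L1 i)⟩ with hu
  set v : S.Λ.toIntSubmodule := ⟨_, S.idx_smul_mem L2 (S.bas_mem L2 i)⟩ with hv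
  have h1 : ∀ j, ∃ q : ℤ, e.repr u j - e.repr v j = k * q := by
    intro j
    have := congrFun (congrFun hg i) j
    have h2 : ((e.repr v j : ℤ) : ZMod k) = ((e.repr u j : ℤ) : ZMod k) := this.symm
    rw [ZMod.intCast_eq_intCast_iff_dvd_sub] at h2
    exact h2
  choose q hq using h1
  have h3 : u - v = k • ∑ j, q j • e j := by
    conv_lhs => rw [← e.sum_repr u, ← e.sum_repr v, ← Finset.sum_sub_distrib]
    rw [Finset.smul_sum]
    refine Finset.sum_congr rfl fun j _ => ?_
    rw [← sub_smul, hq, mul_smul, natCast_zsmul]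
  have h4 := congrArg (fun z : S.Λ.toIntSubmodule => (z : D)) h3
  have h4 : (u : D) - (v : D) = k • ((∑ j, q j • e j : S.Λ.toIntSubmodule) : D) := h4
  have h5 : (k : D) * (S.bas L1 i) - (k : D) * S.bas L2 i = (k : D) * ((∑ j, q j • e j : S.Λ.toIntSubmodule) : D) := by
    rw [← nsmul_eq_mul, ← nsmul_eq_mul, ← nsmul_eq_mul, ← h4]
    have : k • S.bas L2 i = S.idx L2 • S.bas L2 i := by rw [← h]
    rw [this]
  rw [← mul_sub] at h5
  have h6 := mul_left_cancel₀ hk h5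
  have h7 : S.bas L1 i = ((∑ j, q j • e j : S.Λ.toIntSubmodule) : D) + S.bas L2 i := by
    rw [← h6]; abel
  rw [h7]
  exact L2.1.add_mem (L2.2.le (∑ j, q j • e j : S.Λ.toIntSubmodule).2) (S.bas_mem L2 i)

lemma gmod_inj : Function.Injective
    (fun L : S.X => (⟨S.idx L, S.gmod L (S.idx L)⟩ : Σ k : ℕ, (I → I → ZMod k))) := by
  intro L1 L2 h
  have key : ∀ k1 k2, (⟨k1, S.gmod L1 k1⟩ : Σ k : ℕ, (I → I → ZMod k)) = ⟨k2, S.gmod L2 k2⟩ →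
      k1 = k2 ∧ S.gmod L1 k1 = S.gmod L2 k1 := by
    intro k1 k2 h
    obtain ⟨rfl, h⟩ := Sigma.mk.inj_iff.1 h
    exact ⟨rfl, eq_of_heq h⟩
  obtain ⟨h1, h2⟩ := key _ _ h
  apply Subtype.ext
  apply le_antisymm
  · exact S.gmod_le h1 h2
  · refine S.gmod_le h1.symm ?_
    rw [← h1]; exact h2.symm

lemma zX_finite {s : ℝ} (hs : (Fintype.card I : ℝ) ^ 2 + 2 ≤ s) : S.zX s ≠ ∞ := by
  classical
  let F : ℕ → ℝ≥0∞ := fun k => if k = 0 then 0 else (ENNReal.ofReal (k : ℝ)) ^ (-s)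
  have h1 : S.zX s ≤ ∑' p : (Σ k : ℕ, (I → I → ZMod k)), F p.1 := by
    refine le_trans (le_of_eq ?_) (ENNReal.tsum_comp_le_tsum_of_injective S.gmod_inj _)
    unfold zX
    refine tsum_congr fun L => ?_
    simp [F, (S.idx_pos L).ne']
  refine ne_top_of_le_ne_top ?_ h1
  rw [ENNReal.tsum_sigma (fun k (_ : I → I → ZMod k) => F k)]
  have h2 : ∀ k : ℕ, (∑' _ : (I → I → ZMod k), F k) ≤ ENNReal.ofReal (1 / (k : ℝ) ^ 2) := by
    intro k
    rcases Nat.eq_zero_or_pos k with rfl | hk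
    · simp [F]
    · haveI : NeZero k := ⟨hk.ne'⟩
      have hk1 : (1 : ℝ) ≤ k := by exact_mod_cast hk
      have hkp : (0 : ℝ) < k := by linarith
      rw [tsum_fintype, Finset.sum_const, Finset.card_univ, Fintype.card_fun, Fintype.card_fun, ZMod.card, nsmul_eq_mul]
      simp only [F, hk.ne', if_false]
      rw [ENNReal.ofReal_rpow_of_pos hkp]
      rw [show (((k ^ Fintype.card I) ^ Fintype.card I : ℕ) : ℝ≥0∞) = ENNReal.ofReal ((k : ℝ) ^ ((Fintype.card I : ℝ) ^ 2)) by
        rw [← ENNReal.ofReal_natCast]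
        congr 1
        push_cast
        rw [← pow_mul, ← Real.rpow_natCast]
        congr 1
        push_cast; ring]
      rw [← ENNReal.ofReal_mul (by positivity), ← Real.rpow_add hkp]
      apply ENNReal.ofReal_le_ofReal
      rw [one_div, ← Real.rpow_natCast (k : ℝ) 2, ← Real.rpow_neg hkp.le]
      apply Real.rpow_le_rpow_of_exponent_le hk1
      push_cast; linarith
  refine ne_top_of_le_ne_top ?_ (ENNReal.tsum_le_tsum h2)
  rw [← ENNReal.ofReal_tsum_of_nonneg (fun _ => by positivity) (Real.summable_one_div_nat_pow.2 (by norm_num))]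
  exact ENNReal.ofReal_ne_top

lemma nu_smul (t : ℝ) (y : I → ℝ) : S.nu (t • y) = |t| ^ Fintype.card I * S.nu y := by
  unfold nu
  have : S.colM S.b (t • y) = t • S.colM S.b y := by
    ext i j
    simp [colM, Matrix.mulVec_smul]
  rw [this, Matrix.det_smul, abs_mul, abs_pow]

lemma nu_nonneg (y : I → ℝ) : 0 ≤ S.nu y := abs_nonneg _

/-- substitution y = z/t -/
lemma scale_integral (L : S.X) {t : ℝ} (ht : 0 < t) :
    ∫⁻ y, Ex t y * S.eta L y * S.nuI y = ∫⁻ y, Ex 1 y * S.nuI y * S.eta L (t⁻¹ • y) := by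
  have hA : ((t⁻¹ : ℝ) • (1 : Matrix I I ℝ)).det ≠ 0 := by
    rw [Matrix.det_smul]; simp [ht.ne']
  have h := lintegral_mulVec ((t⁻¹ : ℝ) • (1 : Matrix I I ℝ)) hA (fun y => Ex t y * S.eta L y * S.nuI y)
  simp only [Matrix.smul_mulVec, Matrix.one_mulVec] at h
  have hd : |((t⁻¹ : ℝ) • (1 : Matrix I I ℝ)).det|⁻¹ = t ^ Fintype.card I := by
    rw [Matrix.det_smul, Matrix.det_one, mul_one, abs_of_pos (by positivity)]; simp
  rw [hd] at h
  set c := t ^ Fintype.card I with hc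
  have hcp : 0 < c := by positivity
  have h2 : ∀ y, Ex t (t⁻¹ • y) * S.eta L (t⁻¹ • y) * S.nuI (t⁻¹ • y) =
      ENNReal.ofReal c * (Ex 1 y * S.nuI y * S.eta L (t⁻¹ • y)) := by
    intro y
    have e1 : Ex t (t⁻¹ • y) = Ex 1 y := by
      unfold Ex
      rw [nsq_smul]
      congr 2
      field_simp
    have e2 : S.nuI (t⁻¹ • y) = ENNReal.ofReal c * S.nuI y := by
      unfold nuI
      rw [S.nu_smul, abs_of_pos (inv_pos.2 ht), inv_pow, ENNReal.ofReal_mul (by positivity),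
        ENNReal.mul_inv (by simp [ht]) (by simp)]
      rw [ENNReal.ofReal_inv_of_pos hcp, _root_.inv_inv]
    rw [e1, e2]; ring
  simp_rw [h2] at h
  rw [lintegral_const_mul' _ _ (by simp)] at h
  exact ((ENNReal.mul_right_inj (by simp [hcp]) (by simp)).1 h).symm

lemma t_integral {r s : ℝ} (N : ℕ) (hN : 0 < N) (hr : 0 ≤ r) (hs : 0 < s) :
    ∫⁻ t in Set.Ioi (0:ℝ), ENNReal.ofReal (t ^ (N * s - 1)) *
      (open Classical in if 1 ≤ (t⁻¹) ^ N * r ∧ (t⁻¹) ^ N * r ≤ 2 then (1:ℝ≥0∞) else 0) =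
    ENNReal.ofReal ((1 - 2 ^ (-s)) / (N * s)) * ENNReal.ofReal r ^ s := by
  classical
  have hN' : (0:ℝ) < N := by exact_mod_cast hN
  rcases hr.eq_or_lt with rfl | hr
  · simp [hs, not_le.2 (zero_lt_one' ℝ)]
  set u := (r / 2) ^ ((N:ℝ)⁻¹) with hu
  set v := r ^ ((N:ℝ)⁻¹) with hv
  have hu0 : 0 < u := by positivity
  have hv0 : 0 < v := by positivity
  have huN : u ^ N = r / 2 := Real.rpow_inv_natCast_pow (by positivity) hN.ne'
  have hvN : v ^ N = r := Real.rpow_inv_natCast_pow hr.le hN.ne'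
  have huv : u ≤ v := Real.rpow_le_rpow (by positivity) (by linarith) (by positivity)
  have h1 : ∀ t ∈ Set.Ioi (0:ℝ), ENNReal.ofReal (t ^ (N * s - 1)) *
      (if 1 ≤ (t⁻¹) ^ N * r ∧ (t⁻¹) ^ N * r ≤ 2 then (1:ℝ≥0∞) else 0) =
      (Set.Icc u v).indicator (fun t => ENNReal.ofReal (t ^ (N * s - 1))) t := by
    intro t ht
    have ht : 0 < t := ht
    have : (1 ≤ (t⁻¹) ^ N * r ∧ (t⁻¹) ^ N * r ≤ 2) ↔ t ∈ Set.Icc u v := by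
      rw [Set.mem_Icc, ← pow_le_pow_iff_left₀ hu0.le ht.le hN.ne', ← pow_le_pow_iff_left₀ ht.le hv0.le hN.ne',
        huN, hvN, and_comm, inv_pow]
      have : 0 < t ^ N := by positivity
      rw [inv_mul_le_iff₀ this, le_inv_mul_iff₀ this, mul_one]
      constructor
      · rintro ⟨h, h'⟩; exact ⟨by linarith, h'⟩
      · rintro ⟨h, h'⟩; exact ⟨by linarith, h'⟩
    by_cases h : t ∈ Set.Icc u v
    · rw [if_pos (this.2 h), Set.indicator_of_mem h, mul_one]
    · rw [if_neg (fun h' => h (this.1 h')), Set.indicator_of_notMem h, mul_zero]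
  have hsub : Set.Icc u v ∩ Set.Ioi 0 = Set.Icc u v :=
    Set.inter_eq_left.2 (fun t ht => lt_of_lt_of_le hu0 ht.1)
  rw [setLIntegral_congr_fun measurableSet_Ioi h1, setLIntegral_indicator measurableSet_Icc,
    hsub]
  have hintg : IntegrableOn (fun t : ℝ => t ^ (N * s - 1)) (Set.Icc u v) := by
    refine ContinuousOn.integrableOn_Icc ?_
    intro t ht
    exact (Real.continuousAt_rpow_const _ _ (Or.inl (lt_of_lt_of_le hu0 ht.1).ne')).continuousWithinAt
  rw [← ofReal_integral_eq_lintegral_ofReal hintg]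
  · rw [integral_Icc_eq_integral_Ioc, ← intervalIntegral.integral_of_le huv,
      integral_rpow (Or.inr ⟨by have : (0:ℝ) < N * s := by positivity
                                linarith, by
        rw [Set.uIcc_of_le huv]; intro h; exact absurd h.1 (not_le.2 hu0)⟩)]
    rw [ENNReal.ofReal_rpow_of_pos hr, ← ENNReal.ofReal_mul']
    · congr 1
      have e1 : v ^ (N * s - 1 + 1) = r ^ s := by
        rw [hv, ← Real.rpow_mul hr.le]; congr 1; field_simp; ring
      have e2 : u ^ (N * s - 1 + 1) = r ^ s * 2 ^ (-s) := by
        rw [hu, ← Real.rpow_mul (by positivity), show (N:ℝ)⁻¹ * (N * s - 1 + 1) = s by field_simp; ring,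
          Real.div_rpow hr.le (by norm_num), Real.rpow_neg (by norm_num)]; rfl
      rw [e1, e2]
      field_simp
      ring
    · positivity
  · filter_upwards [ae_restrict_mem measurableSet_Icc] with t ht
    have : 0 < t := lt_of_lt_of_le hu0 ht.1
    positivity

theorem mellin_id {s : ℝ} (hs : 0 < s) :
    ∫⁻ t in Set.Ioi (0:ℝ), ENNReal.ofReal (t ^ (Fintype.card I * s - 1)) * S.Jt t =
    ENNReal.ofReal ((1 - 2 ^ (-s)) / (Fintype.card I * s)) * (S.zX s * S.arch s) := by
  classical
  haveI := S.nonemptyI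
  have hN : 0 < Fintype.card I := Fintype.card_pos
  have hsm : Measurable fun p : ℝ × (I → ℝ) => p.1⁻¹ • p.2 := by
    exact (measurable_fst.inv).smul measurable_snd
  have hpow : Measurable fun t : ℝ => ENNReal.ofReal (t ^ (Fintype.card I * s - 1)) := by
    fun_prop
  have hmeas : ∀ L : S.X, Measurable fun p : ℝ × (I → ℝ) =>
      ENNReal.ofReal (p.1 ^ (Fintype.card I * s - 1)) * (Ex 1 p.2 * S.nuI p.2 * S.eta L (p.1⁻¹ • p.2)) := by
    intro L
    refine (hpow.comp measurable_fst).mul ((((measurable_Ex 1).comp measurable_snd).mul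
      (S.measurable_nuI.comp measurable_snd)).mul ((S.measurable_eta L).comp hsm))
  have step1 : ∀ t ∈ Set.Ioi (0:ℝ), ENNReal.ofReal (t ^ (Fintype.card I * s - 1)) * S.Jt t =
      ∑' L : S.X, ∫⁻ y, ENNReal.ofReal (t ^ (Fintype.card I * s - 1)) * (Ex 1 y * S.nuI y * S.eta L (t⁻¹ • y)) := by
    intro t ht
    unfold Jt
    rw [← ENNReal.tsum_mul_left]
    refine tsum_congr fun L => ?_
    rw [S.scale_integral L ht, lintegral_const_mul' _ _ ENNReal.ofReal_ne_top]
  rw [setLIntegral_congr_fun measurableSet_Ioi step1, lintegral_tsum]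
  swap
  · intro L
    exact (Measurable.lintegral_prod_right' (hmeas L)).aemeasurable
  unfold zX
  rw [← ENNReal.tsum_mul_right, ← ENNReal.tsum_mul_left]
  refine tsum_congr fun L => ?_
  have hidx : (0:ℝ) < S.idx L := by exact_mod_cast S.idx_pos L
  rw [lintegral_lintegral_swap (hmeas L).aemeasurable]
  have step2 : ∀ y, ∫⁻ t in Set.Ioi (0:ℝ), ENNReal.ofReal (t ^ (Fintype.card I * s - 1)) * (Ex 1 y * S.nuI y * S.eta L (t⁻¹ • y))
      = (ENNReal.ofReal ((1 - 2 ^ (-s)) / (Fintype.card I * s)) * ENNReal.ofReal (S.idx L) ^ (-s)) *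
        (Ex 1 y * (ENNReal.ofReal (S.nu y)) ^ s * S.nuI y) := by
    intro y
    have h3 : ∀ t ∈ Set.Ioi (0:ℝ), ENNReal.ofReal (t ^ (Fintype.card I * s - 1)) * (Ex 1 y * S.nuI y * S.eta L (t⁻¹ • y)) =
      (Ex 1 y * S.nuI y) * (ENNReal.ofReal (t ^ (Fintype.card I * s - 1)) *
        (if 1 ≤ (t⁻¹) ^ Fintype.card I * (S.nu y / S.idx L) ∧ (t⁻¹) ^ Fintype.card I * (S.nu y / S.idx L) ≤ 2 then (1:ℝ≥0∞) else 0)) := by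
      intro t ht
      have ht : 0 < t := ht
      rw [eta, S.nu_smul, abs_of_pos (inv_pos.2 ht), mul_div_assoc]
      ring
    rw [setLIntegral_congr_fun measurableSet_Ioi h3, lintegral_const_mul]
    · rw [t_integral _ hN (by have := S.nu_nonneg y; positivity) hs, ENNReal.ofReal_div_of_pos hidx,
        ENNReal.div_rpow_of_nonneg _ _ hs.le, ENNReal.rpow_neg, ENNReal.div_eq_inv_mul]
      ring
    · refine hpow.mul (Measurable.ite ?_ measurable_const measurable_const)
      have hm : Measurable fun t : ℝ => (t⁻¹) ^ Fintype.card I * (S.nu y / S.idx L) :=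
        (measurable_inv.pow_const _).mul_const _
      exact (measurableSet_le measurable_const hm).inter (measurableSet_le hm measurable_const)
  simp_rw [step2]
  rw [lintegral_const_mul]
  · rw [← mul_assoc]; rfl
  · exact ((measurable_Ex 1).mul ((ENNReal.measurable_ofReal.comp S.continuous_nu.measurable).pow_const s)).mul S.measurable_nuI

end LD
end ABHN
end part06

section part07
namespace ABHN
open MeasureTheory Real Module
open scoped Matrix ENNReal

variable {D : Type*} [DivisionRing D] [CharZero D] {I : Type*} [Fintype I] [DecidableEq I]

namespace LD
variable (S : LD D I)

lemma integrable_gauss {a : ℝ} (ha : 0 < a) : Integrable fun y : I → ℝ => Real.exp (-a * nsq y) := by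
  have h : Integrable fun y : I → ℝ => ∏ i, Real.exp (-a * (y i) ^ 2) :=
    Integrable.fintype_prod (f := fun (_ : I) (z : ℝ) => Real.exp (-a * z ^ 2))
      (fun _ => integrable_exp_neg_mul_sq ha)
  refine h.congr (Filter.Eventually.of_forall fun y => ?_)
  simp only [nsq, Finset.mul_sum, Real.exp_sum]

lemma nu_le : ∃ C : ℝ, 0 ≤ C ∧ ∀ y, S.nu y ^ 2 ≤ C * (nsq y) ^ Fintype.card I := by
  set N := Fintype.card I
  set C : ℝ := ∑ k, ∑ i, ∑ j, (S.ρ (S.b k)) i j ^ 2 with hC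
  have hC0 : 0 ≤ C := by positivity
  refine ⟨(N.factorial : ℝ) ^ 2 * C ^ N, by positivity, fun y => ?_⟩
  have h0 := nsq_nonneg y
  have h1 : ∀ i j, |S.colM S.b y i j| ≤ Real.sqrt (C * nsq y) := by
    intro i j
    apply Real.abs_le_sqrt
    calc S.colM S.b y i j ^ 2 ≤ nsq (S.ρ (S.b j) *ᵥ y) := by
          unfold nsq
          exact Finset.single_le_sum (f := fun i => ((S.ρ (S.b j) *ᵥ y) i) ^ 2) (fun _ _ => sq_nonneg _) (Finset.mem_univ i)
      _ ≤ _ := nsq_mulVec_le _ _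
      _ ≤ C * nsq y := by
          gcongr
          exact Finset.single_le_sum (f := fun k => ∑ i, ∑ j, (S.ρ (S.b k)) i j ^ 2) (fun _ _ => by positivity) (Finset.mem_univ j)
  have h2 := Matrix.det_le (A := S.colM S.b y) (abv := IsAbsoluteValue.toAbsoluteValue abs) (x := Real.sqrt (C * nsq y)) h1
  have h3 : S.nu y ≤ (N.factorial : ℝ) * Real.sqrt (C * nsq y) ^ N := by
    rw [nsmul_eq_mul] at h2; exact h2
  calc S.nu y ^ 2 ≤ ((N.factorial : ℝ) * Real.sqrt (C * nsq y) ^ N) ^ 2 := by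
        have := S.nu_nonneg y
        gcongr
    _ = (N.factorial : ℝ) ^ 2 * C ^ N * nsq y ^ N := by
        rw [mul_pow, ← pow_mul, mul_comm N 2, pow_mul, Real.sq_sqrt (by positivity), mul_pow]; ring

lemma arch_finite (m : ℕ) : S.arch (2 * m + 1) ≠ ∞ := by
  obtain ⟨C, hC0, hC⟩ := S.nu_le
  set N := Fintype.card I
  set K : ℝ := C ^ m * ((2 / π) ^ (N * m) * (N * m).factorial) with hK
  have hb : ∀ y, Ex 1 y * (ENNReal.ofReal (S.nu y)) ^ (2 * (m:ℝ) + 1) * S.nuI y ≤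
      ENNReal.ofReal K * ENNReal.ofReal (Real.exp (-(π / 2) * nsq y)) := by
    intro y
    have h0 := nsq_nonneg y
    rcases (S.nu_nonneg y).eq_or_lt with h | h
    · rw [← h]; simp [show (0:ℝ) < 2 * m + 1 by positivity]
    have e1 : (ENNReal.ofReal (S.nu y)) ^ (2 * (m:ℝ) + 1) * S.nuI y = ENNReal.ofReal ((S.nu y ^ 2) ^ m) := by
      rw [nuI, ENNReal.ofReal_rpow_of_pos h, ← ENNReal.ofReal_inv_of_pos h, ← ENNReal.ofReal_mul (by positivity)]
      congr 1
      rw [Real.rpow_add h, Real.rpow_one, mul_inv_cancel_right₀ h.ne', ← pow_mul, ← Real.rpow_natCast]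
      push_cast; rfl
    rw [mul_assoc, e1, Ex, ← ENNReal.ofReal_mul (by positivity), ← ENNReal.ofReal_mul (by positivity)]
    apply ENNReal.ofReal_le_ofReal
    have e2 : (S.nu y ^ 2) ^ m ≤ C ^ m * nsq y ^ (N * m) := by
      calc (S.nu y ^ 2) ^ m ≤ (C * nsq y ^ N) ^ m := by
            gcongr; exact hC y
        _ = _ := by rw [mul_pow, ← pow_mul]
    have e3 : nsq y ^ (N * m) ≤ (2 / π) ^ (N * m) * (N * m).factorial * Real.exp (π / 2 * nsq y) := by
      have := Real.pow_div_factorial_le_exp (π / 2 * nsq y) (by positivity) (N * m)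
      rw [div_le_iff₀ (by positivity), mul_pow] at this
      calc nsq y ^ (N * m) = (2 / π) ^ (N * m) * ((π / 2) ^ (N * m) * nsq y ^ (N * m)) := by
            rw [← mul_assoc, ← mul_pow]
            rw [show 2 / π * (π / 2) = 1 by field_simp]; simp
        _ ≤ (2 / π) ^ (N * m) * (Real.exp (π / 2 * nsq y) * (N * m).factorial) := by gcongr
        _ = _ := by ring
    calc Real.exp (-π * 1 ^ 2 * nsq y) * (S.nu y ^ 2) ^ m
        ≤ Real.exp (-π * 1 ^ 2 * nsq y) * (C ^ m * ((2 / π) ^ (N * m) * (N * m).factorial * Real.exp (π / 2 * nsq y))) := by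
          gcongr
          exact e2.trans (by gcongr)
      _ = K * (Real.exp (-π * 1 ^ 2 * nsq y) * Real.exp (π / 2 * nsq y)) := by rw [hK]; ring
      _ = _ := by rw [← Real.exp_add]; congr 2; ring
  refine ne_top_of_le_ne_top ?_ (lintegral_mono hb)
  rw [lintegral_const_mul' _ _ ENNReal.ofReal_ne_top]
  refine ENNReal.mul_ne_top ENNReal.ofReal_ne_top ?_
  have := (integrable_gauss (I := I) (a := π / 2) (by positivity)).lintegral_lt_top
  exact this.ne

lemma Jt_anti {u t : ℝ} (hu : 0 ≤ u) (hut : u ≤ t) : S.Jt t ≤ S.Jt u := by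
  unfold Jt
  refine ENNReal.tsum_le_tsum fun L => lintegral_mono fun y => ?_
  have : Ex t y ≤ Ex u y := by
    unfold Ex
    apply ENNReal.ofReal_le_ofReal
    rw [Real.exp_le_exp]
    have := nsq_nonneg y
    have h2 : u ^ 2 ≤ t ^ 2 := by gcongr
    have h3 : π * u ^ 2 * nsq y ≤ π * t ^ 2 * nsq y := by gcongr
    linarith
  dsimp only
  gcongr

lemma Jt_finite {t : ℝ} (ht : 0 < t) : S.Jt t ≠ ∞ := by
  haveI := S.nonemptyI
  set N := Fintype.card I with hN
  have hN0 : 0 < N := Fintype.card_pos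
  set m := N ^ 2 + 2
  have hm := S.mellin_id (s := 2 * m + 1) (by positivity)
  have hfin : ∫⁻ t in Set.Ioi (0:ℝ), ENNReal.ofReal (t ^ (Fintype.card I * (2 * (m:ℝ) + 1) - 1)) * S.Jt t ≠ ∞ := by
    rw [hm]
    refine ENNReal.mul_ne_top ENNReal.ofReal_ne_top (ENNReal.mul_ne_top (S.zX_finite ?_) (S.arch_finite m))
    have : (m : ℝ) = (N:ℝ) ^ 2 + 2 := by simp [m]
    rw [this]
    have : (0:ℝ) ≤ (N:ℝ)^2 := by positivity
    linarith
  intro h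
  apply hfin
  rw [eq_top_iff]
  calc ∞ = ∫⁻ u in Set.Ioo 0 t, (∞ : ℝ≥0∞) := by
        simp [ht]
    _ ≤ ∫⁻ u in Set.Ioo 0 t, ENNReal.ofReal (u ^ (Fintype.card I * (2 * (m:ℝ) + 1) - 1)) * S.Jt u := by
        refine setLIntegral_mono' measurableSet_Ioo fun u hu => ?_
        have h1 := S.Jt_anti hu.1.le hu.2.le
        rw [h, top_le_iff] at h1
        rw [h1, ENNReal.mul_top]
        have := Real.rpow_pos_of_pos hu.1 (Fintype.card I * (2 * (m:ℝ) + 1) - 1)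
        simp only [ne_eq, ENNReal.ofReal_eq_zero, not_le]
        exact this
    _ ≤ _ := lintegral_mono_set (fun u hu => hu.1)

lemma sum_rho (k : I → ℤ) : ∑ i, (k i : ℝ) • S.ρ (S.b i) = S.ρ (∑ i, k i • S.b i) := by
  rw [map_sum]
  refine Finset.sum_congr rfl fun i _ => ?_
  rw [map_zsmul, Int.cast_smul_eq_zsmul]

lemma sum_b_ne (k : I → ℤ) (hk : k ≠ 0) : ∑ i, k i • S.b i ≠ 0 := by
  intro h
  have h2 : ∑ i, (k i : ℚ) • S.b i = 0 := by
    rw [← h]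
    exact Finset.sum_congr rfl fun i _ => Int.cast_smul_eq_zsmul ℚ _ _
  have := Fintype.linearIndependent_iff.1 S.b.linearIndependent _ h2
  apply hk
  funext i
  exact_mod_cast this i

lemma consts : ∃ κ > 0, ∃ C > 0, ∀ (L : S.X) (y : I → ℝ), 1 ≤ S.nu y / S.idx L → S.nu y / S.idx L ≤ 2 →
    (∀ t, 0 < t → t ≤ 1 → |gth (S.AM L y) t - (t ^ Fintype.card I)⁻¹ * (S.nu y / S.idx L)⁻¹| ≤ C * t) ∧
    (∀ t, 1 ≤ t → gth (S.AM L y) t - 1 ≤ Real.exp (-π * κ * (t ^ 2 - 1)) * (gth (S.AM L y) 1 - 1)) := by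
  haveI := S.nonemptyI
  obtain ⟨κ1, hκ1, h1⟩ := exists_Wmin (fun i => S.ρ (S.b i)) (fun k hk => by
    rw [S.sum_rho]; exact S.det_rho_ne (S.sum_b_ne k hk)) (one_pos (α := ℝ))
  obtain ⟨κ2, hκ2, h2⟩ := exists_Wmin (fun i => (S.ρ (S.b i))ᵀ) (fun k hk => by
    have : ∑ i, (k i : ℝ) • (S.ρ (S.b i))ᵀ = (∑ i, (k i : ℝ) • (S.ρ (S.b i)))ᵀ := by
      rw [Matrix.transpose_sum]; rfl
    rw [this, Matrix.det_transpose, S.sum_rho]; exact S.det_rho_ne (S.sum_b_ne k hk)) (show (0:ℝ) < 1 / 2 by norm_num)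
  obtain ⟨C, hC, h3⟩ := gth_asymp (I := I) hκ2
  refine ⟨κ1, hκ1, C, hC, fun L y hy1 hy2 => ?_⟩
  obtain ⟨M, hM⟩ := S.exists_intMat L
  have hdet := S.AM_det_ne L y hy1
  have habs := S.abs_det_AM L y
  have hunit : IsUnit (S.AM L y).det := hdet.isUnit
  constructor
  · intro t ht ht1
    rw [← habs]
    refine h3 _ (by rw [habs]; exact hy1) ?_ t ht ht1
    refine h2 _ (fun i => (M i)ᵀ) ?_ ?_
    · rw [Matrix.det_transpose, Matrix.det_nonsing_inv, Ring.inverse_eq_inv, abs_inv, habs, one_div]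
      exact inv_anti₀ (by linarith) hy2
    · intro i
      have e := hM i y
      have e2 : (S.AM L y)⁻¹ * S.ρ (S.b i) = (M i).map Int.cast * (S.AM L y)⁻¹ := by
        have := congrArg (fun Z => (S.AM L y)⁻¹ * Z * (S.AM L y)⁻¹) e
        rw [← mul_assoc, mul_assoc, Matrix.mul_nonsing_inv _ hunit, mul_one, ← mul_assoc,
          Matrix.nonsing_inv_mul _ hunit, one_mul] at this
        exact this
      rw [← Matrix.transpose_mul, e2, Matrix.transpose_mul, Matrix.transpose_map]
  · intro t ht
    exact gth_decay _ hdet (h1 _ M (by rw [habs]; exact hy1) (fun i => hM i y)) ht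

/-- coefficient a -/
noncomputable def aT : ℝ≥0∞ := ∑' L : S.X, ∫⁻ y, ENNReal.ofReal ((S.nu y / S.idx L)⁻¹) * S.wt L y
/-- coefficient b -/
noncomputable def bT : ℝ≥0∞ := ∑' L : S.X, ∫⁻ y, S.wt L y

lemma wt_mul_le (L : S.X) (y : I → ℝ) {a b : ℝ≥0∞}
    (h : 1 ≤ S.nu y / S.idx L → S.nu y / S.idx L ≤ 2 → a ≤ b) : a * S.wt L y ≤ b * S.wt L y := by
  have := S.eta_mul_le L y h
  unfold wt
  calc _ = (a * S.eta L y) * ((S.Th L y 1)⁻¹ * Ex 1 y * S.nuI y) := by ring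
    _ ≤ (b * S.eta L y) * ((S.Th L y 1)⁻¹ * Ex 1 y * S.nuI y) := by gcongr
    _ = _ := by ring

lemma sum_add (f g : S.X → (I → ℝ) → ℝ≥0∞) (hg : ∀ L, Measurable (g L)) :
    ∑' L : S.X, ∫⁻ y, (f L y + g L y) * S.wt L y =
    (∑' L : S.X, ∫⁻ y, f L y * S.wt L y) + ∑' L : S.X, ∫⁻ y, g L y * S.wt L y := by
  rw [← ENNReal.tsum_add]
  refine tsum_congr fun L => ?_
  simp only [add_mul]
  exact lintegral_add_right _ ((hg L).mul (S.measurable_wt L))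

lemma sum_const (c : ℝ≥0∞) (hc : c ≠ ∞) (f : S.X → (I → ℝ) → ℝ≥0∞) :
    ∑' L : S.X, ∫⁻ y, (c * f L y) * S.wt L y = c * ∑' L : S.X, ∫⁻ y, f L y * S.wt L y := by
  rw [← ENNReal.tsum_mul_left]
  refine tsum_congr fun L => ?_
  rw [← lintegral_const_mul' _ _ hc]
  simp only [mul_assoc]

lemma sum_one : ∑' L : S.X, ∫⁻ y, (1:ℝ≥0∞) * S.wt L y = S.bT := by
  simp [bT]

lemma sum_c (c : ℝ≥0∞) (hc : c ≠ ∞) : ∑' L : S.X, ∫⁻ y, c * S.wt L y = c * S.bT := by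
  rw [← sum_one, ← S.sum_const c hc]; simp

lemma measurable_rat (L : S.X) : Measurable fun y => ENNReal.ofReal ((S.nu y / S.idx L)⁻¹) :=
  ENNReal.measurable_ofReal.comp ((S.continuous_nu.measurable.div_const _).inv)

lemma J_bounds : ∃ κ > 0, ∃ C > 0,
    (∀ t, 0 < t → t ≤ 1 → S.Jt t + S.bT ≤ ENNReal.ofReal ((t ^ Fintype.card I)⁻¹) * S.aT + ENNReal.ofReal (C * t) * S.bT) ∧
    (∀ t, 0 < t → t ≤ 1 → ENNReal.ofReal ((t ^ Fintype.card I)⁻¹) * S.aT ≤ S.Jt t + S.bT + ENNReal.ofReal (C * t) * S.bT) ∧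
    (∀ t, 1 ≤ t → S.Jt t ≤ ENNReal.ofReal (Real.exp (-π * κ * (t ^ 2 - 1))) * S.Jt 1) := by
  obtain ⟨κ, hκ, C, hC, H⟩ := S.consts
  refine ⟨κ, hκ, C, hC, fun t ht ht1 => ?_, fun t ht ht1 => ?_, fun t ht => ?_⟩
  · rw [S.unfolding, ← S.sum_one, ← S.sum_add _ _ (fun L => measurable_const), S.sum_one, aT,
      ← S.sum_const _ ENNReal.ofReal_ne_top, ← S.sum_c _ ENNReal.ofReal_ne_top, ← S.sum_add _ _ (fun L => measurable_const)]
    refine ENNReal.tsum_le_tsum fun L => lintegral_mono fun y => S.wt_mul_le L y fun h1 h2 => ?_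
    have hd := S.AM_det_ne L y h1
    rw [S.Th_eq L y hd ht]
    have h3 := (H L y h1 h2).1 t ht ht1
    have h4 := one_le_gth _ hd ht
    rw [abs_le] at h3
    rw [← ENNReal.ofReal_one, ← ENNReal.ofReal_add (by linarith) (by norm_num), ← ENNReal.ofReal_mul (by positivity),
      ← ENNReal.ofReal_add (by positivity) (by positivity)]
    apply ENNReal.ofReal_le_ofReal
    linarith
  · rw [S.unfolding, ← S.sum_one, ← S.sum_add _ _ (fun L => measurable_const), S.sum_one, aT,
      ← S.sum_const _ ENNReal.ofReal_ne_top, ← S.sum_c _ ENNReal.ofReal_ne_top, ← S.sum_add _ _ (fun L => measurable_const)]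
    refine ENNReal.tsum_le_tsum fun L => lintegral_mono fun y => S.wt_mul_le L y fun h1 h2 => ?_
    have hd := S.AM_det_ne L y h1
    rw [S.Th_eq L y hd ht]
    have h3 := (H L y h1 h2).1 t ht ht1
    have h4 := one_le_gth _ hd ht
    rw [abs_le] at h3
    rw [← ENNReal.ofReal_one, ← ENNReal.ofReal_add (by linarith) (by norm_num), ← ENNReal.ofReal_mul (by positivity),
      ← ENNReal.ofReal_add (by linarith) (by positivity)]
    apply ENNReal.ofReal_le_ofReal
    linarith
  · rw [S.unfolding, S.unfolding, ← S.sum_const _ ENNReal.ofReal_ne_top]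
    refine ENNReal.tsum_le_tsum fun L => lintegral_mono fun y => S.wt_mul_le L y fun h1 h2 => ?_
    have hd := S.AM_det_ne L y h1
    rw [S.Th_eq L y hd (by linarith), S.Th_eq L y hd one_pos, ← ENNReal.ofReal_mul (by positivity)]
    exact ENNReal.ofReal_le_ofReal ((H L y h1 h2).2 t ht)

lemma aT_le : S.aT ≤ S.bT := by
  rw [aT, ← S.sum_one]
  refine ENNReal.tsum_le_tsum fun L => lintegral_mono fun y => S.wt_mul_le L y fun h1 h2 => ?_
  rw [← ENNReal.ofReal_one]
  exact ENNReal.ofReal_le_ofReal (inv_le_one_of_one_le₀ h1)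

lemma bT_le : S.bT ≤ 2 * S.aT := by
  rw [aT, ← S.sum_one, ← S.sum_const _ (by simp)]
  refine ENNReal.tsum_le_tsum fun L => lintegral_mono fun y => S.wt_mul_le L y fun h1 h2 => ?_
  rw [show (2 : ℝ≥0∞) = ENNReal.ofReal 2 by simp, ← ENNReal.ofReal_mul (by norm_num), ← ENNReal.ofReal_one]
  apply ENNReal.ofReal_le_ofReal
  have : (2:ℝ)⁻¹ ≤ (S.nu y / S.idx L)⁻¹ := inv_anti₀ (by linarith) h2
  linarith

lemma bT_ne_top : S.bT ≠ ∞ := by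
  haveI := S.nonemptyI
  obtain ⟨κ, hκ, C, hC, H⟩ := S.consts
  set t0 : ℝ := min 1 (1 / (C + 4)) with ht0
  have hp : 0 < t0 := by positivity
  have h1 : t0 ≤ 1 := min_le_left _ _
  have h2 : t0 ≤ 1 / (C + 4) := min_le_right _ _
  refine ne_top_of_le_ne_top (S.Jt_finite hp) ?_
  rw [S.unfolding, ← S.sum_one]
  refine ENNReal.tsum_le_tsum fun L => lintegral_mono fun y => S.wt_mul_le L y fun hy1 hy2 => ?_
  have hd := S.AM_det_ne L y hy1
  rw [S.Th_eq L y hd hp, ← ENNReal.ofReal_one]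
  apply ENNReal.ofReal_le_ofReal
  have h3 := (abs_le.1 ((H L y hy1 hy2).1 t0 hp h1)).1
  have h5 : (2:ℝ)⁻¹ ≤ (S.nu y / S.idx L)⁻¹ := inv_anti₀ (by linarith) hy2
  have h6 : C + 4 ≤ (t0 ^ Fintype.card I)⁻¹ := by
    have : t0 ^ Fintype.card I ≤ t0 := pow_le_of_le_one hp.le h1 Fintype.card_ne_zero
    calc C + 4 = (1 / (C + 4))⁻¹ := by simp
      _ ≤ t0⁻¹ := inv_anti₀ hp h2
      _ ≤ _ := inv_anti₀ (by positivity) this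
  have h7 : (C + 4) * 2⁻¹ ≤ (t0 ^ Fintype.card I)⁻¹ * (S.nu y / S.idx L)⁻¹ := by gcongr
  have h8 : C * t0 ≤ C * (1 / (C + 4)) := by gcongr
  have h9 : C * (1 / (C + 4)) ≤ C / 4 := by
    rw [mul_one_div]
    apply div_le_div_of_nonneg_left <;> linarith
  linarith

/-- the order itself -/
def L0 : S.X := ⟨S.Λ, le_rfl, fun x hx l hl => S.mul_memΛ hx hl, by simp⟩

lemma idx_L0 : S.idx S.L0 = 1 := by simp [idx, L0]

lemma bT_ne_zero : S.bT ≠ 0 := by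
  haveI := S.nonemptyI
  intro h
  rw [bT, ENNReal.tsum_eq_zero] at h
  have h1 := h S.L0
  rw [lintegral_eq_zero_iff (S.measurable_wt _)] at h1
  let U : Set (I → ℝ) := {y | 1 < S.nu y ∧ S.nu y < 2}
  have hU : IsOpen U := (isOpen_lt continuous_const S.continuous_nu).inter (isOpen_lt S.continuous_nu continuous_const)
  have hne : U.Nonempty := by
    have h0 : 0 < S.nu S.y0 := abs_pos.2 S.hy0
    set s : ℝ := ((3/2) / S.nu S.y0) ^ ((Fintype.card I : ℝ)⁻¹)
    have hs : s ^ Fintype.card I = (3/2) / S.nu S.y0 := Real.rpow_inv_natCast_pow (by positivity) Fintype.card_ne_zero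
    have hs0 : 0 < s := by positivity
    refine ⟨s • S.y0, ?_⟩
    have : S.nu (s • S.y0) = 3/2 := by
      rw [S.nu_smul, abs_of_pos hs0, hs]; field_simp
    constructor <;> rw [this] <;> norm_num
  have hpos := hU.measure_pos volume hne
  have h2 : U ⊆ {y | ¬ (S.wt S.L0 y = (0 : (I → ℝ) → ℝ≥0∞) y)} := by
    intro y hy
    have hy1 : 1 < S.nu y := hy.1
    have hy2 : S.nu y < 2 := hy.2
    have c1 : 1 ≤ S.nu y / S.idx S.L0 := by rw [idx_L0]; simp; exact hy1.le
    have c2 : S.nu y / S.idx S.L0 ≤ 2 := by rw [idx_L0]; simp; exact hy2.le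
    have hd := S.AM_det_ne _ y c1
    simp only [Set.mem_setOf_eq, Pi.zero_apply, wt, eta, if_pos (And.intro c1 c2), mul_one, mul_eq_zero, not_or, nuI, ENNReal.inv_eq_zero]
    refine ⟨⟨⟨?_, Ex_ne_zero _ _⟩, one_ne_zero⟩, ENNReal.ofReal_ne_top⟩
    rw [S.Th_eq _ y hd one_pos]
    exact ENNReal.ofReal_ne_top
  have h3 : volume U ≤ 0 := by
    rw [← ae_iff.1 h1]
    exact measure_mono h2
  exact absurd hpos (not_lt.2 h3)

end LD
end ABHN
end part07

section part08
namespace ABHN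
open MeasureTheory Real Module Filter Topology Asymptotics
open scoped Matrix ENNReal

lemma mellin_gen (N : ℕ) (J : ℝ → ℝ) (hanti : AntitoneOn J (Set.Ioi 0)) (a b C c : ℝ) (hc : 0 < c)
    (h0 : ∀ t, 0 < t → t ≤ 1 → |J t - (a * t ^ (-(N:ℝ)) - b)| ≤ C * t)
    (h1 : ∀ t, 1 ≤ t → |J t| ≤ C * Real.exp (-c * t)) :
    ∃ G : ℂ → ℂ, (∀ s : ℂ, -1 < s.re → DifferentiableAt ℂ G s) ∧
      ∀ σ : ℝ, (N:ℝ) < σ → MellinConvergent (fun t => (J t : ℂ)) σ ∧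
        mellin (fun t => (J t : ℂ)) σ = G σ + a / (σ - N) - b / σ := by
  set g1 : ℝ → ℂ := Set.indicator (Set.Ioc 0 1) (fun t => (t:ℂ) ^ (-(N:ℂ))) with hg1
  set g0 : ℝ → ℂ := Set.indicator (Set.Ioc 0 1) (fun t => (t:ℂ) ^ (0:ℂ)) with hg0
  set f : ℝ → ℂ := fun t => (J t : ℂ) - ((a:ℂ) • g1 t - (b:ℂ) • g0 t) with hf
  have hJloc : LocallyIntegrableOn (fun t => (J t : ℂ)) (Set.Ioi 0) := by
    rw [locallyIntegrableOn_iff isOpen_Ioi.isLocallyClosed]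
    intro k hk hkc
    have : IntegrableOn J k := (hanti.mono hk).integrableOn_isCompact hkc
    exact this.ofReal
  have hgloc : ∀ z : ℂ, LocallyIntegrableOn (Set.indicator (Set.Ioc 0 1) (fun t : ℝ => (t:ℂ) ^ z)) (Set.Ioi 0) := by
    intro z
    rw [locallyIntegrableOn_iff isOpen_Ioi.isLocallyClosed]
    intro k hk hkc
    have : ContinuousOn (fun t : ℝ => (t:ℂ) ^ z) k := by
      intro t ht
      have : 0 < t := hk ht
      exact (Complex.continuousAt_ofReal_cpow_const _ _ (Or.inr this.ne')).continuousWithinAt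
    exact (this.integrableOn_compact hkc).indicator measurableSet_Ioc
  have hfloc : LocallyIntegrableOn f (Set.Ioi 0) :=
    hJloc.sub (((hgloc _).smul (a:ℂ)).sub ((hgloc _).smul (b:ℂ)))
  have hf0 : ∀ t, 0 < t → t ≤ 1 → ‖f t‖ ≤ C * t := by
    intro t ht ht1
    have e : f t = ((J t - (a * t ^ (-(N:ℝ)) - b) : ℝ) : ℂ) := by
      simp only [hf, hg1, hg0]
      rw [Set.indicator_of_mem (by exact ⟨ht, ht1⟩), Set.indicator_of_mem (by exact ⟨ht, ht1⟩)]
      push_cast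
      rw [Complex.ofReal_cpow ht.le]
      simp
    rw [e, Complex.norm_real]
    exact h0 t ht ht1
  have hf1 : ∀ t, 1 < t → f t = J t := by
    intro t ht
    simp only [hf, hg1, hg0]
    rw [Set.indicator_of_notMem (by simp [ht]), Set.indicator_of_notMem (by simp [ht])]
    simp
  have htop : f =O[atTop] fun t => Real.exp (-c * t) := by
    refine IsBigO.of_bound C ?_
    filter_upwards [eventually_gt_atTop 1] with t ht
    rw [hf1 t ht, Complex.norm_real, Real.norm_of_nonneg (Real.exp_pos _).le]
    exact h1 t ht.le
  have hbot : f =O[𝓝[>] 0] (· ^ (-(-1:ℝ))) := by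
    refine IsBigO.of_bound C ?_
    filter_upwards [Ioc_mem_nhdsGT (zero_lt_one' ℝ)] with t ht
    rw [neg_neg, Real.rpow_one, Real.norm_of_nonneg ht.1.le]
    exact hf0 t ht.1 ht.2
  refine ⟨mellin f, fun s hs => mellin_differentiableAt_of_isBigO_rpow_exp hc hfloc htop hbot hs, fun σ hσ => ?_⟩
  have hN0 : (0:ℝ) ≤ N := Nat.cast_nonneg _
  have m1 := hasMellin_cpow_Ioc (-(N:ℂ)) (s := (σ:ℂ)) (by simp; linarith)
  have m0 := hasMellin_cpow_Ioc 0 (s := (σ:ℂ)) (by simp; linarith)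
  have mf : MellinConvergent f σ := mellinConvergent_of_isBigO_rpow_exp hc hfloc htop hbot (by simp; linarith)
  have m1' : MellinConvergent (fun t => (a:ℂ) • g1 t) σ := m1.1.const_smul _
  have m0' : MellinConvergent (fun t => (b:ℂ) • g0 t) σ := m0.1.const_smul _
  have ms := hasMellin_sub m1' m0'
  have mt := hasMellin_add mf ms.1
  have e : (fun t => (J t : ℂ)) = fun t => f t + ((a:ℂ) • g1 t - (b:ℂ) • g0 t) := by
    funext t; simp [hf]
  rw [e]
  refine ⟨mt.1, ?_⟩
  rw [mt.2, ms.2, mellin_const_smul, mellin_const_smul, m1.2, m0.2]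
  simp only [smul_eq_mul]
  ring

variable {D : Type*} [DivisionRing D] [CharZero D] {I : Type*} [Fintype I] [DecidableEq I]

namespace LD
variable (S : LD D I)

theorem analytic : ∃ P : ℂ → ℂ, ∃ δ > 0, (∀ s : ℂ, -δ < s.re → DifferentiableAt ℂ P s) ∧ P 0 ≠ 0 ∧ P 1 ≠ 0 ∧
    ∀ s : ℝ, 1 < s → S.zX s * S.arch s ≠ ∞ ∧
      P s = (((1 - 2 ^ (-s)) * (S.zX s * S.arch s).toReal * (s - 1) : ℝ) : ℂ) := by
  haveI := S.nonemptyI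
  set N := Fintype.card I with hN
  have hN0 : 0 < N := Fintype.card_pos
  have hNr : (0:ℝ) < N := by exact_mod_cast hN0
  have hbt := S.bT_ne_top
  have hat : S.aT ≠ ∞ := ne_top_of_le_ne_top hbt S.aT_le
  have hb0 := S.bT_ne_zero
  have ha0 : S.aT ≠ 0 := by
    intro h; have := S.bT_le; rw [h, mul_zero] at this; exact hb0 (le_antisymm this bot_le)
  set a := S.aT.toReal with ha
  set b := S.bT.toReal with hb
  have hapos : 0 < a := ENNReal.toReal_pos ha0 hat
  have hbpos : 0 < b := ENNReal.toReal_pos hb0 hbt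
  set J : ℝ → ℝ := fun t => (S.Jt t).toReal with hJ
  have hanti : AntitoneOn J (Set.Ioi 0) := fun u hu t ht hut =>
    ENNReal.toReal_mono (S.Jt_finite hu) (S.Jt_anti (le_of_lt hu) hut)
  obtain ⟨κ, hκ, C, hC, B1, B2, B3⟩ := S.J_bounds
  have hc : 0 < π * κ := by positivity
  obtain ⟨G, hG, hG2⟩ := mellin_gen N J hanti a b (C * b + Real.exp (π * κ) * J 1) (π * κ) hc (by
    intro t ht ht1
    have hp : t ^ (-(N:ℝ)) = (t ^ N)⁻¹ := by rw [Real.rpow_neg ht.le, Real.rpow_natCast]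
    have hpp : 0 < (t ^ N)⁻¹ := by positivity
    have e1 := B1 t ht ht1
    have e2 := B2 t ht ht1
    rw [← ENNReal.ofReal_toReal hat, ← ENNReal.ofReal_toReal hbt, ← ENNReal.ofReal_toReal (S.Jt_finite ht),
      ← ENNReal.ofReal_mul (by positivity), ← ENNReal.ofReal_mul (by positivity),
      ← ENNReal.ofReal_add (by positivity) (by positivity), ← ENNReal.ofReal_add (by positivity) (by positivity),
      ENNReal.ofReal_le_ofReal_iff (by positivity)] at e1
    rw [← ENNReal.ofReal_toReal hat, ← ENNReal.ofReal_toReal hbt, ← ENNReal.ofReal_toReal (S.Jt_finite ht),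
      ← ENNReal.ofReal_mul (by positivity), ← ENNReal.ofReal_mul (by positivity),
      ← ENNReal.ofReal_add (by positivity) (by positivity), ← ENNReal.ofReal_add (by positivity) (by positivity),
      ENNReal.ofReal_le_ofReal_iff (by positivity)] at e2
    rw [hp, abs_le]
    change J t + b ≤ (t ^ N)⁻¹ * a + C * t * b at e1
    change (t ^ N)⁻¹ * a ≤ J t + b + C * t * b at e2
    have : 0 ≤ Real.exp (π * κ) * J 1 * t := by positivity
    constructor <;> nlinarith) (by
    intro t ht
    have e := B3 t ht
    have h1 := S.Jt_finite one_pos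
    rw [abs_of_nonneg (by positivity)]
    have e2 : J t ≤ Real.exp (-π * κ * (t ^ 2 - 1)) * J 1 := by
      have := ENNReal.toReal_mono (ENNReal.mul_ne_top ENNReal.ofReal_ne_top h1) e
      rwa [ENNReal.toReal_mul, ENNReal.toReal_ofReal (Real.exp_pos _).le] at this
    have hJ1 : 0 ≤ J 1 := by positivity
    have e3 : Real.exp (-π * κ * (t ^ 2 - 1)) ≤ Real.exp (π * κ) * Real.exp (-(π * κ) * t) := by
      rw [← Real.exp_add, Real.exp_le_exp]
      nlinarith [mul_nonneg hc.le (show 0 ≤ t ^ 2 - t by nlinarith)]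
    calc J t ≤ _ := e2
      _ ≤ (Real.exp (π * κ) * Real.exp (-(π * κ) * t)) * J 1 := by gcongr
      _ = (Real.exp (π * κ) * J 1) * Real.exp (-(π * κ) * t) := by ring
      _ ≤ _ := by
        have : 0 ≤ C * b := by positivity
        gcongr; linarith)
  refine ⟨fun s => s * (s - 1) * N * G (N * s) + a * s - b * (s - 1), 1 / N, by positivity, ?_, ?_, ?_, ?_⟩
  · intro s hs
    have : DifferentiableAt ℂ (fun s : ℂ => G (N * s)) s := by
      refine DifferentiableAt.comp (g := G) s (hG _ ?_) (by fun_prop)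
      have e : ((N:ℂ) * s).re = N * s.re := by simp
      rw [e]
      have := mul_lt_mul_of_pos_left hs hNr
      have e3 : (N:ℝ) * -(1 / N) = -1 := by field_simp
      linarith
    have h1 : DifferentiableAt ℂ (fun s : ℂ => s * (s - 1) * N) s := by fun_prop
    have h2 : DifferentiableAt ℂ (fun s : ℂ => (a:ℂ) * s) s := by fun_prop
    have h3 : DifferentiableAt ℂ (fun s : ℂ => (b:ℂ) * (s - 1)) s := by fun_prop
    exact ((h1.mul this).add h2).sub h3
  · simp; exact hbpos.ne'
  · simp; exact hapos.ne'
  · intro s hs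
    have hs0 : 0 < s := by linarith
    have hNs : (N:ℝ) < N * s := by nlinarith
    obtain ⟨g1, g2⟩ := hG2 (N * s) hNs
    have hid := S.mellin_id hs0
    have hcpow : ∀ t ∈ Set.Ioi (0:ℝ), (t:ℂ) ^ (((N * s : ℝ) : ℂ) - 1) • (J t : ℂ) = ((t ^ (N * s - 1) * J t : ℝ) : ℂ) := by
      intro t ht
      have ht : (0:ℝ) < t := ht
      push_cast
      rw [Complex.ofReal_cpow ht.le]
      simp
    have hintg : IntegrableOn (fun t : ℝ => t ^ (N * s - 1) * J t) (Set.Ioi 0) := by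
      have : IntegrableOn (fun t : ℝ => ((t ^ (N * s - 1) * J t : ℝ) : ℂ)) (Set.Ioi 0) :=
        (integrableOn_congr_fun hcpow measurableSet_Ioi).1 g1
      have := this.re
      simp only [Complex.ofReal_re, RCLike.re_eq_complex_re] at this
      exact this
    have hmel : mellin (fun t => (J t : ℂ)) ((N * s : ℝ) : ℂ) = ((∫ t in Set.Ioi (0:ℝ), t ^ (N * s - 1) * J t : ℝ) : ℂ) := by
      rw [mellin, setIntegral_congr_fun measurableSet_Ioi hcpow]
      exact integral_ofReal
    have hl : ∫⁻ t in Set.Ioi (0:ℝ), ENNReal.ofReal (t ^ (N * s - 1)) * S.Jt t =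
        ENNReal.ofReal (∫ t in Set.Ioi (0:ℝ), t ^ (N * s - 1) * J t) := by
      rw [ofReal_integral_eq_lintegral_ofReal hintg]
      · refine setLIntegral_congr_fun measurableSet_Ioi fun t ht => ?_
        have ht : (0:ℝ) < t := ht
        rw [ENNReal.ofReal_mul (by positivity), ENNReal.ofReal_toReal (S.Jt_finite ht)]
      · refine (ae_restrict_iff' measurableSet_Ioi).2 (Eventually.of_forall fun t ht => ?_)
        have ht : (0:ℝ) < t := ht
        simp only [Pi.zero_apply]
        positivity
    have h2s : (2:ℝ) ^ (-s) < 1 := Real.rpow_lt_one_of_one_lt_of_neg (by norm_num) (by linarith)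
    have hq : 0 < (1 - 2 ^ (-s)) / (N * s) := by
      apply div_pos (by linarith) (by positivity)
    rw [hl] at hid
    have hfin : S.zX s * S.arch s ≠ ∞ := by
      intro h
      rw [h, ENNReal.mul_top (by simpa using hq)] at hid
      exact ENNReal.ofReal_ne_top hid
    refine ⟨hfin, ?_⟩
    have hre := congrArg ENNReal.toReal hid
    rw [ENNReal.toReal_mul, ENNReal.toReal_ofReal hq.le, ENNReal.toReal_ofReal
      (setIntegral_nonneg measurableSet_Ioi fun t ht => by
        have ht : (0:ℝ) < t := ht
        positivity)] at hre
    rw [hmel, hre] at g2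
    have hne1 : (s:ℂ) - 1 ≠ 0 := by
      intro h
      have : (s:ℂ) = 1 := by linear_combination h
      exact hs.ne' (by exact_mod_cast this)
    have hne0 : (s:ℂ) ≠ 0 := by exact_mod_cast hs0.ne'
    have hneN : (N:ℂ) ≠ 0 := by exact_mod_cast hN0.ne'
    have hG3 : G (N * s) = (((1 - 2 ^ (-s)) / (N * s) * (S.zX s * S.arch s).toReal : ℝ) : ℂ) -
       a / (N * s - N) + b / (N * s) := by
      rw [g2]; push_cast; ring
    beta_reduce
    rw [hG3, show (N:ℂ) * s - N = N * (s - 1) by ring]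
    push_cast
    field_simp
    ring

end LD
end ABHN
end part08

section part09
namespace ABHN
open MeasureTheory Real Module Filter Topology
open scoped Matrix ENNReal

variable {D : Type*} [DivisionRing D] [CharZero D] {I : Type*} [Fintype I] [DecidableEq I]

namespace LD
variable (S : LD D I)

lemma zX_ne_zero (s : ℝ) : S.zX s ≠ 0 := by
  intro h
  rw [zX, ENNReal.tsum_eq_zero] at h
  have := h S.L0
  rw [S.idx_L0] at this
  simp at this

lemma arch_ne_zero {s : ℝ} (hs : 0 ≤ s) : S.arch s ≠ 0 := by
  haveI := S.nonemptyI
  intro h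
  have hm : Measurable fun y => Ex 1 y * (ENNReal.ofReal (S.nu y)) ^ s * S.nuI y := by
    refine (Measurable.mul ?_ ?_).mul S.measurable_nuI
    · exact measurable_Ex 1
    · exact (S.continuous_nu.measurable.ennreal_ofReal).pow_const s
  rw [arch, lintegral_eq_zero_iff hm] at h
  let U : Set (I → ℝ) := {y | 0 < S.nu y}
  have hU : IsOpen U := (isOpen_lt continuous_const S.continuous_nu)
  have hne : U.Nonempty := ⟨S.y0, abs_pos.2 S.hy0⟩
  have hpos := hU.measure_pos volume hne
  have h2 : U ⊆ {y | ¬ (Ex 1 y * (ENNReal.ofReal (S.nu y)) ^ s * S.nuI y = (0 : (I → ℝ) → ℝ≥0∞) y)} := by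
    intro y hy
    have hy : 0 < S.nu y := hy
    simp only [Set.mem_setOf_eq, Pi.zero_apply, mul_eq_zero, not_or, nuI, ENNReal.inv_eq_zero]
    refine ⟨⟨Ex_ne_zero _ _, ?_⟩, ENNReal.ofReal_ne_top⟩
    rw [ENNReal.ofReal_rpow_of_pos hy]
    simp only [ENNReal.ofReal_eq_zero, not_le]
    positivity
  have h3 : volume U ≤ 0 := by
    rw [← ae_iff.1 h]
    exact measure_mono h2
  exact absurd hpos (not_lt.2 h3)

variable {K : Type*} [Field K] [CharZero K] {I' : Type*} [Fintype I'] [DecidableEq I']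
variable (S' : LD K I')

theorem core_contra (n : ℕ) (hn : 2 ≤ n) (C A : ℝ) (hC : 0 < C) (hA : 0 < A) (s1 : ℝ)
    (h : ∀ s : ℝ, s1 < s → S.zX s * S.arch s =
      ENNReal.ofReal (C * A ^ s) * ∏ i ∈ Finset.range n, (S'.zX (n * s - i) * S'.arch (n * s - i))) : False := by
  obtain ⟨P, δ, hδ, hP, -, -, hPe⟩ := S.analytic
  obtain ⟨Q, ε, hε, hQ, hQ0, hQ1, hQe⟩ := S'.analytic
  have hnr : (2:ℝ) ≤ n := by exact_mod_cast hn
  let E : ℂ → ℂ := fun s => 1 - (2:ℂ) ^ (-s)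
  have hE : Differentiable ℂ E := by
    intro s
    refine (differentiableAt_const _).sub ?_
    exact (differentiableAt_id.neg).const_cpow (Or.inl two_ne_zero)
  have hEr : ∀ s : ℝ, E s = ((1 - 2 ^ (-s) : ℝ) : ℂ) := by
    intro s
    simp only [E]
    push_cast
    rw [Complex.ofReal_cpow (by norm_num)]
    simp
  let F : ℂ → ℂ := fun s => P s * ∏ i ∈ Finset.range n, (E (n * s - i) * (n * s - i - 1))
  let R : ℂ → ℂ := fun s => (C * Complex.exp (s * Real.log A)) * (E s * (s - 1)) * ∏ i ∈ Finset.range n, Q (n * s - i)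
  let c : ℝ := max (-δ) ((n - 1 - ε) / n)
  let U : Set ℂ := {s | c < s.re}
  have hUo : IsOpen U := isOpen_lt continuous_const Complex.continuous_re
  have hUc : IsPreconnected U := (convex_halfSpace_re_gt c).isPreconnected
  have hQU : ∀ s ∈ U, ∀ i ∈ Finset.range n, -ε < ((n:ℂ) * s - i).re := by
    intro s hs i hi
    have hs1 : (n - 1 - ε) / n < s.re := lt_of_le_of_lt (le_max_right _ _) hs
    rw [div_lt_iff₀ (by linarith)] at hs1
    have hi1 : (i:ℝ) + 1 ≤ n := by exact_mod_cast Finset.mem_range.1 hi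
    have : ((n:ℂ) * s - i).re = n * s.re - i := by simp
    rw [this]; linarith
  have hF : AnalyticOnNhd ℂ F U := by
    refine DifferentiableOn.analyticOnNhd (fun s hs => ?_) hUo
    refine DifferentiableAt.differentiableWithinAt ?_
    refine (hP s (lt_of_le_of_lt (le_max_left _ _) hs)).mul ?_
    refine DifferentiableAt.fun_finsetProd fun i hi => ?_
    have : DifferentiableAt ℂ (fun s : ℂ => E (n * s - i)) s :=
      DifferentiableAt.comp (g := E) s (hE _) (by fun_prop)
    exact this.mul (by fun_prop)
  have hR : AnalyticOnNhd ℂ R U := by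
    refine DifferentiableOn.analyticOnNhd (fun s hs => ?_) hUo
    refine DifferentiableAt.differentiableWithinAt ?_
    refine DifferentiableAt.mul (DifferentiableAt.mul (by fun_prop) ((hE s).mul (by fun_prop))) ?_
    refine DifferentiableAt.fun_finsetProd fun i hi => ?_
    exact DifferentiableAt.comp (g := Q) s (hQ _ (hQU s hs i hi)) (by fun_prop)
  let x0 : ℝ := max (max 1 s1) c + 1
  have hx1 : 1 < x0 := by
    have := le_max_left (max 1 s1) c; have := le_max_left 1 s1; simp only [x0]; linarith
  have hxs : s1 < x0 := by
    have := le_max_left (max 1 s1) c; have := le_max_right 1 s1; simp only [x0]; linarith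
  have hxc : c < x0 := by
    have := le_max_right (max 1 s1) c; simp only [x0]; linarith
  have key : ∀ s : ℝ, x0 ≤ s → F s = R s := by
    intro s hs
    have hs1 : 1 < s := by linarith
    have hh := h s (by linarith)
    have hi : ∀ i ∈ Finset.range n, 1 < (n:ℝ) * s - i := by
      intro i hi
      have hi1 : (i:ℝ) + 1 ≤ n := by exact_mod_cast Finset.mem_range.1 hi
      nlinarith
    simp only [F, R]
    rw [(hPe s hs1).2, hh, ENNReal.toReal_mul, ENNReal.toReal_ofReal (by positivity), ENNReal.toReal_prod]
    have e1 : ∏ i ∈ Finset.range n, Q (n * s - i) =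
        ((∏ i ∈ Finset.range n, ((1 - 2 ^ (-(n * s - i))) * (S'.zX (n * s - i) * S'.arch (n * s - i)).toReal * (n * s - i - 1)) : ℝ) : ℂ) := by
      rw [Complex.ofReal_prod]
      refine Finset.prod_congr rfl fun i hh => ?_
      rw [← (hQe _ (hi i hh)).2]
      push_cast; rfl
    have e2 : ∏ i ∈ Finset.range n, (E (n * s - i) * (n * s - i - 1)) =
        ((∏ i ∈ Finset.range n, ((1 - 2 ^ (-(n * s - i))) * (n * s - i - 1)) : ℝ) : ℂ) := by
      rw [Complex.ofReal_prod]
      refine Finset.prod_congr rfl fun i hh => ?_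
      have : ((n:ℂ) * s - i) = ((n * s - i : ℝ) : ℂ) := by push_cast; rfl
      rw [this, hEr]
      push_cast; rfl
    have e3 : Complex.exp (s * Real.log A) = ((A ^ s : ℝ) : ℂ) := by
      rw [Real.rpow_def_of_pos hA]; push_cast; rw [mul_comm]
    rw [e1, e2, e3, hEr]
    have e4 : (((s:ℝ):ℂ) - 1) = ((s - 1 : ℝ) : ℂ) := by push_cast; rfl
    rw [e4, ← Complex.ofReal_mul, ← Complex.ofReal_mul, ← Complex.ofReal_mul, ← Complex.ofReal_mul, ← Complex.ofReal_mul]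
    congr 1
    rw [Finset.prod_mul_distrib, Finset.prod_mul_distrib, Finset.prod_mul_distrib]
    ring
  have hfreq : ∃ᶠ z in 𝓝[≠] ((x0:ℝ):ℂ), F z = R z := by
    have ht : Tendsto (fun k : ℕ => ((x0 + 1 / ((k:ℝ) + 1) : ℝ) : ℂ)) atTop (𝓝[≠] ((x0:ℝ):ℂ)) := by
      refine tendsto_nhdsWithin_iff.2 ⟨?_, Eventually.of_forall fun k => ?_⟩
      · have : Tendsto (fun k : ℕ => x0 + 1 / ((k:ℝ) + 1)) atTop (𝓝 (x0 + 0)) :=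
          tendsto_const_nhds.add tendsto_one_div_add_atTop_nhds_zero_nat
        rw [add_zero] at this
        exact (Complex.continuous_ofReal.tendsto _).comp this
      · simp only [Set.mem_compl_iff, Set.mem_singleton_iff]
        intro hk
        have hk : x0 + 1 / ((k:ℝ) + 1) = x0 := by exact_mod_cast hk
        have : 0 < 1 / ((k:ℝ) + 1) := by positivity
        linarith
    refine ht.frequently (Eventually.frequently (Eventually.of_forall fun k => key _ ?_))
    have : 0 < 1 / ((k:ℝ) + 1) := by positivity
    linarith
  have heq := hF.eqOn_of_preconnected_of_frequently_eq hR hUc (show ((x0:ℝ):ℂ) ∈ U from by simpa [U] using hxc) hfreq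
  let s0 : ℝ := ((n:ℝ) - 1) / n
  have hn0 : (0:ℝ) < n := by linarith
  have hs0U : ((s0:ℝ):ℂ) ∈ U := by
    have h1 : c < s0 := by
      apply max_lt
      · have : 0 < s0 := div_pos (by linarith) hn0
        linarith
      · exact div_lt_div_of_pos_right (by linarith) hn0
    simpa [U] using h1
  have hv : (n:ℂ) * (s0:ℝ) = n - 1 := by
    simp only [s0]; push_cast
    have : (n:ℂ) ≠ 0 := by exact_mod_cast hn0.ne'
    field_simp
  have hfin := heq hs0U
  have hF0 : F s0 = 0 := by
    simp only [F]
    refine mul_eq_zero_of_right _ (Finset.prod_eq_zero (i := n - 1) (Finset.mem_range.2 (by omega)) ?_)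
    rw [hv, Nat.cast_sub (by omega)]
    simp [E]
  rw [hF0] at hfin
  refine absurd hfin.symm ?_
  have hs0p : 0 < s0 := div_pos (by linarith) hn0
  have hs01 : s0 < 1 := by rw [div_lt_one hn0]; linarith
  have hC' : (C:ℂ) ≠ 0 := by exact_mod_cast hC.ne'
  refine mul_ne_zero (mul_ne_zero (mul_ne_zero hC' (Complex.exp_ne_zero _)) (mul_ne_zero ?_ ?_)) ?_
  · rw [hEr]
    have : (2:ℝ) ^ (-s0) < 1 := Real.rpow_lt_one_of_one_lt_of_neg (by norm_num) (by linarith)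
    exact_mod_cast (show (1 - 2 ^ (-s0) : ℝ) ≠ 0 by linarith)
  · exact_mod_cast (show (s0 - 1 : ℝ) ≠ 0 by linarith)
  · rw [Finset.prod_ne_zero_iff]
    intro i hi
    have hi := Finset.mem_range.1 hi
    obtain ⟨j, hj⟩ : ∃ j : ℕ, n = i + j + 1 := ⟨n - i - 1, by omega⟩
    rw [hv, hj]
    have : ((i + j + 1 : ℕ) : ℂ) - 1 - i = j := by push_cast; ring
    rw [this]
    rcases j with _ | _ | j
    · simpa using hQ0
    · simpa using hQ1
    · have hj1 : (1:ℝ) < ((j + 1 + 1 : ℕ) : ℝ) := by push_cast; have : (0:ℝ) ≤ j := Nat.cast_nonneg _; linarith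
      have := hQe _ hj1
      rw [Complex.ofReal_natCast] at this
      rw [this.2]
      have h2 : (2:ℝ) ^ (-((j + 1 + 1 : ℕ) : ℝ)) < 1 := Real.rpow_lt_one_of_one_lt_of_neg (by norm_num) (by linarith)
      refine Complex.ofReal_ne_zero.2 (mul_ne_zero (mul_ne_zero (by linarith) ?_) (by linarith))
      refine (ENNReal.toReal_pos (mul_ne_zero (S'.zX_ne_zero _) (S'.arch_ne_zero (by linarith))) this.1).ne'

end LD
end ABHN
end part09

section part10
namespace ABHN
open scoped nonZeroDivisors ENNReal Pointwise

section lattices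
variable {O K : Type*} [CommRing O] [IsDedekindDomain O] [Field K] [CharZero K] [Algebra O K] [IsFractionRing O K]
variable {V : Type*} [AddCommGroup V] [Module O V] [Module K V] [IsScalarTower O K V]

/-- relative index of submodules -/
noncomputable def ri {R : Type*} [Ring R] {V : Type*} [AddCommGroup V] [Module R V] (A B : Submodule R V) : ℕ :=
  A.toAddSubgroup.relIndex B.toAddSubgroup

lemma ri_mul {R : Type*} [Ring R] {V : Type*} [AddCommGroup V] [Module R V] {A B C : Submodule R V} (h1 : A ≤ B) (h2 : B ≤ C) :
    ri A B * ri B C = ri A C :=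
  AddSubgroup.relIndex_mul_relIndex _ _ _ h1 h2

lemma ri_prod {R : Type*} [Ring R] {V : Type*} [AddCommGroup V] [Module R V] {V' : Type*} [AddCommGroup V'] [Module R V']
    (A B : Submodule R V) (A' B' : Submodule R V') :
    ri (A.prod A') (B.prod B') = ri A B * ri A' B' := by
  have e : B.prod B' = (B.prod B') := rfl
  unfold ri AddSubgroup.relIndex
  rw [← AddSubgroup.index_prod]
  let φ : (B.prod B').toAddSubgroup ≃+ B.toAddSubgroup × B'.toAddSubgroup :=
    { toFun := fun x => (⟨x.1.1, x.2.1⟩, ⟨x.1.2, x.2.2⟩)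
      invFun := fun x => ⟨(x.1.1, x.2.1), ⟨x.1.2, x.2.2⟩⟩
      left_inv := fun x => rfl
      right_inv := fun x => rfl
      map_add' := fun x y => rfl }
  rw [← AddSubgroup.index_comap_of_surjective _ (f := φ.toAddMonoidHom) φ.surjective]
  congr 1

lemma nsmul_mem_of_ri {R : Type*} [Ring R] {V : Type*} [AddCommGroup V] [Module R V] {A B : Submodule R V} {x : V} (hx : x ∈ B) :
    ri A B • x ∈ A := by
  have := (A.toAddSubgroup.addSubgroupOf B.toAddSubgroup).nsmul_index_mem ⟨x, hx⟩
  exact this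

lemma smul_dvd (J : FractionalIdeal O⁰ K) {M M' : Submodule O V} (h : M ≤ M') (hi : ri M M' ≠ 0) :
    ri ((J : Submodule O K) • M) ((J : Submodule O K) • M') ∣ ri M M' := by
  by_cases hJ : J = 0
  · subst hJ
    simp [ri]
  set k := ri M M'
  have hk : (k : K) ≠ 0 := by exact_mod_cast hi
  have hk' : FractionalIdeal.spanSingleton O⁰ (k:K) ≠ 0 := FractionalIdeal.spanSingleton_ne_zero_iff.2 hk
  have hle : FractionalIdeal.spanSingleton O⁰ (k:K) * J ≤ J := by
    rw [FractionalIdeal.spanSingleton_mul_le_iff]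
    intro z hz
    rw [← nsmul_eq_mul]
    exact (J : Submodule O K).smul_of_tower_mem k hz
  obtain ⟨y, hy⟩ := IsDedekindDomain.exists_add_spanSingleton_mul_eq hle (mul_ne_zero hk' hJ) (one_ne_zero (α := FractionalIdeal O⁰ K))
  rw [mul_one] at hy
  have hyJ : y ∈ J := by
    rw [← hy]
    exact (le_add_of_nonneg_left (a := FractionalIdeal.spanSingleton O⁰ y) bot_le) (FractionalIdeal.mem_spanSingleton_self _ _)
  let f : V →+ V := (LinearMap.lsmul K V y).toAddMonoidHom
  -- key inclusion
  have key : ((J : Submodule O K) • M').toAddSubgroup ≤ ((J : Submodule O K) • M).toAddSubgroup ⊔ (M'.toAddSubgroup.map f) := by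
    intro z hz
    have hz : z ∈ (J : Submodule O K) • M' := hz
    refine Submodule.smul_induction_on hz (fun r hr n hn => ?_) (fun x y hx hy => add_mem hx hy)
    · 
      have hr : r ∈ J := hr
      rw [← hy] at hr
      obtain ⟨a, ha, b, hb, rfl⟩ := (FractionalIdeal.mem_add _ _ _).1 hr
      rw [add_smul]
      refine AddSubgroup.add_mem_sup ?_ ?_
      · rw [FractionalIdeal.mem_singleton_mul] at ha
        obtain ⟨j, hj, rfl⟩ := ha
        have : ((k:K) * j) • n = j • (k • n) := by
          rw [mul_comm, mul_smul, Nat.cast_smul_eq_nsmul]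
        rw [this]
        exact Submodule.smul_mem_smul hj (nsmul_mem_of_ri hn)
      · rw [FractionalIdeal.mem_spanSingleton] at hb
        obtain ⟨c, rfl⟩ := hb
        refine ⟨c • n, M'.smul_mem c hn, ?_⟩
        change y • c • n = (c • y) • n
        rw [← algebraMap_smul K c n, ← algebraMap_smul K c y, smul_smul, smul_eq_mul, mul_comm]
  have hM : (M.toAddSubgroup.map f) ≤ ((J : Submodule O K) • M).toAddSubgroup := by
    rintro _ ⟨m, hm, rfl⟩
    exact Submodule.smul_mem_smul hyJ hm
  have hM' : (M'.toAddSubgroup.map f) ≤ ((J : Submodule O K) • M').toAddSubgroup := by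
    rintro _ ⟨m, hm, rfl⟩
    exact Submodule.smul_mem_smul hyJ hm
  have e1 : ri ((J : Submodule O K) • M) ((J : Submodule O K) • M') =
      ((J : Submodule O K) • M).toAddSubgroup.relIndex (M'.toAddSubgroup.map f) := by
    rw [← AddSubgroup.relIndex_sup_left]
    unfold ri
    congr 1
    exact le_antisymm key (sup_le (Submodule.smul_mono le_rfl h) hM')
  rw [e1]
  refine (AddSubgroup.relIndex_dvd_of_le_left _ hM).trans ?_
  rw [← AddSubgroup.relIndex_comap]
  refine AddSubgroup.relIndex_dvd_of_le_left _ ?_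
  exact AddSubgroup.le_comap_map _ _

lemma smul_smul_inv (J : FractionalIdeal O⁰ K) (hJ : J ≠ 0) (M : Submodule O V) :
    ((J⁻¹ : FractionalIdeal O⁰ K) : Submodule O K) • ((J : Submodule O K) • M) = M := by
  rw [← Submodule.smul_assoc, smul_eq_mul, ← FractionalIdeal.coe_mul, inv_mul_cancel₀ hJ, FractionalIdeal.coe_one]
  refine le_antisymm (Submodule.smul_le.2 ?_) ?_
  · intro r hr n hn
    obtain ⟨c, rfl⟩ := Submodule.mem_one.1 hr
    rw [algebraMap_smul]; exact M.smul_mem c hn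
  · intro m hm
    have := Submodule.smul_mem_smul (show (1:K) ∈ (1 : Submodule O K) from Submodule.one_le.1 le_rfl) hm
    rwa [one_smul] at this

lemma ri_smul (J : FractionalIdeal O⁰ K) (hJ : J ≠ 0) {M M' : Submodule O V} (h : M ≤ M') (hi : ri M M' ≠ 0) :
    ri ((J : Submodule O K) • M) ((J : Submodule O K) • M') = ri M M' := by
  refine Nat.dvd_antisymm (smul_dvd J h hi) ?_
  have h0 : ri ((J : Submodule O K) • M) ((J : Submodule O K) • M') ≠ 0 :=
    fun h0 => hi (by have := smul_dvd J h hi; rw [h0] at this; exact Nat.eq_zero_of_zero_dvd this)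
  have := smul_dvd J⁻¹ (Submodule.smul_mono (le_refl (J : Submodule O K)) h) h0
  rwa [smul_smul_inv J hJ, smul_smul_inv J hJ] at this


/-- superlattices of finite index -/
abbrev YS {R : Type*} [Ring R] {V : Type*} [AddCommGroup V] [Module R V] (V0 : Submodule R V) : Type _ :=
  {M : Submodule R V // V0 ≤ M ∧ ri V0 M ≠ 0}

/-- zeta sum of superlattices -/
noncomputable def Yz {R : Type*} [Ring R] {V : Type*} [AddCommGroup V] [Module R V] (V0 : Submodule R V) (s : ℝ) : ℝ≥0∞ :=
  ∑' M : YS V0, (ENNReal.ofReal (ri V0 M.1)) ^ (-s)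

/-- the fractional ideal of a superlattice of the integers -/
def fid (c : YS (1 : Submodule O K)) : FractionalIdeal O⁰ K :=
  ⟨c.1, by
    refine ⟨(ri 1 c.1 : ℕ), ?_, ?_⟩
    · have : ((ri 1 c.1 : ℕ) : K) ≠ 0 := by exact_mod_cast c.2.2
      refine mem_nonZeroDivisors_of_ne_zero fun h => this ?_
      rw [← map_natCast (algebraMap O K), h, map_zero]
    · intro b hb
      have := nsmul_mem_of_ri (A := (1 : Submodule O K)) hb
      obtain ⟨y, hy⟩ := Submodule.mem_one.1 this
      exact ⟨y, by rw [hy, Nat.cast_smul_eq_nsmul]⟩⟩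

lemma coe_fid (c : YS (1 : Submodule O K)) : ((fid c : FractionalIdeal O⁰ K) : Submodule O K) = c.1 := rfl

lemma fid_ne_zero (c : YS (1 : Submodule O K)) : fid c ≠ 0 := by
  intro h
  have h1 : (1:K) ∈ c.1 := Submodule.one_le.1 c.2.1
  rw [← coe_fid c, h] at h1
  simp at h1

lemma one_smul_sub (M : Submodule O V) : (1 : Submodule O K) • M = M := by
  refine le_antisymm (Submodule.smul_le.2 ?_) ?_
  · intro r hr n hn
    obtain ⟨c, rfl⟩ := Submodule.mem_one.1 hr
    rw [algebraMap_smul]; exact M.smul_mem c hn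
  · intro m hm
    have := Submodule.smul_mem_smul (show (1:K) ∈ (1 : Submodule O K) from Submodule.one_le.1 le_rfl) hm
    rwa [one_smul] at this

/-- rank condition for a lattice -/
def HasRk (K : Type*) [Field K] [Algebra O K] [Module K V] [IsScalarTower O K V] (V0 : Submodule O V) (r : ℕ) : Prop :=
  ∀ J : Submodule O K, J ≤ 1 → ri (J • V0) V0 = (ri J 1) ^ r

lemma hasRk_prod {V0 : Submodule O V} {r : ℕ} (h : HasRk K V0 r) :
    HasRk K (Submodule.prod (1 : Submodule O K) V0) (r + 1) := by
  intro J hJ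
  have : J • (Submodule.prod (1 : Submodule O K) V0) = Submodule.prod J (J • V0) := by
    refine le_antisymm (Submodule.smul_le.2 ?_) ?_
    · rintro j hj ⟨x, w⟩ ⟨hx, hw⟩
      refine ⟨?_, Submodule.smul_mem_smul hj hw⟩
      obtain ⟨c, rfl⟩ := Submodule.mem_one.1 hx
      change j * algebraMap O K c ∈ J
      rw [mul_comm, ← Algebra.smul_def]; exact J.smul_mem c hj
    · rintro ⟨x, w⟩ ⟨hx, hw⟩
      have e : (x, w) = x • ((1, 0) : K × V) + ((0, w) : K × V) := by simp
      rw [e]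
      refine add_mem (Submodule.smul_mem_smul hx ⟨Submodule.one_le.1 le_rfl, V0.zero_mem⟩) ?_
      have hw : w ∈ J • V0 := hw
      refine Submodule.smul_induction_on (p := fun w => ((0, w) : K × V) ∈ J • (Submodule.prod (1 : Submodule O K) V0)) hw ?_ ?_
      · intro r hr n hn
        have := Submodule.smul_mem_smul (N := Submodule.prod (1 : Submodule O K) V0) hr (n := ((0, n) : K × V)) ⟨Submodule.zero_mem _, hn⟩
        simpa using this
      · intro x y hx hy
        simpa using add_mem hx hy
  rw [this, ri_prod, h J hJ, pow_succ, mul_comm]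


/-- the inverse as a submodule -/
noncomputable def cinv (c : YS (1 : Submodule O K)) : Submodule O K := (((fid c)⁻¹ : FractionalIdeal O⁰ K) : Submodule O K)

lemma cinv_mul (c : YS (1 : Submodule O K)) : cinv c * c.1 = 1 := by
  rw [← coe_fid c, cinv, ← FractionalIdeal.coe_mul, inv_mul_cancel₀ (fid_ne_zero c), FractionalIdeal.coe_one]

lemma cinv_le (c : YS (1 : Submodule O K)) : cinv c ≤ 1 := by
  rw [← cinv_mul c]
  intro j hj
  have := Submodule.mul_mem_mul hj (Submodule.one_le.1 c.2.1)
  rwa [mul_one] at this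

lemma smul_le_of_le_one {J : Submodule O K} (hJ : J ≤ 1) (M : Submodule O V) : J • M ≤ M := by
  have := Submodule.smul_mono_left (N := M) hJ
  rwa [one_smul_sub] at this

/-- the key fiber count -/
lemma fiber_count {V0 : Submodule O V} {r : ℕ} (h : HasRk K V0 r) (M1 : YS V0) (c : YS (1 : Submodule O K)) :
    ri (cinv c • M1.1) M1.1 = (ri 1 c.1) ^ r := by
  have hJ1 := cinv_le c
  have hne : (fid c)⁻¹ ≠ 0 := inv_ne_zero (fid_ne_zero c)
  have e1 : ri (cinv c • V0) (cinv c • M1.1) = ri V0 M1.1 := ri_smul _ hne M1.2.1 M1.2.2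
  have e2 := ri_mul (smul_le_of_le_one hJ1 V0) M1.2.1
  have e3 := ri_mul (Submodule.smul_mono (le_refl (cinv c)) M1.2.1) (smul_le_of_le_one hJ1 M1.1)
  have e4 : ri (cinv c) 1 = ri 1 c.1 := by
    have := ri_smul _ hne c.2.1 c.2.2
    change ri (cinv c • 1) (cinv c • c.1) = ri 1 c.1 at this
    rwa [smul_eq_mul, smul_eq_mul, mul_one, cinv_mul] at this
  have := h _ hJ1
  rw [e4] at this
  rw [← this]
  rw [e1] at e3
  rw [← e3, mul_comm] at e2
  exact (Nat.eq_of_mul_eq_mul_left (Nat.pos_of_ne_zero M1.2.2) e2).symm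

/-- sheared lattice -/
def shear (M1 : Submodule O V) (c : Submodule O K) (u : V) : Submodule O (K × V) where
  carrier := {p | p.1 ∈ c ∧ p.2 - p.1 • u ∈ M1}
  add_mem' := by
    rintro ⟨a, b⟩ ⟨a', b'⟩ ⟨h1, h2⟩ ⟨h1', h2'⟩
    refine ⟨c.add_mem h1 h1', ?_⟩
    have := M1.add_mem h2 h2'
    convert this using 1
    simp [add_smul]; abel
  zero_mem' := by simp
  smul_mem' := by
    rintro t ⟨a, b⟩ ⟨h1, h2⟩
    refine ⟨c.smul_mem t h1, ?_⟩
    have := M1.smul_mem t h2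
    convert this using 1
    simp [smul_sub]

lemma mem_shear {M1 : Submodule O V} {c : Submodule O K} {u : V} {p : K × V} :
    p ∈ shear M1 c u ↔ p.1 ∈ c ∧ p.2 - p.1 • u ∈ M1 := Iff.rfl

lemma one_smul_mem {M1 : Submodule O V} {u : V} (hu : u ∈ M1) {x : K} (hx : x ∈ (1 : Submodule O K)) : x • u ∈ M1 := by
  obtain ⟨c, rfl⟩ := Submodule.mem_one.1 hx
  rw [algebraMap_smul]; exact M1.smul_mem c hu

lemma shear_eq {M1 : Submodule O V} {c : Submodule O K} {u : V} :
    (shear M1 c u).toAddSubgroup.map (AddMonoidHom.prod (AddMonoidHom.fst K V)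
      (AddMonoidHom.snd K V - (LinearMap.toSpanSingleton K V u).toAddMonoidHom.comp (AddMonoidHom.fst K V))) =
      (c.prod M1).toAddSubgroup := by
  ext ⟨x, w⟩
  constructor
  · rintro ⟨⟨x, w⟩, ⟨h1, h2⟩, hh⟩
    simp at hh
    obtain ⟨rfl, rfl⟩ := hh
    exact ⟨h1, h2⟩
  · rintro ⟨h1, h2⟩
    refine ⟨(x, w + x • u), ⟨h1, by simpa using h2⟩, by simp⟩

lemma ri_shear {V0 : Submodule O V} (M1 : YS V0) (c : YS (1 : Submodule O K)) {u : V} (hu : u ∈ M1.1) :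
    Submodule.prod 1 V0 ≤ shear M1.1 c.1 u ∧
    ri (Submodule.prod 1 V0) (shear M1.1 c.1 u) = ri V0 M1.1 * ri 1 c.1 := by
  have l1 : Submodule.prod (1 : Submodule O K) V0 ≤ Submodule.prod 1 M1.1 := Submodule.prod_mono le_rfl M1.2.1
  have es : (shear M1.1 (1 : Submodule O K) u) = Submodule.prod 1 M1.1 := by
    ext ⟨x, w⟩
    rw [mem_shear]
    constructor
    · rintro ⟨h1, h2⟩
      refine ⟨h1, ?_⟩
      have := M1.1.add_mem h2 (one_smul_mem hu h1)
      simpa using this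
    · rintro ⟨h1, h2⟩
      exact ⟨h1, M1.1.sub_mem h2 (one_smul_mem hu h1)⟩
  have l2 : Submodule.prod (1 : Submodule O K) M1.1 ≤ shear M1.1 c.1 u := by
    rw [← es]
    intro p hp
    exact ⟨c.2.1 hp.1, hp.2⟩
  refine ⟨l1.trans l2, ?_⟩
  rw [← ri_mul l1 l2, ri_prod]
  have e : ri (Submodule.prod (1 : Submodule O K) M1.1) (shear M1.1 c.1 u) = ri (Submodule.prod (1 : Submodule O K) M1.1) (Submodule.prod c.1 M1.1) := by
    conv_lhs => rw [← es]
    unfold ri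
    rw [← shear_eq (c := (1 : Submodule O K)) (u := u), ← shear_eq (c := c.1) (u := u)]
    refine (AddSubgroup.relIndex_map_map_of_injective _ _ ?_).symm
    rintro ⟨x, w⟩ ⟨x', w'⟩ hh
    simp at hh
    obtain ⟨rfl, h2⟩ := hh
    simpa using h2
  rw [e, ri_prod]
  have r2 : ri M1.1 M1.1 = 1 := AddSubgroup.relIndex_self _
  have r3 : ri (1 : Submodule O K) 1 = 1 := AddSubgroup.relIndex_self _
  rw [r2, r3]; ring

lemma comp1_aux {V0 : Submodule O V} {M : Submodule O (K × V)} (h1 : Submodule.prod (1 : Submodule O K) V0 ≤ M)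
    (h2 : ri (Submodule.prod (1 : Submodule O K) V0) M ≠ 0) :
    V0 ≤ M.comap (LinearMap.inr O K V) ∧ ri V0 (M.comap (LinearMap.inr O K V)) ≠ 0 := by
  refine ⟨fun w hw => h1 ⟨Submodule.zero_mem _, hw⟩, ?_⟩
  have := AddSubgroup.relIndex_comap_ne_zero (LinearMap.inr O K V).toAddMonoidHom h2
  refine fun h => this ?_
  rw [← h]
  unfold ri
  congr 1
  ext w
  exact ⟨fun h => h.2, fun h => ⟨Submodule.zero_mem _, h⟩⟩

lemma comp2_aux {V0 : Submodule O V} {M : Submodule O (K × V)} (h1 : Submodule.prod (1 : Submodule O K) V0 ≤ M)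
    (h2 : ri (Submodule.prod (1 : Submodule O K) V0) M ≠ 0) :
    1 ≤ M.map (LinearMap.fst O K V) ∧ ri 1 (M.map (LinearMap.fst O K V)) ≠ 0 := by
  refine ⟨fun x hx => ⟨(x, 0), h1 ⟨hx, V0.zero_mem⟩, rfl⟩, ?_⟩
  have : (1 : Submodule O K).toAddSubgroup.relIndex
         (M.toAddSubgroup.map (LinearMap.fst O K V).toAddMonoidHom) ≠ 0 := by
    rw [← AddSubgroup.relIndex_comap]
    refine fun h => h2 ?_
    refine AddSubgroup.relIndex_eq_zero_of_le_left ?_ h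
    intro p hp
    exact hp.1
  exact this

/-- first component -/
def comp1 {V0 : Submodule O V} (M : YS (Submodule.prod (1 : Submodule O K) V0)) : YS V0 :=
  ⟨M.1.comap (LinearMap.inr O K V), comp1_aux M.2.1 M.2.2⟩

/-- second component -/
def comp2 {V0 : Submodule O V} (M : YS (Submodule.prod (1 : Submodule O K) V0)) : YS (1 : Submodule O K) :=
  ⟨M.1.map (LinearMap.fst O K V), comp2_aux M.2.1 M.2.2⟩

lemma exists_shear {V0 : Submodule O V} (M : YS (Submodule.prod (1 : Submodule O K) V0)) :
    ∃ u ∈ (comp1 M).1, M.1 = shear (comp1 M).1 (comp2 M).1 u := by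
  have h1 : (1:K) ∈ cinv (comp2 M) * (comp2 M).1 := by rw [cinv_mul]; exact Submodule.one_le.1 le_rfl
  have key : ∀ z ∈ cinv (comp2 M) * (comp2 M).1, ∃ Y : V, ∀ x ∈ (comp2 M).1, ((x * z, x • Y) : K × V) ∈ M.1 := by
    intro z hz
    refine Submodule.mul_induction_on hz ?_ ?_
    · rintro j hj y ⟨⟨y', w⟩, hp, rfl⟩
      refine ⟨j • w, fun x hx => ?_⟩
      have hxj : x * j ∈ (1 : Submodule O K) := by
        rw [← cinv_mul (comp2 M), mul_comm x j]; exact Submodule.mul_mem_mul hj hx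
      have := one_smul_mem hp hxj
      simpa [smul_smul, mul_assoc] using this
    · rintro z z' ⟨Y, hY⟩ ⟨Y', hY'⟩
      refine ⟨Y + Y', fun x hx => ?_⟩
      have := M.1.add_mem (hY x hx) (hY' x hx)
      simpa [mul_add] using this
  obtain ⟨u, hu⟩ := key 1 h1
  simp only [mul_one] at hu
  have h1c : (1:K) ∈ (comp2 M).1 := Submodule.one_le.1 (comp2 M).2.1
  refine ⟨u, ?_, ?_⟩
  · have a := hu 1 h1c
    have b : ((1, 0) : K × V) ∈ M.1 := M.2.1 ⟨Submodule.one_le.1 le_rfl, V0.zero_mem⟩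
    have := M.1.sub_mem a b
    simp at this
    exact this
  · ext ⟨x, w⟩
    rw [mem_shear]
    constructor
    · intro h
      have hx : x ∈ (comp2 M).1 := ⟨(x, w), h, rfl⟩
      refine ⟨hx, ?_⟩
      have := M.1.sub_mem h (hu x hx)
      simp at this
      exact this
    · rintro ⟨hx, h⟩
      have h : ((0, w - x • u) : K × V) ∈ M.1 := h
      have := M.1.add_mem h (hu x hx)
      simpa using this

lemma shear_inj {M1 : Submodule O V} {c : YS (1 : Submodule O K)} {u u' : V} :
    shear M1 c.1 u = shear M1 c.1 u' ↔ u - u' ∈ cinv c • M1 := by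
  have h1 : u - u' ∈ cinv c • M1 ↔ ∀ x ∈ c.1, x • (u - u') ∈ M1 := by
    constructor
    · intro h x hx
      have := Submodule.smul_mem_smul hx h
      rw [← Submodule.smul_assoc, smul_eq_mul, mul_comm, cinv_mul, one_smul_sub] at this
      exact this
    · intro h
      have h1 : (1:K) ∈ cinv c * c.1 := by rw [cinv_mul]; exact Submodule.one_le.1 le_rfl
      have key : ∀ z ∈ cinv c * c.1, z • (u - u') ∈ cinv c • M1 := by
        intro z hz
        refine Submodule.mul_induction_on hz ?_ ?_
        · intro j hj y hy
          rw [mul_smul]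
          exact Submodule.smul_mem_smul hj (h y hy)
        · intro a b ha hb
          rw [add_smul]; exact add_mem ha hb
      simpa using key 1 h1
  rw [h1]
  constructor
  · intro h x hx
    have : ((x, x • u) : K × V) ∈ shear M1 c.1 u := ⟨hx, by simp⟩
    rw [h] at this
    have := this.2
    simpa [smul_sub] using this
  · intro h
    ext ⟨x, w⟩
    rw [mem_shear, mem_shear]
    refine and_congr_right fun hx => ?_
    have hh := h x hx
    simp only
    constructor
    · intro a
      have := M1.add_mem a hh
      rw [smul_sub] at this
      simpa using this
    · intro a
      have := M1.sub_mem a hh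
      rw [smul_sub] at this
      simpa using this


/-- the sheared lattice as a superlattice -/
def shearY {V0 : Submodule O V} (M1 : YS V0) (c : YS (1 : Submodule O K)) (u : M1.1) : YS (Submodule.prod (1 : Submodule O K) V0) :=
  ⟨shear M1.1 c.1 u, (ri_shear M1 c u.2).1, by
    rw [(ri_shear M1 c u.2).2]; exact mul_ne_zero M1.2.2 c.2.2⟩

lemma comp1_shearY {V0 : Submodule O V} (M1 : YS V0) (c : YS (1 : Submodule O K)) (u : M1.1) : comp1 (shearY M1 c u) = M1 := by
  apply Subtype.ext
  ext w
  change (0:K) ∈ c.1 ∧ w - (0:K) • (u:V) ∈ M1.1 ↔ _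
  simp

lemma comp2_shearY {V0 : Submodule O V} (M1 : YS V0) (c : YS (1 : Submodule O K)) (u : M1.1) : comp2 (shearY M1 c u) = c := by
  apply Subtype.ext
  ext x
  constructor
  · rintro ⟨p, hp, rfl⟩
    exact hp.1
  · intro hx
    exact ⟨(x, x • (u:V)), ⟨hx, by simp⟩, rfl⟩

lemma card_fiber {V0 : Submodule O V} {r : ℕ} (h : HasRk K V0 r) (M1 : YS V0) (c : YS (1 : Submodule O K)) :
    Nat.card {M : YS (Submodule.prod (1 : Submodule O K) V0) // (comp1 M, comp2 M) = (M1, c)} = (ri 1 c.1) ^ r := by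
  rw [← fiber_count h M1 c]
  unfold ri AddSubgroup.relIndex AddSubgroup.index
  symm
  let F : M1.1 → {M : YS (Submodule.prod (1 : Submodule O K) V0) // (comp1 M, comp2 M) = (M1, c)} :=
    fun u => ⟨shearY M1 c u, by rw [comp1_shearY, comp2_shearY]⟩
  have hF : ∀ u u' : M1.1, F u = F u' ↔ (u:V) - u' ∈ cinv c • M1.1 := by
    intro u u'
    rw [← shear_inj (K := K) (M1 := M1.1) (c := c), Subtype.ext_iff, Subtype.ext_iff]
    rfl
  refine Nat.card_congr (Equiv.ofBijective (Quotient.lift F ?_) ⟨?_, ?_⟩)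
  · intro u u' huu
    rw [hF]
    have := (QuotientAddGroup.leftRel_apply).1 huu
    have h2 := AddSubgroup.neg_mem _ this
    have h3 : ((-(-u + u') : M1.1) : V) ∈ cinv c • M1.1 := h2
    simpa [sub_eq_add_neg, add_comm] using h3
  · intro a b
    induction a using Quotient.inductionOn with | _ u
    induction b using Quotient.inductionOn with | _ u'
    intro hh
    have := (hF u u').1 hh
    apply Quotient.sound
    apply QuotientAddGroup.leftRel_apply.2
    have h2 := (cinv c • M1.1).neg_mem this
    have : ((-u + u' : M1.1) : V) ∈ cinv c • M1.1 := by simpa [sub_eq_add_neg, add_comm] using h2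
    exact this
  · rintro ⟨M, hM⟩
    obtain ⟨rfl, rfl⟩ := Prod.mk.inj hM
    obtain ⟨u, hu, e⟩ := exists_shear M
    refine ⟨Quotient.mk _ ⟨u, hu⟩, ?_⟩
    apply Subtype.ext
    apply Subtype.ext
    exact e.symm

lemma Yz_prod {V0 : Submodule O V} {r : ℕ} (h : HasRk K V0 r) (s : ℝ) :
    Yz (Submodule.prod (1 : Submodule O K) V0) s = Yz V0 s * Yz (1 : Submodule O K) (s - r) := by
  unfold Yz
  rw [← (Equiv.sigmaFiberEquiv (fun M : YS (Submodule.prod (1 : Submodule O K) V0) => (comp1 M, comp2 M))).tsum_eq,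
    ENNReal.tsum_sigma', ENNReal.tsum_prod', ← ENNReal.tsum_mul_right]
  refine tsum_congr fun M1 => ?_
  rw [← ENNReal.tsum_mul_left]
  refine tsum_congr fun c => ?_
  have hc : (0:ℝ) < (ri 1 c.1 : ℕ) := by exact_mod_cast Nat.pos_of_ne_zero c.2.2
  have hM : (0:ℝ) < (ri V0 M1.1 : ℕ) := by exact_mod_cast Nat.pos_of_ne_zero M1.2.2
  have e : ∀ M : {M : YS (Submodule.prod (1 : Submodule O K) V0) // (comp1 M, comp2 M) = (M1, c)},
      ri (Submodule.prod (1 : Submodule O K) V0) M.1.1 = ri V0 M1.1 * ri 1 c.1 := by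
    rintro ⟨M, hM⟩
    obtain ⟨rfl, rfl⟩ := Prod.mk.inj hM
    obtain ⟨u, hu, e⟩ := exists_shear M
    have := (ri_shear (comp1 M) (comp2 M) hu).2
    rw [← e] at this
    exact this
  have hcard := card_fiber h M1 c
  have hfin : Finite {M : YS (Submodule.prod (1 : Submodule O K) V0) // (comp1 M, comp2 M) = (M1, c)} := by
    apply Nat.finite_of_card_ne_zero
    rw [hcard]; exact pow_ne_zero _ c.2.2
  calc _ = ∑' M : {M : YS (Submodule.prod (1 : Submodule O K) V0) // (comp1 M, comp2 M) = (M1, c)},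
        (ENNReal.ofReal ((ri V0 M1.1 * ri 1 c.1 : ℕ) : ℝ)) ^ (-s) := by
        refine tsum_congr fun M => ?_
        rw [← e M]; rfl
    _ = ENNReal.ofReal (((ri 1 c.1 : ℕ):ℝ) ^ r) * (ENNReal.ofReal ((ri V0 M1.1 * ri 1 c.1 : ℕ) : ℝ)) ^ (-s) := by
        rw [ENNReal.tsum_const, ENat.card_eq_coe_natCard, hcard]
        congr 1
        rw [← Nat.cast_pow, ENNReal.ofReal_natCast]; rfl
    _ = _ := by
        push_cast
        rw [ENNReal.ofReal_rpow_of_pos (by positivity), ENNReal.ofReal_rpow_of_pos hM, ENNReal.ofReal_rpow_of_pos hc,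
          ← ENNReal.ofReal_mul (by positivity), ← ENNReal.ofReal_mul (by positivity)]
        congr 1
        rw [Real.mul_rpow hM.le hc.le, neg_sub, sub_eq_add_neg, Real.rpow_add hc, Real.rpow_natCast]
        ring

lemma Yz_equiv {V' : Type*} [AddCommGroup V'] [Module O V'] (e : V ≃ₗ[O] V') (V0 : Submodule O V) (V0' : Submodule O V')
    (h : V0.map e.toLinearMap = V0') (s : ℝ) : Yz V0 s = Yz V0' s := by
  subst h
  unfold Yz
  have key : ∀ M : Submodule O V, ri (V0.map e.toLinearMap) (M.map e.toLinearMap) = ri V0 M := fun M =>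
    AddSubgroup.relIndex_map_map_of_injective V0.toAddSubgroup M.toAddSubgroup (f := e.toLinearMap.toAddMonoidHom) e.injective
  let E : YS V0 ≃ YS (V0.map e.toLinearMap) :=
    { toFun := fun M => ⟨M.1.map e.toLinearMap, Submodule.map_mono M.2.1, by rw [key]; exact M.2.2⟩
      invFun := fun M => ⟨M.1.comap e.toLinearMap, Submodule.map_le_iff_le_comap.1 M.2.1, by
        rw [← key, Submodule.map_comap_eq_of_surjective e.surjective]; exact M.2.2⟩
      left_inv := fun M => Subtype.ext (Submodule.comap_map_eq_of_injective e.injective _)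
      right_inv := fun M => Subtype.ext (Submodule.map_comap_eq_of_surjective e.surjective _) }
  rw [← E.tsum_eq]
  refine tsum_congr fun M => ?_
  change _ = ENNReal.ofReal (ri (V0.map e.toLinearMap) (M.1.map e.toLinearMap)) ^ (-s)
  rw [key]

lemma HasRk_equiv {V' : Type*} [AddCommGroup V'] [Module O V'] [Module K V'] [IsScalarTower O K V'] (e : V ≃ₗ[K] V')
    (V0 : Submodule O V) (V0' : Submodule O V')
    (h : V0.map (e.restrictScalars O).toLinearMap = V0') {r : ℕ} (hr : HasRk K V0 r) : HasRk K V0' r := by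
  subst h
  intro J hJ
  rw [← hr J hJ]
  have : J • V0.map (e.restrictScalars O).toLinearMap = (J • V0).map (e.restrictScalars O).toLinearMap := by
    refine le_antisymm (Submodule.smul_le.2 ?_) ?_
    · rintro j hj _ ⟨x, hx, rfl⟩
      refine ⟨j • x, Submodule.smul_mem_smul hj hx, ?_⟩
      simp
    · rintro _ ⟨x, hx, rfl⟩
      refine Submodule.smul_induction_on hx ?_ ?_
      · intro j hj n hn
        have := Submodule.smul_mem_smul hj (Submodule.mem_map_of_mem (f := (e.restrictScalars O).toLinearMap) hn)
        simpa using this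
      · intro x y hx hy
        rw [map_add]; exact add_mem hx hy
  rw [this]
  exact AddSubgroup.relIndex_map_map_of_injective (J • V0).toAddSubgroup V0.toAddSubgroup (f := e.toLinearMap.toAddMonoidHom) e.injective

/-- the standard lattice -/
def stdL (O K : Type*) [CommRing O] [Field K] [Algebra O K] (n : ℕ) : Submodule O (Fin n → K) :=
  Submodule.pi Set.univ (fun _ => 1)

lemma stdL_succ (n : ℕ) : (Submodule.prod (1 : Submodule O K) (stdL O K n)).map
    ((Fin.consLinearEquiv K (fun _ : Fin (n+1) => K)).restrictScalars O).toLinearMap = stdL O K (n+1) := by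
  ext x
  constructor
  · rintro ⟨⟨a, b⟩, ⟨h1, h2⟩, rfl⟩
    intro i _
    refine Fin.cases ?_ (fun j => ?_) i
    · exact h1
    · exact h2 j trivial
  · intro h
    refine ⟨(x 0, fun j => x j.succ), ⟨h 0 trivial, fun j _ => h j.succ trivial⟩, ?_⟩
    exact Fin.cons_self_tail x

lemma hasRk_std (n : ℕ) : HasRk K (stdL O K n) n := by
  induction n with
  | zero =>
    intro J hJ
    rw [pow_zero]
    have : J • stdL O K 0 = stdL O K 0 := Subsingleton.elim _ _
    rw [this]
    exact AddSubgroup.relIndex_self _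
  | succ n ih => exact HasRk_equiv _ _ _ (stdL_succ n) (hasRk_prod ih)

theorem Yz_std (n : ℕ) (s : ℝ) : Yz (stdL O K n) s = ∏ i ∈ Finset.range n, Yz (1 : Submodule O K) (s - i) := by
  induction n with
  | zero =>
    rw [Finset.prod_range_zero]
    unfold Yz
    have hr : ∀ M, ri (stdL O K 0) M = 1 := by
      intro M
      have : M = stdL O K 0 := Subsingleton.elim _ _
      rw [this]; exact AddSubgroup.relIndex_self _
    haveI : Unique (YS (stdL O K 0)) :=
      { default := ⟨stdL O K 0, le_rfl, by rw [hr]; exact one_ne_zero⟩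
        uniq := fun M => Subtype.ext (Subsingleton.elim _ _) }
    rw [tsum_eq_single default (fun b hb => absurd (Subsingleton.elim _ _) hb), hr]
    simp
  | succ n ih =>
    rw [Finset.prod_range_succ, ← ih, ← Yz_prod (hasRk_std n)]
    exact (Yz_equiv _ _ _ (stdL_succ n) s).symm

end lattices
end ABHN
end part10

section part11
namespace ABHN
open scoped nonZeroDivisors ENNReal Pointwise

section corr
variable {P W Q : Type*} [AddCommGroup P] [AddCommGroup W] [AddCommGroup Q]

/-- lattice from a subgroup of the quotient -/
def ofJ (i : P →+ W) (f : P →+ Q) (k : ℕ) (J : AddSubgroup Q) : AddSubgroup W :=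
  ((J.comap f).map i).comap (nsmulAddMonoidHom k)

/-- subgroup of the quotient from a lattice -/
def toJ (i : P →+ W) (f : P →+ Q) (k : ℕ) (L : AddSubgroup W) : AddSubgroup Q :=
  ((L.map (nsmulAddMonoidHom k)).comap i).map f

lemma mem_ofJ {i : P →+ W} {f : P →+ Q} {k : ℕ} {J : AddSubgroup Q} {w : W} :
    w ∈ ofJ i f k J ↔ ∃ p, f p ∈ J ∧ i p = k • w := Iff.rfl

lemma mem_toJ {i : P →+ W} {f : P →+ Q} {k : ℕ} {L : AddSubgroup W} {q : Q} :
    q ∈ toJ i f k L ↔ ∃ p, (∃ l ∈ L, k • l = i p) ∧ f p = q := Iff.rfl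

variable (i : P →+ W) (f : P →+ Q) (k : ℕ) (hi : Function.Injective i) (hf : Function.Surjective f)
  (hker : ∀ x, f x = 0 ↔ ∃ y, k • y = x) (hinj : ∀ w : W, k • w = 0 → w = 0) (hsurj : ∀ w : W, ∃ w', k • w' = w)

lemma range_le_ofJ (hker : ∀ x, f x = 0 ↔ ∃ y, k • y = x) (J : AddSubgroup Q) : i.range ≤ ofJ i f k J := by
  rintro _ ⟨p, rfl⟩
  refine mem_ofJ.2 ⟨k • p, ?_, by simp⟩
  rw [(hker _).2 ⟨p, rfl⟩]; exact J.zero_mem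

lemma smul_mem_of_ofJ (J : AddSubgroup Q) {w : W} (h : w ∈ ofJ i f k J) : k • w ∈ i.range := by
  obtain ⟨p, _, h⟩ := mem_ofJ.1 h
  exact ⟨p, h⟩

lemma toJ_ofJ (hi : Function.Injective i) (hf : Function.Surjective f) (hsurj : ∀ w : W, ∃ w', k • w' = w) (J : AddSubgroup Q) :
    toJ i f k (ofJ i f k J) = J := by
  ext q
  rw [mem_toJ]
  constructor
  · rintro ⟨p, ⟨l, hl, e⟩, rfl⟩
    obtain ⟨p', h1, h2⟩ := mem_ofJ.1 hl
    rw [e] at h2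
    rwa [← hi h2]
  · intro hq
    obtain ⟨p, rfl⟩ := hf q
    obtain ⟨w, hw⟩ := hsurj (i p)
    exact ⟨p, ⟨w, mem_ofJ.2 ⟨p, hq, hw.symm⟩, hw⟩, rfl⟩

lemma ofJ_toJ (hker : ∀ x, f x = 0 ↔ ∃ y, k • y = x) (hinj : ∀ w : W, k • w = 0 → w = 0)
    (L : AddSubgroup W) (h1 : i.range ≤ L) (h2 : ∀ l ∈ L, k • l ∈ i.range) :
    ofJ i f k (toJ i f k L) = L := by
  ext w
  rw [mem_ofJ]
  constructor
  · rintro ⟨p, hp, e⟩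
    obtain ⟨p', ⟨l, hl, e'⟩, e2⟩ := mem_toJ.1 hp
    have : f (p - p') = 0 := by rw [map_sub, e2, sub_self]
    obtain ⟨y, hy⟩ := (hker _).1 this
    have : k • (w - l - i y) = 0 := by
      rw [smul_sub, smul_sub, ← e, e', ← map_nsmul, hy, map_sub]; abel
    have := hinj _ this
    have : w = l + i y := by rw [← sub_eq_zero, ← this]; abel
    rw [this]
    exact L.add_mem hl (h1 ⟨y, rfl⟩)
  · intro hw
    obtain ⟨p, hp⟩ := h2 w hw
    exact ⟨p, mem_toJ.2 ⟨p, ⟨w, hw, hp.symm⟩, rfl⟩, hp⟩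

lemma relIndex_ofJ (hi : Function.Injective i) (hf : Function.Surjective f)
    (hker : ∀ x, f x = 0 ↔ ∃ y, k • y = x) (hinj : ∀ w : W, k • w = 0 → w = 0) (hsurj : ∀ w : W, ∃ w', k • w' = w) (J : AddSubgroup Q) :
    i.range.relIndex (ofJ i f k J) = Nat.card J := by
  -- the set of p with f p in J is in bijection with L
  let A : AddSubgroup P := J.comap f
  have e1 : i.range.relIndex (ofJ i f k J) = ((i.range.map (nsmulAddMonoidHom k)).relIndex ((ofJ i f k J).map (nsmulAddMonoidHom k))) := by
    rw [AddSubgroup.relIndex_map_map_of_injective]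
    refine (injective_iff_map_eq_zero _).2 fun w hw => hinj w hw
  have e2 : (ofJ i f k J).map (nsmulAddMonoidHom k) = A.map i := by
    unfold ofJ
    ext w
    constructor
    · rintro ⟨x, hx, rfl⟩; exact hx
    · intro hw
      obtain ⟨x, rfl⟩ := hsurj w
      exact ⟨x, hw, rfl⟩
  have e3 : (i.range.map (nsmulAddMonoidHom k)) = (f.ker).map i := by
    ext w
    constructor
    · rintro ⟨_, ⟨p, rfl⟩, rfl⟩
      exact ⟨k • p, (hker _).2 ⟨p, rfl⟩, by simp⟩
    · rintro ⟨p, hp, rfl⟩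
      obtain ⟨y, rfl⟩ := (hker _).1 hp
      exact ⟨i y, ⟨y, rfl⟩, by simp⟩
  rw [e1, e2, e3, AddSubgroup.relIndex_map_map_of_injective _ _ hi]
  have e4 : f.ker = (⊥ : AddSubgroup Q).comap f := rfl
  rw [e4, AddSubgroup.relIndex_comap, AddSubgroup.map_comap_eq_self_of_surjective hf, AddSubgroup.relIndex_bot_left]

end corr

section mat
variable {R : Type*} [CommRing R] {n : ℕ} [NeZero n]

/-- additive subgroups of matrices stable under left multiplication -/
def IsLeftId (J : AddSubgroup (Matrix (Fin n) (Fin n) R)) : Prop := ∀ a x, x ∈ J → a * x ∈ J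

/-- stable under scalars -/
def IsSub (T : AddSubgroup (Fin n → R)) : Prop := ∀ (a : R) x, x ∈ T → a • x ∈ T

/-- matrices with rows in T -/
def rowsIn (T : AddSubgroup (Fin n → R)) : AddSubgroup (Matrix (Fin n) (Fin n) R) where
  carrier := {A | ∀ i, A i ∈ T}
  add_mem' := fun ha hb i => T.add_mem (ha i) (hb i)
  zero_mem' := fun i => T.zero_mem
  neg_mem' := fun ha i => T.neg_mem (ha i)

/-- matrix with one row -/
def oneRow (v : Fin n → R) : Matrix (Fin n) (Fin n) R := Matrix.of fun i j => if i = 0 then v j else 0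

/-- first rows -/
def rowOf (J : AddSubgroup (Matrix (Fin n) (Fin n) R)) : AddSubgroup (Fin n → R) where
  carrier := {v | oneRow v ∈ J}
  add_mem' := fun {a b} ha hb => by
    have := J.add_mem ha hb
    change oneRow (a + b) ∈ J
    convert this using 1
    ext i j; by_cases h : i = 0 <;> simp [oneRow, h]
  zero_mem' := by
    have := J.zero_mem
    change oneRow 0 ∈ J
    convert this using 1
    ext i j; simp [oneRow]
  neg_mem' := fun {a} ha => by
    have := J.neg_mem ha
    change oneRow (-a) ∈ J
    convert this using 1
    ext i j; by_cases h : i = 0 <;> simp [oneRow, h]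

lemma isLeftId_rowsIn {T : AddSubgroup (Fin n → R)} (h : IsSub T) : IsLeftId (rowsIn T) := by
  intro a x hx i
  have : (a * x) i = ∑ j, a i j • x j := by
    ext l; simp [Matrix.mul_apply]
  rw [this]
  exact T.sum_mem fun j _ => h _ _ (hx j)

lemma isSub_rowOf {J : AddSubgroup (Matrix (Fin n) (Fin n) R)} (h : IsLeftId J) : IsSub (rowOf J) := by
  intro a x hx
  have := h (Matrix.diagonal fun _ => a) _ hx
  change oneRow (a • x) ∈ J
  convert this using 1
  ext i j; by_cases h : i = 0 <;> simp [oneRow, h]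

lemma rowOf_rowsIn (T : AddSubgroup (Fin n → R)) : rowOf (rowsIn T) = T := by
  ext v
  constructor
  · intro h
    have := h 0
    convert this using 1
    ext j; simp [oneRow]
  · intro h i
    by_cases hi : i = 0
    · convert h using 1
      ext j; simp [oneRow, hi]
    · convert T.zero_mem using 1
      ext j; simp [oneRow, hi]

lemma rowsIn_rowOf {J : AddSubgroup (Matrix (Fin n) (Fin n) R)} (h : IsLeftId J) : rowsIn (rowOf J) = J := by
  ext A
  constructor
  · intro hA
    have : A = ∑ i, Matrix.single i 0 (1:R) * oneRow (A i) := by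
      ext a b
      rw [Matrix.sum_apply, Finset.sum_eq_single a]
      · simp [oneRow]
      · intro c _ hc
        simp [Matrix.single_mul_apply_of_ne, hc.symm]
      · simp
    rw [this]
    exact J.sum_mem fun i _ => h _ _ (hA i)
  · intro hA i
    have := h (Matrix.single 0 i (1:R)) _ hA
    change oneRow (A i) ∈ J
    convert this using 1
    ext a b
    by_cases ha : a = 0
    · subst ha; simp [oneRow]
    · simp [oneRow, ha, Matrix.single_mul_apply_of_ne]

lemma card_rowsIn (T : AddSubgroup (Fin n → R)) : Nat.card (rowsIn T) = Nat.card T ^ n := by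
  have : Nat.card (Fin n → T) = Nat.card T ^ n := by rw [Nat.card_fun]; simp
  rw [← this]
  exact Nat.card_congr
    { toFun := fun A i => ⟨A.1 i, A.2 i⟩
      invFun := fun g => ⟨fun i => (g i).1, fun i => (g i).2⟩
      left_inv := fun _ => rfl
      right_inv := fun _ => rfl }
end mat


section final
variable {O K : Type*} [CommRing O] [IsDedekindDomain O] [Field K] [CharZero K] [Algebra O K] [IsFractionRing O K]

lemma divis (W : Type*) [AddCommGroup W] [Module ℚ W] (k : ℕ) (hk : k ≠ 0) :
    (∀ w : W, k • w = 0 → w = 0) ∧ (∀ w : W, ∃ w', k • w' = w) := by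
  have hk' : (k:ℚ) ≠ 0 := by exact_mod_cast hk
  constructor
  · intro w hw
    rw [← Nat.cast_smul_eq_nsmul ℚ] at hw
    exact (smul_eq_zero.1 hw).resolve_left hk'
  · intro w
    refine ⟨(k:ℚ)⁻¹ • w, ?_⟩
    rw [← Nat.cast_smul_eq_nsmul ℚ, smul_smul, mul_inv_cancel₀ hk', one_smul]

/-- embedding of the standard lattice -/
def stdi (O K : Type*) [CommRing O] [Field K] [Algebra O K] (n : ℕ) : (Fin n → O) →+ (Fin n → K) :=
  (algebraMap O K).toAddMonoidHom.compLeft (Fin n)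

/-- reduction -/
def stdf (O : Type*) [CommRing O] (n k : ℕ) : (Fin n → O) →+ (Fin n → O ⧸ Ideal.span {(k:O)}) :=
  (Ideal.Quotient.mk (Ideal.span {(k:O)})).toAddMonoidHom.compLeft (Fin n)

lemma stdi_range (n : ℕ) : (stdi O K n).range = (stdL O K n).toAddSubgroup := by
  ext x
  constructor
  · rintro ⟨p, rfl⟩ i _
    exact Submodule.mem_one.2 ⟨p i, rfl⟩
  · intro h
    choose p hp using fun i => Submodule.mem_one.1 (h i trivial)
    exact ⟨p, funext hp⟩

lemma stdi_inj (n : ℕ) : Function.Injective (stdi O K n) := by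
  intro x y h
  ext i
  exact IsFractionRing.injective O K (congrFun h i)

lemma stdf_surj (n k : ℕ) : Function.Surjective (stdf O n k) := by
  intro x
  choose p hp using fun i => Ideal.Quotient.mk_surjective (x i)
  exact ⟨p, funext hp⟩

lemma stdf_ker (n k : ℕ) (x : Fin n → O) : stdf O n k x = 0 ↔ ∃ y, k • y = x := by
  constructor
  · intro h
    choose p hp using fun i => Ideal.mem_span_singleton'.1 (Ideal.Quotient.eq_zero_iff_mem.1 (congrFun h i))
    refine ⟨p, funext fun i => ?_⟩
    rw [← hp i]; simp [mul_comm]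
  · rintro ⟨y, rfl⟩
    ext i
    refine Ideal.Quotient.eq_zero_iff_mem.2 (Ideal.mem_span_singleton'.2 ⟨y i, ?_⟩)
    simp [mul_comm]

/-- counting superlattices of the standard lattice -/
noncomputable def E3 (n k : ℕ) [NeZero n] (hk : k ≠ 0) :
    {T : AddSubgroup (Fin n → O ⧸ Ideal.span {(k:O)}) // IsSub T ∧ Nat.card T ^ n = k} ≃
    {M : YS (stdL O K n) // ri (stdL O K n) M.1 ^ n = k} where
  toFun T := by
    have hr : (stdL O K n).toAddSubgroup.relIndex (ofJ (stdi O K n) (stdf O n k) k T.1) = Nat.card T.1 := by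
      rw [← stdi_range]
      exact relIndex_ofJ _ _ _ (stdi_inj n) (stdf_surj n k) (stdf_ker n k) (divis _ k hk).1 (divis _ k hk).2 _
    refine ⟨⟨{ ofJ (stdi O K n) (stdf O n k) k T.1 with smul_mem' := ?_ }, ?_, ?_⟩, ?_⟩
    · intro c x hx
      obtain ⟨p, h1, h2⟩ := mem_ofJ.1 hx
      refine mem_ofJ.2 ⟨c • p, ?_, ?_⟩
      · have := T.2.1 (Ideal.Quotient.mk _ c) _ h1
        convert this using 1
        ext i
        simp [stdf]
      · rw [smul_comm, ← h2]
        ext i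
        simp [stdi, Algebra.smul_def]
    · have := range_le_ofJ (stdi O K n) (stdf O n k) k (stdf_ker n k) T.1
      rw [stdi_range] at this
      exact this
    · intro h
      have h : (stdL O K n).toAddSubgroup.relIndex (ofJ (stdi O K n) (stdf O n k) k T.1) = 0 := h
      rw [hr] at h
      have := T.2.2
      rw [h, zero_pow (NeZero.ne n)] at this
      exact hk this.symm
    · have : (stdL O K n).toAddSubgroup.relIndex (ofJ (stdi O K n) (stdf O n k) k T.1) ^ n = k := by
        rw [hr]; exact T.2.2
      exact this
  invFun M := by
    have h2 : ∀ l ∈ M.1.1.toAddSubgroup, k • l ∈ (stdi O K n).range := by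
      intro l hl
      rw [stdi_range]
      have := nsmul_mem_of_ri (A := stdL O K n) hl
      obtain ⟨d, hd⟩ := dvd_pow_self (ri (stdL O K n) M.1.1) (NeZero.ne n)
      rw [M.2] at hd
      rw [hd, mul_comm, mul_smul]
      exact AddSubgroup.nsmul_mem _ this _
    have h1 : (stdi O K n).range ≤ M.1.1.toAddSubgroup := by
      rw [stdi_range]; exact M.1.2.1
    refine ⟨toJ (stdi O K n) (stdf O n k) k M.1.1.toAddSubgroup, ?_, ?_⟩
    · intro a x hx
      obtain ⟨p, ⟨l, hl, e⟩, rfl⟩ := mem_toJ.1 hx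
      obtain ⟨c, rfl⟩ := Ideal.Quotient.mk_surjective a
      refine mem_toJ.2 ⟨c • p, ⟨c • l, M.1.1.smul_mem c hl, ?_⟩, ?_⟩
      · rw [smul_comm, e]
        ext i
        simp [stdi, Algebra.smul_def]
      · ext i
        simp [stdf]
    · have := relIndex_ofJ _ _ _ (stdi_inj (O := O) (K := K) n) (stdf_surj n k) (stdf_ker n k) (divis _ k hk).1 (divis _ k hk).2 (toJ (stdi O K n) (stdf O n k) k M.1.1.toAddSubgroup)
      rw [← this, ofJ_toJ _ _ _ (stdf_ker n k) (divis _ k hk).1 _ h1 h2, stdi_range]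
      exact M.2
  left_inv T := Subtype.ext (toJ_ofJ (stdi O K n) (stdf O n k) k (stdi_inj n) (stdf_surj n k) (divis _ k hk).2 T.1)
  right_inv M := by
    have h2 : ∀ l ∈ M.1.1.toAddSubgroup, k • l ∈ (stdi O K n).range := by
      intro l hl
      rw [stdi_range]
      have := nsmul_mem_of_ri (A := stdL O K n) hl
      obtain ⟨d, hd⟩ := dvd_pow_self (ri (stdL O K n) M.1.1) (NeZero.ne n)
      rw [M.2] at hd
      rw [hd, mul_comm, mul_smul]
      exact AddSubgroup.nsmul_mem _ this _
    have h1 : (stdi O K n).range ≤ M.1.1.toAddSubgroup := by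
      rw [stdi_range]; exact M.1.2.1
    apply Subtype.ext
    apply Subtype.ext
    apply Submodule.toAddSubgroup_injective
    exact ofJ_toJ (stdi O K n) (stdf O n k) k (stdf_ker n k) (divis _ k hk).1 _ h1 h2

/-- left ideals of matrix rings -/
def E2 {R : Type*} [CommRing R] (n k : ℕ) [NeZero n] :
    {J : AddSubgroup (Matrix (Fin n) (Fin n) R) // IsLeftId J ∧ Nat.card J = k} ≃ {T : AddSubgroup (Fin n → R) // IsSub T ∧ Nat.card T ^ n = k} where
  toFun J := ⟨rowOf J.1, isSub_rowOf J.2.1, by rw [← card_rowsIn, rowsIn_rowOf J.2.1]; exact J.2.2⟩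
  invFun T := ⟨rowsIn T.1, isLeftId_rowsIn T.2.1, by rw [card_rowsIn]; exact T.2.2⟩
  left_inv J := Subtype.ext (rowsIn_rowOf J.2.1)
  right_inv T := Subtype.ext (rowOf_rowsIn T.1)

variable {D I : Type*} [DivisionRing D] [CharZero D] [Fintype I] [DecidableEq I] (S : LD D I)

/-- left superlattices and left ideals -/
noncomputable def E1 {Q : Type*} [Ring Q] (k : ℕ) (hk : k ≠ 0) (f : S.Λ →+ Q) (hf : Function.Surjective f)
    (hker : ∀ x, f x = 0 ↔ ∃ y, k • y = x) (hmul : ∀ x y z : S.Λ, (z : D) = x * y → f z = f x * f y) :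
    {L : S.X // S.idx L = k} ≃ {J : AddSubgroup Q // (∀ a x, x ∈ J → a * x ∈ J) ∧ Nat.card J = k} where
  toFun L := by
    have h2 : ∀ l ∈ L.1.1, k • l ∈ S.Λ.subtype.range := by
      intro l hl
      rw [AddSubgroup.range_subtype, ← L.2]
      exact S.idx_smul_mem L.1 hl
    have h1 : S.Λ.subtype.range ≤ L.1.1 := by
      rw [AddSubgroup.range_subtype]; exact L.1.2.le
    refine ⟨toJ S.Λ.subtype f k L.1.1, ?_, ?_⟩
    · intro a x hx
      obtain ⟨p, ⟨l, hl, e⟩, rfl⟩ := mem_toJ.1 hx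
      obtain ⟨c, rfl⟩ := hf a
      have hl' := L.1.2.mul _ c.2 _ hl
      refine mem_toJ.2 ⟨⟨c * p, S.mul_memΛ c.2 p.2⟩, ⟨c * l, hl', ?_⟩, ?_⟩
      · rw [← mul_smul_comm, e]; rfl
      · exact hmul _ _ _ rfl
    · have := relIndex_ofJ S.Λ.subtype f k Subtype.val_injective hf hker (divis _ k hk).1 (divis _ k hk).2 (toJ S.Λ.subtype f k L.1.1)
      rw [← this, ofJ_toJ _ _ _ hker (divis _ k hk).1 _ h1 h2, AddSubgroup.range_subtype]
      exact L.2
  invFun J := by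
    have hr : S.Λ.relIndex (ofJ S.Λ.subtype f k J.1) = Nat.card J.1 := by
      have := relIndex_ofJ S.Λ.subtype f k Subtype.val_injective hf hker (divis _ k hk).1 (divis _ k hk).2 J.1
      rwa [AddSubgroup.range_subtype] at this
    refine ⟨⟨ofJ S.Λ.subtype f k J.1, ?_, ?_, ?_⟩, ?_⟩
    · have := range_le_ofJ S.Λ.subtype f k hker J.1
      rwa [AddSubgroup.range_subtype] at this
    · intro x hx l hl
      obtain ⟨p, h1, h2⟩ := mem_ofJ.1 hl
      refine mem_ofJ.2 ⟨⟨x * p, S.mul_memΛ hx p.2⟩, ?_, ?_⟩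
      · rw [hmul ⟨x, hx⟩ p _ rfl]
        exact J.2.1 _ _ h1
      · rw [← mul_smul_comm, ← h2]; rfl
    · rw [hr, J.2.2]; exact hk
    · exact hr.trans J.2.2
  left_inv L := by
    have h2 : ∀ l ∈ L.1.1, k • l ∈ S.Λ.subtype.range := by
      intro l hl
      rw [AddSubgroup.range_subtype, ← L.2]
      exact S.idx_smul_mem L.1 hl
    have h1 : S.Λ.subtype.range ≤ L.1.1 := by
      rw [AddSubgroup.range_subtype]; exact L.1.2.le
    exact Subtype.ext (Subtype.ext (ofJ_toJ _ _ _ hker (divis _ k hk).1 _ h1 h2))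
  right_inv J := Subtype.ext (toJ_ofJ _ _ _ Subtype.val_injective hf (divis _ k hk).2 _)

theorem zX_eq_Yz (n : ℕ) [NeZero n]
    (hf : ∀ k : ℕ, k ≠ 0 → ∃ f : S.Λ →+ Matrix (Fin n) (Fin n) (O ⧸ Ideal.span {(k:O)}), Function.Surjective f ∧
      (∀ x, f x = 0 ↔ ∃ y, k • y = x) ∧ (∀ x y z : S.Λ, (z : D) = x * y → f z = f x * f y)) (s : ℝ) :
    S.zX s = Yz (stdL O K n) (n * s) := by
  unfold LD.zX Yz
  rw [← (Equiv.sigmaFiberEquiv (fun L : S.X => S.idx L)).tsum_eq,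
    ← (Equiv.sigmaFiberEquiv (fun M : YS (stdL O K n) => ri (stdL O K n) M.1 ^ n)).tsum_eq, ENNReal.tsum_sigma', ENNReal.tsum_sigma']
  refine tsum_congr fun k => ?_
  by_cases hk : k = 0
  · subst hk
    haveI : IsEmpty {L : S.X // S.idx L = 0} := ⟨fun L => (S.idx_pos L.1).ne' L.2⟩
    haveI : IsEmpty {M : YS (stdL O K n) // ri (stdL O K n) M.1 ^ n = 0} := ⟨fun M => M.1.2.2 (pow_eq_zero_iff (NeZero.ne n) |>.1 M.2)⟩
    rw [tsum_empty, tsum_empty]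
  obtain ⟨f, h1, h2, h3⟩ := hf k hk
  rw [← (((E1 S k hk f h1 h2 h3).trans (E2 n k)).trans (E3 (K := K) n k hk)).tsum_eq]
  refine tsum_congr fun L => ?_
  set M := (((E1 S k hk f h1 h2 h3).trans (E2 n k)).trans (E3 (K := K) n k hk)) L
  change ENNReal.ofReal (S.idx L.1) ^ (-s) = ENNReal.ofReal (ri (stdL O K n) M.1.1) ^ (-(n * s))
  have e1 := M.2
  have e2 : S.idx L.1 = ri (stdL O K n) M.1.1 ^ n := L.2.trans e1.symm
  rw [e2, Nat.cast_pow, ENNReal.ofReal_pow (by positivity), ← ENNReal.rpow_natCast, ← ENNReal.rpow_mul]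
  congr 1; ring

end final
end ABHN
end part11

section part12
namespace ABHN
open IsDedekindDomain

section indep
variable {k M R E : Type*} [Field k] [Field M] [Algebra k M] [Ring R] [Algebra k R] [Ring E] [Nontrivial E] [Algebra M E]

lemma simple_indep [Algebra.IsCentral k R] [IsSimpleRing R] (φ : R →+* E)
    (hφ : ∀ a : k, φ (algebraMap k R a) = algebraMap M E (algebraMap k M a)) (r : ℕ) :
    ∀ (c : Fin r → M), LinearIndependent k c → ∀ d : Fin r → R, ∑ i, c i • φ (d i) = 0 → ∀ i, d i = 0 := by
  induction r with
  | zero => intro c hc d h i; exact i.elim0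
  | succ r ih =>
    intro c hc d h
    have hc' : LinearIndependent k (fun i : Fin r => c i.succ) := hc.comp _ (Fin.succ_injective r)
    suffices h0 : d 0 = 0 by
      intro i
      refine Fin.cases h0 (fun j => ?_) i
      refine ih _ hc' (fun i => d i.succ) ?_ j
      rw [Fin.sum_univ_succ, h0] at h
      simpa using h
    by_contra hne
    let J : TwoSidedIdeal R := TwoSidedIdeal.mk' {x | ∃ e : Fin r → R, c 0 • φ x + ∑ i : Fin r, c i.succ • φ (e i) = 0}
      ⟨fun _ => 0, by simp⟩
      (by
        rintro x y ⟨e, he⟩ ⟨e', he'⟩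
        refine ⟨fun i => e i + e' i, ?_⟩
        have := congrArg₂ (· + ·) he he'
        simp only [add_zero] at this
        rw [← this]
        simp only [map_add, smul_add, Finset.sum_add_distrib]; abel)
      (by
        rintro x ⟨e, he⟩
        refine ⟨fun i => - e i, ?_⟩
        have := congrArg (fun z => -z) he
        simp only [neg_zero] at this
        rw [← this]
        simp only [map_neg, smul_neg, Finset.sum_neg_distrib, neg_add])
      (by
        rintro x y ⟨e, he⟩
        refine ⟨fun i => x * e i, ?_⟩
        have := congrArg (fun z => φ x * z) he
        simp only [mul_zero] at this
        rw [← this]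
        simp only [map_mul, mul_add, Finset.mul_sum, mul_smul_comm])
      (by
        rintro x y ⟨e, he⟩
        refine ⟨fun i => e i * y, ?_⟩
        have := congrArg (fun z => z * φ y) he
        simp only [zero_mul] at this
        rw [← this]
        simp only [map_mul, add_mul, Finset.sum_mul, smul_mul_assoc])
    have hJ : d 0 ∈ J := by
      refine (TwoSidedIdeal.mem_mk' _ _ _ _ _ _ _).2 ⟨fun i => d i.succ, ?_⟩
      rwa [Fin.sum_univ_succ] at h
    have hJ1 : (1 : R) ∈ J := by
      rcases eq_bot_or_eq_top J with h | h
      · rw [h] at hJ; exact absurd ((TwoSidedIdeal.mem_bot R).1 hJ) hne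
      · rw [h]; trivial
    obtain ⟨e, he⟩ := (TwoSidedIdeal.mem_mk' _ _ _ _ _ _ _).1 hJ1
    rw [map_one] at he
    have hcomm : ∀ x i, x * e i - e i * x = 0 := by
      intro x
      refine ih _ hc' (fun i => x * e i - e i * x) ?_
      have h1 := congrArg (fun z => φ x * z - z * φ x) he
      simp only [mul_zero, zero_mul, sub_zero] at h1
      rw [← h1]
      simp only [map_sub, map_mul, smul_sub, Finset.sum_sub_distrib, mul_add, add_mul, Finset.mul_sum, Finset.sum_mul, mul_smul_comm, smul_mul_assoc,
        mul_one, one_mul]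
      abel
    have hcen : ∀ i, ∃ a : k, algebraMap k R a = e i := by
      intro i
      have : e i ∈ Subalgebra.center k R := Subalgebra.mem_center_iff.2 fun x => sub_eq_zero.1 (hcomm x i)
      rw [Algebra.IsCentral.center_eq_bot] at this
      exact Algebra.mem_bot.1 this
    choose a ha using hcen
    have h2 : algebraMap M E (c 0 + ∑ i : Fin r, algebraMap k M (a i) * c i.succ) = 0 := by
      rw [← he, map_add, map_sum, Algebra.algebraMap_eq_smul_one]
      congr 1
      refine Finset.sum_congr rfl fun i _ => ?_
      rw [← ha i, hφ, map_mul, Algebra.smul_def, Algebra.commutes]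
    have h3 : c 0 + ∑ i : Fin r, algebraMap k M (a i) * c i.succ = 0 := by
      rw [← map_zero (algebraMap M E)] at h2
      exact (algebraMap M E).injective h2
    have h4 := Fintype.linearIndependent_iff.1 hc (Fin.cons 1 a) (by
      rw [Fin.sum_univ_succ]
      simpa [Algebra.smul_def] using h3) 0
    simp at h4

lemma indep_map [Algebra.IsCentral k R] [IsSimpleRing R] (φ : R →+* E)
    (hφ : ∀ a : k, φ (algebraMap k R a) = algebraMap M E (algebraMap k M a)) {ι : Type*} (d : ι → R) (hd : LinearIndependent k d) :
    LinearIndependent M (fun i => φ (d i)) := by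
  classical
  rw [linearIndependent_iff']
  intro s g hg
  let U : Submodule k M := Submodule.span k (s.image g : Set M)
  haveI : FiniteDimensional k U := FiniteDimensional.span_finset k _
  let b := Module.finBasis k U
  have hgU : ∀ i ∈ s, g i ∈ U := fun i hi => Submodule.subset_span (by simpa using ⟨i, hi, rfl⟩)
  let a : ι → Fin (Module.finrank k U) → k := fun i j => if h : i ∈ s then b.repr ⟨g i, hgU i h⟩ j else 0
  have hg' : ∀ i ∈ s, g i = ∑ j, algebraMap k M (a i j) * (b j : M) := by
    intro i hi
    have := congrArg Subtype.val (b.sum_repr ⟨g i, hgU i hi⟩)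
    refine (show g i = _ from this.symm).trans ?_
    rw [AddSubmonoidClass.coe_finset_sum]
    refine Finset.sum_congr rfl fun j _ => ?_
    simp only [a, hi, dif_pos, Submodule.coe_smul, Algebra.smul_def]
  have key := simple_indep φ hφ _ (fun j => (b j : M)) (by
    have := b.linearIndependent.map' U.subtype (Submodule.ker_subtype U)
    exact this) (fun j => ∑ i ∈ s, a i j • d i) (by
      rw [← hg]
      have : ∀ i ∈ s, g i • φ (d i) = ∑ j, (b j : M) • φ (a i j • d i) := by
        intro i hi
        rw [hg' i hi, Finset.sum_smul]
        refine Finset.sum_congr rfl fun j _ => ?_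
        rw [Algebra.smul_def (a i j), map_mul, hφ, mul_comm, mul_smul, Algebra.smul_def (algebraMap k M (a i j))]
      rw [Finset.sum_congr rfl this, Finset.sum_comm]
      refine Finset.sum_congr rfl fun j _ => ?_
      rw [map_sum, Finset.smul_sum])
  intro i hi
  rw [hg' i hi]
  refine Finset.sum_eq_zero fun j _ => ?_
  rw [linearIndependent_iff'.1 hd s (fun i => a i j) (key j) i hi, map_zero, zero_mul]
end indep

section red
variable {O K : Type*} [CommRing O] [IsDedekindDomain O] [Field K] [Algebra O K] [IsFractionRing O K]

lemma val_alg (v : HeightOneSpectrum O) (r : O) : Valued.v (algebraMap O (v.adicCompletion K) r) = v.intValuation r := by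
  rw [← HeightOneSpectrum.valuation_of_algebraMap (K := K), ← HeightOneSpectrum.valuedAdicCompletion_eq_valuation']
  rw [IsScalarTower.algebraMap_apply O K (v.adicCompletion K)]; rfl

lemma approx_int (v : HeightOneSpectrum O) (a : v.adicCompletion K) (ha : Valued.v a ≤ 1) (m : O) (hm : m ≠ 0) :
    ∃ r : O, Valued.v (a - algebraMap O _ r) ≤ v.intValuation m := by
  have hm0 : v.intValuation m ≠ 0 := v.intValuation_ne_zero m hm
  have hopen : IsOpen {y : v.adicCompletion K | Valued.v (a - y) ≤ v.intValuation m} := by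
    set c : v.adicCompletion K := algebraMap O _ m with hc
    have hcv : Valued.v c = v.intValuation m := val_alg v m
    have h1 : IsOpen {z : v.adicCompletion K | Valued.v z ≤ 1} := Valued.isOpen_integer (v.adicCompletion K)
    have hcont : Continuous (fun y : v.adicCompletion K => (a - y) * c⁻¹) :=
      (continuous_const.sub continuous_id).mul continuous_const
    have h2 := h1.preimage hcont
    convert h2 using 1
    ext y
    simp only [Set.mem_setOf_eq, Set.mem_preimage, map_mul, map_inv₀, hcv]
    rw [← div_eq_mul_inv, div_le_one₀ (zero_lt_iff.2 hm0)]
  obtain ⟨x, hx⟩ := (HeightOneSpectrum.denseRange_algebraMap (K := K) v).exists_mem_open hopen ⟨a, by simp⟩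
  have hx : Valued.v (a - algebraMap K _ x) ≤ v.intValuation m := hx
  have hx1 : v.valuation K x ≤ 1 := by
    rw [← HeightOneSpectrum.valuedAdicCompletion_eq_valuation']
    have e : ((x : K) : v.adicCompletion K) = a - (a - algebraMap K _ x) := by rw [sub_sub_cancel]; rfl
    rw [e]
    refine (Valuation.map_sub _ _ _).trans (max_le ha (hx.trans (v.intValuation_le_one m)))
  obtain ⟨r, hr⟩ := v.exists_valuation_sub_lt_of_integer hx1 (Units.mk0 _ hm0)
  refine ⟨r, ?_⟩
  have e : a - algebraMap O _ r = (a - algebraMap K _ x) - (((algebraMap O K r - x : K)) : v.adicCompletion K) := by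
    have : (((algebraMap O K r - x : K)) : v.adicCompletion K) = algebraMap K _ (algebraMap O K r) - algebraMap K _ x := by
      rw [← map_sub]; rfl
    rw [this, ← IsScalarTower.algebraMap_apply O K (v.adicCompletion K)]; abel
  rw [e]
  refine (Valuation.map_sub _ _ _).trans (max_le hx ?_)
  rw [HeightOneSpectrum.valuedAdicCompletion_eq_valuation']
  exact hr.le

lemma crt (m : O) (hm : m ≠ 0) (a : ∀ v : HeightOneSpectrum O, v.adicCompletion K) (ha : ∀ v, Valued.v (a v) ≤ 1) :
    ∃ r : O, ∀ v, Valued.v (a v - algebraMap O _ r) ≤ v.intValuation m := by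
  classical
  have hfin : {v : HeightOneSpectrum O | v.asIdeal ∣ Ideal.span {m}}.Finite := Ideal.finite_factors (by simpa using hm)
  choose r hr using fun v => approx_int v (a v) (ha v) m hm
  obtain ⟨y, hy⟩ := IsDedekindDomain.exists_forall_sub_mem_ideal (s := hfin.toFinset) (fun v => v.asIdeal)
    (fun v => multiplicity v.asIdeal (Ideal.span {m})) (fun v _ => v.prime) (fun v _ w _ h h' => h (HeightOneSpectrum.ext h')) (fun v => r v.1)
  refine ⟨y, fun v => ?_⟩
  by_cases hv : v.asIdeal ∣ Ideal.span {m}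
  · have h1 := hy v (by simpa using hv)
    rw [← HeightOneSpectrum.intValuation_le_pow_iff_mem, ← v.intValuation_eq_exp_neg_multiplicity hm] at h1
    have e : a v - algebraMap O _ y = (a v - algebraMap O _ (r v)) - algebraMap O _ (y - r v) := by rw [map_sub]; abel
    rw [e]
    refine (Valuation.map_sub _ _ _).trans (max_le (hr v) ?_)
    rw [val_alg]; exact h1
  · have h1 : v.intValuation m = 1 := by
      refine le_antisymm (v.intValuation_le_one m) (not_lt.1 fun h => hv ?_)
      exact (v.intValuation_lt_one_iff_dvd m).1 h
    rw [h1]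
    refine (Valuation.map_sub _ _ _).trans (max_le (ha v) ?_)
    rw [val_alg]; exact v.intValuation_le_one y

lemma dvd_of_val (m r : O) (hm : m ≠ 0) (h : ∀ v : HeightOneSpectrum O, v.intValuation r ≤ v.intValuation m) : m ∣ r := by
  have hm' : algebraMap O (FractionRing O) m ≠ 0 := by
    simpa using hm
  obtain ⟨c, hc⟩ := HeightOneSpectrum.mem_integers_of_valuation_le_one (R := O) (FractionRing O) (algebraMap O _ r / algebraMap O _ m) (by
    intro v
    rw [map_div₀, HeightOneSpectrum.valuation_of_algebraMap, HeightOneSpectrum.valuation_of_algebraMap]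
    exact div_le_one_of_le₀ (h v) zero_le')
  refine ⟨c, ?_⟩
  apply IsFractionRing.injective O (FractionRing O)
  rw [map_mul, hc, mul_div_cancel₀ _ hm']

noncomputable def red (K : Type*) [Field K] [Algebra O K] [IsFractionRing O K] (m : O) (hm : m ≠ 0)
    (a : ∀ v : HeightOneSpectrum O, v.adicCompletionIntegers K) : O ⧸ Ideal.span {m} :=
  Ideal.Quotient.mk _ (crt m hm (fun v => (a v : v.adicCompletion K)) (fun v => (a v).2)).choose

lemma red_eq (m : O) (hm : m ≠ 0) (a : ∀ v : HeightOneSpectrum O, v.adicCompletionIntegers K) (r : O) :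
    red K m hm a = Ideal.Quotient.mk _ r ↔ ∀ v, Valued.v ((a v : v.adicCompletion K) - algebraMap O _ r) ≤ v.intValuation m := by
  have hs := (crt m hm (fun v => (a v : v.adicCompletion K)) (fun v => (a v).2)).choose_spec
  unfold red
  set r0 := (crt m hm (fun v => (a v : v.adicCompletion K)) (fun v => (a v).2)).choose
  rw [Ideal.Quotient.eq, Ideal.mem_span_singleton]
  constructor
  · rintro ⟨c, hc⟩ v
    have e : (a v : v.adicCompletion K) - algebraMap O _ r = (a v - algebraMap O _ r0) + algebraMap O _ (r0 - r) := by rw [map_sub]; abel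
    rw [e, hc]
    refine (Valuation.map_add _ _ _).trans (max_le (hs v) ?_)
    rw [val_alg, map_mul]
    exact mul_le_of_le_one_right' (v.intValuation_le_one c)
  · intro h
    refine dvd_of_val m _ hm fun v => ?_
    rw [← val_alg (K := K)]
    have e : algebraMap O (v.adicCompletion K) (r0 - r) = (a v - algebraMap O _ r) - (a v - algebraMap O _ r0) := by rw [map_sub]; abel
    rw [e]
    exact (Valuation.map_sub _ _ _).trans (max_le (h v) (hs v))

lemma red_spec (m : O) (hm : m ≠ 0) (a : ∀ v : HeightOneSpectrum O, v.adicCompletionIntegers K) :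
    ∃ r : O, red K m hm a = Ideal.Quotient.mk _ r ∧ ∀ v, Valued.v ((a v : v.adicCompletion K) - algebraMap O _ r) ≤ v.intValuation m := by
  obtain ⟨r, hr⟩ := Ideal.Quotient.mk_surjective (red K m hm a)
  exact ⟨r, hr.symm, (red_eq m hm a r).1 hr.symm⟩

/-- reduction as a ring homomorphism -/
noncomputable def redHom (K : Type*) [Field K] [Algebra O K] [IsFractionRing O K] (m : O) (hm : m ≠ 0) :
    (∀ v : HeightOneSpectrum O, v.adicCompletionIntegers K) →+* O ⧸ Ideal.span {m} where
  toFun := red K m hm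
  map_one' := by
    rw [← map_one (Ideal.Quotient.mk _), red_eq]
    intro v; simp
  map_zero' := by
    rw [← map_zero (Ideal.Quotient.mk _), red_eq]
    intro v; simp
  map_add' a b := by
    obtain ⟨r, hr, h⟩ := red_spec m hm a
    obtain ⟨r', hr', h'⟩ := red_spec m hm b
    rw [hr, hr', ← map_add, red_eq]
    intro v
    have e : ((a + b) v : v.adicCompletion K) - algebraMap O _ (r + r') = (a v - algebraMap O _ r) + (b v - algebraMap O _ r') := by
      rw [map_add]; simp; abel
    rw [e]
    exact (Valuation.map_add _ _ _).trans (max_le (h v) (h' v))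
  map_mul' a b := by
    obtain ⟨r, hr, h⟩ := red_spec m hm a
    obtain ⟨r', hr', h'⟩ := red_spec m hm b
    rw [hr, hr', ← map_mul, red_eq]
    intro v
    have e : ((a * b) v : v.adicCompletion K) - algebraMap O _ (r * r') = (a v - algebraMap O _ r) * b v + algebraMap O _ r * (b v - algebraMap O _ r') := by
      rw [map_mul]; simp; ring
    rw [e]
    refine (Valuation.map_add _ _ _).trans (max_le ?_ ?_)
    · rw [map_mul]
      exact (mul_le_of_le_one_right' (b v).2).trans (h v)
    · rw [map_mul]
      refine (mul_le_of_le_one_left' ?_).trans (h' v)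
      rw [val_alg]; exact v.intValuation_le_one r

lemma redHom_eq_zero (m : O) (hm : m ≠ 0) (a : ∀ v : HeightOneSpectrum O, v.adicCompletionIntegers K) :
    redHom K m hm a = 0 ↔ ∀ v, Valued.v (a v : v.adicCompletion K) ≤ v.intValuation m := by
  change red K m hm a = 0 ↔ _
  rw [← map_zero (Ideal.Quotient.mk _), red_eq]
  simp
end red
end ABHN
end part12

section part13
namespace ABHN
open IsDedekindDomain Module NumberField

section conj
variable {R F : Type*} [CommRing R] [IsDomain R] [IsPrincipalIdealRing R] [Field F] [Algebra R F] [IsFractionRing R F]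

/-- conjugating an order into integral matrices -/
lemma exists_conj {n : ℕ} {ι : Type*} [Finite ι] (u : ι → Matrix (Fin n) (Fin n) F)
    (hu : ∀ i j, u i * u j ∈ Submodule.span R (Set.range u)) :
    ∃ e : Matrix (Fin n) (Fin n) F ≃ₐ[F] Matrix (Fin n) (Fin n) F, ∀ i a b, e (u i) a b ∈ Set.range (algebraMap R F) := by
  classical
  let S : Set (Fin n → F) := Set.range (fun j : Fin n => (Pi.single j 1 : Fin n → F)) ∪ Set.range (fun p : ι × Fin n => (u p.1).mulVec (Pi.single p.2 1))
  let L : Submodule R (Fin n → F) := Submodule.span R S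
  have hSfin : S.Finite := (Set.finite_range _).union (Set.finite_range _)
  haveI : Submodule.IsLattice F L := by
    constructor
    · exact Submodule.fg_span hSfin
    · rw [eq_top_iff]
      have h1 : Submodule.span F (Set.range (Pi.basisFun F (Fin n))) ≤ Submodule.span F (L : Set (Fin n → F)) := by
        refine Submodule.span_mono ?_
        rintro _ ⟨j, rfl⟩
        exact Submodule.subset_span (Or.inl ⟨j, by simp⟩)
      rwa [(Pi.basisFun F (Fin n)).span_eq] at h1
  have hst : ∀ i, ∀ x ∈ L, (u i).mulVec x ∈ L := by
    intro i x hx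
    have hl : ∀ (A : Matrix (Fin n) (Fin n) F), A ∈ Submodule.span R (Set.range u) → ∀ j : Fin n, A.mulVec (Pi.single j 1) ∈ L := by
      intro A hA j
      induction hA using Submodule.span_induction with
      | mem x h => obtain ⟨k, rfl⟩ := h; exact Submodule.subset_span (Or.inr ⟨(k, j), rfl⟩)
      | zero => rw [Matrix.zero_mulVec]; exact L.zero_mem
      | add x y _ _ h1 h2 => rw [Matrix.add_mulVec]; exact L.add_mem h1 h2
      | smul r x _ h => rw [Matrix.smul_mulVec]; exact L.smul_mem r h
    induction hx using Submodule.span_induction with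
    | mem x h =>
      rcases h with ⟨j, rfl⟩ | ⟨⟨k, j⟩, rfl⟩
      · exact Submodule.subset_span (Or.inr ⟨(i, j), rfl⟩)
      · simp only [Matrix.mulVec_mulVec]
        exact hl _ (hu i k) j
    | zero => simp
    | add x y _ _ h1 h2 => rw [Matrix.mulVec_add]; exact L.add_mem h1 h2
    | smul r x _ h => rw [Matrix.mulVec_smul]; exact L.smul_mem r h
  haveI : Module.IsTorsionFree R F := by infer_instance
  have hr : finrank R L = n := by rw [Submodule.IsLattice.finrank_of_pi F L]; simp
  haveI : Module.Free R L := Submodule.IsLattice.free F L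
  let β0 : Basis (Fin n) R L := finBasisOfFinrankEq R L hr
  let β : Basis (Fin n) F (Fin n → F) := β0.extendOfIsLattice F
  refine ⟨Matrix.toLinAlgEquiv'.trans (LinearMap.toMatrixAlgEquiv β), ?_⟩
  intro i a b
  have h1 : (Matrix.toLinAlgEquiv'.trans (LinearMap.toMatrixAlgEquiv β)) (u i) a b = β.repr ((u i).mulVec (β b)) a := by
    rw [AlgEquiv.trans_apply, LinearMap.toMatrixAlgEquiv_apply, Matrix.toLinAlgEquiv'_apply]
  rw [h1]
  have h2 : β b ∈ L := by rw [show β b = (β0 b : Fin n → F) from Basis.extendOfIsLattice_apply F β0 b]; exact (β0 b).2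
  have h3 := hst i _ h2
  refine ⟨β0.repr ⟨_, h3⟩ a, ?_⟩
  have h4 : (u i).mulVec (β b) = ∑ c, algebraMap R F (β0.repr ⟨_, h3⟩ c) • β c := by
    have := congrArg Subtype.val (β0.sum_repr ⟨_, h3⟩)
    refine (show (u i).mulVec (β b) = _ from this.symm).trans ?_
    rw [AddSubmonoidClass.coe_finset_sum]
    refine Finset.sum_congr rfl fun c _ => ?_
    rw [Submodule.coe_smul, algebraMap_smul, show β c = (β0 c : Fin n → F) from Basis.extendOfIsLattice_apply F β0 c]
  refine Eq.trans ?_ (congrArg (fun z => β.repr z a) h4).symm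
  exact (congrFun (β.repr_sum_self (fun c => algebraMap R F (β0.repr ⟨_, h3⟩ c))) a).symm
end conj

section basis
variable {O K D : Type*} [CommRing O] [IsDomain O] [Field K] [Algebra O K] [IsFractionRing O K] [Ring D] [Algebra K D] [Algebra O D] [IsScalarTower O K D]

lemma exists_int_basis {ι : Type*} [Fintype ι] (b : Basis ι K D) :
    ∃ b' : Basis ι K D, ∀ i j, b' i * b' j ∈ Submodule.span O (Set.range b') := by
  classical
  obtain ⟨N, hN⟩ := IsLocalization.exist_integer_multiples_of_finite (nonZeroDivisors O)
    (fun p : ι × ι × ι => b.repr (b p.1 * b p.2.1) p.2.2)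
  have hN0 : algebraMap O K N ≠ 0 := by
    simpa using nonZeroDivisors.ne_zero N.2
  let w : ι → Kˣ := fun _ => Units.mk0 _ hN0
  refine ⟨b.unitsSMul w, fun i j => ?_⟩
  have hw : ∀ i, b.unitsSMul w i = algebraMap O K N • b i := fun i => by
    rw [Basis.unitsSMul_apply]; rfl
  rw [hw, hw, smul_mul_smul_comm, ← b.sum_repr (b i * b j), Finset.smul_sum]
  refine Submodule.sum_mem _ fun k _ => ?_
  obtain ⟨c, hc⟩ := hN (i, j, k)
  have : (algebraMap O K N * algebraMap O K N) • b.repr (b i * b j) k • b k = c • b.unitsSMul w k := by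
    rw [hw, ← algebraMap_smul K c, hc, smul_smul, smul_smul, Algebra.smul_def (N : O)]
    congr 1
    ring
  rw [this]
  exact Submodule.smul_mem _ _ (Submodule.subset_span ⟨k, rfl⟩)
end basis

section trace
variable {k M D : Type*} [Field k] [Field M] [Algebra k M] [Ring D] [Algebra k D] [Algebra.IsCentral k D] [IsSimpleRing D]

lemma trace_split {n : ℕ} [NeZero n] [FiniteDimensional k D] (hd : finrank k D = n ^ 2) (φ : D →ₐ[k] Matrix (Fin n) (Fin n) M) (x : D) :
    algebraMap k M (LinearMap.trace k D (LinearMap.mulLeft k x)) = n * (φ x).trace := by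
  classical
  let b := finBasisOfFinrankEq k D hd
  have hli : LinearIndependent M (fun i => φ (b i)) := indep_map (k := k) (M := M) (φ : D →+* Matrix (Fin n) (Fin n) M)
    (fun a => by
      change φ (algebraMap k D a) = _
      rw [AlgHom.commutes, IsScalarTower.algebraMap_apply k M (Matrix (Fin n) (Fin n) M)]) b b.linearIndependent
  let β := basisOfLinearIndependentOfCardEqFinrank hli (by simp [Module.finrank_matrix, sq])
  have hβ : ∀ i, β i = φ (b i) := fun i => by simp [β]
  have h1 : LinearMap.trace M (Matrix (Fin n) (Fin n) M) (LinearMap.mulLeft M (φ x)) = algebraMap k M (LinearMap.trace k D (LinearMap.mulLeft k x)) := by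
    rw [LinearMap.trace_eq_matrix_trace _ b, LinearMap.trace_eq_matrix_trace _ β, Matrix.trace, Matrix.trace, map_sum]
    refine Finset.sum_congr rfl fun i _ => ?_
    simp only [Matrix.diag, LinearMap.toMatrix_apply, LinearMap.mulLeft_apply]
    have : φ x * β i = ∑ j, algebraMap k M (b.repr (x * b i) j) • β j := by
      simp only [hβ]
      rw [← map_mul, ← b.sum_repr (x * b i), map_sum]
      refine Finset.sum_congr rfl fun j _ => ?_
      rw [map_smul, algebraMap_smul, b.sum_repr]
    rw [this]
    exact congrFun (β.repr_sum_self _) i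
  rw [← h1, LinearMap.trace_eq_matrix_trace _ (Matrix.stdBasis M (Fin n) (Fin n)), Matrix.trace, Fintype.sum_prod_type]
  simp only [Matrix.diag, LinearMap.toMatrix_apply, LinearMap.mulLeft_apply]
  have : ∀ i j, ((Matrix.stdBasis M (Fin n) (Fin n)).repr (φ x * (Matrix.stdBasis M (Fin n) (Fin n)) (i, j))) (i, j) = φ x i i := by
    intro i j
    rw [Matrix.stdBasis_eq_single]
    change (φ x * Matrix.single i j (1 : M) : Matrix (Fin n) (Fin n) M) i j = _
    simp
  simp [this, Matrix.trace, Finset.mul_sum]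
end trace
end ABHN
end part13

section part14
namespace ABHN
open IsDedekindDomain Module NumberField

section ord
variable {K D : Type*} [Field K] [NumberField K] [DivisionRing D] [CharZero D] [Algebra K D] {n : ℕ}

/-- the order of elements that are integral at all places -/
def Ord (φ : ∀ v : HeightOneSpectrum (𝓞 K), D →ₐ[K] Matrix (Fin n) (Fin n) (v.adicCompletion K)) : Subring D where
  carrier := {x | ∀ v i j, φ v x i j ∈ v.adicCompletionIntegers K}
  one_mem' v i j := by
    rw [map_one, Matrix.one_apply]; split_ifs
    · exact one_mem _
    · exact zero_mem _
  zero_mem' v i j := by rw [map_zero]; exact zero_mem _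
  add_mem' h1 h2 v i j := by rw [map_add]; exact add_mem (h1 v i j) (h2 v i j)
  neg_mem' h1 v i j := by rw [map_neg]; exact neg_mem (h1 v i j)
  mul_mem' h1 h2 v i j := by
    rw [map_mul, Matrix.mul_apply]
    exact sum_mem fun k _ => mul_mem (h1 v i k) (h2 v k j)

variable [Algebra (𝓞 K) D] [IsScalarTower (𝓞 K) K D]
variable (φ : ∀ v : HeightOneSpectrum (𝓞 K), D →ₐ[K] Matrix (Fin n) (Fin n) (v.adicCompletion K))

lemma ord_smul (r : 𝓞 K) {x : D} (hx : x ∈ Ord φ) : r • x ∈ Ord φ := by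
  intro v i j
  rw [← algebraMap_smul K r x, map_smul, Matrix.smul_apply, Algebra.smul_def]
  refine mul_mem ?_ (hx v i j)
  rw [← IsScalarTower.algebraMap_apply (𝓞 K) K (v.adicCompletion K)]
  change Valued.v (algebraMap (𝓞 K) (v.adicCompletion K) r) ≤ 1
  exact (val_alg (K := K) v r).le.trans (v.intValuation_le_one r)

lemma trace_int [NeZero n] [FiniteDimensional K D] [Algebra.IsCentral K D] (hd : finrank K D = n ^ 2) {x : D} (hx : x ∈ Ord φ) :
    ∃ c : 𝓞 K, algebraMap (𝓞 K) K c = LinearMap.trace K D (LinearMap.mulLeft K x) := by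
  refine HeightOneSpectrum.mem_integers_of_valuation_le_one K _ fun v => ?_
  rw [← HeightOneSpectrum.valuedAdicCompletion_eq_valuation']
  change Valued.v (algebraMap K (v.adicCompletion K) (LinearMap.trace K D (LinearMap.mulLeft K x))) ≤ 1
  rw [trace_split hd (φ v) x]
  change _ ∈ v.adicCompletionIntegers K
  exact mul_mem (natCast_mem _ n) (sum_mem fun i _ => hx v i i)

/-- the order as a module over the integers of `K` -/
def OrdS : Submodule (𝓞 K) D where
  carrier := Ord φ
  zero_mem' := (Ord φ).zero_mem
  add_mem' := (Ord φ).add_mem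
  smul_mem' r x hx := ord_smul φ r hx

lemma ordS_fg [NeZero n] [FiniteDimensional K D] [Algebra.IsCentral K D] (hd : finrank K D = n ^ 2) {ι : Type*} [Fintype ι] (b : Basis ι K D)
    (hb : ∀ i, b i ∈ Ord φ) : (OrdS φ).FG := by
  classical
  let B : LinearMap.BilinForm K D := (LinearMap.mul K D).compr₂ ((LinearMap.trace K D) ∘ₗ (LinearMap.mul K D))
  have hBv : ∀ x y, B x y = LinearMap.trace K D (LinearMap.mulLeft K (x * y)) := fun x y => rfl
  have h1 : LinearMap.trace K D (LinearMap.mulLeft K (1 : D)) ≠ 0 := by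
    rw [LinearMap.mulLeft_one]
    change LinearMap.trace K D 1 ≠ 0
    rw [LinearMap.trace_one, hd]
    exact_mod_cast pow_ne_zero 2 (NeZero.ne n)
  have hB : B.Nondegenerate := by
    constructor
    · intro x h
      by_contra hx
      have := h x⁻¹
      rw [hBv, mul_inv_cancel₀ hx] at this
      exact h1 this
    · intro x h
      by_contra hx
      have := h x⁻¹
      rw [hBv, inv_mul_cancel₀ hx] at this
      exact h1 this
  have hle : OrdS φ ≤ B.dualSubmodule (Submodule.span (𝓞 K) (Set.range b)) := by
    intro x hx y hy
    have hy' : y ∈ OrdS φ := (Submodule.span_le (p := OrdS φ)).2 (by rintro _ ⟨i, rfl⟩; exact hb i) hy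
    obtain ⟨c, hc⟩ := trace_int φ hd ((Ord φ).mul_mem hx hy')
    rw [hBv, ← hc]
    exact Submodule.mem_one.2 ⟨c, rfl⟩
  rw [LinearMap.BilinForm.dualSubmodule_span_of_basis B hB] at hle
  haveI : Module.Finite (𝓞 K) (Submodule.span (𝓞 K) (Set.range (B.dualBasis hB b))) :=
    Module.Finite.span_of_finite _ (Set.finite_range _)
  haveI : IsNoetherian (𝓞 K) (Submodule.span (𝓞 K) (Set.range (B.dualBasis hB b))) := isNoetherian_of_isNoetherianRing_of_finite _ _
  haveI : IsNoetherian (𝓞 K) (OrdS φ) := isNoetherian_of_le hle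
  exact Module.Finite.iff_fg.1 inferInstance

lemma ord_lattice [NeZero n] [FiniteDimensional K D] [Algebra.IsCentral K D] (hd : finrank K D = n ^ 2) {ι : Type*} [Fintype ι] (b : Basis ι K D)
    (hb : ∀ i, b i ∈ Ord φ) {I : Type*} [Fintype I] (hI : Fintype.card I = finrank ℚ D) :
    ∃ β : Basis I ℚ D, AddSubgroup.closure (Set.range β) = (Ord φ).toAddSubgroup := by
  classical
  let L : Submodule ℤ D := AddSubgroup.toIntSubmodule (Ord φ).toAddSubgroup
  have hmem : ∀ x, x ∈ L ↔ x ∈ Ord φ := fun x => Iff.rfl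
  haveI : Module.Finite (𝓞 K) (OrdS φ) := Module.Finite.iff_fg.2 (ordS_fg φ hd b hb)
  have hfin : Module.Finite ℤ (OrdS φ) := Module.Finite.trans (𝓞 K) (OrdS φ)
  have hLfg : L.FG := by
    rw [← Module.Finite.iff_fg]
    let e : OrdS φ →+ L := ⟨⟨fun x => ⟨x.1, x.2⟩, rfl⟩, fun _ _ => rfl⟩
    exact Module.Finite.of_surjective e.toIntLinearMap (fun x => ⟨⟨x.1, x.2⟩, rfl⟩)
  haveI : Submodule.IsLattice ℚ L := by
    refine ⟨hLfg, eq_top_iff.2 fun x _ => ?_⟩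
    obtain ⟨N, hN⟩ := IsLocalization.exist_integer_multiples_of_finite (Algebra.algebraMapSubmonoid (𝓞 K) (nonZeroDivisors ℤ)) (fun i => b.repr x i)
    obtain ⟨N, m, hm, rfl⟩ := N
    have hm0 : m ≠ 0 := nonZeroDivisors.ne_zero hm
    have hx : (m : ℚ) • x ∈ L := by
      have : (m : ℚ) • x = ∑ i, ((m : K) * b.repr x i) • b i := by
        conv_lhs => rw [← b.sum_repr x]
        rw [Finset.smul_sum]
        refine Finset.sum_congr rfl fun i _ => ?_
        rw [mul_smul, Int.cast_smul_eq_zsmul, Int.cast_smul_eq_zsmul]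
      rw [this]
      refine Submodule.sum_mem _ fun i _ => ?_
      obtain ⟨c, hc⟩ := hN i
      have e : ((m : K) * b.repr x i) • b i = c • b i := by
        rw [← algebraMap_smul K c, hc]
        congr 1
      rw [e]
      exact ord_smul φ c (hb i)
    have := (Submodule.span ℚ (L : Set D)).smul_mem ((m : ℚ)⁻¹) (Submodule.subset_span hx)
    rwa [smul_smul, inv_mul_cancel₀ (by exact_mod_cast hm0), one_smul] at this
  haveI : Module.Free ℤ L := Submodule.IsLattice.free ℚ L
  let β0 := Module.Free.chooseBasis ℤ L
  let β1 : Basis _ ℚ D := β0.extendOfIsLattice ℚ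
  have hc : Fintype.card (Module.Free.ChooseBasisIndex ℤ L) = Fintype.card I := by
    rw [hI, Module.finrank_eq_card_basis β1]
  refine ⟨β1.reindex (Fintype.equivOfCardEq hc), ?_⟩
  rw [Basis.range_reindex]
  have h1 : Set.range β1 = L.subtype '' (Set.range β0) := by
    rw [← Set.range_comp]
    congr 1
    ext i
    exact Basis.extendOfIsLattice_apply ℚ β0 i
  have h2 : Submodule.span ℤ (Set.range β1) = L := by
    rw [h1, Submodule.span_image, β0.span_eq, Submodule.map_top, Submodule.range_subtype]
  rw [← Submodule.span_int_eq_addSubgroupClosure, h2]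
  rfl

/-- reduction of the order -/
noncomputable def ordRed (k : ℕ) (hk : (k : 𝓞 K) ≠ 0) : Ord φ →+* Matrix (Fin n) (Fin n) (𝓞 K ⧸ Ideal.span {(k : 𝓞 K)}) where
  toFun x := Matrix.of fun i j => redHom K (k : 𝓞 K) hk (fun v => ⟨φ v x i j, x.2 v i j⟩)
  map_one' := by
    ext i j
    rw [Matrix.of_apply, Matrix.one_apply]
    split_ifs with h
    · rw [← map_one (redHom K (k : 𝓞 K) hk)]
      congr 1; ext v; simp [h]
    · rw [← map_zero (redHom K (k : 𝓞 K) hk)]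
      congr 1; ext v; simp [h]
  map_zero' := by
    ext i j
    rw [Matrix.of_apply, Matrix.zero_apply, ← map_zero (redHom K (k : 𝓞 K) hk)]
    congr 1; ext v; simp
  map_add' x y := by
    ext i j
    rw [Matrix.of_apply, Matrix.add_apply, Matrix.of_apply, Matrix.of_apply, ← map_add]
    congr 1; ext v; simp
  map_mul' x y := by
    ext i j
    rw [Matrix.of_apply, Matrix.mul_apply]
    simp only [Matrix.of_apply, ← map_mul]
    rw [← map_sum]
    congr 1; ext v
    simp [Matrix.mul_apply]

lemma ordRed_ker (k : ℕ) (hk : (k : 𝓞 K) ≠ 0) (x : Ord φ) : ordRed φ k hk x = 0 ↔ ∃ y : Ord φ, k • y = x := by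
  have hk0 : k ≠ 0 := by rintro rfl; simp at hk
  have hval : ∀ v : HeightOneSpectrum (𝓞 K), v.intValuation (k : 𝓞 K) ≠ 0 := fun v => v.intValuation_ne_zero _ hk
  constructor
  · intro h
    refine ⟨⟨(k : D)⁻¹ * x, fun v i j => ?_⟩, Subtype.ext ?_⟩
    · have h1 := (redHom_eq_zero (K := K) (k : 𝓞 K) hk _).1 (congrFun (congrFun h i) j) v
      have h2 : φ v ((k : D)⁻¹ * x) = (k : K)⁻¹ • φ v x := by
        rw [← map_smul, Algebra.smul_def]; simp
      rw [h2, Matrix.smul_apply, Algebra.smul_def]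
      change Valued.v (algebraMap K (v.adicCompletion K) (k : K)⁻¹ * φ v x i j) ≤ 1
      have h3 : Valued.v (algebraMap K (v.adicCompletion K) (k : K)⁻¹) = (v.intValuation (k : 𝓞 K))⁻¹ := by
        rw [map_inv₀, map_inv₀, ← val_alg (K := K)]; simp
      rw [map_mul, h3, mul_comm, ← div_eq_mul_inv, div_le_one₀ (zero_lt_iff.2 (hval v))]
      exact h1
    · change k • ((k : D)⁻¹ * x) = x
      rw [nsmul_eq_mul, ← mul_assoc, mul_inv_cancel₀ (by exact_mod_cast hk0), one_mul]
  · rintro ⟨y, rfl⟩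
    ext i j
    rw [map_nsmul, Matrix.smul_apply, Matrix.zero_apply, nsmul_eq_mul]
    have : ((k : ℕ) : 𝓞 K ⧸ Ideal.span {(k : 𝓞 K)}) = 0 := by
      rw [← map_natCast (Ideal.Quotient.mk (Ideal.span {(k : 𝓞 K)})), Ideal.Quotient.eq_zero_iff_mem]
      exact Ideal.mem_span_singleton_self _
    rw [this, zero_mul]

lemma ordRed_surj [FiniteDimensional K D] (hd : finrank K D = n ^ 2) {I : Type*} [Fintype I]
    (β : Basis I ℚ D) (hβ : AddSubgroup.closure (Set.range β) = (Ord φ).toAddSubgroup) (k : ℕ) (hk : (k : 𝓞 K) ≠ 0) :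
    Function.Surjective (ordRed φ k hk) := by
  classical
  have hk0 : k ≠ 0 := by rintro rfl; simp at hk
  haveI : NeZero k := ⟨hk0⟩
  have hmem : ∀ x : D, x ∈ Ord φ ↔ x ∈ Submodule.span ℤ (Set.range β) := by
    intro x
    rw [← Submodule.mem_toAddSubgroup, Submodule.span_int_eq_addSubgroupClosure, hβ]; rfl
  let b0 : Basis I ℤ (Submodule.span ℤ (Set.range β)) := Basis.span (β.linearIndependent.restrict_scalars (by
    intro a b h; simpa using h))
  let e : Ord φ ≃+ Submodule.span ℤ (Set.range β) :=
    ⟨⟨fun x => ⟨x.1, (hmem _).1 x.2⟩, fun x => ⟨x.1, (hmem _).2 x.2⟩, fun _ => rfl, fun _ => rfl⟩, fun _ _ => rfl⟩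
  let g : Ord φ →+ (I → ZMod k) :=
    { toFun := fun x i => ((b0.repr (e x) i : ℤ) : ZMod k)
      map_zero' := by ext; simp
      map_add' := by intro x y; ext; simp }
  have hg : Function.Surjective g := by
    intro c
    refine ⟨e.symm (b0.equivFun.symm fun i => ((c i).val : ℤ)), ?_⟩
    ext i
    change ((b0.repr (e (e.symm _)) i : ℤ) : ZMod k) = c i
    rw [AddEquiv.apply_symm_apply, ← Basis.equivFun_apply, LinearEquiv.apply_symm_apply]
    simp
  have hgk : ∀ x, g x = 0 ↔ ordRed φ k hk x = 0 := by
    intro x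
    rw [ordRed_ker]
    constructor
    · intro h
      have h1 : ∀ i, ∃ c : ℤ, b0.repr (e x) i = k * c := fun i => by
        have := congrFun h i
        exact (ZMod.intCast_zmod_eq_zero_iff_dvd _ _).1 this
      choose c hc using h1
      refine ⟨e.symm (b0.equivFun.symm c), e.injective ?_⟩
      rw [map_nsmul, AddEquiv.apply_symm_apply]
      apply b0.equivFun.injective
      rw [map_nsmul, LinearEquiv.apply_symm_apply]
      ext i
      rw [Pi.smul_apply, Basis.equivFun_apply, hc, nsmul_eq_mul]
    · rintro ⟨y, rfl⟩
      rw [map_nsmul]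
      ext i
      simp
  have hker : g.ker = (ordRed φ k hk).toAddMonoidHom.ker := by
    ext x; exact hgk x
  have hcard : Nat.card (𝓞 K ⧸ Ideal.span {(k : 𝓞 K)}) = k ^ finrank ℚ K := by
    rw [← RingOfIntegers.rank K, ← Ideal.absNorm_span_natCast]; rfl
  have hfin : Finite (𝓞 K ⧸ Ideal.span {(k : 𝓞 K)}) := Nat.finite_of_card_ne_zero (by rw [hcard]; positivity)
  have h1 : Nat.card (ordRed φ k hk).toAddMonoidHom.range = Nat.card (I → ZMod k) := by
    rw [Nat.card_congr (QuotientAddGroup.quotientKerEquivRange _).symm.toEquiv, ← hker]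
    exact Nat.card_congr (QuotientAddGroup.quotientKerEquivOfSurjective g hg).toEquiv
  have h2 : Nat.card (I → ZMod k) = Nat.card (Matrix (Fin n) (Fin n) (𝓞 K ⧸ Ideal.span {(k : 𝓞 K)})) := by
    have e1 : Nat.card (Matrix (Fin n) (Fin n) (𝓞 K ⧸ Ideal.span {(k : 𝓞 K)})) = ((k ^ finrank ℚ K) ^ n) ^ n := by
      change Nat.card (Fin n → Fin n → _) = _
      rw [Nat.card_fun, Nat.card_fun, hcard]; simp
    have e2 : Nat.card I = finrank ℚ K * n ^ 2 := by
      rw [Nat.card_eq_fintype_card, ← Module.finrank_eq_card_basis β, ← hd, Module.finrank_mul_finrank]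
    rw [e1, Nat.card_fun, Nat.card_zmod, e2, ← pow_mul, ← pow_mul, sq]
    try rw [mul_assoc]
  have h3 := AddSubgroup.eq_top_of_card_eq _ (h1.trans h2)
  exact AddMonoidHom.range_eq_top.1 h3
end ord

/-- Existence of good orders. -/
theorem exists_order {K D : Type*} [Field K] [NumberField K] [DivisionRing D] [CharZero D] [Algebra K D] [FiniteDimensional K D]
    [Algebra.IsCentral K D] (n : ℕ) [NeZero n] (hd : finrank K D = n ^ 2)
    (h : ∀ v : HeightOneSpectrum (𝓞 K), Nonempty (D →ₐ[K] Matrix (Fin n) (Fin n) (v.adicCompletion K)))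
    {I : Type*} [Fintype I] (hI : Fintype.card I = finrank ℚ D) :
    ∃ β : Basis I ℚ D, (1 : D) ∈ AddSubgroup.closure (Set.range β) ∧ (∀ i j, β i * β j ∈ AddSubgroup.closure (Set.range β)) ∧
      ∀ k : ℕ, k ≠ 0 → ∃ f : AddSubgroup.closure (Set.range β) →+ Matrix (Fin n) (Fin n) (𝓞 K ⧸ Ideal.span {(k : 𝓞 K)}),
        Function.Surjective f ∧ (∀ x, f x = 0 ↔ ∃ y, k • y = x) ∧
        (∀ x y z : AddSubgroup.closure (Set.range β), (z : D) = x * y → f z = f x * f y) := by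
  classical
  letI : Algebra (𝓞 K) D := Algebra.compHom D (algebraMap (𝓞 K) K)
  haveI : IsScalarTower (𝓞 K) K D := IsScalarTower.of_algebraMap_eq fun _ => rfl
  let φ0 := fun v => (h v).some
  obtain ⟨b, hb⟩ := exists_int_basis (O := 𝓞 K) (finBasisOfFinrankEq K D hd)
  have hsp : ∀ v (x : D), x ∈ Submodule.span (𝓞 K) (Set.range b) →
      φ0 v x ∈ Submodule.span (v.adicCompletionIntegers K) (Set.range fun i => φ0 v (b i)) := by
    intro v x hx
    induction hx using Submodule.span_induction with
    | mem x h => obtain ⟨i, rfl⟩ := h; exact Submodule.subset_span ⟨i, rfl⟩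
    | zero => rw [map_zero]; exact zero_mem _
    | add x y _ _ h1 h2 => rw [map_add]; exact add_mem h1 h2
    | smul r x _ h =>
      have hr : algebraMap K (v.adicCompletion K) (algebraMap (𝓞 K) K r) ∈ v.adicCompletionIntegers K :=
        (val_alg (K := K) v r).le.trans (v.intValuation_le_one r)
      have : φ0 v (r • x) = (⟨_, hr⟩ : v.adicCompletionIntegers K) • φ0 v x := by
        rw [← algebraMap_smul K r x, map_smul, ← algebraMap_smul (v.adicCompletion K) (algebraMap (𝓞 K) K r)]
        rfl
      rw [this]
      exact Submodule.smul_mem _ _ h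
  have hconj := fun v => exists_conj (R := v.adicCompletionIntegers K) (fun i => φ0 v (b i)) (fun i j => by
    rw [← map_mul]; exact hsp v _ (hb i j))
  choose e he using hconj
  let φ : ∀ v : HeightOneSpectrum (𝓞 K), D →ₐ[K] Matrix (Fin n) (Fin n) (v.adicCompletion K) := fun v =>
    ((e v).restrictScalars K).toAlgHom.comp (φ0 v)
  have hbφ : ∀ i, b i ∈ Ord φ := by
    intro i v a c
    obtain ⟨r, hr⟩ := he v i a c
    change e v (φ0 v (b i)) a c ∈ _
    rw [← hr]
    exact r.2
  obtain ⟨β, hβ⟩ := ord_lattice φ hd b hbφ hI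
  refine ⟨β, ?_, ?_, ?_⟩
  · rw [hβ]; exact (Ord φ).one_mem
  · intro i j
    have hm : ∀ i, β i ∈ (Ord φ).toAddSubgroup := fun i => by
      rw [← hβ]; exact AddSubgroup.subset_closure ⟨i, rfl⟩
    rw [hβ]; exact (Ord φ).mul_mem (hm i) (hm j)
  · intro k hk
    have hk' : (k : 𝓞 K) ≠ 0 := by exact_mod_cast hk
    let ε : AddSubgroup.closure (Set.range β) ≃+ Ord φ :=
      ⟨⟨fun x => ⟨x.1, (le_of_eq hβ) x.2⟩, fun x => ⟨x.1, (le_of_eq hβ.symm) x.2⟩, fun _ => rfl, fun _ => rfl⟩, fun _ _ => rfl⟩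
    refine ⟨(ordRed φ k hk').toAddMonoidHom.comp ε.toAddMonoidHom, ?_, ?_, ?_⟩
    · exact (ordRed_surj φ hd β hβ k hk').comp ε.surjective
    · intro x
      change ordRed φ k hk' (ε x) = 0 ↔ _
      rw [ordRed_ker]
      constructor
      · rintro ⟨y, hy⟩
        refine ⟨ε.symm y, ε.injective ?_⟩
        rw [map_nsmul, AddEquiv.apply_symm_apply, hy]
      · rintro ⟨y, rfl⟩
        exact ⟨ε y, by rw [map_nsmul]⟩
    · intro x y z hz
      change ordRed φ k hk' (ε z) = ordRed φ k hk' (ε x) * ordRed φ k hk' (ε y)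
      rw [← map_mul]
      congr 1
      exact Subtype.ext hz
end ABHN
end part14

section part15
namespace ABHN
open MeasureTheory Measure Set
open scoped ENNReal

theorem lint_fin_prod {n : ℕ} {E : Fin n → Type*} [∀ i, MeasurableSpace (E i)]
    (μ : ∀ i, Measure (E i)) [∀ i, SigmaFinite (μ i)] (f : ∀ i, E i → ℝ≥0∞)
    (hf : ∀ i, Measurable (f i)) :
    ∫⁻ x : ∀ i, E i, ∏ i, f i (x i) ∂(Measure.pi μ) = ∏ i, ∫⁻ x, f i x ∂(μ i) := by
  induction n with
  | zero => simp [Measure.pi_of_empty]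
  | succ n ih =>
    have h := (measurePreserving_piFinSuccAbove μ 0).symm
    rw [← h.lintegral_comp_emb (MeasurableEquiv.measurableEmbedding _)]
    simp_rw [MeasurableEquiv.piFinSuccAbove_symm_apply, Fin.insertNthEquiv, Equiv.coe_fn_mk,
      Fin.prod_univ_succ, Fin.insertNth_zero]
    simp only [Fin.zero_succAbove, cast_eq, Fin.cons_zero, Fin.cons_succ]
    have h2 := lintegral_prod_mul (μ := μ 0) (ν := Measure.pi fun j : Fin n => μ (Fin.succ j))
      (f := f 0) (g := fun x => ∏ i : Fin n, f i.succ (x i)) (hf 0).aemeasurable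
      (Finset.measurable_prod _ fun i _ => (hf _).comp (measurable_pi_apply i)).aemeasurable
    rw [ih _ _ (fun i => hf _)] at h2
    exact h2

theorem lint_pi_prod {ι : Type*} [Fintype ι] {E : ι → Type*} [∀ i, MeasurableSpace (E i)]
    (μ : ∀ i, Measure (E i)) [∀ i, SigmaFinite (μ i)] (f : ∀ i, E i → ℝ≥0∞)
    (hf : ∀ i, Measurable (f i)) :
    ∫⁻ x : ∀ i, E i, ∏ i, f i (x i) ∂(Measure.pi μ) = ∏ i, ∫⁻ x, f i x ∂(μ i) := by
  let e := (Fintype.equivFin ι).symm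
  rw [← (measurePreserving_piCongrLeft _ e).lintegral_comp_emb (MeasurableEquiv.measurableEmbedding _)]
  simp_rw [← e.prod_comp, MeasurableEquiv.coe_piCongrLeft, Equiv.piCongrLeft_apply_apply]
  exact lint_fin_prod (fun i => μ (e i)) (fun i => f (e i)) (fun i => hf _)

theorem pi_withDens {ι : Type*} [Fintype ι] {E : ι → Type*} [∀ i, MeasurableSpace (E i)]
    (μ : ∀ i, Measure (E i)) [∀ i, SigmaFinite (μ i)] (f : ∀ i, E i → ℝ≥0∞)
    (hf : ∀ i, Measurable (f i)) (hs : ∀ i, SigmaFinite ((μ i).withDensity (f i))) :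
    Measure.pi (fun i => (μ i).withDensity (f i)) =
      (Measure.pi μ).withDensity (fun x => ∏ i, f i (x i)) := by
  apply Measure.pi_eq
  intro s hs
  rw [withDensity_apply _ (MeasurableSet.univ_pi hs), ← lintegral_indicator (MeasurableSet.univ_pi hs)]
  have : (fun x : ∀ i, E i => (univ.pi s).indicator (fun x => ∏ i, f i (x i)) x) =
      fun x => ∏ i, (s i).indicator (f i) (x i) := by
    funext x
    by_cases hx : x ∈ univ.pi s
    · rw [indicator_of_mem hx]
      exact Finset.prod_congr rfl fun i _ => (indicator_of_mem (hx i (mem_univ _)) _).symm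
    · rw [indicator_of_notMem hx]
      simp only [mem_univ_pi, not_forall] at hx
      obtain ⟨i, hi⟩ := hx
      exact (Finset.prod_eq_zero (Finset.mem_univ i) (indicator_of_notMem hi _)).symm
  rw [this, lint_pi_prod μ _ fun i => (hf i).indicator (hs i)]
  exact Finset.prod_congr rfl fun i _ => by
    rw [withDensity_apply _ (hs i), lintegral_indicator (hs i)]

theorem polar {E : Type*} [NormedAddCommGroup E] [NormedSpace ℝ E] [FiniteDimensional ℝ E]
    [MeasurableSpace E] [BorelSpace E] [Nontrivial E] (μ : Measure E) [μ.IsAddHaarMeasure] :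
    ∃ c : ℝ≥0∞, c ≠ 0 ∧ c ≠ ∞ ∧ ∀ f : ℝ → ℝ≥0∞, Measurable f →
      ∫⁻ x, f ‖x‖ ∂μ = c * ∫⁻ r in Ioi (0:ℝ), ENNReal.ofReal (r ^ (Module.finrank ℝ E - 1)) * f r := by
  refine ⟨μ.toSphere univ, ?_, measure_ne_top _ _, fun f hf => ?_⟩
  · exact fun h => μ.toSphere_ne_zero (measure_univ_eq_zero.1 h)
  calc
    ∫⁻ x, f (‖x‖) ∂μ = ∫⁻ x : ({(0)}ᶜ : Set E), f (‖x.1‖) ∂(μ.comap (↑)) := by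
      rw [lintegral_subtype_comap (measurableSet_singleton _).compl fun x ↦ f (‖x‖),
        restrict_compl_singleton]
    _ = ∫⁻ x, f x.2 ∂μ.toSphere.prod (.volumeIoiPow (Module.finrank ℝ E - 1)) := by
      simpa using μ.measurePreserving_homeomorphUnitSphereProd.lintegral_comp_emb
        (Homeomorph.measurableEmbedding _) (f ∘ Subtype.val ∘ Prod.snd)
    _ = μ.toSphere univ * ∫⁻ x : Ioi (0 : ℝ), f x ∂.volumeIoiPow (Module.finrank ℝ E - 1) := by
      have := lintegral_prod_mul (μ := μ.toSphere) (ν := .volumeIoiPow (Module.finrank ℝ E - 1))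
        (f := fun _ => 1) (g := fun x => f x.1) aemeasurable_const (hf.comp measurable_subtype_coe).aemeasurable
      simpa using this
    _ = _ := by
      congr 1
      rw [Measure.volumeIoiPow]
      refine (lintegral_withDensity_eq_lintegral_mul _ (by fun_prop) (g := fun x : Ioi (0:ℝ) => f x) (hf.comp measurable_subtype_coe)).trans ?_
      exact lintegral_subtype_comap measurableSet_Ioi fun r => ENNReal.ofReal (r ^ (Module.finrank ℝ E - 1)) * f r
end ABHN
end part15

section part16
namespace ABHN
open MeasureTheory Measure Set
open scoped ENNReal Matrix

section loc
variable (𝕜 : Type*) [RCLike 𝕜]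

noncomputable def gd (z : 𝕜) : ℝ≥0∞ := ENNReal.ofReal (Real.exp (-Real.pi * ‖z‖ ^ 2))
noncomputable def hv : Measure 𝕜 := (stdOrthonormalBasis ℝ 𝕜).toBasis.addHaar
noncomputable def gm : Measure 𝕜 := (hv 𝕜).withDensity (gd 𝕜)
instance : (hv 𝕜).IsAddHaarMeasure := by unfold hv; infer_instance

theorem gd_meas : Measurable (gd 𝕜) := by unfold gd; fun_prop

instance : IsProbabilityMeasure (gm 𝕜) := by
  letI : MeasureSpace 𝕜 := measureSpaceOfInnerProductSpace
  have h0 : (volume : Measure 𝕜) = hv 𝕜 := rfl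
  have h := GaussianFourier.integral_rexp_neg_mul_sq_norm (V := 𝕜) Real.pi_pos
  rw [div_self Real.pi_ne_zero, Real.one_rpow] at h
  have hi : Integrable (fun v : 𝕜 => Real.exp (-Real.pi * ‖v‖ ^ 2)) := by
    by_contra hc
    rw [integral_undef hc] at h
    exact zero_ne_one h
  refine ⟨?_⟩
  rw [gm, withDensity_apply _ MeasurableSet.univ, setLIntegral_univ, ← h0]
  unfold gd
  rw [← ofReal_integral_eq_lintegral_ofReal hi (ae_of_all _ fun x => (Real.exp_pos _).le), h, ENNReal.ofReal_one]

variable {𝕜}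
noncomputable def gds {ι : Type*} [Fintype ι] (x : ι → 𝕜) : ℝ≥0∞ :=
  ENNReal.ofReal (Real.exp (-Real.pi * ∑ i, ‖x i‖ ^ 2))

theorem gds_eq {ι : Type*} [Fintype ι] (x : ι → 𝕜) : ∏ i, gd 𝕜 (x i) = gds x := by
  unfold gd gds
  rw [← ENNReal.ofReal_prod_of_nonneg (fun i _ => (Real.exp_pos _).le), ← Real.exp_sum, Finset.mul_sum]

theorem gds_meas {ι : Type*} [Fintype ι] : Measurable (gds (𝕜 := 𝕜) (ι := ι)) := by
  unfold gds; fun_prop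

theorem pi_gm {ι : Type*} [Fintype ι] : Measure.pi (fun _ : ι => gm 𝕜) =
    (Measure.pi (fun _ : ι => hv 𝕜)).withDensity gds := by
  have : ∀ i : ι, SigmaFinite ((hv 𝕜).withDensity (gd 𝕜)) := fun i => by
    change SigmaFinite (gm 𝕜); infer_instance
  have h := pi_withDens (fun _ : ι => hv 𝕜) (fun _ => gd 𝕜) (fun _ => gd_meas 𝕜) this
  refine Eq.trans h ?_
  simp_rw [gds_eq]

theorem gm_inv {ι : Type*} [Fintype ι] (L : (ι → 𝕜) ≃L[𝕜] (ι → 𝕜))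
    (hL : ∀ x, ∑ i, ‖L x i‖ ^ 2 = ∑ i, ‖x i‖ ^ 2) :
    MeasurePreserving L (Measure.pi fun _ : ι => gm 𝕜) (Measure.pi fun _ : ι => gm 𝕜) := by
  have hm : Measurable L := L.continuous.measurable
  refine ⟨hm, ?_⟩
  have : (Measure.map L (Measure.pi (fun _ : ι => hv 𝕜))).IsAddHaarMeasure :=
    L.isAddHaarMeasure_map _
  have hc := isAddLeftInvariant_eq_smul (Measure.map L (Measure.pi (fun _ : ι => hv 𝕜)))
    (Measure.pi (fun _ : ι => hv 𝕜))
  set c := (Measure.map L (Measure.pi (fun _ : ι => hv 𝕜))).addHaarScalarFactor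
    (Measure.pi (fun _ : ι => hv 𝕜))
  have key : Measure.map L (Measure.pi fun _ : ι => gm 𝕜) = c • Measure.pi fun _ : ι => gm 𝕜 := by
    ext s hs
    rw [Measure.map_apply hm hs, pi_gm, withDensity_apply _ (hm hs), Measure.smul_apply,
      withDensity_apply _ hs]
    have h1 : ∀ x, gds (L x) = gds x := fun x => by unfold gds; rw [hL]
    calc _ = ∫⁻ a in L ⁻¹' s, gds (L a) ∂(Measure.pi (fun _ : ι => hv 𝕜)) := by simp_rw [h1]
      _ = ∫⁻ a in s, gds a ∂(Measure.map L (Measure.pi (fun _ : ι => hv 𝕜))) := by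
          rw [setLIntegral_map hs gds_meas hm]
      _ = _ := by
          rw [hc, Measure.restrict_smul, lintegral_smul_measure]
  have hp : IsProbabilityMeasure (Measure.map L (Measure.pi fun _ : ι => gm 𝕜)) :=
    isProbabilityMeasure_map hm.aemeasurable
  have h1 := hp.measure_univ
  rw [key, Measure.smul_apply, measure_univ] at h1
  have hc1 : c = 1 := by
    rw [ENNReal.smul_def, smul_eq_mul, mul_one] at h1
    exact_mod_cast h1
  rw [key, hc1, one_smul]

noncomputable def l2 {ι : Type*} [Fintype ι] (x : ι → 𝕜) : ℝ := √(∑ i, ‖x i‖ ^ 2)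

noncomputable def hp (𝕜 : Type*) [RCLike 𝕜] (t : ℝ) : ℝ≥0∞ := ∫⁻ z, (ENNReal.ofReal ‖z‖) ^ t ∂(gm 𝕜)

theorem norm_moment (j : ℕ) : ∃ c : ℝ≥0∞, c ≠ 0 ∧ c ≠ ∞ ∧ ∀ t : ℝ, 
    ∫⁻ x : Fin (j+1) → 𝕜, (ENNReal.ofReal (l2 x)) ^ t ∂(Measure.pi fun _ => gm 𝕜) =
      c * hp 𝕜 (t + Module.finrank ℝ 𝕜 * j) := by
  obtain ⟨c1, h1, h1', H1⟩ := polar (hv 𝕜)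
  let e : (Fin (j+1) → 𝕜) ≃L[𝕜] EuclideanSpace 𝕜 (Fin (j+1)) := (EuclideanSpace.equiv (Fin (j+1)) 𝕜).symm
  have he : ∀ x, ‖e x‖ = l2 x := fun x => by
    rw [EuclideanSpace.norm_eq]; rfl
  letI : MeasurableSpace (EuclideanSpace 𝕜 (Fin (j+1))) := borel _
  haveI : BorelSpace (EuclideanSpace 𝕜 (Fin (j+1))) := ⟨rfl⟩
  have hm : Measurable e := e.continuous.measurable
  have : (Measure.map e (Measure.pi (fun _ : Fin (j+1) => hv 𝕜))).IsAddHaarMeasure :=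
    e.isAddHaarMeasure_map _
  obtain ⟨c2, h2, h2', H2⟩ := polar (Measure.map e (Measure.pi (fun _ : Fin (j+1) => hv 𝕜)))
  refine ⟨c2 * c1⁻¹, mul_ne_zero h2 (ENNReal.inv_ne_zero.2 h1'),
    ENNReal.mul_ne_top h2' (ENNReal.inv_ne_top.2 h1), fun t => ?_⟩
  have hg : ∀ t : ℝ, Measurable fun r : ℝ => ENNReal.ofReal r ^ t * ENNReal.ofReal (Real.exp (-Real.pi * r ^ 2)) := by
    intro t; fun_prop
  have A := (lintegral_map ((hg t).comp measurable_norm) hm).symm.trans (H2 _ (hg t))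
  simp only [Function.comp_def] at A
  have B := H1 _ (hg (t + Module.finrank ℝ 𝕜 * j))
  have A' : ∫⁻ x : Fin (j+1) → 𝕜, (ENNReal.ofReal (l2 x)) ^ t ∂(Measure.pi fun _ => gm 𝕜) =
    ∫⁻ (a : Fin (j + 1) → 𝕜), ENNReal.ofReal ‖e a‖ ^ t * ENNReal.ofReal (Real.exp (-Real.pi * ‖e a‖ ^ 2))
      ∂Measure.pi fun x => hv 𝕜 := by
    rw [pi_gm, lintegral_withDensity_eq_lintegral_mul _ gds_meas (by unfold l2; fun_prop)]
    refine lintegral_congr fun x => ?_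
    simp only [Pi.mul_apply]
    rw [he, mul_comm, gds, l2, Real.sq_sqrt (Finset.sum_nonneg fun i _ => sq_nonneg _)]
  have B' : hp 𝕜 (t + Module.finrank ℝ 𝕜 * j) = ∫⁻ (x : 𝕜), ENNReal.ofReal ‖x‖ ^ (t + Module.finrank ℝ 𝕜 * j) *
      ENNReal.ofReal (Real.exp (-Real.pi * ‖x‖ ^ 2)) ∂hv 𝕜 := by
    rw [hp, gm, lintegral_withDensity_eq_lintegral_mul _ (gd_meas 𝕜) (by fun_prop)]
    refine lintegral_congr fun x => ?_
    simp only [Pi.mul_apply]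
    rw [mul_comm, gd]
  rw [A', A, B', B, mul_assoc, ← mul_assoc c1⁻¹, ENNReal.inv_mul_cancel h1 h1', one_mul]
  congr 1
  refine setLIntegral_congr_fun measurableSet_Ioi fun r hr => ?_
  have hr' : (0:ℝ) < r := hr
  rw [← mul_assoc, ← mul_assoc]
  congr 1
  rw [ENNReal.ofReal_rpow_of_pos hr', ENNReal.ofReal_rpow_of_pos hr', ← ENNReal.ofReal_mul (by positivity),
    ← ENNReal.ofReal_mul (by positivity)]
  congr 1
  rw [← Real.rpow_natCast, ← Real.rpow_natCast, ← Real.rpow_add hr', ← Real.rpow_add hr']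
  congr 1
  have hd : Module.finrank ℝ (EuclideanSpace 𝕜 (Fin (j+1))) = (j+1) * Module.finrank ℝ 𝕜 := by
    have := Module.finrank_mul_finrank ℝ 𝕜 (EuclideanSpace 𝕜 (Fin (j+1)))
    rw [finrank_euclideanSpace_fin] at this
    rw [← this, mul_comm]
  have hpos : 0 < Module.finrank ℝ 𝕜 := Module.finrank_pos
  rw [hd, Nat.cast_sub (by nlinarith), Nat.cast_sub (by omega)]
  push_cast
  ring
end loc
end ABHN
end part16

section part17
namespace ABHN
open MeasureTheory Measure Set
open scoped ENNReal Matrix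

section rot
variable {𝕜 : Type*} [RCLike 𝕜]

theorem exists_rot {n : ℕ} (x : Fin (n+1) → 𝕜) : ∃ U : Matrix (Fin (n+1)) (Fin (n+1)) 𝕜,
    U * Uᴴ = 1 ∧ x ᵥ* U = Pi.single 0 ((l2 x : ℝ) : 𝕜) := by
  by_cases hx : l2 x = 0
  · refine ⟨1, by simp, ?_⟩
    have h0 : x = 0 := by
      funext i
      rw [l2, Real.sqrt_eq_zero (Finset.sum_nonneg fun i _ => sq_nonneg _),
        Finset.sum_eq_zero_iff_of_nonneg (fun i _ => sq_nonneg _)] at hx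
      simpa using hx i (Finset.mem_univ i)
    rw [hx, h0]; simp
  let E := EuclideanSpace 𝕜 (Fin (n+1))
  let y : E := WithLp.toLp 2 x
  have hy : ‖y‖ = l2 x := by rw [EuclideanSpace.norm_eq]; rfl
  let v : Fin (n+1) → E := fun _ => (((l2 x)⁻¹ : ℝ) : 𝕜) • y
  have hv1 : ‖v 0‖ = 1 := by
    simp only [v, norm_smul, hy, RCLike.norm_ofReal, abs_inv]
    rw [abs_of_nonneg (show 0 ≤ l2 x from Real.sqrt_nonneg _)]
    exact inv_mul_cancel₀ hx
  obtain ⟨b, hb⟩ := Orthonormal.exists_orthonormalBasis_extension_of_card_eq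
    (𝕜 := 𝕜) (E := E) (ι := Fin (n+1)) (by simp [E]) (v := v) (s := {0}) (by
      constructor
      · rintro ⟨i, rfl⟩; exact hv1
      · rintro ⟨i, rfl⟩ ⟨j, rfl⟩ h; exact absurd rfl h)
  have hb0 : b 0 = (((l2 x)⁻¹ : ℝ) : 𝕜) • y := hb 0 rfl
  refine ⟨Matrix.of fun i j => star (b j i), ?_, ?_⟩
  · rw [← mul_eq_one_comm]
    ext i j
    have := b.inner_eq_ite j i
    rw [PiLp.inner_apply] at this
    rw [Matrix.mul_apply, Matrix.one_apply]
    simp_rw [eq_comm (a := i)]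
    rw [← this]
    refine Finset.sum_congr rfl fun k _ => ?_
    simp [Matrix.conjTranspose_apply, RCLike.inner_apply, mul_comm]
  · funext j
    have hyb : y = ((l2 x : ℝ) : 𝕜) • b 0 := by
      rw [hb0, smul_smul, ← RCLike.ofReal_mul, mul_inv_cancel₀ hx]; simp
    have h1 : (x ᵥ* Matrix.of fun i j => star (b j i)) j = inner 𝕜 (b j) y := by
      rw [PiLp.inner_apply, Matrix.vecMul, dotProduct]
      refine Finset.sum_congr rfl fun k _ => ?_
      simp [RCLike.inner_apply, y]
    rw [h1, hyb, inner_smul_right, b.inner_eq_ite]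
    by_cases hj : j = 0
    · subst hj; simp
    · simp [hj]

theorem rot_norm {n : ℕ} (U : Matrix (Fin n) (Fin n) 𝕜) (hU : U * Uᴴ = 1) (x : Fin n → 𝕜) :
    ∑ i, ‖(x ᵥ* U) i‖ ^ 2 = ∑ i, ‖x i‖ ^ 2 := by
  have key : ∀ z : Fin n → 𝕜, ((∑ i, ‖z i‖ ^ 2 : ℝ) : 𝕜) = z ⬝ᵥ star z := fun z => by
    push_cast
    refine Finset.sum_congr rfl fun i _ => ?_
    rw [Pi.star_apply, RCLike.star_def, RCLike.mul_conj]
  have : ((∑ i, ‖(x ᵥ* U) i‖ ^ 2 : ℝ) : 𝕜) = ((∑ i, ‖x i‖ ^ 2 : ℝ) : 𝕜) := by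
    rw [key, key, Matrix.star_vecMul, Matrix.dotProduct_mulVec, Matrix.vecMul_vecMul, hU, Matrix.vecMul_one]
  exact_mod_cast this

theorem rot_det {n : ℕ} (U : Matrix (Fin n) (Fin n) 𝕜) (hU : U * Uᴴ = 1) : ‖U.det‖ = 1 := by
  have := congrArg Matrix.det hU
  rw [Matrix.det_mul, Matrix.det_conjTranspose, Matrix.det_one, RCLike.star_def, RCLike.mul_conj] at this
  have h : ‖U.det‖ ^ 2 = 1 := by exact_mod_cast this
  nlinarith [norm_nonneg U.det]

theorem rot_mp {n : ℕ} (U : Matrix (Fin n) (Fin n) 𝕜) (hU : U * Uᴴ = 1) :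
    MeasurePreserving (fun x : Fin n → 𝕜 => x ᵥ* U) (Measure.pi fun _ => gm 𝕜) (Measure.pi fun _ => gm 𝕜) := by
  have hU2 : Uᴴ * U = 1 := mul_eq_one_comm.1 hU
  let L : (Fin n → 𝕜) ≃ₗ[𝕜] (Fin n → 𝕜) := LinearEquiv.ofLinear (Matrix.vecMulLinear U) (Matrix.vecMulLinear Uᴴ)
    (LinearMap.ext fun z => by simp only [LinearMap.comp_apply, Matrix.vecMulLinear_apply, Matrix.vecMul_vecMul, hU2, Matrix.vecMul_one, LinearMap.id_apply])
    (LinearMap.ext fun z => by simp only [LinearMap.comp_apply, Matrix.vecMulLinear_apply, Matrix.vecMul_vecMul, hU, Matrix.vecMul_one, LinearMap.id_apply])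
  exact gm_inv L.toContinuousLinearEquiv (fun x => rot_norm U hU x)

noncomputable def H (𝕜 : Type*) [RCLike 𝕜] (n : ℕ) (t : ℝ) : ℝ≥0∞ :=
  ∫⁻ Y : Fin n → Fin n → 𝕜, (ENNReal.ofReal ‖(Matrix.of Y).det‖) ^ t ∂(Measure.pi fun _ => Measure.pi fun _ => gm 𝕜)

theorem tail_mp (n : ℕ) : MeasurePreserving (fun x : Fin (n+1) → 𝕜 => fun j : Fin n => x j.succ)
    (Measure.pi fun _ => gm 𝕜) (Measure.pi fun _ => gm 𝕜) := by
  have h := measurePreserving_piFinSuccAbove (fun _ : Fin (n+1) => gm 𝕜) 0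
  have h2 := (measurePreserving_snd (μ := gm 𝕜) (ν := Measure.pi fun _ : Fin n => gm 𝕜)).comp h
  exact h2

theorem det_cons_rot {n : ℕ} (x : Fin (n+1) → 𝕜) (U : Matrix (Fin (n+1)) (Fin (n+1)) 𝕜)
    (hU : U * Uᴴ = 1) (hx : x ᵥ* U = Pi.single 0 ((l2 x : ℝ) : 𝕜)) (Y : Fin n → Fin (n+1) → 𝕜) :
    ‖(Matrix.of (Fin.cons x Y : Fin (n+1) → Fin (n+1) → 𝕜)).det‖ =
      l2 x * ‖(Matrix.of fun (i j : Fin n) => (Y i ᵥ* U) j.succ).det‖ := by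
  have h1 : ‖(Matrix.of (Fin.cons x Y : Fin (n+1) → Fin (n+1) → 𝕜)).det‖ =
      ‖((Matrix.of (Fin.cons x Y : Fin (n+1) → Fin (n+1) → 𝕜)) * U).det‖ := by
    rw [Matrix.det_mul, norm_mul, rot_det U hU, mul_one]
  have h2 : ∀ i, ((Matrix.of (Fin.cons x Y : Fin (n+1) → Fin (n+1) → 𝕜)) * U) i =
     (Fin.cons x Y : Fin (n+1) → Fin (n+1) → 𝕜) i ᵥ* U := fun i => by
    rw [Matrix.mul_apply_eq_vecMul]; rfl
  rw [h1, Matrix.det_succ_row_zero, Fin.sum_univ_succ, Finset.sum_eq_zero, add_zero]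
  · rw [h2, Fin.cons_zero, hx]
    simp only [Fin.val_zero, pow_zero, one_mul, Pi.single_eq_same, norm_mul, RCLike.norm_ofReal]
    rw [abs_of_nonneg (show 0 ≤ l2 x from Real.sqrt_nonneg _)]
    congr 3
  · intro i _
    rw [h2, Fin.cons_zero, hx]
    simp

theorem H_succ (n : ℕ) : ∃ c : ℝ≥0∞, c ≠ 0 ∧ c ≠ ∞ ∧ ∀ t : ℝ, 0 < t →
    H 𝕜 (n+1) t = c * hp 𝕜 (t + Module.finrank ℝ 𝕜 * n) * H 𝕜 n t := by
  obtain ⟨c, h0, h1, hc⟩ := norm_moment (𝕜 := 𝕜) n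
  refine ⟨c, h0, h1, fun t ht => ?_⟩
  have hmp := (measurePreserving_piFinSuccAbove (fun _ : Fin (n+1) => (Measure.pi fun _ : Fin (n+1) => gm 𝕜)) 0).symm
  have hmeas : ∀ m, Measurable fun Y : Fin m → Fin m → 𝕜 => ENNReal.ofReal ‖(Matrix.of Y).det‖ ^ t := fun m => by
    have : Continuous fun Y : Fin m → Fin m → 𝕜 => (Matrix.of Y).det := by fun_prop
    exact (this.measurable.norm.ennreal_ofReal).pow_const t
  rw [H, ← hmp.lintegral_comp_emb (MeasurableEquiv.measurableEmbedding _), lintegral_prod]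
  swap
  · exact ((hmeas (n+1)).comp (MeasurableEquiv.measurable _)).aemeasurable
  have : ∀ x : Fin (n+1) → 𝕜, ∫⁻ Y : Fin n → Fin (n+1) → 𝕜,
      (ENNReal.ofReal ‖(Matrix.of ((MeasurableEquiv.piFinSuccAbove (fun _ : Fin (n+1) => Fin (n+1) → 𝕜) 0).symm (x, Y))).det‖) ^ t
       ∂(Measure.pi fun _ => Measure.pi fun _ => gm 𝕜) = ENNReal.ofReal (l2 x) ^ t * H 𝕜 n t := by
    intro x
    obtain ⟨U, hU, hx⟩ := exists_rot x
    have e1 : ∀ Y : Fin n → Fin (n+1) → 𝕜, (ENNReal.ofReal ‖(Matrix.of ((MeasurableEquiv.piFinSuccAbove (fun _ : Fin (n+1) => Fin (n+1) → 𝕜) 0).symm (x, Y))).det‖) ^ t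
      = ENNReal.ofReal (l2 x) ^ t * (ENNReal.ofReal ‖(Matrix.of fun (i j : Fin n) => (Y i ᵥ* U) j.succ).det‖) ^ t := by
      intro Y
      have := det_cons_rot x U hU hx Y
      rw [← ENNReal.mul_rpow_of_nonneg _ _ ht.le, ← ENNReal.ofReal_mul (show 0 ≤ l2 x from Real.sqrt_nonneg _), ← this]
      simp_rw [MeasurableEquiv.piFinSuccAbove_symm_apply, Fin.insertNthEquiv, Equiv.coe_fn_mk, Fin.insertNth_zero]
      rfl
    have mp := measurePreserving_pi (fun _ : Fin n => (Measure.pi fun _ : Fin (n+1) => gm 𝕜))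
      (fun _ : Fin n => (Measure.pi fun _ : Fin n => gm 𝕜)) (fun _ => (tail_mp n).comp (rot_mp U hU))
    simp_rw [e1]
    refine (lintegral_const_mul _ ((hmeas n).comp mp.measurable)).trans ?_
    congr 1
    exact mp.lintegral_comp (hmeas n)
  simp_rw [← hc]
  refine (lintegral_congr this).trans ?_
  rw [lintegral_mul_const]
  unfold l2
  fun_prop

theorem H_prod (n : ℕ) : ∃ c : ℝ≥0∞, c ≠ 0 ∧ c ≠ ∞ ∧ ∀ t : ℝ, 0 < t →
    H 𝕜 n t = c * ∏ i ∈ Finset.range n, hp 𝕜 (t + Module.finrank ℝ 𝕜 * i) := by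
  induction n with
  | zero => 
    refine ⟨1, one_ne_zero, ENNReal.one_ne_top, fun t ht => ?_⟩
    simp [H]
  | succ n ih =>
    obtain ⟨c, h0, h1, hc⟩ := ih
    obtain ⟨d, g0, g1, hd⟩ := H_succ (𝕜 := 𝕜) n
    refine ⟨d * c, mul_ne_zero g0 h0, ENNReal.mul_ne_top g1 h1, fun t ht => ?_⟩
    rw [hd t ht, hc t ht, Finset.prod_range_succ]
    ring
end rot
end ABHN
end part17

section part18
namespace ABHN
open MeasureTheory Measure Set Module
open scoped ENNReal Matrix

theorem det_bd {ι : Type*} [Fintype ι] [DecidableEq ι] {κ : ι → Type*} [∀ i, Fintype (κ i)] [∀ i, DecidableEq (κ i)]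
    (M : ∀ i, Matrix (κ i) (κ i) ℝ) : (Matrix.blockDiagonal' M).det = ∏ i, (M i).det := by
  letI : LinearOrder ι := LinearOrder.lift' (Fintype.equivFin ι) (Fintype.equivFin ι).injective
  have hb : Matrix.BlockTriangular (Matrix.blockDiagonal' M) Sigma.fst := by
    intro x y hxy
    exact Matrix.blockDiagonal'_apply_ne _ _ _ (ne_of_gt hxy)
  rw [hb.det_fintype]
  refine Finset.prod_congr rfl fun i _ => ?_
  rw [← Matrix.det_submatrix_equiv_self (Equiv.sigmaSubtype i).symm]
  congr 1
  ext x y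
  exact Matrix.blockDiagonal'_apply_eq M i x y

theorem det_pi_dep {ι : Type*} [Fintype ι] [DecidableEq ι] {κ : ι → Type*} [∀ i, Fintype (κ i)] [∀ i, DecidableEq (κ i)]
    {M : ι → Type*} [∀ i, AddCommGroup (M i)] [∀ i, Module ℝ (M i)] (b : ∀ i, Basis (κ i) ℝ (M i))
    (f : ∀ i, M i →ₗ[ℝ] M i) :
    LinearMap.det (LinearMap.pi (fun i => (f i).comp (LinearMap.proj i))) = ∏ i, LinearMap.det (f i) := by
  rw [← LinearMap.det_toMatrix (Pi.basis b)]
  have : LinearMap.toMatrix (Pi.basis b) (Pi.basis b) (LinearMap.pi (fun i => (f i).comp (LinearMap.proj i))) =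
      Matrix.blockDiagonal' fun i => LinearMap.toMatrix (b i) (b i) (f i) := by
    ext ⟨i, x⟩ ⟨j, y⟩
    rw [LinearMap.toMatrix_apply, Pi.basis_repr, Pi.basis_apply]
    by_cases h : i = j
    · subst h
      simp [Matrix.blockDiagonal'_apply_eq, LinearMap.toMatrix_apply]
    · rw [Matrix.blockDiagonal'_apply_ne _ _ _ h]
      simp [h]
  rw [this, det_bd]
  exact Finset.prod_congr rfl fun i _ => LinearMap.det_toMatrix _ _

section m
variable {𝕜 : Type*} [RCLike 𝕜] {n : ℕ}
theorem det_mulRight (hN : ∀ z : 𝕜, |Algebra.norm ℝ z| = ‖z‖ ^ finrank ℝ 𝕜) (Y : Matrix (Fin n) (Fin n) 𝕜) :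
    |LinearMap.det (LinearMap.mulRight ℝ Y)| = ‖Y.det‖ ^ (n * finrank ℝ 𝕜) := by
  have h1 : LinearMap.mulRight ℝ Y = (LinearMap.pi (fun i : Fin n => 
      ((Matrix.toLin' Yᵀ).restrictScalars ℝ).comp (LinearMap.proj i)) : (Fin n → Fin n → 𝕜) →ₗ[ℝ] (Fin n → Fin n → 𝕜)) := by
    apply LinearMap.ext
    intro X
    funext i
    change (X * Y) i = Yᵀ *ᵥ X i
    rw [Matrix.mulVec_transpose, Matrix.mul_apply_eq_vecMul]
  rw [h1]
  erw [LinearMap.det_pi]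
  rw [Finset.prod_const, Finset.card_univ, Fintype.card_fin, LinearMap.det_restrictScalars,
    LinearMap.det_toLin', Matrix.det_transpose, abs_pow, hN, ← pow_mul, mul_comm]
end m

section a
variable {W : Type*} [Fintype W] [DecidableEq W] (KK : W → Type) [∀ w, RCLike (KK w)] (n : ℕ)

abbrev IX : Type _ := Σ w : W, Σ _ : Fin n, Σ _ : Fin n, Fin (finrank ℝ (KK w))
abbrev VV : Type _ := ∀ w : W, Matrix (Fin n) (Fin n) (KK w)

noncomputable def BB0 (w : W) : Basis (Σ _ : Fin n, Σ _ : Fin n, Fin (finrank ℝ (KK w))) ℝ (Matrix (Fin n) (Fin n) (KK w)) :=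
  (Pi.basis fun _ => Pi.basis fun _ => (stdOrthonormalBasis ℝ (KK w)).toBasis).map (Matrix.ofLinearEquiv ℝ)
noncomputable def BB : Basis (IX KK n) ℝ (VV KK n) := Pi.basis (BB0 KK n)

theorem nsq_BB (Y : VV KK n) : nsq ((BB KK n).equivFun Y) = ∑ w, ∑ i, ∑ j, ‖Y w i j‖ ^ 2 := by
  unfold nsq
  rw [Fintype.sum_sigma]
  refine Finset.sum_congr rfl fun w _ => ?_
  rw [Fintype.sum_sigma]
  refine Finset.sum_congr rfl fun i _ => ?_
  rw [Fintype.sum_sigma]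
  refine Finset.sum_congr rfl fun j _ => ?_
  have h : ∀ k, (BB KK n).equivFun Y ⟨w, i, j, k⟩ = (stdOrthonormalBasis ℝ (KK w)).repr (Y w i j) k := fun k => by
    rw [Basis.equivFun_apply, BB, Pi.basis_repr, BB0]
    rw [Basis.map_repr, LinearEquiv.trans_apply, Pi.basis_repr, Pi.basis_repr]
    rfl
  simp_rw [h]
  rw [← (stdOrthonormalBasis ℝ (KK w)).repr.norm_map (Y w i j), EuclideanSpace.norm_eq,
    Real.sq_sqrt (Finset.sum_nonneg fun i _ => sq_nonneg _)]
  simp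

theorem det_VV (hN : ∀ w, ∀ z : KK w, |Algebra.norm ℝ z| = ‖z‖ ^ finrank ℝ (KK w)) (Y : VV KK n) :
    |LinearMap.det (LinearMap.mulRight ℝ Y)| = ∏ w, ‖(Y w).det‖ ^ (n * finrank ℝ (KK w)) := by
  have h1 : LinearMap.mulRight ℝ Y = LinearMap.pi (fun w => (LinearMap.mulRight ℝ (Y w)).comp (LinearMap.proj w)) := by
    apply LinearMap.ext
    intro X
    rfl
  rw [h1, det_pi_dep (BB0 KK n), Finset.abs_prod]
  exact Finset.prod_congr rfl fun w _ => det_mulRight (hN w) (Y w)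

variable {D : Type*} [DivisionRing D] [CharZero D] (Φ : D →+* VV KK n)
noncomputable def rhoV : D →+* Matrix (IX KK n) (IX KK n) ℝ :=
  ((LinearMap.toMatrixAlgEquiv (BB KK n)).toRingEquiv.toRingHom.comp (Algebra.lmul ℝ (VV KK n)).toRingHom).comp Φ

theorem rhoV_apply (d : D) (Y : VV KK n) :
    rhoV KK n Φ d *ᵥ (BB KK n).equivFun Y = (BB KK n).equivFun (Φ d * Y) :=
  LinearMap.toMatrix_mulVec_repr (BB KK n) (BB KK n) (LinearMap.mulLeft ℝ (Φ d)) Y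

theorem colM_det (b : IX KK n → D) (Y : VV KK n) :
    (Matrix.of fun i j => (rhoV KK n Φ (b j) *ᵥ (BB KK n).equivFun Y) i).det =
      LinearMap.det (LinearMap.mulRight ℝ Y) * (BB KK n).det (fun j => Φ (b j)) := by
  have := (BB KK n).det_comp (LinearMap.mulRight ℝ Y) (fun j => Φ (b j))
  rw [← this, Basis.det_apply]
  congr 1
  ext i j
  rw [Matrix.of_apply, rhoV_apply]
  rfl

noncomputable def mkLD (b : Basis (IX KK n) ℚ D) (h1 : (1 : D) ∈ AddSubgroup.closure (Set.range b))
    (h2 : ∀ i j, b i * b j ∈ AddSubgroup.closure (Set.range b))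
    (hΦ : LinearIndependent ℝ fun i => Φ (b i)) : LD D (IX KK n) where
  b := b
  one_mem := h1
  mul_mem := h2
  ρ := rhoV KK n Φ
  y0 := (BB KK n).equivFun 1
  hy0 := by
    rw [colM_det]
    have : LinearMap.mulRight ℝ (1 : VV KK n) = LinearMap.id := by ext1 x; simp
    rw [this, LinearMap.det_id, one_mul]
    have hc : (BB KK n).det (fun j => Φ (b j)) ≠ 0 := by
      have hs : ⊤ ≤ Submodule.span ℝ (Set.range fun i => Φ (b i)) :=
        (hΦ.span_eq_top_of_card_eq_finrank' (finrank_eq_card_basis (BB KK n)).symm).ge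
      have := ((BB KK n).is_basis_iff_det (v := fun i => Φ (b i))).1 ⟨hΦ, top_le_iff.1 hs⟩
      exact this.ne_zero
    exact hc
end a
end ABHN
end part18

section part19
namespace ABHN
open MeasureTheory Measure Set Module
open scoped ENNReal Matrix

section a
variable {W : Type*} [Fintype W] [DecidableEq W] (KK : W → Type) [∀ w, RCLike (KK w)] (n : ℕ)

noncomputable def muV : Measure (∀ w : W, Fin n → Fin n → KK w) :=
  Measure.pi fun w => Measure.pi fun _ => Measure.pi fun _ => hv (KK w)
noncomputable def gaV : Measure (∀ w : W, Fin n → Fin n → KK w) :=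
  Measure.pi fun w => Measure.pi fun _ => Measure.pi fun _ => gm (KK w)
instance : (muV KK n).IsAddHaarMeasure := by
  unfold muV
  have h1 : ∀ w, (Measure.pi fun _ : Fin n => Measure.pi fun _ : Fin n => hv (KK w)).IsAddHaarMeasure := fun w =>
    pi.isAddHaarMeasure _
  exact pi.isAddHaarMeasure _

noncomputable def GV (Y : ∀ w : W, Fin n → Fin n → KK w) : ℝ≥0∞ := ∏ w, ∏ i, gds (Y w i)

theorem GV_meas : Measurable (GV KK n) := by
  unfold GV
  refine Finset.measurable_prod _ fun w _ => Finset.measurable_prod _ fun i _ => ?_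
  exact gds_meas.comp (by fun_prop)

theorem sf1 (w : W) : SigmaFinite (Measure.pi fun _ : Fin n => Measure.pi fun _ : Fin n => hv (KK w)) := by
  have h0 : SigmaFinite (Measure.pi fun _ : Fin n => hv (KK w)) := inferInstance
  have : ∀ _ : Fin n, SigmaFinite (Measure.pi fun _ : Fin n => hv (KK w)) := fun _ => h0
  exact pi.sigmaFinite _
instance bsV : BorelSpace (∀ w : W, Fin n → Fin n → KK w) := by
  haveI : ∀ w, BorelSpace (Fin n → Fin n → KK w) := fun w => inferInstance
  haveI : ∀ w, SecondCountableTopology (Fin n → Fin n → KK w) := fun w => inferInstance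
  infer_instance

theorem gaV_eq : gaV KK n = (muV KK n).withDensity (GV KK n) := by
  have h1 : ∀ w, (Measure.pi fun _ : Fin n => Measure.pi fun _ : Fin n => gm (KK w)) =
      (Measure.pi fun _ : Fin n => Measure.pi fun _ : Fin n => hv (KK w)).withDensity
        (fun Y => ∏ i, gds (Y i)) := fun w => by
    have := pi_withDens (fun _ : Fin n => Measure.pi fun _ : Fin n => hv (KK w)) (fun _ => gds)
      (fun _ => gds_meas) (fun i => by rw [← pi_gm]; infer_instance)
    rw [← this]
    simp_rw [pi_gm]
  haveI := sf1 KK n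
  have := pi_withDens (fun w => Measure.pi fun _ : Fin n => Measure.pi fun _ : Fin n => hv (KK w))
    (fun w Y => ∏ i, gds (Y i)) (fun w => Finset.measurable_prod _ fun i _ => gds_meas.comp (by fun_prop))
    (fun w => by rw [← h1]; infer_instance)
  rw [gaV]
  simp_rw [h1]
  exact this

theorem Ex_GV (Y : VV KK n) : LD.Ex 1 ((BB KK n).equivFun Y) = GV KK n Y := by
  unfold LD.Ex GV gds
  rw [nsq_BB]
  simp_rw [← ENNReal.ofReal_prod_of_nonneg (fun i _ => (Real.exp_pos _).le), ← Real.exp_sum]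
  rw [← ENNReal.ofReal_prod_of_nonneg (fun i _ => (Real.exp_pos _).le), ← Real.exp_sum]
  simp_rw [← Finset.mul_sum]
  rw [one_pow, mul_one]

theorem vol_V : ∃ c : ℝ≥0∞, c ≠ 0 ∧ c ≠ ∞ ∧ ∀ F : (IX KK n → ℝ) → ℝ≥0∞, Measurable F →
    ∫⁻ y, F y = c * ∫⁻ Y, F ((BB KK n).equivFun Y) ∂(muV KK n) := by
  let L : (∀ w : W, Fin n → Fin n → KK w) ≃ₗ[ℝ] (IX KK n → ℝ) := (BB KK n).equivFun
  let L' := L.toContinuousLinearEquiv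
  have hm : Measurable L' := L'.continuous.measurable
  have h1 : (Measure.map L' (muV KK n)).IsAddHaarMeasure := L'.isAddHaarMeasure_map _
  have h2 := isAddLeftInvariant_eq_smul (volume : Measure (IX KK n → ℝ)) (Measure.map L' (muV KK n))
  have h3 := addHaarScalarFactor_pos_of_isAddHaarMeasure (volume : Measure (IX KK n → ℝ)) (Measure.map L' (muV KK n))
  refine ⟨_, ENNReal.coe_ne_zero.2 h3.ne', ENNReal.coe_ne_top, fun F hF => ?_⟩
  have h4 := lintegral_map hF hm (μ := muV KK n)
  conv_lhs => rw [h2]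
  rw [lintegral_smul_measure, h4]
  rfl

theorem rpow_mul_inv (x : ℝ≥0∞) (hx : x ≠ ∞) {s : ℝ} (hs : 1 < s) : x ^ s * x⁻¹ = x ^ (s - 1) := by
  by_cases h : x = 0
  · rw [h, ENNReal.zero_rpow_of_pos (by linarith), ENNReal.zero_rpow_of_pos (by linarith), zero_mul]
  · rw [ENNReal.rpow_sub _ _ h hx, ENNReal.rpow_one, div_eq_mul_inv]

variable {D : Type*} [DivisionRing D] [CharZero D] (Φ : D →+* VV KK n)

theorem arch_formula (hN : ∀ w, ∀ z : KK w, |Algebra.norm ℝ z| = ‖z‖ ^ finrank ℝ (KK w)) (hn : 0 < n)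
    (b : Basis (IX KK n) ℚ D) (h1 : (1 : D) ∈ AddSubgroup.closure (Set.range b))
    (h2 : ∀ i j, b i * b j ∈ AddSubgroup.closure (Set.range b))
    (hΦ : LinearIndependent ℝ fun i => Φ (b i)) :
    ∃ a A : ℝ, 0 < a ∧ 0 < A ∧ ∀ s : ℝ, 1 < s → (mkLD KK n Φ b h1 h2 hΦ).arch s =
      ENNReal.ofReal (a * A ^ s) *
        ∏ w, ∏ i ∈ Finset.range n, hp (KK w) (finrank ℝ (KK w) * (n * (s - 1) + i)) := by
  obtain ⟨c, hc0, hc1, hc⟩ := vol_V KK n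
  set S := mkLD KK n Φ b h1 h2 hΦ with hS
  choose d hd0 hd1 hd using fun w => H_prod (𝕜 := KK w) n
  set A : ℝ := |(BB KK n).det (fun j => Φ (b j))| with hA
  have hnu : ∀ Y : VV KK n, S.nu ((BB KK n).equivFun Y) = A * ∏ w, ‖(Y w).det‖ ^ (n * finrank ℝ (KK w)) := by
    intro Y
    have := colM_det KK n Φ b Y
    rw [LD.nu]
    change |(Matrix.of fun i j => (rhoV KK n Φ (b j) *ᵥ (BB KK n).equivFun Y) i).det| = _
    rw [this, abs_mul, det_VV KK n hN, mul_comm]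
  have hA0 : 0 < A := by
    have := S.hy0
    have h' := colM_det KK n Φ b 1
    change (Matrix.of fun i j => (rhoV KK n Φ (b j) *ᵥ (BB KK n).equivFun 1) i).det ≠ 0 at this
    rw [h'] at this
    exact abs_pos.2 (right_ne_zero_of_mul this)
  have hdm : ∀ w, Measurable fun Y : Fin n → Fin n → KK w => (Matrix.of Y).det := fun w => by
    have : Continuous fun Y : Fin n → Fin n → KK w => (Matrix.of Y).det := by fun_prop
    exact this.measurable
  have main : ∀ s : ℝ, 1 < s → S.arch s = c * (ENNReal.ofReal A ^ (s - 1) * ∏ w, H (KK w) n (finrank ℝ (KK w) * (n * (s - 1)))) := by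
    intro s hs
    have hs' : 0 < s - 1 := by linarith
    have hsm : ∀ y, S.nuI y * 1 = (ENNReal.ofReal (S.nu y))⁻¹ := fun y => mul_one _
    have e0 : S.arch s = ∫⁻ y, LD.Ex 1 y * ENNReal.ofReal (S.nu y) ^ (s - 1) := by
      rw [LD.arch]
      refine lintegral_congr fun y => ?_
      rw [mul_assoc, LD.nuI, rpow_mul_inv _ ENNReal.ofReal_ne_top hs]
    have hEx : Measurable fun y : IX KK n → ℝ => LD.Ex 1 y * ENNReal.ofReal (S.nu y) ^ (s - 1) := by
      have := S.continuous_nu.measurable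
      have h2 : Measurable fun y : IX KK n → ℝ => LD.Ex 1 y := by unfold LD.Ex nsq; fun_prop
      exact h2.mul (this.ennreal_ofReal.pow_const _)
    rw [e0, hc _ hEx]
    congr 1
    have e1 : ∀ Y : ∀ w : W, Fin n → Fin n → KK w, ENNReal.ofReal (S.nu ((BB KK n).equivFun Y)) ^ (s - 1) =
        ENNReal.ofReal A ^ (s-1) * ∏ w, ENNReal.ofReal ‖(Matrix.of (Y w)).det‖ ^ (finrank ℝ (KK w) * (n * (s - 1)) : ℝ) := by
      intro Y
      have := hnu Y
      rw [this, ENNReal.ofReal_mul hA0.le, ENNReal.mul_rpow_of_nonneg _ _ hs'.le,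
        ENNReal.ofReal_prod_of_nonneg (fun i _ => by positivity), ← ENNReal.prod_rpow_of_nonneg hs'.le]
      congr 1
      refine Finset.prod_congr rfl fun w _ => ?_
      rw [ENNReal.ofReal_pow (norm_nonneg _), ← ENNReal.rpow_natCast, ← ENNReal.rpow_mul]
      congr 1
      push_cast; ring
    have e2 : ∀ Y : ∀ w : W, Fin n → Fin n → KK w,
        LD.Ex 1 ((BB KK n).equivFun Y) * ENNReal.ofReal (S.nu ((BB KK n).equivFun Y)) ^ (s - 1) =
        GV KK n Y * (ENNReal.ofReal A ^ (s-1) * ∏ w, ENNReal.ofReal ‖(Matrix.of (Y w)).det‖ ^ (finrank ℝ (KK w) * (n * (s - 1)) : ℝ)) := by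
      intro Y
      have h3 := e1 Y
      have h4 := Ex_GV KK n Y
      rw [← h3, ← h4]
    refine (lintegral_congr e2).trans ?_
    have hm1 : ∀ w, Measurable fun Y : Fin n → Fin n → KK w => ENNReal.ofReal ‖(Matrix.of Y).det‖ ^ (finrank ℝ (KK w) * (n * (s - 1)) : ℝ) :=
      fun w => ((hdm w).norm.ennreal_ofReal).pow_const _
    have hm2 : Measurable fun Y : ∀ w : W, Fin n → Fin n → KK w => ∏ w, ENNReal.ofReal ‖(Matrix.of (Y w)).det‖ ^ (finrank ℝ (KK w) * (n * (s - 1)) : ℝ) :=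
      Finset.measurable_prod _ fun w _ => (hm1 w).comp (measurable_pi_apply w)
    refine (lintegral_withDensity_eq_lintegral_mul _ (GV_meas KK n) (hm2.const_mul _)).symm.trans ?_
    rw [← gaV_eq, lintegral_const_mul _ hm2]
    congr 1
    exact lint_pi_prod (fun w => Measure.pi fun _ : Fin n => Measure.pi fun _ : Fin n => gm (KK w)) _ hm1
  refine ⟨(c * ∏ w, d w).toReal * A⁻¹, A, ?_, hA0, fun s hs => ?_⟩
  · refine mul_pos (ENNReal.toReal_pos (mul_ne_zero hc0 (Finset.prod_ne_zero_iff.2 fun w _ => hd0 w))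
      (ENNReal.mul_ne_top hc1 (ENNReal.prod_ne_top fun w _ => hd1 w))) (inv_pos.2 hA0)
  · have hs' : 0 < s - 1 := by linarith
    rw [main s hs, mul_assoc, ENNReal.ofReal_mul ENNReal.toReal_nonneg,
      ENNReal.ofReal_toReal (ENNReal.mul_ne_top hc1 (ENNReal.prod_ne_top fun w _ => hd1 w)),
      ENNReal.ofReal_rpow_of_pos hA0]
    have : A⁻¹ * A ^ s = A ^ (s - 1) := by
      rw [Real.rpow_sub_one hA0.ne']; field_simp
    rw [this]
    have h5 : ∀ w, H (KK w) n (finrank ℝ (KK w) * (n * (s - 1))) = d w * 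
        ∏ i ∈ Finset.range n, hp (KK w) (finrank ℝ (KK w) * (n * (s - 1) + i)) := by
      intro w
      rw [hd w]
      · congr 1
        refine Finset.prod_congr rfl fun i _ => ?_
        congr 1; ring
      · have : 0 < finrank ℝ (KK w) := finrank_pos
        positivity
    simp_rw [h5]
    rw [Finset.prod_mul_distrib]
    ring
end a
end ABHN
end part19

section part20
namespace ABHN
open Module NumberField IsDedekindDomain
open scoped TensorProduct

/-- representation of `R` of degree `m` over `M`, along `σ : k → M`. -/
def Rp {k M : Type*} [Field k] [Field M] (σ : k →+* M) (R : Type*) [Ring R] [Algebra k R] (m : ℕ) : Prop :=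
  ∃ φ : R →+* Matrix (Fin m) (Fin m) M, ∀ a, φ (algebraMap k R a) = algebraMap M _ (σ a)

section
variable {k M R : Type*} [Field k] [Field M] [Algebra k M] [Ring R] [Algebra k R] [Algebra.IsCentral k R] [IsSimpleRing R]

theorem one_tmul_algebraMap {k M R : Type*} [Field k] [Field M] [Algebra k M] [Ring R] [Algebra k R] (a : k) :
    (1 : M) ⊗ₜ[k] (algebraMap k R a) = algebraMap M (M ⊗[k] R) (algebraMap k M a) := by
  rw [Algebra.TensorProduct.algebraMap_apply, Algebra.algebraMap_eq_smul_one a, TensorProduct.tmul_smul, TensorProduct.smul_tmul', Algebra.algebraMap_eq_smul_one a]; rfl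

/-- A ring hom from `M ⊗ R` to a nontrivial ring is injective. -/
theorem tensor_inj {E : Type*} [Ring E] [Nontrivial E] [Algebra M E] (f : M ⊗[k] R →ₐ[M] E) : Function.Injective f := by
  let b := Basis.ofVectorSpace k R
  let B := Algebra.TensorProduct.basis M b
  have hli := indep_map (k := k) (M := M) (E := E) (f.toRingHom.comp (Algebra.TensorProduct.includeRight : R →ₐ[k] M ⊗[k] R).toRingHom)
    (by
      intro a
      simp only [RingHom.comp_apply, AlgHom.toRingHom_eq_coe, RingHom.coe_coe, Algebra.TensorProduct.includeRight_apply]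
      rw [one_tmul_algebraMap]
      rw [AlgHom.commutes]) b b.linearIndependent
  have h2 : LinearIndependent M (f.toLinearMap ∘ B) := by
    convert hli using 1
    ext i
    simp [B]
  exact (LinearMap.ker_eq_bot (f := f.toLinearMap)).1 (by
    rw [LinearMap.ker_eq_bot']
    intro m hm
    have h3 := B.linearCombination_repr m
    rw [← h3] at hm
    have h4 : Finsupp.linearCombination M (f.toLinearMap ∘ B) (B.repr m) = 0 := by
      rw [← hm, Finsupp.apply_linearCombination]
    have h5 := (linearIndependent_iff.1 h2) _ h4
    rw [← h3, h5, map_zero])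

theorem tensor_simple : IsSimpleRing (M ⊗[k] R) := by
  haveI : Nontrivial (M ⊗[k] R) := inferInstance
  refine ⟨⟨fun I => ?_⟩⟩
  by_contra hc
  push Not at hc
  obtain ⟨hb, ht⟩ := hc
  let E := I.ringCon.Quotient
  haveI : Nontrivial E := by
    refine ⟨0, 1, fun h => ht ?_⟩
    rw [← TwoSidedIdeal.one_mem_iff]
    exact (TwoSidedIdeal.mem_iff _ _).2 (I.ringCon.eq.1 h.symm)
  letI : Algebra M E := (I.ringCon.mk'.comp (algebraMap M (M ⊗[k] R))).toAlgebra' (by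
    intro c x
    obtain ⟨y, rfl⟩ := I.ringCon.mk'_surjective x
    simp only [RingHom.comp_apply]
    rw [← map_mul, ← map_mul, Algebra.commutes])
  let f : M ⊗[k] R →ₐ[M] E := { I.ringCon.mk' with commutes' := fun _ => rfl }
  have hf : Function.Injective f := tensor_inj f
  apply hb
  rw [eq_bot_iff]
  intro x hx
  have h1 : f x = f 0 := I.ringCon.eq.2 ((TwoSidedIdeal.mem_iff _ _).1 hx)
  rw [TwoSidedIdeal.mem_bot]
  exact hf h1

theorem rp_algClosed [IsAlgClosed M] [FiniteDimensional k R] {n : ℕ} (hd : finrank k R = n ^ 2) : Rp (algebraMap k M) R n := by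
  haveI := tensor_simple (k := k) (M := M) (R := R)
  obtain ⟨d, _, ⟨e⟩⟩ := IsSimpleRing.exists_algEquiv_matrix_of_isAlgClosed M (M ⊗[k] R)
  have h1 := e.toLinearEquiv.finrank_eq
  rw [Module.finrank_baseChange, hd, Module.finrank_matrix, Fintype.card_fin, finrank_self, mul_one, ← sq] at h1
  have h2 : n = d := Nat.pow_left_injective (n := 2) (by norm_num) h1
  subst h2
  refine ⟨e.toRingEquiv.toRingHom.comp (Algebra.TensorProduct.includeRight : R →ₐ[k] M ⊗[k] R).toRingHom, fun a => ?_⟩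
  have := e.commutes (algebraMap k M a)
  rw [← this]
  rw [← one_tmul_algebraMap]
  rfl
end
end ABHN
end part20

section part21
namespace ABHN
open Module NumberField IsDedekindDomain
open scoped TensorProduct

section core
open scoped Classical
variable (K : Type*) [Field K] [NumberField K]

abbrev WK : Type _ := {w : InfinitePlace K // w.IsReal} ⊕ {w : InfinitePlace K // w.IsComplex}

def KKs {α β : Type*} : α ⊕ β → Type
  | .inl _ => ℝ
  | .inr _ => ℂ

set_option synthInstance.checkSynthOrder false in
noncomputable instance instKKs {α β : Type*} : ∀ w : α ⊕ β, RCLike (KKs w)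
  | .inl _ => (inferInstance : RCLike ℝ)
  | .inr _ => (inferInstance : RCLike ℂ)

abbrev KKf : WK K → Type := KKs

noncomputable def embW : ∀ w : WK K, K →+* KKf K w
  | .inl w => InfinitePlace.embedding_of_isReal w.2
  | .inr w => w.1.embedding

theorem hN_KKf (w : WK K) (z : KKf K w) : |Algebra.norm ℝ z| = ‖z‖ ^ finrank ℝ (KKf K w) := by
  cases w with
  | inl w =>
    have : ∀ z : ℝ, |Algebra.norm ℝ z| = ‖z‖ ^ finrank ℝ ℝ := by
      intro z; simp [Algebra.norm_self]
    exact this z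
  | inr w =>
    have : ∀ z : ℂ, |Algebra.norm ℝ z| = ‖z‖ ^ finrank ℝ ℂ := by
      intro z
      rw [Algebra.norm_complex_eq, Complex.finrank_real_complex]
      simp [Complex.normSq_eq_norm_sq]
    exact this z

theorem sum_finrank_KKf : ∑ w : WK K, finrank ℝ (KKf K w) = finrank ℚ K := by
  classical
  rw [Fintype.sum_sum_type]
  have h1 : ∀ w, finrank ℝ (KKf K (.inl w)) = 1 := fun w => finrank_self ℝ
  have h2 : ∀ w, finrank ℝ (KKf K (.inr w)) = 2 := fun w => Complex.finrank_real_complex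
  simp only [h1, h2, Finset.sum_const, Finset.card_univ, smul_eq_mul, mul_one]
  rw [← InfinitePlace.card_add_two_mul_card_eq_rank K, mul_comm]

theorem card_IX (n : ℕ) : Fintype.card (IX (KKf K) n) = n ^ 2 * finrank ℚ K := by
  simp only [IX, Fintype.card_sigma, Fintype.card_fin, Finset.sum_const, Finset.card_univ, smul_eq_mul]
  rw [← sum_finrank_KKf, Finset.mul_sum]
  exact Finset.sum_congr rfl fun w _ => by ring

theorem emb_indep {ι : Type*} [Fintype ι] (r : Free.ChooseBasisIndex ℤ (𝓞 K) → ℝ)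
    (h : ∀ w : WK K, ∑ j, r j • embW K w (integralBasis K j) = 0) : r = 0 := by
  have hb := (mixedEmbedding.latticeBasis K).linearIndependent
  rw [Fintype.linearIndependent_iff] at hb
  funext j
  refine hb r ?_ j
  simp only [mixedEmbedding.latticeBasis_apply]
  refine Prod.ext (funext fun w => ?_) (funext fun w => ?_)
  · simp only [Prod.fst_sum, Finset.sum_apply, Prod.smul_fst, Pi.smul_apply, mixedEmbedding.mixedEmbedding_apply_isReal]
    exact h (.inl w)
  · simp only [Prod.snd_sum, Finset.sum_apply, Prod.smul_snd, Pi.smul_apply, mixedEmbedding.mixedEmbedding_apply_isComplex]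
    exact h (.inr w)

variable {K}
variable {D : Type*} [DivisionRing D] [CharZero D] [Algebra K D] [FiniteDimensional K D] [Algebra.IsCentral K D]
  {n : ℕ} [NeZero n] (hd : finrank K D = n ^ 2) 
  (φ : ∀ w : WK K, D →+* Matrix (Fin n) (Fin n) (KKf K w))
  (hφ : ∀ w a, φ w (algebraMap K D a) = algebraMap (KKf K w) _ (embW K w a))

theorem Phi_indep (hd : finrank K D = n ^ 2) (hφ : ∀ w a, φ w (algebraMap K D a) = algebraMap (KKf K w) _ (embW K w a))
    (β : Basis (IX (KKf K) n) ℚ D) : LinearIndependent ℝ fun i => (RingHom.pi φ : D →+* VV (KKf K) n) (β i) := by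
  classical
  set Φ : D →+* VV (KKf K) n := RingHom.pi φ with hΦ
  let d := finBasis K D
  have hΦr : ∀ (q : ℚ) (x : D), Φ (q • x) = (q : ℝ) • Φ x := by
    intro q x
    letI : Module ℚ (VV (KKf K) n) := Module.compHom _ (algebraMap ℚ ℝ)
    exact map_rat_smul Φ q x
  have h1 : LinearIndependent ℝ (fun p : Fin (finrank K D) × Free.ChooseBasisIndex ℤ (𝓞 K) => Φ (integralBasis K p.2 • d p.1)) := by
    rw [Fintype.linearIndependent_iff]
    intro r hr
    have h2 : ∀ i, (fun j => r (i, j)) = 0 := by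
      intro i
      refine emb_indep (ι := Fin 0) K _ fun w => ?_
      letI : Algebra K (KKf K w) := (embW K w).toAlgebra
      have := indep_map (k := K) (M := KKf K w) (φ w) (fun a => hφ w a) d d.linearIndependent
      rw [Fintype.linearIndependent_iff] at this
      refine this (fun i => ∑ j, r (i, j) • embW K w (integralBasis K j)) ?_ i
      have h3 := congrFun hr w
      rw [Fintype.sum_prod_type, Finset.sum_apply] at h3
      rw [← show _ = (0 : Matrix (Fin n) (Fin n) (KKf K w)) from h3]
      refine Finset.sum_congr rfl fun i _ => ?_
      rw [Finset.sum_apply, Finset.sum_smul]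
      refine Finset.sum_congr rfl fun j _ => ?_
      rw [Pi.smul_apply]
      have : Φ (integralBasis K j • d i) w = embW K w (integralBasis K j) • φ w (d i) := by
        change φ w _ = _
        rw [Algebra.smul_def, map_mul, hφ, Algebra.smul_def]
      rw [this, smul_assoc]
    rintro ⟨i, j⟩
    exact congrFun (h2 i) j
  have hcard : Fintype.card (Fin (finrank K D) × Free.ChooseBasisIndex ℤ (𝓞 K)) = finrank ℝ (VV (KKf K) n) := by
    rw [finrank_eq_card_basis (BB (KKf K) n), card_IX, Fintype.card_prod, Fintype.card_fin, hd,
      ← finrank_eq_card_basis (integralBasis K)]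
  have h2 := h1.span_eq_top_of_card_eq_finrank' hcard
  refine linearIndependent_of_top_le_span_of_card_eq_finrank ?_ (finrank_eq_card_basis (BB (KKf K) n)).symm
  rw [← h2, Submodule.span_le]
  rintro _ ⟨p, rfl⟩
  simp only
  rw [← β.sum_repr (integralBasis K p.2 • d p.1), map_sum]
  refine sum_mem fun i _ => ?_
  rw [hΦr]
  exact Submodule.smul_mem _ _ (Submodule.subset_span ⟨i, rfl⟩)

/-- Package for one division algebra. -/
theorem exists_LD (hd : finrank K D = n ^ 2) (hφ : ∀ w a, φ w (algebraMap K D a) = algebraMap (KKf K w) _ (embW K w a))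
    (h : ∀ v : HeightOneSpectrum (𝓞 K), Nonempty (D →ₐ[K] Matrix (Fin n) (Fin n) (v.adicCompletion K))) :
    ∃ S : LD D (IX (KKf K) n), (∀ s : ℝ, S.zX s = Yz (stdL (𝓞 K) K n) (n * s)) ∧
    ∃ a A : ℝ, 0 < a ∧ 0 < A ∧ ∀ s : ℝ, 1 < s → S.arch s =
      ENNReal.ofReal (a * A ^ s) *
        ∏ w, ∏ i ∈ Finset.range n, hp (KKf K w) (finrank ℝ (KKf K w) * (n * (s - 1) + i)) := by
  classical
  obtain ⟨β, h1, h2, h3⟩ := exists_order n hd h (I := IX (KKf K) n) (by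
    rw [card_IX, ← hd, mul_comm]
    have : IsScalarTower ℚ K D := inferInstance
    exact finrank_mul_finrank ℚ K D)
  have hΦ := Phi_indep φ hd hφ β
  refine ⟨mkLD (KKf K) n (RingHom.pi φ) β h1 h2 hΦ, fun s => zX_eq_Yz _ n ?_ s, ?_⟩
  · exact h3
  · exact arch_formula (KKf K) n (RingHom.pi φ) (hN_KKf K) (NeZero.pos n) β h1 h2 hΦ

theorem one_mat_rep {L M : Type*} [Field L] [Field M] (σ : L →+* M) : ∃ φ : L →+* Matrix (Fin 1) (Fin 1) M, ∀ a, φ a = algebraMap M _ (σ a) :=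
  ⟨(algebraMap M (Matrix (Fin 1) (Fin 1) M)).comp σ, fun _ => rfl⟩

theorem core_w (hd : finrank K D = n ^ 2) (hφ : ∀ w a, φ w (algebraMap K D a) = algebraMap (KKf K w) _ (embW K w a))
    (h : ∀ v : HeightOneSpectrum (𝓞 K), Nonempty (D →ₐ[K] Matrix (Fin n) (Fin n) (v.adicCompletion K))) : n = 1 := by
  classical
  by_contra hn1
  have hn : 2 ≤ n := by have := NeZero.pos n; omega
  obtain ⟨S, hS1, a, A, ha, hA, hS2⟩ := exists_LD φ hd hφ h
  choose φ1 hφ1 using fun w : WK K => one_mat_rep (embW K w)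
  obtain ⟨S', hS1', a', A', ha', hA', hS2'⟩ := exists_LD (K := K) (D := K) (n := 1) φ1 (by simp) hφ1
    (fun v => ⟨Algebra.ofId K _⟩)
  have hnp : (0 : ℝ) < n := by exact_mod_cast NeZero.pos n
  refine LD.core_contra S S' n hn (a / (a' ^ n * A' ^ (-(∑ i ∈ Finset.range n, (i : ℝ))))) (A / A' ^ ((n : ℝ) ^ 2)) (by positivity) (by positivity) (2 : ℝ) ?_
  intro s hs
  rw [Finset.prod_mul_distrib]
  have hz : S.zX s = ∏ i ∈ Finset.range n, S'.zX (n * s - i) := by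
    rw [hS1, Yz_std]
    refine Finset.prod_congr rfl fun i _ => ?_
    rw [hS1', Nat.cast_one, one_mul, Yz_std, Finset.prod_range_one, Nat.cast_zero, sub_zero]
  have hin : ∀ i ∈ Finset.range n, (1 : ℝ) < n * s - i := by
    intro i hi
    have : (i : ℝ) + 1 ≤ n := by exact_mod_cast Finset.mem_range.1 hi
    nlinarith
  have harch : S.arch s = ENNReal.ofReal (a / (a' ^ n * A' ^ (-(∑ i ∈ Finset.range n, (i : ℝ)))) * (A / A' ^ ((n : ℝ) ^ 2)) ^ s) *
      ∏ i ∈ Finset.range n, S'.arch (n * s - i) := by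
    rw [hS2 s (by linarith), Finset.prod_congr rfl fun i hi => hS2' _ (hin i hi), Finset.prod_mul_distrib, ← mul_assoc]
    rw [← ENNReal.ofReal_prod_of_nonneg (fun i _ => by positivity), ← ENNReal.ofReal_mul (by positivity)]
    congr 1
    · congr 1
      rw [Finset.prod_mul_distrib, Finset.prod_const, Finset.card_range, ← Real.rpow_sum_of_pos hA', Finset.sum_sub_distrib,
        Finset.sum_const, Finset.card_range, nsmul_eq_mul, Real.div_rpow hA.le (by positivity), ← Real.rpow_mul hA'.le,
        sub_eq_add_neg, Real.rpow_add hA']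
      rw [show (n : ℝ) * (n * s) = n ^ 2 * s by ring]
      field_simp
    · rw [Finset.prod_comm (s := Finset.range n)]
      refine Finset.prod_congr rfl fun w _ => ?_
      rw [← Finset.prod_range_reflect]
      refine Finset.prod_congr rfl fun i hi => ?_
      rw [Finset.prod_range_one]
      congr 2
      have : i + 1 ≤ n := Finset.mem_range.1 hi
      rw [Nat.sub_sub, Nat.cast_sub (by omega)]
      push_cast
      ring
  rw [hz, harch]
  ring

/-- Core theorem: a division algebra that is everywhere locally split is trivial. -/
theorem core_div (hd : finrank K D = n ^ 2)
    (h : ∀ v : HeightOneSpectrum (𝓞 K), Rp (algebraMap K (v.adicCompletion K)) D n)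
    (hr : ∀ σ : K →+* ℝ, Rp σ D n) : n = 1 := by
  have : ∀ w : WK K, ∃ φ : D →+* Matrix (Fin n) (Fin n) (KKf K w), ∀ a, φ (algebraMap K D a) = algebraMap (KKf K w) _ (embW K w a) := by
    rintro (w | w)
    · exact hr _
    · letI : Algebra K ℂ := w.1.embedding.toAlgebra
      exact rp_algClosed (M := ℂ) hd
  choose φ hφ using this
  refine core_w φ hd hφ fun v => ?_
  obtain ⟨f, hf⟩ := h v
  exact ⟨{ f with commutes' := fun r => hf r }⟩

end core
end ABHN
end part21

section part22
namespace ABHN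
open Module
open scoped TensorProduct

section indep2
variable {k R B E : Type*} [Field k] [Ring R] [Algebra k R] [Ring B] [Algebra k B] [Ring E]

lemma simple_indep2 [Algebra.IsCentral k R] [IsSimpleRing R] (φ : R →+* E) (ψ : B →+* E) (hψ : Function.Injective ψ)
    (hφ : ∀ a : k, φ (algebraMap k R a) = ψ (algebraMap k B a)) (hcm : ∀ b x, ψ b * φ x = φ x * ψ b) (r : ℕ) :
    ∀ (c : Fin r → B), LinearIndependent k c → ∀ d : Fin r → R, ∑ i, φ (d i) * ψ (c i) = 0 → ∀ i, d i = 0 := by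
  induction r with
  | zero => intro c hc d h i; exact i.elim0
  | succ r ih =>
    intro c hc d h
    have hc' : LinearIndependent k (fun i : Fin r => c i.succ) := hc.comp _ (Fin.succ_injective r)
    suffices h0 : d 0 = 0 by
      intro i
      refine Fin.cases h0 (fun j => ?_) i
      refine ih _ hc' (fun i => d i.succ) ?_ j
      rw [Fin.sum_univ_succ, h0] at h
      simpa using h
    by_contra hne
    let J : TwoSidedIdeal R := TwoSidedIdeal.mk' {x | ∃ e : Fin r → R, φ x * ψ (c 0) + ∑ i : Fin r, φ (e i) * ψ (c i.succ) = 0}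
      ⟨fun _ => 0, by simp⟩
      (by
        rintro x y ⟨e, he⟩ ⟨e', he'⟩
        refine ⟨fun i => e i + e' i, ?_⟩
        have := congrArg₂ (· + ·) he he'
        simp only [add_zero] at this
        rw [← this]
        simp only [map_add, add_mul, Finset.sum_add_distrib]; abel)
      (by
        rintro x ⟨e, he⟩
        refine ⟨fun i => - e i, ?_⟩
        have := congrArg (fun z => -z) he
        simp only [neg_zero] at this
        rw [← this]
        simp only [map_neg, neg_mul, Finset.sum_neg_distrib, neg_add])
      (by
        rintro x y ⟨e, he⟩
        refine ⟨fun i => x * e i, ?_⟩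
        have := congrArg (fun z => φ x * z) he
        simp only [mul_zero] at this
        rw [← this]
        simp only [map_mul, mul_add, Finset.mul_sum, mul_assoc])
      (by
        rintro x y ⟨e, he⟩
        refine ⟨fun i => e i * y, ?_⟩
        have := congrArg (fun z => z * φ y) he
        simp only [zero_mul] at this
        rw [← this]
        simp only [map_mul, add_mul, Finset.sum_mul, mul_assoc, hcm])
    have hJ : d 0 ∈ J := by
      refine (TwoSidedIdeal.mem_mk' _ _ _ _ _ _ _).2 ⟨fun i => d i.succ, ?_⟩
      rwa [Fin.sum_univ_succ] at h
    have hJ1 : (1 : R) ∈ J := by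
      rcases eq_bot_or_eq_top J with h | h
      · rw [h] at hJ; exact absurd ((TwoSidedIdeal.mem_bot R).1 hJ) hne
      · rw [h]; trivial
    obtain ⟨e, he⟩ := (TwoSidedIdeal.mem_mk' _ _ _ _ _ _ _).1 hJ1
    rw [map_one, one_mul] at he
    have hcomm : ∀ x i, x * e i - e i * x = 0 := by
      intro x
      refine ih _ hc' (fun i => x * e i - e i * x) ?_
      have h1 := congrArg (fun z => φ x * z - z * φ x) he
      simp only [mul_zero, zero_mul, sub_zero] at h1
      rw [← h1]
      simp only [map_sub, map_mul, sub_mul, Finset.sum_sub_distrib, mul_add, add_mul, Finset.mul_sum, Finset.sum_mul, mul_assoc, hcm]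
      abel
    have hcen : ∀ i, ∃ a : k, algebraMap k R a = e i := by
      intro i
      have : e i ∈ Subalgebra.center k R := Subalgebra.mem_center_iff.2 fun x => sub_eq_zero.1 (hcomm x i)
      rw [Algebra.IsCentral.center_eq_bot] at this
      exact Algebra.mem_bot.1 this
    choose a ha using hcen
    have h3 : c 0 + ∑ i : Fin r, algebraMap k B (a i) * c i.succ = 0 := by
      apply hψ
      rw [map_zero, ← he, map_add, map_sum]
      congr 1
      refine Finset.sum_congr rfl fun i _ => ?_
      rw [← ha i, hφ, map_mul]
    have h4 := Fintype.linearIndependent_iff.1 hc (Fin.cons 1 a) (by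
      rw [Fin.sum_univ_succ]
      simpa [Algebra.smul_def] using h3) 0
    simp at h4

theorem tensor_inj2 [Algebra.IsCentral k R] [IsSimpleRing R] [FiniteDimensional k B] (f : R ⊗[k] B →+* E)
    (hf : Function.Injective (fun b : B => f (1 ⊗ₜ b))) : Function.Injective f := by
  rw [injective_iff_map_eq_zero]
  intro z hz
  let bB := Module.finBasis k B
  obtain ⟨d, hd⟩ : ∃ d : Fin (finrank k B) → R, ∑ i, d i ⊗ₜ[k] bB i = z := by
    refine ⟨fun i => TensorProduct.equivFinsuppOfBasisRight bB z i, ?_⟩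
    have h1 := (TensorProduct.equivFinsuppOfBasisRight (M := R) bB).symm_apply_apply z
    rw [TensorProduct.equivFinsuppOfBasisRight_symm_apply, Finsupp.sum_fintype _ _ (by simp)] at h1
    exact h1
  have h2 := simple_indep2 (k := k) (f.comp (Algebra.TensorProduct.includeLeft : R →ₐ[k] R ⊗[k] B).toRingHom)
    (f.comp (Algebra.TensorProduct.includeRight : B →ₐ[k] R ⊗[k] B).toRingHom) hf (by
      intro a
      simp only [RingHom.comp_apply]
      congr 1
      change algebraMap k R a ⊗ₜ[k] (1 : B) = 1 ⊗ₜ algebraMap k B a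
      rw [Algebra.algebraMap_eq_smul_one, Algebra.algebraMap_eq_smul_one, TensorProduct.smul_tmul]) (by
      intro b x
      simp only [RingHom.comp_apply, ← map_mul]
      congr 1
      change ((1 : R) ⊗ₜ[k] b) * (x ⊗ₜ 1) = (x ⊗ₜ 1) * (1 ⊗ₜ b)
      simp) _ bB bB.linearIndependent d (by
      simp only [RingHom.comp_apply, ← map_mul]
      rw [← map_sum, ← hz, ← hd]
      congr 1
      refine Finset.sum_congr rfl fun i _ => ?_
      change (d i ⊗ₜ[k] (1 : B)) * (1 ⊗ₜ bB i) = _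
      simp)
  rw [← hd]
  simp [h2]

theorem tensor_simple2 [Algebra.IsCentral k R] [IsSimpleRing R] [IsSimpleRing B] [FiniteDimensional k B] : IsSimpleRing (R ⊗[k] B) := by
  haveI : Nontrivial (R ⊗[k] B) := inferInstance
  refine ⟨⟨fun I => ?_⟩⟩
  by_contra hc
  push Not at hc
  obtain ⟨hb, ht⟩ := hc
  let E := I.ringCon.Quotient
  haveI : Nontrivial E := by
    refine ⟨0, 1, fun h => ht ?_⟩
    rw [← TwoSidedIdeal.one_mem_iff]
    exact (TwoSidedIdeal.mem_iff _ _).2 (I.ringCon.eq.1 h.symm)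
  have hf : Function.Injective I.ringCon.mk' := tensor_inj2 _ (by
    exact (I.ringCon.mk'.comp (Algebra.TensorProduct.includeRight : B →ₐ[k] R ⊗[k] B).toRingHom).injective)
  apply hb
  rw [eq_bot_iff]
  intro x hx
  have h1 : I.ringCon.mk' x = I.ringCon.mk' 0 := I.ringCon.eq.2 ((TwoSidedIdeal.mem_iff _ _).1 hx)
  rw [TwoSidedIdeal.mem_bot]
  exact hf h1

theorem central_tensor (A : Type*) [Ring A] [Algebra k A] [Algebra.IsCentral k R] (z : A ⊗[k] R)
    (hz : ∀ x : R, (1 ⊗ₜ x) * z = z * (1 ⊗ₜ x)) : ∃ a : A, z = a ⊗ₜ 1 := by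
  have h1 : z ∈ Subalgebra.centralizer k ((Algebra.TensorProduct.includeRight : R →ₐ[k] A ⊗[k] R).range : Set (A ⊗[k] R)) := by
    rw [Subalgebra.mem_centralizer_iff]
    rintro _ ⟨x, rfl⟩
    exact hz x
  rw [Subalgebra.centralizer_range_includeRight_eq_center_tensorProduct, Algebra.IsCentral.center_eq_bot] at h1
  obtain ⟨y, rfl⟩ := h1
  clear hz
  induction y using TensorProduct.induction_on with
  | zero => exact ⟨0, by simp⟩
  | tmul a x =>
    obtain ⟨c, hc⟩ := Algebra.mem_bot.1 x.2
    refine ⟨c • a, ?_⟩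
    change a ⊗ₜ[k] (x : R) = _
    rw [← hc, Algebra.algebraMap_eq_smul_one, TensorProduct.smul_tmul]
  | add x y hx hy =>
    obtain ⟨a, ha⟩ := hx
    obtain ⟨b, hb⟩ := hy
    refine ⟨a + b, ?_⟩
    rw [TensorProduct.add_tmul, ← ha, ← hb]
    exact map_add _ _ _

theorem central_baseChange (M : Type*) [Field M] [Algebra k M] [Algebra.IsCentral k R] : Algebra.IsCentral M (M ⊗[k] R) := by
  refine ⟨fun z hz => ?_⟩
  rw [Subalgebra.mem_center_iff] at hz
  obtain ⟨a, rfl⟩ := central_tensor M z fun x => hz _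
  exact Algebra.mem_bot.2 ⟨a, rfl⟩

theorem central_tensor2 (A : Type*) [Ring A] [Algebra k A] [Nontrivial R] [Algebra.IsCentral k A] [Algebra.IsCentral k R] : Algebra.IsCentral k (A ⊗[k] R) := by
  refine ⟨fun z hz => ?_⟩
  rw [Subalgebra.mem_center_iff] at hz
  obtain ⟨a, rfl⟩ := central_tensor A z fun x => hz _
  have hinj : Function.Injective (Algebra.TensorProduct.includeLeft : A →ₐ[k] A ⊗[k] R) :=
    Algebra.TensorProduct.includeLeft_injective (algebraMap k R).injective
  have : a ∈ Subalgebra.center k A := Subalgebra.mem_center_iff.2 fun x => by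
    have h := hz (x ⊗ₜ 1)
    apply hinj
    simpa using h
  rw [Algebra.IsCentral.center_eq_bot] at this
  obtain ⟨c, rfl⟩ := Algebra.mem_bot.1 this
  exact Algebra.mem_bot.2 ⟨c, rfl⟩
end indep2

section rp
variable {k M R : Type*} [Field k] [Field M] {σ : k →+* M} [Ring R] [Algebra k R]

theorem rp_of_end {V : Type*} [AddCommGroup V] [Module M V] [FiniteDimensional M V] (φ : R →+* Module.End M V)
    (hφ : ∀ a, φ (algebraMap k R a) = algebraMap M _ (σ a)) {m : ℕ} (hm : finrank M V = m) : Rp σ R m := by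
  let e := LinearMap.toMatrixAlgEquiv (Module.finBasisOfFinrankEq M V hm)
  refine ⟨e.toRingEquiv.toRingHom.comp φ, fun a => ?_⟩
  have := e.commutes (σ a)
  rw [← this, ← hφ]
  rfl

theorem rp_to_end {m : ℕ} (h : Rp σ R m) : ∃ φ : R →+* Module.End M (Fin m → M), ∀ a, φ (algebraMap k R a) = algebraMap M _ (σ a) := by
  obtain ⟨φ, hφ⟩ := h
  let e := (Matrix.toLinAlgEquiv' : Matrix (Fin m) (Fin m) M ≃ₐ[M] _)
  refine ⟨e.toRingEquiv.toRingHom.comp φ, fun a => ?_⟩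
  have := e.commutes (σ a)
  rw [← this, ← hφ]
  rfl

theorem rp_add {m m' : ℕ} (h : Rp σ R m) (h' : Rp σ R m') : Rp σ R (m + m') := by
  obtain ⟨φ, hφ⟩ := rp_to_end h
  obtain ⟨φ', hφ'⟩ := rp_to_end h'
  refine rp_of_end (V := (Fin m → M) × (Fin m' → M)) 
    { toFun := fun x => LinearMap.prodMap (φ x) (φ' x)
      map_one' := by ext <;> simp
      map_zero' := by ext <;> simp
      map_add' := by intros; ext <;> simp
      map_mul' := by intros; ext <;> simp } ?_ (by simp)
  intro a
  change LinearMap.prodMap _ _ = _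
  rw [hφ, hφ']
  ext <;> simp

theorem rp_zero : Rp σ R 0 := ⟨{ toFun := fun _ => 0, map_one' := Subsingleton.elim _ _, map_zero' := rfl, map_add' := by simp, map_mul' := by simp }, fun _ => Subsingleton.elim _ _⟩

theorem rp_mul {m : ℕ} (h : Rp σ R m) (c : ℕ) : Rp σ R (c * m) := by
  induction c with
  | zero => rw [zero_mul]; exact rp_zero
  | succ c ih => rw [Nat.succ_mul]; exact rp_add ih h

theorem rp_comp {N : Type*} [Field N] (τ : M →+* N) {m : ℕ} (h : Rp σ R m) : Rp (τ.comp σ) R m := by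
  obtain ⟨φ, hφ⟩ := h
  refine ⟨τ.mapMatrix.comp φ, fun a => ?_⟩
  rw [RingHom.comp_apply, hφ]
  ext i j
  simp [Matrix.algebraMap_matrix_apply, apply_ite τ]

theorem rp_hom {R' : Type*} [Ring R'] [Algebra k R'] (f : R' →ₐ[k] R) {m : ℕ} (h : Rp σ R m) : Rp σ R' m := by
  obtain ⟨φ, hφ⟩ := h
  exact ⟨φ.comp f.toRingHom, fun a => by rw [← hφ, ← f.commutes]; rfl⟩

theorem rp_restrict {F : Type*} [Field F] [Algebra k F] [FiniteDimensional k F] {m : ℕ} (h : Rp (algebraMap k F) R m) :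
    Rp (RingHom.id k) R (finrank k F * m) := by
  obtain ⟨φ, hφ⟩ := rp_to_end h
  refine rp_of_end (V := Fin m → F) 
    { toFun := fun x => (φ x).restrictScalars k
      map_one' := by rw [map_one]; rfl
      map_zero' := by rw [map_zero]; rfl
      map_add' := by intros; rw [map_add]; rfl
      map_mul' := by intros; rw [map_mul]; rfl } ?_ (by rw [Module.finrank_pi_fintype]; simp [mul_comm])
  intro a
  change (φ _).restrictScalars k = _
  rw [hφ]
  ext x i
  simp [Algebra.smul_def]

theorem rp_baseChange {F : Type*} [Field F] [Algebra k F] (τ : F →+* M) {m : ℕ} (h : Rp (τ.comp (algebraMap k F)) R m) :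
    Rp τ (F ⊗[k] R) m := by
  obtain ⟨φ, hφ⟩ := h
  letI : Algebra F M := τ.toAlgebra
  letI : Algebra k M := (τ.comp (algebraMap k F)).toAlgebra
  haveI : IsScalarTower k F M := IsScalarTower.of_algebraMap_eq fun _ => rfl
  let φ' : R →ₐ[k] Matrix (Fin m) (Fin m) M := { φ with commutes' := hφ }
  let f := Algebra.TensorProduct.lift (Algebra.ofId F (Matrix (Fin m) (Fin m) M)) φ' (fun x y => Algebra.commutes x (φ' y))
  exact ⟨f.toRingHom, fun a => f.commutes a⟩

theorem rp_of_baseChange {F : Type*} [Field F] [Algebra k F] (τ : F →+* M) {m : ℕ} (h : Rp τ (F ⊗[k] R) m) :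
    Rp (τ.comp (algebraMap k F)) R m := by
  obtain ⟨φ, hφ⟩ := h
  refine ⟨φ.comp (Algebra.TensorProduct.includeRight : R →ₐ[k] F ⊗[k] R).toRingHom, fun a => ?_⟩
  rw [RingHom.comp_apply, RingHom.comp_apply, ← hφ, ← one_tmul_algebraMap]
  rfl

theorem rp_matrix {q : ℕ} (h : Rp σ R q) (r : ℕ) : Rp σ (Matrix (Fin r) (Fin r) R) (r * q) := by
  obtain ⟨φ, hφ⟩ := h
  let e1 := Matrix.compRingEquiv (Fin r) (Fin q) M
  let e2 := Matrix.reindexRingEquiv M (finProdFinEquiv (m := r) (n := q))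
  refine ⟨(e2.toRingHom.comp e1.toRingHom).comp φ.mapMatrix, fun a => ?_⟩
  ext x y
  obtain ⟨⟨i, i'⟩, rfl⟩ := finProdFinEquiv.surjective x
  obtain ⟨⟨j, j'⟩, rfl⟩ := finProdFinEquiv.surjective y
  simp [e1, e2, Matrix.algebraMap_matrix_apply, apply_ite φ, hφ]
  by_cases h : i = j <;> by_cases h' : i' = j' <;> simp [h, h', Matrix.algebraMap_matrix_apply]

theorem rp_morita {r m : ℕ} [NeZero r] (h : Rp σ (Matrix (Fin r) (Fin r) R) m) : ∃ q, m = r * q ∧ Rp σ R q := by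
  classical
  obtain ⟨φ, hφ⟩ := rp_to_end h
  let E : Fin r → Fin r → Module.End M (Fin m → M) := fun i j => φ (Matrix.single i j 1)
  have hE : ∀ i j k l x, E i j (E k l x) = if j = k then E i l x else 0 := by
    intro i j k l x
    rw [← Module.End.mul_apply, ← map_mul]
    split_ifs with hjk
    · subst hjk; simp [E]
    · rw [Matrix.single_mul_single_of_ne _ _ _ _ hjk, map_zero]; rfl
  have hs : ∀ d i j x, φ (Matrix.scalar (Fin r) d) (E i j x) = E i j (φ (Matrix.scalar (Fin r) d) x) := by
    intro d i j x
    rw [← Module.End.mul_apply, ← Module.End.mul_apply, ← map_mul, ← map_mul]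
    congr 2
    ext a b
    simp [Matrix.scalar_apply, Matrix.single_apply, Matrix.diagonal_mul, Matrix.mul_diagonal]
    
  have h1 : ∀ x, ∑ i, E i i x = x := by
    intro x
    rw [← LinearMap.sum_apply, ← map_sum]
    have : ∑ i : Fin r, Matrix.single i i (1 : R) = 1 := by
      ext a b
      rw [Matrix.sum_apply]
      simp only [Matrix.single_apply, Matrix.one_apply]
      by_cases hab : a = b
      · subst hab; simp
      · rw [if_neg hab]; exact Finset.sum_eq_zero fun i _ => if_neg fun h => hab (h.1.symm.trans h.2)
    rw [this, map_one]; rfl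
  let V : Submodule M (Fin m → M) := LinearMap.range (E 0 0)
  have hV : ∀ x ∈ V, E 0 0 x = x := by
    rintro _ ⟨y, rfl⟩
    rw [hE, if_pos rfl]
  let e : (Fin m → M) ≃ₗ[M] (Fin r → V) := LinearEquiv.ofLinear
    (LinearMap.pi fun i => (E 0 i).codRestrict V fun x => ⟨E 0 i x, by rw [hE, if_pos rfl]⟩)
    (∑ i, (E i 0).comp (V.subtype.comp (LinearMap.proj i)))
    (by
      refine LinearMap.ext fun y => funext fun i => Subtype.ext ?_
      change E 0 i ((∑ i, (E i 0).comp (V.subtype.comp (LinearMap.proj i))) y) = y i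
      rw [LinearMap.sum_apply, map_sum]
      change ∑ j, E 0 i (E j 0 (y j : Fin m → M)) = y i
      simp only [hE]
      simp [hV _ (y i).2])
    (by
      refine LinearMap.ext fun x => ?_
      rw [LinearMap.comp_apply, LinearMap.sum_apply]
      change ∑ j, E j 0 (E 0 j x) = x
      simp only [hE]
      simpa using h1 x)
  refine ⟨finrank M V, ?_, ?_⟩
  · have := e.finrank_eq
    rw [Module.finrank_fin_fun, Module.finrank_pi_fintype M] at this
    simpa using this
  · have hmem : ∀ d, ∀ x ∈ V, φ (Matrix.scalar (Fin r) d) x ∈ V := by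
      rintro d _ ⟨y, rfl⟩
      rw [hs]; exact ⟨_, rfl⟩
    refine rp_of_end (V := V)
      { toFun := fun d => (φ (Matrix.scalar (Fin r) d)).restrict (hmem d)
        map_one' := by ext x : 2; simp
        map_zero' := by ext x : 2; simp
        map_add' := by intros; ext x : 2; simp only [map_add]; rfl
        map_mul' := by intros; ext x : 2; simp only [map_mul]; rfl } ?_ rfl
    intro a
    ext x : 2
    have := hφ a
    have h3 : Matrix.scalar (Fin r) (algebraMap k R a) = algebraMap k _ a := by ext i j; simp [Matrix.algebraMap_matrix_apply, Matrix.scalar_apply, Matrix.diagonal_apply]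
    simp only [RingHom.coe_mk, MonoidHom.coe_mk, OneHom.coe_mk, LinearMap.restrict_coe_apply, h3, hφ]
    rfl

theorem rp_dvd [Algebra.IsCentral k R] [IsSimpleRing R] [FiniteDimensional k R] {ρ m : ℕ} (hd : finrank k R = ρ ^ 2) (h : Rp σ R m) : ρ ∣ m := by
  let N := AlgebraicClosure M
  letI : Algebra k N := ((algebraMap M N).comp σ).toAlgebra
  have h1 : Rp ((RingHom.id N).comp (algebraMap k N)) R m := rp_comp (algebraMap M N) h
  have h2 := rp_baseChange _ h1
  haveI := tensor_simple (k := k) (M := N) (R := R)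
  obtain ⟨d, _, ⟨e⟩⟩ := IsSimpleRing.exists_algEquiv_matrix_of_isAlgClosed N (N ⊗[k] R)
  have h3 := e.toLinearEquiv.finrank_eq
  rw [Module.finrank_baseChange, hd, Module.finrank_matrix, Fintype.card_fin, finrank_self, mul_one, ← sq] at h3
  have h4 : ρ = d := Nat.pow_left_injective (n := 2) (by norm_num) h3
  subst h4
  obtain ⟨q, hq, -⟩ := rp_morita (rp_hom e.symm.toAlgHom h2)
  exact ⟨q, hq⟩

theorem csa_square (k R : Type*) [Field k] [Ring R] [Algebra k R] [Algebra.IsCentral k R] [IsSimpleRing R] [FiniteDimensional k R] : ∃ ρ, ρ ≠ 0 ∧ finrank k R = ρ ^ 2 := by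
  let N := AlgebraicClosure k
  haveI := tensor_simple (k := k) (M := N) (R := R)
  obtain ⟨d, _, ⟨e⟩⟩ := IsSimpleRing.exists_algEquiv_matrix_of_isAlgClosed N (N ⊗[k] R)
  have h3 := e.toLinearEquiv.finrank_eq
  rw [Module.finrank_baseChange, Module.finrank_matrix, Fintype.card_fin, finrank_self, mul_one, ← sq] at h3
  exact ⟨d, NeZero.ne d, h3⟩
end rp
end ABHN
end part22

section part23
namespace ABHN
open Module NumberField IsDedekindDomain
open scoped TensorProduct

universe u v
theorem csa_wa (k : Type u) (R : Type v) [Field k] [Ring R] [Algebra k R] [Algebra.IsCentral k R] [IsSimpleRing R] [FiniteDimensional k R]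
    {ρ : ℕ} (hd : finrank k R = ρ ^ 2) (hρ : ρ ≠ 0) :
    ∃ (r d : ℕ) (_ : NeZero r) (_ : NeZero d) (D : Type v) (_ : DivisionRing D) (_ : Algebra k D) (_ : FiniteDimensional k D)
      (_ : Algebra.IsCentral k D), Nonempty (R ≃ₐ[k] Matrix (Fin r) (Fin r) D) ∧ r * d = ρ ∧ finrank k D = d ^ 2 := by
  haveI : IsArtinianRing R := IsArtinianRing.of_finite k R
  obtain ⟨r, hr, D, _, _, _, ⟨e⟩⟩ := IsSimpleRing.exists_algEquiv_matrix_divisionRing_finite k R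
  haveI : Algebra.IsCentral k D := by
    refine ⟨fun c hc => ?_⟩
    rw [Subalgebra.mem_center_iff] at hc
    have h1 : e.symm (Matrix.scalar (Fin r) c) ∈ Subalgebra.center k R := by
      rw [Subalgebra.mem_center_iff]
      intro x
      apply e.injective
      rw [map_mul, map_mul, e.apply_symm_apply]
      ext i j
      simp [Matrix.scalar_apply, Matrix.mul_diagonal, Matrix.diagonal_mul, hc]
    rw [Algebra.IsCentral.center_eq_bot] at h1
    obtain ⟨a, ha⟩ := Algebra.mem_bot.1 h1
    refine Algebra.mem_bot.2 ⟨a, ?_⟩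
    have h2 := congrArg e ha
    rw [e.commutes, e.apply_symm_apply] at h2
    have h3 := congrFun (congrFun h2 0) 0
    simpa [Matrix.algebraMap_matrix_apply, Matrix.scalar_apply] using h3
  obtain ⟨d, hd0, hdd⟩ := csa_square k D
  have h4 := e.toLinearEquiv.finrank_eq
  rw [hd, Module.finrank_matrix, Fintype.card_fin, hdd, ← sq, ← mul_pow] at h4
  exact ⟨r, d, hr, ⟨hd0⟩, D, _, _, inferInstance, inferInstance, ⟨e⟩, (Nat.pow_left_injective (n := 2) (by norm_num) h4).symm, hdd⟩

theorem rp_self {k R : Type*} [Field k] [Ring R] [Algebra k R] [FiniteDimensional k R] : Rp (RingHom.id k) R (finrank k R) :=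
  rp_of_end (V := R) (Algebra.lmul k R).toRingHom (fun a => (Algebra.lmul k R).commutes a) rfl

/-- R4 -/
theorem rp_global {K : Type u} {R : Type v} [Field K] [NumberField K] [Ring R] [Algebra K R] [Algebra.IsCentral K R] [IsSimpleRing R]
    [FiniteDimensional K R] {ρ : ℕ} (hd : finrank K R = ρ ^ 2) (hρ : ρ ≠ 0)
    (h : ∀ v : HeightOneSpectrum (𝓞 K), Rp (algebraMap K (v.adicCompletion K)) R ρ) (hr : ∀ σ : K →+* ℝ, Rp σ R ρ) :
    Rp (RingHom.id K) R ρ := by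
  obtain ⟨r, d, _, _, D, _, _, _, _, ⟨e⟩, hrd, hdd⟩ := csa_wa K R hd hρ
  haveI : CharZero D := charZero_of_injective_algebraMap (algebraMap K D).injective
  have key : ∀ {M : Type _} [Field M] (σ : K →+* M), Rp σ R ρ → Rp σ D d := by
    intro M _ σ hh
    obtain ⟨q, hq, h1⟩ := rp_morita (rp_hom e.symm.toAlgHom hh)
    have : d = q := Nat.eq_of_mul_eq_mul_left (NeZero.pos r) (hrd.trans hq)
    rwa [this]
  have key' : ∀ (σ : K →+* ℝ), Rp σ R ρ → Rp σ D d := by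
    intro σ hh
    obtain ⟨q, hq, h1⟩ := rp_morita (rp_hom e.symm.toAlgHom hh)
    have : d = q := Nat.eq_of_mul_eq_mul_left (NeZero.pos r) (hrd.trans hq)
    rwa [this]
  have hd1 := core_div hdd (fun v => key _ (h v)) (fun σ => key' _ (hr σ))
  have h5 : Rp (RingHom.id K) D (finrank K D) := rp_self
  have h6 := rp_hom e.toAlgHom (rp_matrix h5 r)
  rw [hdd, hd1] at h6
  rw [← hrd, hd1]
  exact h6

/-- `f = ∑ a_i x b_i` uniquely -/
theorem sandwich {k R ι : Type*} [Fintype ι] [Field k] [Ring R] [Algebra k R] [Algebra.IsCentral k R] [IsSimpleRing R] [FiniteDimensional k R] (a : Basis ι k R) :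
    ∃ Θ : (ι → R) ≃ₗ[k] Module.End k R, ∀ b x, Θ b x = ∑ i, a i * x * b i := by
  let Θ : (ι → R) →ₗ[k] Module.End k R :=
    { toFun := fun b => ∑ i, LinearMap.mulRight k (b i) ∘ₗ LinearMap.mulLeft k (a i)
      map_add' := by intro b b'; ext x; simp [mul_add, Finset.sum_add_distrib]
      map_smul' := by intro c b; ext x; simp [Finset.smul_sum] }
  have hΘ : ∀ b x, Θ b x = ∑ i, a i * x * b i := by intro b x; simp [Θ]
  have hinj : Function.Injective Θ := by
    rw [injective_iff_map_eq_zero]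
    intro b hb
    let e := Fintype.equivFin ι
    let φ : Rᵐᵒᵖ →+* Module.End k R :=
      { toFun := fun x => LinearMap.mulRight k x.unop
        map_one' := by ext; simp
        map_zero' := by ext; simp
        map_add' := by intros; ext; simp [mul_add]
        map_mul' := by intros; ext; simp [mul_assoc] }
    have := simple_indep2 (k := k) (R := Rᵐᵒᵖ) (B := R) (E := Module.End k R) φ (Algebra.lmul k R).toRingHom (Algebra.lmul_injective) (by
        intro c; ext x; simp [φ, Algebra.smul_def, Algebra.commutes]) (by intro b x; ext y; simp [φ, mul_assoc]) _ (a ∘ e.symm) (a.linearIndependent.comp _ e.symm.injective)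
        (fun i => MulOpposite.op (b (e.symm i))) (by
          ext x
          rw [LinearMap.sum_apply]
          have h := congrArg (fun f => f x) hb
          simp only [hΘ, LinearMap.zero_apply] at h ⊢
          rw [← h, ← e.symm.sum_comp]
          refine Finset.sum_congr rfl fun i _ => ?_
          simp [φ])
    ext i
    simpa using this (e i)
  refine ⟨LinearEquiv.ofInjectiveOfFinrankEq Θ hinj ?_, fun b x => hΘ b x⟩
  rw [Module.finrank_pi_fintype, Module.finrank_linearMap]
  simp [Module.finrank_eq_card_basis a]

end ABHN
end part23

section part24
namespace ABHN
open Module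
open scoped TensorProduct

theorem selfcent {k D L : Type*} [Field k] [DivisionRing D] [Algebra k D] [FiniteDimensional k D] [Algebra.IsCentral k D]
    [Field L] [Algebra k L] [FiniteDimensional k L] (ι : L →ₐ[k] D) (hι : ∀ x, (∀ l, ι l * x = x * ι l) → ∃ l, ι l = x)
    {d : ℕ} (hd : finrank k D = d ^ 2) (hd0 : d ≠ 0) : finrank k L = d ∧ Rp (algebraMap k L) D d := by
  letI : Module L D := Module.compHom D (ι.toOpposite (fun x y => by
    rw [commute_iff_eq, ← map_mul, ← map_mul, mul_comm])).toRingHom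
  have hsm : ∀ (l : L) (x : D), l • x = x * ι l := fun l x => rfl
  haveI : IsScalarTower k L D := ⟨fun c l x => by rw [hsm, hsm, map_smul, mul_smul_comm]⟩
  haveI : FiniteDimensional L D := Module.Finite.right k L D
  have hlm := Module.finrank_mul_finrank k L D
  set m := finrank L D with hm
  let φ : D →+* Module.End L D :=
    { toFun := fun x => { toFun := fun y => x * y, map_add' := mul_add x, map_smul' := fun l y => by simp [hsm, mul_assoc] }
      map_one' := by ext; simp
      map_zero' := by ext; simp
      map_add' := by intros; ext; simp [add_mul]
      map_mul' := by intros; ext; simp [mul_assoc] }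
  have h1 : Rp (algebraMap k L) D m := rp_of_end φ (fun c => by
    ext x
    rw [Module.algebraMap_end_apply, hsm, AlgHom.commutes, ← Algebra.commutes]; rfl) rfl
  have hdm : d ∣ m := rp_dvd hd h1
  have hm0 : m ≠ 0 := by
    rintro h0
    rw [h0, mul_zero, hd] at hlm
    exact pow_ne_zero 2 hd0 hlm.symm
  have hmd : m ≤ d := by
    let a := Module.finBasis k D
    obtain ⟨Θ, hΘ⟩ := sandwich a
    let T : (Fin (finrank k D) → L) →ₗ[k] Module.End k D := Θ.toLinearMap ∘ₗ ι.toLinearMap.compLeft _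
    let rs : Module.End L D →ₗ[k] Module.End k D :=
      { toFun := fun f => f.restrictScalars k, map_add' := fun _ _ => rfl, map_smul' := fun _ _ => rfl }
    have hrs : Function.Injective rs := LinearMap.restrictScalars_injective k
    have hle : LinearMap.range rs ≤ LinearMap.range T := by
      rintro _ ⟨f, rfl⟩
      have hc : ∀ i, ∃ l, ι l = Θ.symm (rs f) i := by
        intro i
        apply hι
        intro l
        have h0 : Θ (fun i => ι l * Θ.symm (rs f) i - Θ.symm (rs f) i * ι l) = 0 := by
          ext x
          rw [hΘ]
          simp only [mul_sub, Finset.sum_sub_distrib]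
          have e1 := hΘ (Θ.symm (rs f)) (x * ι l)
          have e2 := hΘ (Θ.symm (rs f)) x
          rw [Θ.apply_symm_apply] at e1 e2
          have e3 : rs f (x * ι l) = rs f x * ι l := f.map_smul l x
          rw [e1, e2, Finset.sum_mul] at e3
          simp only [mul_assoc] at e3 ⊢
          rw [e3, sub_self]; rfl
        have h0' := Θ.injective (h0.trans (map_zero Θ).symm)
        exact sub_eq_zero.1 (congrFun h0' i)
      choose c hc using hc
      refine ⟨c, ?_⟩
      have : ι.toLinearMap.compLeft _ c = Θ.symm (rs f) := funext hc
      change Θ (ι.toLinearMap.compLeft _ c) = _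
      rw [this, Θ.apply_symm_apply]
    have e1 := Submodule.finrank_mono hle
    rw [LinearMap.finrank_range_of_inj hrs] at e1
    have e2 := e1.trans (LinearMap.finrank_range_le T)
    rw [← Module.finrank_mul_finrank k L (Module.End L D), Module.finrank_linearMap, Module.finrank_pi_fintype] at e2
    simp only [Finset.sum_const, Finset.card_univ, Fintype.card_fin, smul_eq_mul] at e2
    rw [mul_comm (finrank k D), hd] at e2
    have e3 := Nat.le_of_mul_le_mul_left e2 finrank_pos
    rw [← sq] at e3
    exact (Nat.pow_le_pow_iff_left (by norm_num)).1 e3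
  have hmd' : m = d := le_antisymm hmd (Nat.le_of_dvd (Nat.pos_of_ne_zero hm0) hdm)
  rw [hmd'] at h1 hlm
  refine ⟨?_, h1⟩
  rw [hd, sq] at hlm
  exact Nat.eq_of_mul_eq_mul_right (Nat.pos_of_ne_zero hd0) hlm

universe u v
theorem exists_max_subfield {k : Type u} {D : Type v} [Field k] [DivisionRing D] [Algebra k D] [FiniteDimensional k D] [Algebra.IsCentral k D]
    {d : ℕ} (hd : finrank k D = d ^ 2) (hd0 : d ≠ 0) :
    ∃ (L : Type v) (_ : Field L) (_ : Algebra k L), finrank k L = d ∧ Rp (algebraMap k L) D d := by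
  have hwf : WellFounded (fun S T : Subalgebra k D => T < S) :=
    (InvImage.wf (fun S : Subalgebra k D => Subalgebra.toSubmodule S) (wellFounded_gt (α := Submodule k D)))
  obtain ⟨L, hL, hmax⟩ := hwf.has_min {S : Subalgebra k D | ∀ x ∈ S, ∀ y ∈ S, x * y = y * x} ⟨⊥, by
    rintro x hx y hy
    obtain ⟨c, rfl⟩ := Algebra.mem_bot.1 hx
    exact Algebra.commutes _ _⟩
  letI : CommRing L := { (inferInstance : Ring L) with mul_comm := fun x y => Subtype.ext (hL x x.2 y y.2) }
  haveI : IsDomain L := Subalgebra.isDomain L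
  letI : Field L := fieldOfFiniteDimensional k L
  refine ⟨L, inferInstance, inferInstance, selfcent L.val ?_ hd hd0⟩
  intro x hx
  have hx' : ∀ y ∈ L, y * x = x * y := fun y hy => hx ⟨y, hy⟩
  have hcom := Algebra.isMulCommutative_adjoin k (s := (L : Set D) ∪ {x}) (by
    rintro a (ha | ha) b (hb | hb)
    · exact hL a ha b hb
    · rw [Set.mem_singleton_iff.1 hb]; exact hx' a ha
    · rw [Set.mem_singleton_iff.1 ha]; exact (hx' b hb).symm
    · rw [Set.mem_singleton_iff.1 ha, Set.mem_singleton_iff.1 hb])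
  have h1 : ¬ L < Algebra.adjoin k ((L : Set D) ∪ {x}) := hmax _ (fun a ha b hb => 
    congrArg Subtype.val (hcom.is_comm.comm (⟨a, ha⟩ : Algebra.adjoin k ((L : Set D) ∪ {x})) ⟨b, hb⟩))
  have h2 : L ≤ Algebra.adjoin k ((L : Set D) ∪ {x}) := fun y hy => Algebra.subset_adjoin (Or.inl hy)
  have h3 : Algebra.adjoin k ((L : Set D) ∪ {x}) ≤ L := by
    by_contra h
    exact h1 (lt_of_le_not_ge h2 h)
  exact ⟨⟨x, h3 (Algebra.subset_adjoin (Or.inr rfl))⟩, rfl⟩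

/-- local step (1) -/
theorem local_split {K : Type*} {k : Type u} {R : Type v} [Field K] [Field k] (σ : K →+* k) [Ring R] [Algebra K R] [Algebra.IsCentral K R] [IsSimpleRing R]
    [FiniteDimensional K R] {ρ n : ℕ} (hd : finrank K R = ρ ^ 2) (hρ : ρ ≠ 0) (h : Rp σ R (n * ρ)) :
    ∃ (L : Type (max u v)) (_ : Field L) (_ : Algebra k L), finrank k L ≠ 0 ∧ finrank k L ∣ n ∧ Rp ((algebraMap k L).comp σ) R ρ := by
  letI : Algebra K k := σ.toAlgebra
  have h1 : Rp (RingHom.id k) (k ⊗[K] R) (n * ρ) := rp_baseChange (RingHom.id k) h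
  haveI := tensor_simple (k := K) (M := k) (R := R)
  haveI := central_baseChange (k := K) (R := R) k
  have hd' : finrank k (k ⊗[K] R) = ρ ^ 2 := by rw [Module.finrank_baseChange, hd]
  obtain ⟨r, d, _, _, D, _, _, _, _, ⟨e⟩, hrd, hdd⟩ := csa_wa k (k ⊗[K] R) hd' hρ
  obtain ⟨q, hq, h2⟩ := rp_morita (rp_hom e.symm.toAlgHom h1)
  have hq' : q = n * d := by
    rw [← hrd, mul_left_comm] at hq
    exact (Nat.eq_of_mul_eq_mul_left (NeZero.pos r) hq).symm
  have hdn : d ∣ n := by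
    obtain ⟨φ, hφ⟩ := rp_to_end h2
    letI : Module D (Fin q → k) := Module.compHom _ φ
    haveI : IsScalarTower k D (Fin q → k) := ⟨fun c x y => by
      change φ (c • x) y = c • φ x y
      rw [Algebra.smul_def, map_mul, hφ]; rfl⟩
    have h3 := Module.finrank_mul_finrank k D (Fin q → k)
    rw [Module.finrank_fin_fun, hdd] at h3
    replace h3 := h3.trans hq'
    rw [sq, mul_assoc, mul_comm n d] at h3
    exact ⟨_, (Nat.eq_of_mul_eq_mul_left (NeZero.pos d) h3).symm⟩
  obtain ⟨L, _, _, hL, h4⟩ := exists_max_subfield hdd (NeZero.ne d)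
  refine ⟨L, inferInstance, inferInstance, by rw [hL]; exact NeZero.ne d, by rw [hL]; exact hdn, ?_⟩
  have h5 := rp_hom e.toAlgHom (rp_matrix h4 r)
  rw [hrd] at h5
  exact rp_of_baseChange (algebraMap k L) h5
end ABHN
end part24

section part25
namespace ABHN
open Module Polynomial

theorem krasner_ext {k : Type*} [NontriviallyNormedField k] [CompleteSpace k] [CharZero k] [IsUltrametricDist k]
    {L : Type*} [Field L] [Algebra k L] (hL : finrank k L ≠ 0) {n : ℕ} (hn : n ≠ 0) (hdn : finrank k L ∣ n) :
    ∃ f : k[X], f.Monic ∧ f.natDegree = n ∧ ∃ ε : ℝ, 0 < ε ∧ ∀ g : k[X], g.Monic → g.natDegree = n →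
      (∀ i, ‖g.coeff i - f.coeff i‖ < ε) → ∀ (M : Type*) [Field M] [Algebra k M] (β : M), aeval β g = 0 → Nonempty (L →ₐ[k] M) := by
  classical
  haveI : FiniteDimensional k L := FiniteDimensional.of_finrank_pos (Nat.pos_of_ne_zero hL)
  let pb := Field.powerBasisOfFiniteOfSeparable k L
  have hintg : IsIntegral k pb.gen := Algebra.IsIntegral.isIntegral _
  set h := minpoly k pb.gen with hh
  have hmon : h.Monic := minpoly.monic hintg
  have hirr : Irreducible h := minpoly.irreducible hintg
  have hdeg : h.natDegree = finrank k L := by rw [pb.finrank, pb.natDegree_minpoly]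
  obtain ⟨j, hj⟩ := hdn
  have hj0 : j ≠ 0 := by rintro rfl; simp at hj; exact hn hj
  let F := AlgebraicClosure k
  letI : NormedField F := spectralNorm.normedField k F
  letI : NormedAlgebra k F := spectralNorm.normedAlgebra k F
  -- separation
  obtain ⟨δ, hδ, hsep⟩ : ∃ δ : ℝ, 0 < δ ∧ ∀ a ∈ h.rootSet F, ∀ a' ∈ h.rootSet F, a ≠ a' → δ ≤ ‖a - a'‖ := by
    let S : Finset (F × F) := ((h.rootSet F).toFinset ×ˢ (h.rootSet F).toFinset).filter fun x => x.1 ≠ x.2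
    by_cases hS : S.Nonempty
    · obtain ⟨x, hx, hmin⟩ := S.exists_min_image (fun x => ‖x.1 - x.2‖) hS
      refine ⟨‖x.1 - x.2‖, norm_pos_iff.2 (sub_ne_zero.2 (Finset.mem_filter.1 hx).2), fun a ha a' ha' hne => ?_⟩
      exact hmin (a, a') (Finset.mem_filter.2 ⟨Finset.mem_product.2 ⟨by simpa using ha, by simpa using ha'⟩, hne⟩)
    · refine ⟨1, one_pos, fun a ha a' ha' hne => (hS ⟨(a, a'), Finset.mem_filter.2 ⟨Finset.mem_product.2 ⟨by simpa using ha, by simpa using ha'⟩, hne⟩⟩).elim⟩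
  let f := h ^ j
  have hfm : f.Monic := hmon.pow j
  have hfd : f.natDegree = n := by rw [hmon.natDegree_pow, hdeg, hj, mul_comm]
  let C : ℝ := (∑ i ∈ Finset.range n, ‖f.coeff i‖) + 1
  have hC : 1 ≤ C := by
    have : (0 : ℝ) ≤ ∑ i ∈ Finset.range n, ‖f.coeff i‖ := Finset.sum_nonneg fun _ _ => norm_nonneg _
    simp only [C]; linarith
  let ε : ℝ := min 1 ((δ / (C + 1)) ^ n / (n + 1))
  have hε : 0 < ε := by simp only [ε]; positivity
  refine ⟨f, hfm, hfd, ε, hε, ?_⟩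
  intro g hgm hgd hgf M _ _ βM hβM
  have hβint : IsIntegral k βM := ⟨g, hgm, hβM⟩
  have hpirr := minpoly.irreducible hβint
  obtain ⟨β, hβ⟩ := IsAlgClosed.exists_aeval_eq_zero F (minpoly k βM) (by
    exact (Polynomial.degree_pos_of_irreducible hpirr).ne')
  have hmin : minpoly k β = minpoly k βM := (minpoly.eq_of_irreducible_of_monic hpirr hβ (minpoly.monic hβint)).symm
  have hgβ : aeval β g = 0 := by
    obtain ⟨q, hq⟩ := minpoly.dvd k βM hβM
    rw [hq, map_mul, hβ, zero_mul]
  have hβb : ‖β‖ ≤ C + 1 := by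
    have h1 := Polynomial.IsRoot.norm_lt_cauchyBound (p := g.map (algebraMap k F)) (hgm.map _).ne_zero (a := β) (by simpa [Polynomial.IsRoot, Polynomial.eval_map_algebraMap] using hgβ)
    refine (NNReal.coe_le_coe.2 h1.le).trans ?_
    rw [Polynomial.cauchyBound, (hgm.map _).leadingCoeff]
    simp only [nnnorm_one, div_one, NNReal.coe_add, NNReal.coe_one]
    have h2 : (Finset.range (g.map (algebraMap k F)).natDegree).sup (fun x => ‖(g.map (algebraMap k F)).coeff x‖₊) ≤ Real.toNNReal C := by
      refine Finset.sup_le fun i hi => ?_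
      apply NNReal.coe_le_coe.1
      rw [Real.coe_toNNReal _ (by linarith), coe_nnnorm, coeff_map, norm_algebraMap']
      rw [Polynomial.natDegree_map, hgd] at hi
      have h3 : ‖g.coeff i‖ ≤ ‖g.coeff i - f.coeff i‖ + ‖f.coeff i‖ := by
        simpa using norm_add_le (g.coeff i - f.coeff i) (f.coeff i)
      have h4 := Finset.single_le_sum (f := fun i => ‖f.coeff i‖) (fun i _ => norm_nonneg _) hi
      have h5 := (hgf i).le.trans (min_le_left _ _)
      simp only [C]; linarith
    have := NNReal.coe_le_coe.2 h2
    rw [Real.coe_toNNReal _ (by linarith)] at this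
    linarith
  obtain ⟨a, ha, hab⟩ := exists_aroots_norm_sub_lt_of_norm_coeff_sub_lt (f := g) (g := f) (L := F) (ε := (δ / (C + 1)) ^ n / (n + 1)) (by positivity) hgβ hgm hfm
    (hfd.trans hgd.symm) (fun i => by rw [norm_sub_rev]; exact (hgf i).trans_le (min_le_right _ _)) (IsAlgClosed.splits _)
  have hab' : ‖β - a‖ < δ := by
    refine hab.trans_le ?_
    rw [hgd, ← mul_div_assoc, mul_div_cancel_left₀ _ (by positivity), ← Real.rpow_natCast, ← Real.rpow_mul (by positivity), mul_inv_cancel₀ (by exact_mod_cast hn), Real.rpow_one]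
    calc δ / (C + 1) * max ‖β‖ 1 ≤ δ / (C + 1) * (C + 1) := by gcongr; exact max_le hβb (by linarith)
      _ = δ := by field_simp
  have hha : aeval a h = 0 := by
    have := (Polynomial.mem_aroots.1 ha).2
    rw [map_pow] at this
    exact pow_eq_zero_iff hj0 |>.1 this
  have hmina : minpoly k a = h := (minpoly.eq_of_irreducible_of_monic hirr hha hmon).symm
  have hroot : ∀ x : F, aeval x h = 0 → x ∈ h.rootSet F := fun x hx => (Polynomial.mem_rootSet).2 ⟨hmon.ne_zero, hx⟩
  have hmem : a ∈ IntermediateField.adjoin k {β} := by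
    refine IsKrasner.krasner (K := k) (x := a) (y := β) (by rw [hmina]; exact hirr.separable) (IsAlgClosed.splits _) (Algebra.IsIntegral.isIntegral _) ?_
    intro a' hc hne
    rw [norm_sub_rev] at hab'
    refine hab'.trans_le (hsep a (hroot a hha) a' (hroot a' ?_) hne)
    rw [← hmina, hc]
    exact minpoly.aeval _ _
  have hβF : IsIntegral k β := Algebra.IsIntegral.isIntegral _
  let s2 : IntermediateField.adjoin k {β} →ₐ[k] M := (IntermediateField.adjoin.powerBasis hβF).lift βM (by
    rw [IntermediateField.adjoin.powerBasis_gen, IntermediateField.minpoly_gen, hmin]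
    exact minpoly.aeval _ _)
  let s1 : L →ₐ[k] IntermediateField.adjoin k {β} := pb.lift ⟨a, hmem⟩ (by
    apply (algebraMap (IntermediateField.adjoin k {β}) F).injective
    rw [map_zero, ← Polynomial.aeval_algebraMap_apply]
    exact hha)
  exact ⟨s2.comp s1⟩
end ABHN
end part25

section part26
namespace ABHN
open Module IsDedekindDomain
open scoped TensorProduct

section
variable {O k ι : Type*} [CommRing O] [IsDomain O] [IsDiscreteValuationRing O] [Field k] [Algebra O k] [IsFractionRing O k] [Fintype ι] [DecidableEq ι]

theorem indep_lift {τ : Type*} [Finite τ] (w : τ → ι → O) (h : LinearIndependent (IsLocalRing.ResidueField O) (fun t i => IsLocalRing.residue O (w t i))) :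
    LinearIndependent k (fun t i => algebraMap O k (w t i)) := by
  have hO : LinearIndependent O (fun t i => algebraMap O k (w t i)) := by
    haveI := Fintype.ofFinite τ
    rw [Fintype.linearIndependent_iff] at h ⊢
    intro c hc
    by_contra! hne
    obtain ⟨t0, ht0⟩ := hne
    obtain ⟨t, -, ht⟩ := Finset.exists_min_image Finset.univ (fun t => IsDiscreteValuationRing.addVal O (c t)) ⟨t0, Finset.mem_univ _⟩
    have hdv : ∀ s, c t ∣ c s := fun s => IsDiscreteValuationRing.addVal_le_iff_dvd.1 (ht s (Finset.mem_univ _))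
    choose g hg using hdv
    have hct : c t ≠ 0 := fun h0 => ht0 (by rw [hg t0, h0, zero_mul])
    have hgt : g t = 1 := mul_left_cancel₀ hct (by rw [← hg t, mul_one])
    have h2 : ∀ i, ∑ s, g s * w s i = 0 := by
      intro i
      refine mul_left_cancel₀ hct (IsFractionRing.injective O k ?_)
      have := congrFun hc i
      simp only [Finset.sum_apply, Pi.smul_apply, Pi.zero_apply, Algebra.smul_def] at this
      rw [mul_zero, map_zero, Finset.mul_sum, map_sum, ← this]
      refine Finset.sum_congr rfl fun s _ => ?_
      rw [← mul_assoc, ← hg s, map_mul]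
      rfl
    have h3 := h (fun s => IsLocalRing.residue O (g s)) (by
      ext i
      simp only [Finset.sum_apply, Pi.smul_apply, Pi.zero_apply, smul_eq_mul]
      rw [← map_zero (IsLocalRing.residue O), ← h2 i, map_sum]
      simp) t
    simp [hgt] at h3
  exact (LinearIndependent.iff_fractionRing O k).1 hO

theorem rank_lift (M : Matrix ι ι O) : (M.map (IsLocalRing.residue O)).rank ≤ (M.map (algebraMap O k)).rank := by
  classical
  rw [Matrix.rank_eq_finrank_span_cols, Matrix.rank_eq_finrank_span_cols]
  obtain ⟨b, hb⟩ : ∃ b : Fin (finrank (IsLocalRing.ResidueField O) (Submodule.span (IsLocalRing.ResidueField O) (Set.range (M.map (IsLocalRing.residue O)).col))) → ι,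
      LinearIndependent (IsLocalRing.ResidueField O) (fun t => (M.map (IsLocalRing.residue O)).col (b t)) := by
    obtain ⟨f, hf, -, hli⟩ := Submodule.exists_fun_fin_finrank_span_eq (IsLocalRing.ResidueField O) (Set.range (M.map (IsLocalRing.residue O)).col)
    choose b hb using hf
    exact ⟨b, by simpa only [hb] using hli⟩
  have h2 := indep_lift (k := k) (fun t i => M i (b t)) hb
  have h3 := finrank_span_eq_card h2
  rw [Fintype.card_fin] at h3
  rw [← h3]
  refine Submodule.finrank_mono (Submodule.span_mono ?_)
  rintro _ ⟨t, rfl⟩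
  exact ⟨b t, rfl⟩
end

theorem fin_split (κ A : Type*) [Field κ] [Finite κ] [Ring A] [Algebra κ A] [Algebra.IsCentral κ A] [IsSimpleRing A] [FiniteDimensional κ A]
    {ρ : ℕ} (hd : finrank κ A = ρ ^ 2) (hρ : ρ ≠ 0) : Nonempty (A ≃ₐ[κ] Matrix (Fin ρ) (Fin ρ) κ) := by
  obtain ⟨r, d, _, _, D, _, _, _, _, ⟨e⟩, hrd, hD⟩ := csa_wa κ A hd hρ
  haveI : Finite D := Module.finite_of_finite κ
  have hcomm : ∀ x y : D, x * y = y * x := (littleWedderburn D).mul_comm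
  have hsurj : Function.Surjective (algebraMap κ D) := by
    intro x
    have := Algebra.IsCentral.out (K := κ) (D := D) (Subalgebra.mem_center_iff.2 fun y => hcomm y x)
    exact this
  have h1 : finrank κ D = 1 := by
    have := (LinearEquiv.ofBijective (Algebra.linearMap κ D) ⟨(algebraMap κ D).injective, hsurj⟩).finrank_eq
    rw [← this, finrank_self]
  have hd1 : d = 1 := by rw [h1] at hD; exact (Nat.pow_eq_one.1 hD.symm).resolve_right two_ne_zero
  have hr : r = ρ := by rw [← hrd, hd1, mul_one]
  subst hr
  exact ⟨e.trans (AlgEquiv.ofBijective (Algebra.ofId κ D) ⟨(algebraMap κ D).injective, hsurj⟩).symm.mapMatrix⟩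

theorem tcond_csa {κ A ι : Type*} [Field κ] [Ring A] [Nontrivial A] [Algebra κ A] [Fintype ι] [DecidableEq ι] (a : Basis ι κ A) (c : ι → ι → ι → κ)
    (hc : ∀ l m, ∑ i, ∑ j, c l i j • (a i * a m * a j) = if l = m then 1 else 0) : IsSimpleRing A ∧ Algebra.IsCentral κ A := by
  have hx : ∀ l x, ∑ i, ∑ j, c l i j • (a i * x * a j) = algebraMap κ A (a.repr x l) := by
    intro l x
    have h1 : (∑ i, ∑ j, c l i j • (LinearMap.mulRight κ (a j) ∘ₗ LinearMap.mulLeft κ (a i))) = (Algebra.linearMap κ A) ∘ₗ (a.coord l) := by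
      refine a.ext fun m => ?_
      simp only [LinearMap.sum_apply, LinearMap.smul_apply, LinearMap.comp_apply, LinearMap.mulLeft_apply, LinearMap.mulRight_apply, hc]
      simp [Finsupp.single_apply, eq_comm, apply_ite (algebraMap κ A)]
    have := LinearMap.congr_fun h1 x
    simpa only [LinearMap.sum_apply, LinearMap.smul_apply, LinearMap.comp_apply, LinearMap.mulLeft_apply, LinearMap.mulRight_apply, Algebra.linearMap_apply, Basis.coord_apply] using this
  constructor
  · refine isSimpleRing_iff_isTwoSided_imp.2 ⟨inferInstance, fun I hI => ?_⟩
    by_cases h : I = ⊥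
    · exact Or.inl h
    · right
      obtain ⟨x, hxI, hx0⟩ := Submodule.exists_mem_ne_zero_of_ne_bot h
      obtain ⟨l, hl⟩ : ∃ l, a.repr x l ≠ 0 := by
        by_contra! h
        exact hx0 (a.repr.map_eq_zero_iff.1 (Finsupp.ext h))
      refine Ideal.eq_top_of_isUnit_mem I (x := algebraMap κ A (a.repr x l)) ?_ ((IsUnit.mk0 _ hl).map (algebraMap κ A))
      rw [← hx]
      refine Submodule.sum_mem _ fun i _ => Submodule.sum_mem _ fun j _ => ?_
      rw [Algebra.smul_def]
      exact I.mul_mem_left _ (I.mul_mem_right _ (I.mul_mem_left _ hxI))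
  · refine ⟨fun x hxc => ?_⟩
    rw [Subalgebra.mem_center_iff] at hxc
    obtain ⟨l, hl⟩ : ∃ l, a.repr 1 l ≠ 0 := by
      by_contra! h
      exact one_ne_zero (a.repr.map_eq_zero_iff.1 (Finsupp.ext h))
    have h1 := hx l x
    have h2 := congrArg (· * x) (hx l 1)
    simp only [Finset.sum_mul, mul_one, smul_mul_assoc] at h2
    have h3 : algebraMap κ A (a.repr 1 l) * x = algebraMap κ A (a.repr x l) := by
      rw [← h1, ← h2]
      refine Finset.sum_congr rfl fun i _ => Finset.sum_congr rfl fun j _ => ?_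
      rw [mul_assoc, mul_assoc, hxc]
    rw [Algebra.mem_bot]
    refine ⟨(a.repr 1 l)⁻¹ * a.repr x l, ?_⟩
    rw [map_mul, ← h3, ← mul_assoc, ← map_mul, inv_mul_cancel₀ hl, map_one, one_mul]

section
variable {O : Type*} {k ι : Type*} [CommRing O] [IsDomain O] [IsDiscreteValuationRing O] [Field k] [Algebra O k] [IsFractionRing O k] [Fintype ι] [DecidableEq ι]
  [TopologicalSpace O] [IsTopologicalRing O] [CompactSpace O] [T2Space O]

theorem good_local (M : ι → Matrix ι ι O) (s : ι → ι → ι → O) (hmul : ∀ i j, M i * M j = ∑ l, s i j l • M l) (u : ι → O)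
    (hone : ∑ i, u i • M i = 1) (hu : ∀ i, (M i).mulVec u = Pi.single i 1) (c : ι → ι → ι → O)
    (hc : ∀ l m, ∑ i, ∑ j, c l i j • (M i * M m * M j) = if l = m then 1 else 0) {ρ : ℕ} (hρ : ρ ≠ 0) (hι : Fintype.card ι = ρ ^ 2) :
    ∃ t : ι → O, (∑ i, t i • M i) * (∑ i, t i • M i) = ∑ i, t i • M i ∧ (∑ i, t i • M i) ≠ 0 ∧
      ((∑ i, t i • M i).map (algebraMap O k)).rank ≤ ρ := by
  classical
  let κ := IsLocalRing.ResidueField O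
  let q : O →+* κ := IsLocalRing.residue O
  let Q : Matrix ι ι O →+* Matrix ι ι κ := q.mapMatrix
  let N : ι → Matrix ι ι κ := fun i => Q (M i)
  have hQs : ∀ (x : O) (X : Matrix ι ι O), Q (x • X) = q x • Q X := by
    intro x X; ext i j; simp [Q]
  have hNmul : ∀ i j, N i * N j = ∑ l, q (s i j l) • N l := by
    intro i j
    rw [← map_mul, hmul, map_sum]; simp only [hQs]; rfl
  have hNone : ∑ i, q (u i) • N i = 1 := by
    rw [← map_one Q, ← hone, map_sum]; simp only [hQs]; rfl
  let A : Subalgebra κ (Matrix ι ι κ) := Submodule.toSubalgebra (Submodule.span κ (Set.range N))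
    (by rw [← hNone]; exact Submodule.sum_mem _ fun i _ => Submodule.smul_mem _ _ (Submodule.subset_span ⟨i, rfl⟩))
    (by
      intro x y hx hy
      induction hx using Submodule.span_induction with
      | mem x hx =>
        obtain ⟨i, rfl⟩ := hx
        induction hy using Submodule.span_induction with
        | mem y hy =>
          obtain ⟨j, rfl⟩ := hy
          rw [hNmul]; exact Submodule.sum_mem _ fun i _ => Submodule.smul_mem _ _ (Submodule.subset_span ⟨i, rfl⟩)
        | zero => simp
        | add y z _ _ h1 h2 => rw [mul_add]; exact Submodule.add_mem _ h1 h2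
        | smul r y _ h => rw [mul_smul_comm]; exact Submodule.smul_mem _ _ h
      | zero => simp
      | add y z _ _ h1 h2 => rw [add_mul]; exact Submodule.add_mem _ h1 h2
      | smul r y _ h => rw [smul_mul_assoc]; exact Submodule.smul_mem _ _ h)
  have hNA : ∀ i, N i ∈ A := fun i => Submodule.subset_span ⟨i, rfl⟩
  have hNu : ∀ i, (N i).mulVec (fun j => q (u j)) = Pi.single i 1 := by
    intro i
    have h1 := congrArg (fun w : ι → O => fun j => q (w j)) (hu i)
    ext j
    have := congrFun h1 j
    simp only [Matrix.mulVec, dotProduct, map_sum, map_mul, Pi.single_apply, apply_ite q, map_one, map_zero] at this ⊢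
    exact this
  have hli : LinearIndependent κ N := by
    rw [Fintype.linearIndependent_iff]
    intro g hg i
    have := congrFun (congrArg (fun X : Matrix ι ι κ => X.mulVec (fun j => q (u j))) hg) i
    simpa [Matrix.sum_mulVec, Matrix.smul_mulVec, hNu, Finset.sum_apply, Pi.single_apply] using this
  let a : Basis ι κ A := Basis.span hli
  have ha : ∀ i, (a i : Matrix ι ι κ) = N i := fun i => by
    have := Basis.span_apply hli i
    exact congrArg Subtype.val this
  have hne : Nonempty ι := Fintype.card_pos_iff.1 (by rw [hι]; positivity)
  have hcsa := tcond_csa a (fun l i j => q (c l i j)) (by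
    intro l m
    apply Subtype.ext
    have := congrArg Q (hc l m)
    rw [map_sum] at this
    simp only [map_sum, hQs, map_mul] at this
    have e2 : ((if l = m then (1 : A) else 0 : A) : Matrix ι ι κ) = if l = m then 1 else 0 := by split_ifs <;> rfl
    rw [e2]
    simp only [AddSubmonoidClass.coe_finset_sum, SetLike.val_smul, MulMemClass.coe_mul, ha]
    rw [apply_ite Q, map_one, map_zero] at this
    exact this)
  obtain ⟨h1, h2⟩ := hcsa
  haveI : FiniteDimensional κ A := a.finiteDimensional_of_finite
  haveI : Finite κ := inferInstanceAs (Finite (IsLocalRing.ResidueField O))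
  obtain ⟨θ⟩ := fin_split κ A (ρ := ρ) (by rw [finrank_eq_card_basis a, hι]) hρ
  haveI : NeZero ρ := ⟨hρ⟩
  let e0 : A := θ.symm (Matrix.single 0 0 1)
  have he0 : e0 * e0 = e0 := by rw [← map_mul, Matrix.single_mul_single_same, one_mul]
  have he00 : e0 ≠ 0 := by
    intro h
    have := (map_eq_zero_iff θ.symm θ.symm.injective).1 h
    have := congrFun (congrFun this 0) 0
    simp at this
  -- rank of e0
  have hrk : (e0 : Matrix ι ι κ).rank ≤ ρ := by
    let W0 : (Fin ρ → κ) →ₗ[κ] Matrix (Fin ρ) (Fin ρ) κ :=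
      { toFun := fun w => Matrix.of fun i j => if i = 0 then w j else 0
        map_add' := by intro x y; ext i j; simp; split_ifs <;> simp
        map_smul' := by intro x y; ext i j; simp }
    let W1 : Matrix ι ι κ →ₗ[κ] (ι → κ) :=
      { toFun := fun X => X.mulVec (fun j => q (u j))
        map_add' := by intro x y; exact Matrix.add_mulVec _ _ _
        map_smul' := by intro x y; exact Matrix.smul_mulVec _ _ _ }
    let W : (Fin ρ → κ) →ₗ[κ] (ι → κ) := W1 ∘ₗ A.val.toLinearMap ∘ₗ θ.symm.toLinearMap ∘ₗ W0
    have hle : (e0 : Matrix ι ι κ).mulVecLin.range ≤ W.range := by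
      rintro _ ⟨y, rfl⟩
      let x : A := ∑ i, y i • a i
      have hx : W1 (x : Matrix ι ι κ) = y := by
        ext j
        simp only [x, AddSubmonoidClass.coe_finset_sum, SetLike.val_smul, ha, map_sum, map_smul]
        simp only [W1, LinearMap.coe_mk, AddHom.coe_mk, hNu, Finset.sum_apply, Pi.smul_apply, Pi.single_apply]
        simp
      refine ⟨fun j => θ x 0 j, ?_⟩
      have h1 : θ.symm (W0 (fun j => θ x 0 j)) = e0 * x := by
        apply θ.injective
        rw [map_mul, AlgEquiv.apply_symm_apply, AlgEquiv.apply_symm_apply]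
        ext i j
        by_cases hi : i = 0
        · subst hi; simp [W0]
        · simp [W0, hi]
      change W1 (θ.symm (W0 (fun j => θ x 0 j)) : Matrix ι ι κ) = _
      rw [h1, Matrix.mulVecLin_apply, ← hx]
      exact (Matrix.mulVec_mulVec _ _ _).symm
    calc (e0 : Matrix ι ι κ).rank ≤ finrank κ W.range := Submodule.finrank_mono hle
      _ ≤ finrank κ (Fin ρ → κ) := LinearMap.finrank_range_le W
      _ = ρ := by simp
  -- lift
  let G : (ι → O) → Matrix ι ι O := fun t => ∑ i, t i • M i
  have hG : Continuous G := by
    refine continuous_finset_sum _ fun i _ => ?_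
    exact (continuous_apply i).smul continuous_const
  have hQc : IsClosed {X : Matrix ι ι O | Q X = e0} := by
    have h0 : IsClosed (X := O) (IsLocalRing.maximalIdeal O) :=
      (IsLocalRing.maximalIdeal O).toAddSubgroup.isClosed_of_isOpen (IsLocalRing.isOpen_maximalIdeal O)
    have h1 : {X : Matrix ι ι O | Q X = e0} = ⋂ i, ⋂ j, {X | q (X i j) = (e0 : Matrix ι ι κ) i j} := by
      ext X
      simp only [Set.mem_setOf_eq, Set.mem_iInter]
      exact ⟨fun h i j => by rw [← h]; rfl, fun h => by ext i j; exact h i j⟩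
    rw [h1]
    refine isClosed_iInter fun i => isClosed_iInter fun j => ?_
    obtain ⟨z, hz⟩ := IsLocalRing.residue_surjective ((e0 : Matrix ι ι κ) i j)
    have h2 : {X : Matrix ι ι O | q (X i j) = (e0 : Matrix ι ι κ) i j} = (fun X : Matrix ι ι O => X i j - z) ⁻¹' (IsLocalRing.maximalIdeal O) := by
      ext X
      simp only [Set.mem_setOf_eq, Set.mem_preimage, SetLike.mem_coe]
      rw [← hz, ← IsLocalRing.residue_eq_zero_iff, map_sub, sub_eq_zero]
    rw [h2]
    exact h0.preimage (by fun_prop)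
  obtain ⟨P, hP, hPP⟩ := exists_idempotent_in_compact_subsemigroup (M := Matrix ι ι O) (fun r => by fun_prop) (Set.range G ∩ {X | Q X = e0}) (by
      obtain ⟨t, ht⟩ : ∃ t : ι → O, Q (G t) = e0 := by
        choose t ht using fun i => IsLocalRing.residue_surjective (a.repr e0 i)
        refine ⟨t, ?_⟩
        have := congrArg Subtype.val (a.sum_repr e0)
        rw [← this]
        simp only [G, map_sum, hQs, AddSubmonoidClass.coe_finset_sum, SetLike.val_smul, ha]
        exact Finset.sum_congr rfl fun i _ => by rw [← ht i]
      exact ⟨G t, ⟨t, rfl⟩, ht⟩)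
    ((isCompact_range hG).inter_right hQc) (by
      rintro _ ⟨⟨t, rfl⟩, ht⟩ _ ⟨⟨t', rfl⟩, ht'⟩
      refine ⟨⟨fun l => ∑ i, ∑ j, t i * t' j * s i j l, ?_⟩, ?_⟩
      · simp only [G, Finset.sum_mul, Finset.mul_sum, smul_mul_assoc, mul_smul_comm, hmul, Finset.smul_sum, Finset.sum_smul, smul_smul]
        rw [Finset.sum_comm]
        conv_rhs => rw [Finset.sum_comm]
        refine Finset.sum_congr rfl fun y _ => ?_
        rw [Finset.sum_comm]
        refine Finset.sum_congr rfl fun i _ => Finset.sum_congr rfl fun x _ => ?_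
        rw [mul_left_comm, mul_assoc]
      · change Q _ = _
        rw [map_mul, ht, ht', ← MulMemClass.coe_mul, he0])
  obtain ⟨⟨t, rfl⟩, hQP⟩ := hP
  refine ⟨t, hPP, ?_, ?_⟩
  · intro h0
    apply he00
    apply Subtype.ext
    rw [← hQP]
    simp only [G, h0, map_zero]; rfl
  · have h3 := rank_lift (k := k) (1 - G t)
    have h4 : ((1 - G t).map (algebraMap O k)).rank + ((G t).map (algebraMap O k)).rank ≤ Fintype.card ι := by
      refine Matrix.rank_add_rank_le_card_of_mul_eq_zero ?_
      rw [← RingHom.mapMatrix_apply, ← RingHom.mapMatrix_apply, ← map_mul, sub_mul, one_mul]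
      simp only [G] at hPP ⊢
      rw [hPP, sub_self, map_zero]
    have h5 : Fintype.card ι ≤ ((1 - G t).map (IsLocalRing.residue O)).rank + (e0 : Matrix ι ι κ).rank := by
      have e1 : (1 - G t).map (IsLocalRing.residue O) = 1 - (e0 : Matrix ι ι κ) := by
        rw [← hQP, ← map_one Q, ← map_sub]; rfl
      rw [e1]
      have e2 : (⊤ : Submodule κ (ι → κ)) ≤ (1 - (e0 : Matrix ι ι κ)).mulVecLin.range ⊔ (e0 : Matrix ι ι κ).mulVecLin.range := by
        intro y _
        have : y = (1 - (e0 : Matrix ι ι κ)).mulVecLin y + (e0 : Matrix ι ι κ).mulVecLin y := by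
          simp [Matrix.sub_mulVec]
        rw [this]
        exact Submodule.add_mem_sup ⟨_, rfl⟩ ⟨_, rfl⟩
      have e3 := (Submodule.finrank_mono e2).trans (Submodule.finrank_add_le_finrank_add_finrank _ _)
      rw [finrank_top, finrank_fintype_fun_eq_card] at e3
      exact e3
    change ((G t).map (algebraMap O k)).rank ≤ ρ
    omega

theorem rp_op {F M R : Type*} [Field F] [Field M] [Ring R] [Algebra F R] (σ : F →+* M) {m : ℕ} (h : Rp σ Rᵐᵒᵖ m) : Rp σ R m := by
  obtain ⟨φ, hφ⟩ := h
  refine ⟨{ toFun := fun x => (φ (MulOpposite.op x)).transpose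
            map_one' := by simp
            map_mul' := by intro x y; rw [MulOpposite.op_mul, map_mul, Matrix.transpose_mul]
            map_zero' := by simp
            map_add' := by intro x y; rw [MulOpposite.op_add, map_add, Matrix.transpose_add] }, fun a => ?_⟩
  have := hφ a
  change (φ (algebraMap F Rᵐᵒᵖ a)).transpose = _
  rw [this]
  simp [Matrix.algebraMap_eq_diagonal]

theorem good_local2 {K R : Type*} [Field K] [Ring R] [Algebra K R] [Algebra.IsCentral K R] [IsSimpleRing R] [FiniteDimensional K R]
    [Algebra K k] (b : Basis ι K R) (c : ι → ι → ι → K) (hc : ∀ l m, ∑ i, ∑ j, c l i j • (b i * b m * b j) = if l = m then 1 else 0)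
    (hsO : ∀ i j l, ∃ y : O, algebraMap O k y = algebraMap K k (b.repr (b i * b j) l))
    (huO : ∀ i, ∃ y : O, algebraMap O k y = algebraMap K k (b.repr 1 i))
    (hcO : ∀ l i j, ∃ y : O, algebraMap O k y = algebraMap K k (c l i j)) {ρ : ℕ} (hρ : ρ ≠ 0) (hι : Fintype.card ι = ρ ^ 2) :
    Rp (algebraMap K k) R ρ := by
  classical
  choose sO hsO using hsO
  choose uO huO using huO
  choose cO hcO using hcO
  have hOk := IsFractionRing.injective O k
  let M : ι → Matrix ι ι O := fun i => Matrix.of fun l j => sO i j l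
  let L : R →ₐ[K] Matrix ι ι K := Algebra.leftMulMatrix b
  let φ : Matrix ι ι K →+* Matrix ι ι k := (algebraMap K k).mapMatrix
  let ψ : Matrix ι ι O →+* Matrix ι ι k := (algebraMap O k).mapMatrix
  have hψ : Function.Injective ψ := fun X Y h => by
    ext i j; exact hOk (congrFun (congrFun h i) j)
  have hψs : ∀ (x : O) X, ψ (x • X) = algebraMap O k x • ψ X := by intro x X; ext i j; simp [ψ]
  have hφs : ∀ (x : K) X, φ (x • X) = algebraMap K k x • φ X := by intro x X; ext i j; simp [φ]
  have hM : ∀ i, ψ (M i) = φ (L (b i)) := by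
    intro i; ext l j
    simp only [ψ, φ, L, M, RingHom.mapMatrix_apply, Matrix.map_apply, Matrix.of_apply, hsO, Algebra.leftMulMatrix_eq_repr_mul]
  obtain ⟨t, hPP, hP0, hrk⟩ := good_local (k := k) M sO (by
      intro i j
      apply hψ
      rw [map_mul, map_sum]
      simp only [hψs, hM, hsO]
      rw [← map_mul, ← map_mul, ← b.sum_repr (b i * b j), map_sum, map_sum]
      simp only [map_smul, hφs, Basis.sum_repr]) uO (by
      apply hψ
      rw [map_sum]
      simp only [hψs, hM, huO, map_one]
      have h1 := congrArg (fun x => φ (L x)) (b.sum_repr 1)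
      simpa only [map_sum, map_smul, hφs, map_one] using h1) (by
      intro i
      ext l
      apply hOk
      have h1 : (L (b i)).mulVec (b.repr 1) l = (Pi.single i 1 : ι → K) l := by
        rw [Algebra.leftMulMatrix_mulVec_repr, mul_one, Basis.repr_self, Finsupp.single_eq_pi_single]
      have h2 := congrArg (algebraMap K k) h1
      have h3 := hM i
      simp only [Matrix.mulVec, dotProduct, map_sum, map_mul, Pi.single_apply, apply_ite (algebraMap K k), apply_ite (algebraMap O k), map_one, map_zero] at h2 ⊢
      rw [← h2]
      refine Finset.sum_congr rfl fun j _ => ?_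
      rw [huO]
      exact congrArg (· * _) (congrFun (congrFun h3 l) j)) cO (by
      intro l m
      apply hψ
      have h1 := congrArg (fun x => φ (L x)) (hc l m)
      simp only [map_sum, map_smul, map_mul, hφs, apply_ite L, apply_ite φ, map_one, map_zero] at h1
      rw [map_sum]
      simp only [map_sum, hψs, map_mul, hM, hcO, apply_ite ψ, map_one, map_zero]
      exact h1) hρ hι
  let B : Basis ι k (k ⊗[K] R) := Algebra.TensorProduct.basis k b
  let e : k ⊗[K] R := ∑ i, algebraMap O k (t i) • (1 ⊗ₜ b i)
  have hBL : ∀ x : R, Algebra.leftMulMatrix B (1 ⊗ₜ x) = φ (L x) := by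
    intro x; ext l j
    simp [Algebra.leftMulMatrix_eq_repr_mul, B, φ, L, Algebra.algebraMap_eq_smul_one]
  have he : Algebra.leftMulMatrix B e = ψ (∑ i, t i • M i) := by
    simp only [e, map_sum, map_smul, hBL, hψs, hM]
  have hinj := Algebra.leftMulMatrix_injective B
  have hee : e * e = e := hinj (by rw [map_mul, he, ← map_mul, hPP])
  have he0 : e ≠ 0 := fun h => hP0 (hψ (by rw [← he, h, map_zero, map_zero]))
  let V : Submodule k (k ⊗[K] R) := (LinearMap.mulLeft k e).range
  haveI : FiniteDimensional k (k ⊗[K] R) := B.finiteDimensional_of_finite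
  have hV : finrank k V ≤ ρ := by
    refine le_trans (le_of_eq ?_) hrk
    change finrank k (LinearMap.mulLeft k e).range = (ψ (∑ i, t i • M i)).rank
    rw [← he, Matrix.rank_eq_finrank_range_toLin _ B B]
    have : LinearMap.mulLeft k e = (Matrix.toLin B B) (Algebra.leftMulMatrix B e) := ((Matrix.toLin_toMatrix B B (Algebra.lmul k _ e))).symm
    rw [this]
  have hVm : ∀ x : R, ∀ y ∈ V, LinearMap.mulRight k (1 ⊗ₜ x : k ⊗[K] R) y ∈ V := by
    rintro x _ ⟨z, rfl⟩
    exact ⟨z * (1 ⊗ₜ x), by simp [mul_assoc]⟩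
  let Φ : Rᵐᵒᵖ →+* Module.End k V :=
    { toFun := fun x => (LinearMap.mulRight k (1 ⊗ₜ x.unop : k ⊗[K] R)).restrict (hVm x.unop)
      map_one' := by ext y; simp [← Algebra.TensorProduct.one_def]
      map_mul' := by
        intro x y; ext z
        simp only [LinearMap.restrict_coe_apply, LinearMap.mulRight_apply, Module.End.mul_apply, MulOpposite.unop_mul, mul_assoc, Algebra.TensorProduct.tmul_mul_tmul, mul_one]
      map_zero' := by ext y; simp
      map_add' := by intro x y; ext z; simp [TensorProduct.tmul_add, mul_add] }
  have h1 : Rp (algebraMap K k) Rᵐᵒᵖ (finrank k V) := rp_of_end Φ (by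
    intro a
    ext y
    change (y : k ⊗[K] R) * (1 ⊗ₜ (algebraMap K R a)) = _
    rw [one_tmul_algebraMap]
    rw [← Algebra.commutes, ← Algebra.smul_def]
    rfl) rfl
  have h2 : finrank K Rᵐᵒᵖ = ρ ^ 2 := by
    rw [← hι, ← finrank_eq_card_basis b]
    exact (MulOpposite.opLinearEquiv K).finrank_eq.symm
  have h3 := rp_dvd h2 h1
  have h4 : finrank k V ≠ 0 := by
    intro h
    have := Submodule.finrank_eq_zero.1 h
    have h5 : e ∈ V := ⟨e, hee⟩
    rw [this] at h5
    exact he0 h5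
  have h5 : finrank k V = ρ := le_antisymm hV (Nat.le_of_dvd (Nat.pos_of_ne_zero h4) h3)
  rw [h5] at h1
  exact rp_op _ h1
end

open NumberField

theorem finite_residue {K : Type*} [Field K] [NumberField K] (v : HeightOneSpectrum (𝓞 K)) : CompactSpace (v.adicCompletionIntegers K) := by
  have hfin : Finite (IsLocalRing.ResidueField (v.adicCompletionIntegers K)) := by
    haveI : Finite (𝓞 K ⧸ v.asIdeal) := Ideal.finiteQuotientOfFreeOfNeBot _ v.ne_bot
    obtain ⟨m, hm, hm0⟩ := Submodule.exists_mem_ne_zero_of_ne_bot v.ne_bot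
    have hmv : v.intValuation m < 1 := (v.intValuation_lt_one_iff_mem m).2 hm
    let f : 𝓞 K →+* IsLocalRing.ResidueField (v.adicCompletionIntegers K) := (IsLocalRing.residue _).comp (algebraMap (𝓞 K) (v.adicCompletionIntegers K))
    have hlt : ∀ x : v.adicCompletionIntegers K, Valued.v (x : v.adicCompletion K) < 1 → IsLocalRing.residue _ x = 0 := by
      intro x hx
      rw [IsLocalRing.residue_eq_zero_iff, IsLocalRing.mem_maximalIdeal, mem_nonunits_iff, HeightOneSpectrum.adicCompletionIntegers.isUnit_iff_valued_eq_one]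
      exact hx.ne
    refine Finite.of_surjective (Ideal.Quotient.lift v.asIdeal f ?_) ?_
    · intro r hr
      apply hlt
      exact (val_alg (K := K) v r).le.trans_lt ((v.intValuation_lt_one_iff_mem r).2 hr)
    · refine Ideal.Quotient.lift_surjective_of_surjective _ _ ?_
      intro y
      obtain ⟨a, rfl⟩ := IsLocalRing.residue_surjective y
      obtain ⟨r, hr⟩ := approx_int v (a : v.adicCompletion K) a.2 m hm0
      refine ⟨r, ?_⟩
      symm
      rw [← sub_eq_zero]
      change IsLocalRing.residue _ a - IsLocalRing.residue _ _ = 0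
      rw [← map_sub]
      apply hlt
      exact hr.trans_lt hmv
  refine Valued.integer.compactSpace_iff_completeSpace_and_isDiscreteValuationRing_and_finite_residueField.2 ⟨?_, ?_, hfin⟩
  · exact (Valued.isClosed_integer (v.adicCompletion K)).completeSpace_coe
  · exact inferInstanceAs (IsDiscreteValuationRing (v.adicCompletionIntegers K))

theorem good_places {K R : Type*} [Field K] [NumberField K] [Ring R] [Algebra K R] [Algebra.IsCentral K R] [IsSimpleRing R] [FiniteDimensional K R]
    {ρ : ℕ} (hd : finrank K R = ρ ^ 2) (hρ : ρ ≠ 0) : {v : HeightOneSpectrum (𝓞 K) | ¬ Rp (algebraMap K (v.adicCompletion K)) R ρ}.Finite := by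
  classical
  let b := finBasis K R
  obtain ⟨Θ, hΘ⟩ := sandwich b
  let β : Fin (finrank K R) → Fin (finrank K R) → R := fun l => Θ.symm ((Algebra.linearMap K R) ∘ₗ b.coord l)
  let c : Fin (finrank K R) → Fin (finrank K R) → Fin (finrank K R) → K := fun l i j => b.repr (β l i) j
  have hc : ∀ l m, ∑ i, ∑ j, c l i j • (b i * b m * b j) = if l = m then 1 else 0 := by
    intro l m
    have h1 := hΘ (β l) (b m)
    rw [LinearEquiv.apply_symm_apply] at h1
    have h2 : ∀ i, ∑ j, c l i j • (b i * b m * b j) = b i * b m * β l i := by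
      intro i
      conv_rhs => rw [← b.sum_repr (β l i), Finset.mul_sum]
      simp only [mul_smul_comm, c]
    simp only [h2, ← h1]
    simp [Finsupp.single_apply, eq_comm, apply_ite (algebraMap K R)]
  have hT : (⋃ i, ⋃ j, ⋃ l, HeightOneSpectrum.Support (𝓞 K) (b.repr (b i * b j) l) ∪ HeightOneSpectrum.Support (𝓞 K) (b.repr 1 i) ∪
      HeightOneSpectrum.Support (𝓞 K) (c l i j)).Finite := by
    refine Set.finite_iUnion fun i => Set.finite_iUnion fun j => Set.finite_iUnion fun l => ?_
    exact ((HeightOneSpectrum.Support.finite _ _).union (HeightOneSpectrum.Support.finite _ _)).union (HeightOneSpectrum.Support.finite _ _)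
  refine hT.subset fun v hv => ?_
  by_contra hn
  apply hv
  simp only [Set.mem_iUnion, not_exists, Set.mem_union, not_or, HeightOneSpectrum.Support, Set.mem_setOf_eq, not_lt] at hn
  have hlift : ∀ x : K, v.valuation K x ≤ 1 → ∃ y : v.adicCompletionIntegers K, algebraMap (v.adicCompletionIntegers K) (v.adicCompletion K) y = algebraMap K (v.adicCompletion K) x := by
    intro x hx
    refine ⟨⟨algebraMap K (v.adicCompletion K) x, ?_⟩, rfl⟩
    rw [HeightOneSpectrum.mem_adicCompletionIntegers]
    exact (HeightOneSpectrum.valuedAdicCompletion_eq_valuation' v x).le.trans hx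
  haveI := finite_residue v
  exact good_local2 (O := v.adicCompletionIntegers K) b c hc (fun i j l => hlift _ (hn i j l).1.1)
    (fun i => hlift _ (hn i i i).1.2) (fun l i j => hlift _ (hn i j l).2) hρ (by rw [Fintype.card_fin, hd])
end ABHN
end part26

section part27
namespace ABHN
open Module IsDedekindDomain NumberField Polynomial
open scoped TensorProduct

theorem comp_hom (K F : Type*) [Field K] [NumberField K] [Field F] [NumberField F] [Algebra K F] (u : HeightOneSpectrum (𝓞 F)) :
    ∃ (v : HeightOneSpectrum (𝓞 K)) (τ : v.adicCompletion K →+* u.adicCompletion F),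
      τ.comp (algebraMap K (v.adicCompletion K)) = (algebraMap F (u.adicCompletion F)).comp (algebraMap K F) := by
  let v : HeightOneSpectrum (𝓞 K) := ⟨u.asIdeal.comap (algebraMap (𝓞 K) (𝓞 F)), inferInstance, Ideal.IsIntegral.comap_ne_bot (𝓞 K) u.ne_bot⟩
  haveI : u.asIdeal.LiesOver v.asIdeal := ⟨rfl⟩
  have hc := (HeightOneSpectrum.uniformContinuous_algebraMap_liesOver K F v u).continuous
  let τ0 := UniformSpace.Completion.mapRingHom (algebraMap (WithVal (v.valuation K)) (WithVal (u.valuation F))) hc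
  let τ : v.adicCompletion K →+* u.adicCompletion F :=
    { toFun := fun x => .ofCompletion (τ0 x.toCompletion)
      map_one' := congrArg _ (map_one τ0)
      map_zero' := congrArg _ (map_zero τ0)
      map_mul' := fun x y => congrArg _ (map_mul τ0 _ _)
      map_add' := fun x y => congrArg _ (map_add τ0 _ _) }
  refine ⟨v, τ, ?_⟩
  ext x
  exact UniformSpace.Completion.mapRingHom_coe hc (WithVal.toVal _ x)

theorem krasner_val {k Γ : Type*} [Field k] [LinearOrderedCommGroupWithZero Γ] [val : Valued k Γ] [hv : val.v.RankOne] [CompleteSpace k] [CharZero k]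
    {L : Type*} [Field L] [Algebra k L] (hL : finrank k L ≠ 0) {n : ℕ} (hn : n ≠ 0) (hdn : finrank k L ∣ n) :
    ∃ f : k[X], ∃ y : k, y ≠ 0 ∧ ∀ g : k[X], g.Monic → g.natDegree = n →
      (∀ i < n, Valued.v (g.coeff i - f.coeff i) ≤ Valued.v y) → ∀ (M : Type*) [Field M] [Algebra k M] (β : M), aeval β g = 0 → Nonempty (L →ₐ[k] M) := by
  letI : NontriviallyNormedField k := Valued.toNontriviallyNormedField k Γ
  haveI : IsUltrametricDist k := Valued.instIsUltrametricDist k Γ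
  obtain ⟨f, hfm, hfn, ε, hε, H⟩ := krasner_ext (k := k) hL hn hdn
  obtain ⟨y, hy0, hy⟩ := NormedField.exists_norm_lt k hε
  refine ⟨f, y, norm_pos_iff.1 hy0, fun g hgm hgn hg M _ _ β hβ => H g hgm hgn (fun i => ?_) M β hβ⟩
  rcases lt_trichotomy i n with h | h | h
  · exact lt_of_le_of_lt (Valued.toNormedField.norm_le_iff.2 (hg i h)) hy
  · subst h
    have h1 : g.coeff i = 1 := by rw [← hgn]; exact hgm.coeff_natDegree
    have h2 : f.coeff i = 1 := by rw [← hfn]; exact hfm.coeff_natDegree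
    rw [h1, h2, sub_self, norm_zero]; exact hε
  · rw [coeff_eq_zero_of_natDegree_lt (by omega), coeff_eq_zero_of_natDegree_lt (by omega), sub_self, norm_zero]; exact hε

universe u v

theorem irr_step {K : Type u} {R : Type v} [Field K] [NumberField K] [Ring R] [Algebra K R] [Algebra.IsCentral K R] [IsSimpleRing R]
    [FiniteDimensional K R] {ρ : ℕ} (hd : finrank K R = ρ ^ 2) (hρ : ρ ≠ 0) (p : K[X]) (hp : Irreducible p)
    (h1 : ∀ (v : HeightOneSpectrum (𝓞 K)) (F : Type u) [Field F] [NumberField F] (u : HeightOneSpectrum (𝓞 F)) (τ : v.adicCompletion K →+* u.adicCompletion F) (β : u.adicCompletion F),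
      eval₂ (τ.comp (algebraMap K (v.adicCompletion K))) β p = 0 → Rp (τ.comp (algebraMap K (v.adicCompletion K))) R ρ)
    (h2 : ∀ (σ : K →+* ℝ) (β : ℝ), eval₂ σ β p = 0 → Rp σ R ρ) : Rp (RingHom.id K) R (p.natDegree * ρ) := by
  haveI : Fact (Irreducible p) := ⟨hp⟩
  let F := AdjoinRoot p
  let pb := AdjoinRoot.powerBasis hp.ne_zero
  haveI : Module.Finite K F := pb.finite
  haveI : NumberField F := NumberField.of_module_finite K F
  have hroot : ∀ {M : Type u} [Field M] (σ : F →+* M), eval₂ (σ.comp (algebraMap K F)) (σ (AdjoinRoot.root p)) p = 0 := by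
    intro M _ σ
    rw [← hom_eval₂]
    have : eval₂ (algebraMap K F) (AdjoinRoot.root p) p = 0 := AdjoinRoot.eval₂_root p
    rw [this, map_zero]
  have hroot2 : ∀ (σ : F →+* ℝ), eval₂ (σ.comp (algebraMap K F)) (σ (AdjoinRoot.root p)) p = 0 := by
    intro σ
    rw [← hom_eval₂]
    have : eval₂ (algebraMap K F) (AdjoinRoot.root p) p = 0 := AdjoinRoot.eval₂_root p
    rw [this, map_zero]
  haveI := tensor_simple (k := K) (M := F) (R := R)
  haveI := central_baseChange (k := K) (R := R) F
  have hg : Rp (RingHom.id F) (F ⊗[K] R) ρ := by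
    refine rp_global (by rw [finrank_baseChange, hd]) hρ ?_ ?_
    · intro u
      refine rp_baseChange _ ?_
      obtain ⟨v, τ, hτ⟩ := comp_hom K F u
      rw [← hτ]
      refine h1 v F u τ (algebraMap F _ (AdjoinRoot.root p)) ?_
      rw [hτ]
      exact hroot _
    · intro σ
      refine rp_baseChange _ (h2 _ (σ (AdjoinRoot.root p)) ?_)
      exact hroot2 σ
  have h3 := rp_of_baseChange (RingHom.id F) hg
  have h4 : Rp (algebraMap K F) R ρ := h3
  have h5 := rp_restrict h4
  have h6 : finrank K F = p.natDegree := by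
    rw [pb.finrank]; rfl
  rwa [h6] at h5

theorem poly_induct {K : Type u} {R : Type v} [Field K] [NumberField K] [Ring R] [Algebra K R] [Algebra.IsCentral K R] [IsSimpleRing R]
    [FiniteDimensional K R] {ρ : ℕ} (hd : finrank K R = ρ ^ 2) (hρ : ρ ≠ 0) (m : ℕ) : ∀ (p : K[X]) (hp : p ≠ 0) (hm : p.natDegree = m)
    (h1 : ∀ (v : HeightOneSpectrum (𝓞 K)) (F : Type u) [Field F] [NumberField F] (u : HeightOneSpectrum (𝓞 F)) (τ : v.adicCompletion K →+* u.adicCompletion F) (β : u.adicCompletion F),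
      eval₂ (τ.comp (algebraMap K (v.adicCompletion K))) β p = 0 → Rp (τ.comp (algebraMap K (v.adicCompletion K))) R ρ)
    (h2 : ∀ (σ : K →+* ℝ) (β : ℝ), eval₂ σ β p = 0 → Rp σ R ρ), Rp (RingHom.id K) R (m * ρ) := by
  induction m using Nat.strong_induction_on with
  | _ m ih =>
  intro p hp hm h1 h2
  by_cases hm0 : m = 0
  · subst hm0; rw [Nat.zero_mul]; exact rp_zero
  have hu : ¬ IsUnit p := fun h => hm0 (by rw [← hm]; exact natDegree_eq_zero_of_isUnit h)
  obtain ⟨q, hq, r, hr⟩ := WfDvdMonoid.exists_irreducible_factor hu hp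
  have hr0 : r ≠ 0 := by rintro rfl; exact hp (by rw [hr, mul_zero])
  have hdeg : p.natDegree = q.natDegree + r.natDegree := by rw [hr, natDegree_mul hq.ne_zero hr0]
  have hq1 := hq.natDegree_pos
  have e1 := irr_step hd hρ q hq
    (fun v F _ _ u τ β h => h1 v F u τ β (by rw [hr, eval₂_mul, h, zero_mul]))
    (fun σ β h => h2 σ β (by rw [hr, eval₂_mul, h, zero_mul]))
  have e2 := ih r.natDegree (by omega) r hr0 rfl
    (fun v F _ _ u τ β h => h1 v F u τ β (by rw [hr, eval₂_mul, h, mul_zero]))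
    (fun σ β h => h2 σ β (by rw [hr, eval₂_mul, h, mul_zero]))
  have := rp_add e1 e2
  rwa [← add_mul, ← hdeg, hm] at this
end ABHN
end part27

section part28
namespace ABHN
open Module IsDedekindDomain NumberField Polynomial
open scoped TensorProduct

theorem small_nat {K : Type*} [Field K] [NumberField K] (S : Finset (HeightOneSpectrum (𝓞 K))) :
    ∃ N : ℕ, N ≠ 0 ∧ ∀ v ∈ S, v.intValuation (N : 𝓞 K) < 1 := by
  classical
  refine ⟨∏ v ∈ S, Ideal.absNorm v.asIdeal, ?_, ?_⟩
  · exact Finset.prod_ne_zero_iff.2 fun v _ => fun h => v.ne_bot (Ideal.absNorm_eq_zero_iff.1 h)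
  · intro v hv
    rw [HeightOneSpectrum.intValuation_lt_one_iff_mem]
    have h1 := Ideal.absNorm_mem v.asIdeal
    obtain ⟨c, hc⟩ := Finset.dvd_prod_of_mem (fun v : HeightOneSpectrum (𝓞 K) => Ideal.absNorm v.asIdeal) hv
    rw [hc, Nat.cast_mul]
    exact Ideal.mul_mem_right _ _ h1

theorem pow_small {Γ : Type*} [LinearOrderedCommGroupWithZero Γ] [MulArchimedean Γ] {ι : Type*} (S : Finset ι)
    (a b : ι → Γ) (ha : ∀ i ∈ S, a i < 1) (hb : ∀ i ∈ S, b i ≠ 0) : ∃ e : ℕ, ∀ i ∈ S, a i ^ e ≤ b i := by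
  classical
  induction S using Finset.induction_on with
  | empty => exact ⟨0, by simp⟩
  | insert i S hi ih =>
    obtain ⟨e, he⟩ := ih (fun j hj => ha j (Finset.mem_insert_of_mem hj)) (fun j hj => hb j (Finset.mem_insert_of_mem hj))
    obtain ⟨e', he'⟩ := exists_pow_lt₀ (ha i (Finset.mem_insert_self _ _)) (Units.mk0 (b i) (hb i (Finset.mem_insert_self _ _)))
    refine ⟨max e e', fun j hj => ?_⟩
    have hle : a j ≤ 1 := (ha j hj).le
    rcases Finset.mem_insert.1 hj with rfl | hj
    · exact (pow_le_pow_right_of_le_one' hle (le_max_right _ _)).trans he'.le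
    · exact (pow_le_pow_right_of_le_one' hle (le_max_left _ _)).trans (he j hj)

theorem weak_approx {K : Type*} [Field K] [NumberField K] (S : Finset (HeightOneSpectrum (𝓞 K)))
    (f y : ∀ v : HeightOneSpectrum (𝓞 K), v.adicCompletion K) (hy : ∀ v, y v ≠ 0) :
    ∃ a : K, ∀ v ∈ S, Valued.v (algebraMap K (v.adicCompletion K) a - f v) ≤ Valued.v (y v) := by
  classical
  obtain ⟨N, hN, hS⟩ := small_nat S
  obtain ⟨e, he⟩ := pow_small S (fun v => v.intValuation (N : 𝓞 K)) (fun v => min (Valued.v (y v)) (if f v = 0 then 1 else (Valued.v (f v))⁻¹)) hS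
    (by
      intro v hv
      have h1 : Valued.v (y v) ≠ 0 := (Valuation.ne_zero_iff _).2 (hy v)
      rcases min_choice (Valued.v (y v)) (if f v = 0 then 1 else (Valued.v (f v))⁻¹) with h | h <;> rw [h]
      · exact h1
      · split_ifs with h2
        · exact one_ne_zero
        · exact inv_ne_zero ((Valuation.ne_zero_iff _).2 h2))
  have hNO : (N : 𝓞 K) ≠ 0 := Nat.cast_ne_zero.2 hN
  have hNe : (N : 𝓞 K) ^ e ≠ 0 := pow_ne_zero _ hNO
  have hva : ∀ (v : HeightOneSpectrum (𝓞 K)) (r : 𝓞 K), Valued.v (algebraMap (𝓞 K) (v.adicCompletion K) r) = v.intValuation r := fun v r => val_alg (K := K) v r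
  have hval : ∀ v : HeightOneSpectrum (𝓞 K), Valued.v (algebraMap (𝓞 K) (v.adicCompletion K) ((N : 𝓞 K) ^ e)) = v.intValuation (N : 𝓞 K) ^ e := by
    intro v; rw [hva, map_pow]
  obtain ⟨r, hr⟩ := crt (K := K) (((N : 𝓞 K) ^ e) * (N : 𝓞 K) ^ e) (mul_ne_zero hNe hNe)
    (fun v => if v ∈ S then algebraMap (𝓞 K) (v.adicCompletion K) ((N : 𝓞 K) ^ e) * f v else 0) (by
      intro v
      split_ifs with hv
      · rw [map_mul, hval]
        have h1 := (he v hv).trans (min_le_right _ _)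
        split_ifs at h1 with h2
        · rw [h2, map_zero, mul_zero]; exact zero_le_one
        · have h3 : Valued.v (f v) ≠ 0 := (Valuation.ne_zero_iff _).2 h2
          calc _ ≤ (Valued.v (f v))⁻¹ * Valued.v (f v) := mul_le_mul_left h1 _
            _ = 1 := inv_mul_cancel₀ h3
            _ ≤ 1 := le_rfl
      · rw [map_zero]; exact zero_le_one)
  refine ⟨algebraMap (𝓞 K) K r / algebraMap (𝓞 K) K ((N : 𝓞 K) ^ e), fun v hv => ?_⟩
  have h1 := hr v
  rw [if_pos hv] at h1
  set c := algebraMap (𝓞 K) (v.adicCompletion K) ((N : 𝓞 K) ^ e) with hc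
  have hc0 : Valued.v c ≠ 0 := by
    rw [hc, hva]; exact v.intValuation_ne_zero _ hNe
  have hc1 : c ≠ 0 := (Valuation.ne_zero_iff _).1 hc0
  have h2 : algebraMap K (v.adicCompletion K) (algebraMap (𝓞 K) K r / algebraMap (𝓞 K) K ((N : 𝓞 K) ^ e)) = algebraMap (𝓞 K) (v.adicCompletion K) r / c := by
    rw [map_div₀, hc, IsScalarTower.algebraMap_apply (𝓞 K) K (v.adicCompletion K), IsScalarTower.algebraMap_apply (𝓞 K) K (v.adicCompletion K)]
  rw [h2]
  have h3 : algebraMap (𝓞 K) (v.adicCompletion K) r / c - f v = - ((c * f v - algebraMap (𝓞 K) (v.adicCompletion K) r) / c) := by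
    field_simp; ring
  rw [h3, Valuation.map_neg, map_div₀]
  have h4 : v.intValuation ((N : 𝓞 K) ^ e * (N : 𝓞 K) ^ e) = Valued.v c * Valued.v c := by
    rw [hc, hva, map_mul]
  rw [h4] at h1
  have h5 : Valued.v c ≤ Valued.v (y v) := by
    rw [hc, hval]; exact (he v hv).trans (min_le_left _ _)
  refine le_trans ?_ h5
  exact div_le_of_le_mul₀ zero_le zero_le h1

theorem even_bound (p : ℝ[X]) (hp : p.Monic) (he : Even p.natDegree) : ∃ B : ℝ, ∀ x, B ≤ p.eval x := by
  by_cases h0 : p.natDegree = 0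
  · rw [hp.natDegree_eq_zero] at h0
    exact ⟨1, fun x => by simp [h0]⟩
  have hd : 0 < p.degree := natDegree_pos_iff_degree_pos.1 (Nat.pos_of_ne_zero h0)
  have t1 := tendsto_atTop_of_leadingCoeff_nonneg p hd (by rw [hp.leadingCoeff]; exact zero_le_one)
  have hq : (p.comp (-X)).natDegree = p.natDegree := by rw [natDegree_comp, natDegree_neg, natDegree_X, mul_one]
  have t2 := tendsto_atTop_of_leadingCoeff_nonneg (p.comp (-X)) (natDegree_pos_iff_degree_pos.1 (by omega))
    (by rw [leadingCoeff_comp (by simp), hp.leadingCoeff]; simp [he.neg_one_pow])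
  have t3 : Filter.Tendsto (fun x => p.eval x) Filter.atBot Filter.atTop := by
    have := t2.comp Filter.tendsto_neg_atBot_atTop
    refine this.congr fun x => by simp
  have t4 : Filter.Tendsto (fun x => p.eval x) (Filter.cocompact ℝ) Filter.atTop := by
    rw [cocompact_eq_atBot_atTop]
    exact t3.sup t1
  obtain ⟨x, hx⟩ := Continuous.exists_forall_le p.continuous t4
  exact ⟨_, hx⟩

theorem real_shift {K : Type*} [Field K] [NumberField K] (g : K[X]) (hg : g.Monic) (he : Even g.natDegree) :
    ∃ t : ℕ, ∀ (s : ℕ), t ≤ s → ∀ (σ : K →+* ℝ) (β : ℝ), eval₂ σ β (g + C (s : K)) ≠ 0 := by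
  have h : ∀ σ : K →+* ℝ, ∃ B : ℕ, ∀ x, -(B : ℝ) < eval₂ σ x g := by
    intro σ
    obtain ⟨B, hB⟩ := even_bound (g.map σ) (hg.map σ) (by rw [natDegree_map]; exact he)
    obtain ⟨m, hm⟩ := exists_nat_gt (-B)
    refine ⟨m, fun x => ?_⟩
    have := hB x
    rw [eval_map] at this
    linarith
  choose B hB using h
  refine ⟨∑ σ, B σ, fun s hs σ β h => ?_⟩
  rw [eval₂_add, eval₂_C, map_natCast] at h
  have h1 : B σ ≤ s := (Finset.single_le_sum (f := B) (fun _ _ => Nat.zero_le _) (Finset.mem_univ σ)).trans hs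
  have h2 : (B σ : ℝ) ≤ s := by exact_mod_cast h1
  have := hB σ β
  linarith

universe u v
theorem local_poly {K : Type u} {R : Type v} [Field K] [NumberField K] [Ring R] [Algebra K R] [Algebra.IsCentral K R] [IsSimpleRing R]
    [FiniteDimensional K R] {ρ : ℕ} (hd : finrank K R = ρ ^ 2) (hρ : ρ ≠ 0) {n : ℕ} (hn : n ≠ 0) (v : HeightOneSpectrum (𝓞 K))
    (h : Rp (algebraMap K (v.adicCompletion K)) R (n * ρ)) :
    ∃ (f : (v.adicCompletion K)[X]) (y : v.adicCompletion K), y ≠ 0 ∧ ∀ g : (v.adicCompletion K)[X], g.Monic → g.natDegree = n →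
      (∀ i < n, Valued.v (g.coeff i - f.coeff i) ≤ Valued.v y) → ∀ (M : Type u) [Field M] (τ : v.adicCompletion K →+* M) (β : M),
        eval₂ τ β g = 0 → Rp (τ.comp (algebraMap K (v.adicCompletion K))) R ρ := by
  obtain ⟨L, _, _, hL, hdn, hR⟩ := local_split _ hd hρ h
  haveI : CharZero (v.adicCompletion K) := charZero_of_injective_algebraMap (algebraMap K (v.adicCompletion K)).injective
  obtain ⟨f, y, hy, H⟩ := krasner_val (k := v.adicCompletion K) (Γ := WithZero (Multiplicative ℤ)) hL hn hdn
  refine ⟨f, y, hy, fun g hgm hgn hg M _ τ β hβ => ?_⟩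
  letI : Algebra (v.adicCompletion K) M := τ.toAlgebra
  obtain ⟨j⟩ := H g hgm hgn hg M β hβ
  have := rp_comp (j : L →+* M) hR
  rw [← RingHom.comp_assoc, AlgHom.comp_algebraMap] at this
  exact this

theorem rp_index {K : Type u} {R : Type v} [Field K] [NumberField K] [Ring R] [Algebra K R] [Algebra.IsCentral K R] [IsSimpleRing R]
    [FiniteDimensional K R] {ρ : ℕ} (hd : finrank K R = ρ ^ 2) (hρ : ρ ≠ 0) {n : ℕ} (hn : n ≠ 0)
    (h : ∀ v : HeightOneSpectrum (𝓞 K), Rp (algebraMap K (v.adicCompletion K)) R (n * ρ)) (hr : ∀ σ : K →+* ℝ, Rp σ R (n * ρ)) :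
    Rp (RingHom.id K) R (n * ρ) := by
  classical
  choose f y hy H using fun v => local_poly hd hρ hn v (h v)
  let S := (good_places hd hρ).toFinset
  have hS : ∀ v, v ∉ S → Rp (algebraMap K (v.adicCompletion K)) R ρ := by
    intro v hv
    by_contra hc
    exact hv ((Set.Finite.mem_toFinset _).2 hc)
  choose a ha using fun i => weak_approx S (fun v => (f v).coeff i) y hy
  obtain ⟨N, hN, hNS⟩ := small_nat S
  obtain ⟨e, he⟩ := pow_small S (fun v => v.intValuation (N : 𝓞 K)) (fun v => Valued.v (y v)) hNS
    (fun v _ => (Valuation.ne_zero_iff _).2 (hy v))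
  let g0 : K[X] := X ^ n + ∑ i ∈ Finset.range n, C (a i) * X ^ i
  have hlow : (∑ i ∈ Finset.range n, C (a i) * X ^ i : K[X]).degree < (n : WithBot ℕ) := by
    refine (degree_sum_le _ _).trans_lt ((Finset.sup_lt_iff (WithBot.bot_lt_coe n)).2 fun i hi => ?_)
    exact (degree_C_mul_X_pow_le _ _).trans_lt (WithBot.coe_lt_coe.2 (Finset.mem_range.1 hi))
  have hg0m : g0.Monic := monic_X_pow_add hlow
  have hg0n : g0.natDegree = n := by
    refine natDegree_eq_of_degree_eq_some ?_
    rw [degree_add_eq_left_of_degree_lt (by rw [degree_X_pow]; exact hlow), degree_X_pow]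
  have hg0c : ∀ i < n, g0.coeff i = a i := by
    intro i hi
    simp only [g0, coeff_add, coeff_X_pow, finsetSum_coeff, coeff_C_mul]
    rw [if_neg (by omega), zero_add, Finset.sum_eq_single i]
    · simp
    · intro b _ hb; simp [hb.symm]
    · intro h; exact absurd (Finset.mem_range.2 hi) h
  obtain ⟨t, ht⟩ : ∃ t : ℕ, Even n → ∀ (s : ℕ), t ≤ s → ∀ (σ : K →+* ℝ) (β : ℝ), eval₂ σ β (g0 + C (s : K)) ≠ 0 := by
    by_cases hev : Even n
    · obtain ⟨t, ht⟩ := real_shift g0 hg0m (by rwa [hg0n])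
      exact ⟨t, fun _ => ht⟩
    · exact ⟨0, fun h => absurd h hev⟩
  let s : ℕ := t * N ^ e
  have hts : t ≤ s := Nat.le_mul_of_pos_right _ (Nat.pos_of_ne_zero (pow_ne_zero _ hN))
  let g : K[X] := g0 + C (s : K)
  have hCd : (C (s : K)).degree < g0.degree := by
    refine degree_C_le.trans_lt ?_
    rw [degree_eq_natDegree hg0m.ne_zero, hg0n]
    exact WithBot.coe_lt_coe.2 (Nat.pos_of_ne_zero hn)
  have hgm : g.Monic := hg0m.add_of_left hCd
  have hgn : g.natDegree = n := by
    rw [← hg0n]; exact natDegree_add_eq_left_of_degree_lt hCd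
  refine poly_induct hd hρ n g hgm.ne_zero hgn ?_ ?_
  · intro v F _ _ u τ β hβ
    by_cases hv : v ∈ S
    · refine H v (g.map (algebraMap K _)) (hgm.map _) (by rw [natDegree_map, hgn]) ?_ _ τ β (by rw [eval₂_map]; exact hβ)
      intro i hi
      have h1 : Valued.v (algebraMap K (v.adicCompletion K) (a i) - (f v).coeff i) ≤ Valued.v (y v) := ha i v hv
      have h2 : Valued.v (algebraMap K (v.adicCompletion K) ((C (s : K)).coeff i)) ≤ Valued.v (y v) := by
        rw [coeff_C]
        split_ifs
        · have e1 : algebraMap K (v.adicCompletion K) (s : K) = algebraMap (𝓞 K) (v.adicCompletion K) ((t : 𝓞 K) * (N : 𝓞 K) ^ e) := by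
            rw [map_natCast]; simp [s]
          rw [e1]
          refine (val_alg (K := K) v _).le.trans ?_
          rw [map_mul, map_pow]
          exact (mul_le_of_le_one_left' (v.intValuation_le_one _)).trans (he v hv)
        · rw [map_zero, map_zero]; exact zero_le
      rw [coeff_map, coeff_add, hg0c i hi, map_add, add_sub_right_comm]
      exact (Valuation.map_add _ _ _).trans (max_le h1 h2)
    · exact rp_comp τ (hS v hv)
  · intro σ β hβ
    obtain ⟨L, _, _, hL, hdn, hR⟩ := local_split σ hd hρ (hr σ)
    haveI : FiniteDimensional ℝ L := FiniteDimensional.of_finrank_pos (Nat.pos_of_ne_zero hL)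
    rcases Real.nonempty_algEquiv_or L with ⟨⟨e1⟩⟩ | ⟨⟨e1⟩⟩
    · have := rp_comp (e1 : L →+* ℝ) hR
      rw [← RingHom.comp_assoc] at this
      have h3 : (e1 : L →+* ℝ).comp (algebraMap ℝ L) = RingHom.id ℝ := by
        ext x; exact e1.commutes x
      rwa [h3, RingHom.id_comp] at this
    · have h3 : finrank ℝ L = 2 := by rw [e1.toLinearEquiv.finrank_eq, Complex.finrank_real_complex]
      rw [h3] at hdn
      exact absurd hβ (ht (even_iff_two_dvd.2 hdn) s hts σ β)
end ABHN
end part28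

namespace ABHN
open Module IsDedekindDomain NumberField
open scoped TensorProduct

theorem modules_iso {k R V W : Type*} [Field k] [Ring R] [Algebra k R] [IsSimpleRing R] [FiniteDimensional k R]
    [AddCommGroup V] [Module R V] [Module k V] [IsScalarTower k R V] [FiniteDimensional k V]
    [AddCommGroup W] [Module R W] [Module k W] [IsScalarTower k R W] [FiniteDimensional k W] (h : finrank k V = finrank k W) :
    Nonempty (V ≃ₗ[R] W) := by
  haveI : IsArtinianRing R := IsArtinianRing.of_finite k R
  haveI : IsSemisimpleRing R := IsSimpleRing.isSemisimpleRing_iff_isArtinianRing.2 inferInstance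
  haveI : Module.Finite R V := Module.Finite.of_restrictScalars_finite k R V
  haveI : Module.Finite R W := Module.Finite.of_restrictScalars_finite k R W
  by_cases hW : finrank k W = 0
  · haveI : Subsingleton W := finrank_zero_iff.1 hW
    haveI : Subsingleton V := finrank_zero_iff.1 (h.trans hW)
    exact ⟨0⟩
  haveI : Nontrivial W := nontrivial_of_finrank_pos (Nat.pos_of_ne_zero hW)
  have hi : IsIsotypic R (V × W) := IsSimpleRing.isIsotypic R (V × W)
  obtain ⟨S, hS⟩ := IsAtomic.exists_atom (Submodule R (V × W))
  rw [← isSimpleModule_iff_isAtom] at hS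
  have hT := hi S
  obtain ⟨n, ⟨e1⟩⟩ := (hT.of_injective (LinearMap.inl R V W) LinearMap.inl_injective).linearEquiv_fun
  obtain ⟨m, ⟨e2⟩⟩ := (hT.of_injective (LinearMap.inr R V W) LinearMap.inr_injective).linearEquiv_fun
  haveI : FiniteDimensional k S := Module.Finite.of_injective ((S.subtype).restrictScalars k) S.injective_subtype
  have hS0 : 0 < finrank k S := by
    haveI : Nontrivial S := IsSimpleModule.nontrivial R S
    exact finrank_pos
  have h1 := (e1.restrictScalars k).finrank_eq
  have h2 := (e2.restrictScalars k).finrank_eq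
  rw [finrank_pi_fintype, Finset.sum_const, Finset.card_univ, Fintype.card_fin, smul_eq_mul] at h1 h2
  have : n = m := Nat.eq_of_mul_eq_mul_right hS0 (by rw [← h1, ← h2, h])
  subst this
  exact ⟨e1.trans e2.symm⟩

theorem rp_of_emb {K M A B : Type*} [Field K] [Field M] [Algebra K M] [Ring A] [Algebra K A] [Ring B] [Algebra K B] [FiniteDimensional K B]
    (j : M ⊗[K] A →ₐ[M] M ⊗[K] B) : Rp (algebraMap K M) (A ⊗[K] Bᵐᵒᵖ) (finrank K B) := by
  let V := M ⊗[K] B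
  let f : A →ₐ[K] Module.End M V := ((Algebra.lmul M V).restrictScalars K).comp ((j.restrictScalars K).comp Algebra.TensorProduct.includeRight)
  let g : Bᵐᵒᵖ →ₐ[K] Module.End M V :=
    { toFun := fun b => LinearMap.mulRight M ((1 : M) ⊗ₜ[K] b.unop)
      map_one' := by ext; simp
      map_zero' := by ext; simp
      map_mul' := fun x y => by
        refine LinearMap.ext fun z => ?_
        simp only [LinearMap.mulRight_apply, Module.End.mul_apply, MulOpposite.unop_mul]
        rw [mul_assoc, Algebra.TensorProduct.tmul_mul_tmul, mul_one]
      map_add' := fun x y => by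
        refine LinearMap.ext fun z => ?_
        simp only [LinearMap.mulRight_apply, LinearMap.add_apply, MulOpposite.unop_add, TensorProduct.tmul_add, mul_add]
      commutes' := fun r => by
        refine LinearMap.ext fun z => ?_
        rw [LinearMap.mulRight_apply, Module.algebraMap_end_apply, MulOpposite.algebraMap_apply, MulOpposite.unop_op,
          Algebra.algebraMap_eq_smul_one, TensorProduct.tmul_smul, mul_smul_comm, ← Algebra.TensorProduct.one_def, mul_one] }
  let φ := Algebra.TensorProduct.lift f g (fun a b => by
    refine LinearMap.ext fun z => ?_
    exact (mul_assoc _ _ _).symm)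
  refine rp_of_end (V := V) φ.toRingHom (fun a => ?_) (finrank_baseChange)
  refine (φ.commutes a).trans ?_
  refine LinearMap.ext fun z => ?_
  rw [Module.algebraMap_end_apply, Module.algebraMap_end_apply, algebraMap_smul]

theorem emb_of_rp {K A B : Type*} [Field K] [Ring A] [Algebra K A] [Ring B] [Algebra K B] [FiniteDimensional K B] [IsSimpleRing A] [IsSimpleRing B]
    (h : Rp (RingHom.id K) (A ⊗[K] Bᵐᵒᵖ) (finrank K B)) : ∃ f : A →ₐ[K] B, Function.Injective f := by
  obtain ⟨φ, hφ⟩ := rp_to_end h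
  let Φ : A ⊗[K] Bᵐᵒᵖ →ₐ[K] Module.End K (Fin (finrank K B) → K) := { φ with commutes' := hφ }
  let V := Fin (finrank K B) → K
  let ψ : Bᵐᵒᵖ →ₐ[K] Module.End K V := Φ.comp Algebra.TensorProduct.includeRight
  let θ : A →ₐ[K] Module.End K V := Φ.comp Algebra.TensorProduct.includeLeft
  have hcomm : ∀ a b, θ a * ψ b = ψ b * θ a := by
    intro a b
    change Φ _ * Φ _ = Φ _ * Φ _
    rw [← map_mul, ← map_mul]
    congr 1
    simp
  letI : Module Bᵐᵒᵖ V := Module.compHom V ψ.toRingHom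
  have hsm : ∀ (b : Bᵐᵒᵖ) (x : V), b • x = ψ b x := fun _ _ => rfl
  haveI : IsScalarTower K Bᵐᵒᵖ V := ⟨fun r b x => by
    rw [hsm, hsm, map_smul]; rfl⟩
  obtain ⟨e⟩ : Nonempty (V ≃ₗ[Bᵐᵒᵖ] B) := modules_iso (k := K) (by rw [finrank_fin_fun])
  have key : ∀ (a : A) (b : B), e (θ a (e.symm b)) = e (θ a (e.symm 1)) * b := by
    intro a b
    have h1 : e.symm b = (MulOpposite.op b) • e.symm 1 := by
      rw [← map_smul, op_smul_eq_mul, one_mul]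
    have h2 := congrArg (fun F : Module.End K V => F (e.symm 1)) (hcomm a (MulOpposite.op b))
    simp only [Module.End.mul_apply] at h2
    rw [h1, hsm, h2, ← hsm, map_smul, op_smul_eq_mul]
  have hlin : ∀ (r : K) (x : V), e (r • x) = r • e x := fun r x => (e.restrictScalars K).map_smul r x
  let f : A →ₐ[K] B :=
    { toFun := fun a => e (θ a (e.symm 1))
      map_one' := by rw [map_one]; simp
      map_zero' := by rw [map_zero]; simp
      map_mul' := fun x y => by
        rw [map_mul, Module.End.mul_apply, ← key x, e.symm_apply_apply]
      map_add' := fun x y => by rw [map_add, LinearMap.add_apply, map_add]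
      commutes' := fun r => by
        rw [AlgHom.commutes, Module.algebraMap_end_apply, hlin, e.apply_symm_apply, Algebra.algebraMap_eq_smul_one] }
  exact ⟨f, f.toRingHom.injective⟩

theorem emb_baseChange {K M A B : Type*} [Field K] [Field M] [Algebra K M] [Ring A] [Algebra K A] [Ring B] [Algebra K B]
    [Algebra.IsCentral K A] [IsSimpleRing A] [FiniteDimensional K A] [Nontrivial B] (f : A →ₐ[K] B) : ∃ j : M ⊗[K] A →ₐ[M] M ⊗[K] B, Function.Injective j :=
  ⟨Algebra.TensorProduct.map (AlgHom.id M M) f, tensor_inj _⟩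

theorem emb_global {K A B : Type*} [Field K] [NumberField K] [Ring A] [Algebra K A] [Ring B] [Algebra K B]
    [FiniteDimensional K A] [FiniteDimensional K B] [Algebra.IsCentral K A] [IsSimpleRing A] [Algebra.IsCentral K B] [IsSimpleRing B]
    (h : ∀ v : HeightOneSpectrum (𝓞 K), Rp (algebraMap K (v.adicCompletion K)) (A ⊗[K] Bᵐᵒᵖ) (finrank K B))
    (hr : ∀ σ : K →+* ℝ, Rp σ (A ⊗[K] Bᵐᵒᵖ) (finrank K B)) : ∃ f : A →ₐ[K] B, Function.Injective f := by
  haveI : IsSimpleRing (A ⊗[K] Bᵐᵒᵖ) := tensor_simple2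
  haveI : Algebra.IsCentral K (A ⊗[K] Bᵐᵒᵖ) := central_tensor2 A
  obtain ⟨ρ, hρ, hd⟩ := csa_square K (A ⊗[K] Bᵐᵒᵖ)
  obtain ⟨v0⟩ : Nonempty (HeightOneSpectrum (𝓞 K)) := by
    obtain ⟨I, hI⟩ := Ideal.exists_maximal (𝓞 K)
    exact ⟨⟨I, hI.isPrime, Ring.ne_bot_of_isMaximal_of_not_isField hI (RingOfIntegers.not_isField K)⟩⟩
  obtain ⟨n, hn⟩ := rp_dvd hd (h v0)
  have hB : finrank K B ≠ 0 := finrank_pos.ne'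
  have hn0 : n ≠ 0 := by rintro rfl; exact hB (by rw [hn, mul_zero])
  rw [mul_comm] at hn
  refine emb_of_rp ?_
  rw [hn] at h hr ⊢
  exact rp_index hd hρ hn0 h hr

end ABHN

open scoped TensorProduct
open NumberField IsDedekindDomain

theorem embedding_iff_embedding_at_all_places
    (K : Type*) [Field K] [NumberField K]
    (A B : Type*) [Ring A] [Algebra K A] [Ring B] [Algebra K B]
    [FiniteDimensional K A] [FiniteDimensional K B]
    [Algebra.IsCentral K A] [IsSimpleRing A]
    [Algebra.IsCentral K B] [IsSimpleRing B] :
    (∃ f : A →ₐ[K] B, Function.Injective f) ↔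
      ((∀ v : HeightOneSpectrum (𝓞 K),
          letI : SMulCommClass K (v.adicCompletion K) (v.adicCompletion K) :=
            Algebra.to_smulCommClass
          ∃ f : (v.adicCompletion K ⊗[K] A) →ₐ[v.adicCompletion K]
            (v.adicCompletion K ⊗[K] B), Function.Injective f) ∧
       (∀ σ : K →+* ℝ,
          letI : Algebra K ℝ := σ.toAlgebra
          ∃ f : (ℝ ⊗[K] A) →ₐ[ℝ] (ℝ ⊗[K] B), Function.Injective f) ∧
       (∀ σ : K →+* ℂ,
          letI : Algebra K ℂ := σ.toAlgebra
          ∃ f : (ℂ ⊗[K] A) →ₐ[ℂ] (ℂ ⊗[K] B), Function.Injective f)) := by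
  constructor
  · rintro ⟨f, -⟩
    refine ⟨fun v => ABHN.emb_baseChange f, fun σ => ?_, fun σ => ?_⟩
    · letI : Algebra K ℝ := σ.toAlgebra
      exact ABHN.emb_baseChange f
    · letI : Algebra K ℂ := σ.toAlgebra
      exact ABHN.emb_baseChange f
  · rintro ⟨h1, h2, -⟩
    refine ABHN.emb_global (fun v => ?_) (fun σ => ?_)
    · obtain ⟨j, -⟩ := h1 v
      exact ABHN.rp_of_emb j
    · letI : Algebra K ℝ := σ.toAlgebra
      obtain ⟨j, -⟩ := h2 σ
      exact ABHN.rp_of_emb j
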